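/- Let Ω ⊂ ℝ¹⁶ ≅ 𝕆² be an open convex subset and let T = (T₁₁, T₂₂, T₁₂) : Ω → ℝ × ℝ × 𝕆 be a C^∞-smooth octonionic-Hermitian-matrix-valued function. Then T satisfies the closedness equations Σ_{p=0}^{7} (∂T₁₂/∂x₂^p)·e_p = Σ_{p=0}^{7} e_p·(∂T₂₂/∂x₁^p) and Σ_{p=0}^{7} (∂conj(T₁₂)/∂x₁^p)·e_p = Σ_{p=0}^{7} e_p·(∂T₁₁/∂x₂^p) on Ω if and only if there exists a C^∞-smooth function u : Ω → ℝ such that Hess_𝕆(u) = T on Ω, i.e. Δ₁u = T₁₁, Δ₂u = T₂₂ and u_{1̄2} = T₁₂. (Theorem 8.2, the local dd^c-lemma for octonionic Kähler metrics.) -/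

import Mathlib

noncomputable section

open scoped Quaternion

/-- The octonions, realized as pairs of quaternions (Cayley–Dickson). -/
abbrev Oct : Type := ℍ[ℝ] × ℍ[ℝ]

/-- Octonionic multiplication: (x,y)·(w,z) = (xw − z̄y, zx + yw̄). -/
def omul (a b : Oct) : Oct :=
  (a.1 * b.1 - star b.2 * a.2, b.2 * a.1 + a.2 * star b.1)

/-- Octonionic conjugation. -/
def oconj (a : Oct) : Oct := (star a.1, -a.2)

/-- Real part of an octonion. -/
def oRe (a : Oct) : ℝ := a.1.re

/-- Squared norm |q|² = Re(q·q̄). -/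
def onSq (a : Oct) : ℝ := oRe (omul a (oconj a))

/-- Octonionic Hermitian 2×2 matrix: (α, β, q) represents [[α, q],[q̄, β]]. -/
abbrev Herm : Type := ℝ × ℝ × Oct

/-- Determinant of an octonionic Hermitian 2×2 matrix. -/
def detH (A : Herm) : ℝ := A.1 * A.2.1 - onSq A.2.2

/-- The quadratic form ξ ↦ Re(ξ*Aξ). -/
def qform (A : Herm) (ξ : Oct × Oct) : ℝ :=
  A.1 * onSq ξ.1 + A.2.1 * onSq ξ.2 + 2 * oRe (omul (oconj ξ.1) (omul A.2.2 ξ.2))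

/-- Positive definiteness. -/
def PosDefH (A : Herm) : Prop := ∀ ξ : Oct × Oct, ξ ≠ 0 → 0 < qform A ξ

/-- Nonnegative definiteness. -/
def NonnegDefH (A : Herm) : Prop := ∀ ξ : Oct × Oct, 0 ≤ qform A ξ

/-- The point space ℝ¹⁶, with coordinates x_i^p, i = 1,2 and p = 0,…,7. -/
abbrev Pt : Type := Fin 2 → Fin 8 → ℝ

def qI : ℍ[ℝ] := ⟨0, 1, 0, 0⟩
def qJ : ℍ[ℝ] := ⟨0, 0, 1, 0⟩
def qK : ℍ[ℝ] := ⟨0, 0, 0, 1⟩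

/-- The standard real basis e₀ = 1, e₁, …, e₇ of the octonions. -/
def e : Fin 8 → Oct :=
  ![((1 : ℍ[ℝ]), 0), (qI, 0), (qJ, 0), (qK, 0),
    (0, (1 : ℍ[ℝ])), (0, qI), (0, qJ), (0, qK)]

/-- The coordinate unit vector of the coordinate x_i^p. -/
def uvec (i : Fin 2) (p : Fin 8) : Pt := Pi.single i (Pi.single p 1)

/-- Partial derivative ∂f/∂x_i^p of a real-valued function on ℝ¹⁶. -/
def pd (i : Fin 2) (p : Fin 8) (f : Pt → ℝ) : Pt → ℝ :=
  fun x => fderiv ℝ f x (uvec i p)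

/-- The entry f_{ī j} = Σ_{p,q} e_p·(∂²f/∂x_i^p∂x_j^q)·conj(e_q) of the octonionic Hessian. -/
def hessEntry (f : Pt → ℝ) (i j : Fin 2) (x : Pt) : Oct :=
  ∑ p, ∑ q, pd i p (pd j q f) x • omul (e p) (oconj (e q))

/-- The Laplacian Δᵢ = Σ_p ∂²/∂(x_i^p)² in the i-th octonionic variable. -/
def lap (i : Fin 2) (f : Pt → ℝ) (x : Pt) : ℝ := ∑ p, pd i p (pd i p f) x

/-- The identification ℝ¹⁶ ≅ 𝕆². -/
def toO2 (x : Pt) : Oct × Oct := (∑ p, x 0 p • e p, ∑ p, x 1 p • e p)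

namespace OK
open Finset

/-- xor masks of the ten gamma matrices -/
def msk : Fin 10 → Fin 16 := ![0, 8, 9, 10, 11, 12, 13, 14, 15, 0]

/-- index permutation attached to the gamma matrix `a` -/
def sh (a : Fin 10) (i : Fin 16) : Fin 16 := i ^^^ msk a

/-- signs of the gamma matrices -/
def sg : Fin 10 → Fin 16 → ℤ := ![
  ![1, 1, 1, 1, 1, 1, 1, 1, 1, 1, 1, 1, 1, 1, 1, 1],
  ![1, 1, 1, 1, 1, 1, 1, 1, 1, 1, 1, 1, 1, 1, 1, 1],
  ![-1, 1, -1, 1, -1, 1, 1, -1, 1, -1, 1, -1, 1, -1, -1, 1],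
  ![-1, 1, 1, -1, -1, -1, 1, 1, 1, -1, -1, 1, 1, 1, -1, -1],
  ![-1, -1, 1, 1, -1, 1, -1, 1, 1, 1, -1, -1, 1, -1, 1, -1],
  ![-1, 1, 1, 1, 1, -1, -1, -1, 1, -1, -1, -1, -1, 1, 1, 1],
  ![-1, -1, 1, -1, 1, 1, 1, -1, 1, 1, -1, 1, -1, -1, -1, 1],
  ![-1, -1, -1, 1, 1, -1, 1, 1, 1, 1, 1, -1, -1, 1, -1, -1],
  ![-1, 1, -1, -1, 1, 1, -1, 1, 1, -1, 1, 1, -1, -1, 1, -1],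
  ![1, 1, 1, 1, 1, 1, 1, 1, -1, -1, -1, -1, -1, -1, -1, -1]]

/-- the metric signs -/
def et : Fin 10 → ℤ := ![-1, 1, 1, 1, 1, 1, 1, 1, 1, 1]

lemma sh_sh (a : Fin 10) (i : Fin 16) : sh a (sh a i) = i := by
  revert a i; decide

lemma sg_sh (a : Fin 10) (i : Fin 16) : sg a (sh a i) = sg a i := by
  revert a i; decide

lemma sg_sq (a : Fin 10) (i : Fin 16) : sg a i * sg a i = 1 := by
  revert a i; decide

lemma sh_zero (i : Fin 16) : sh 0 i = i := by revert i; decide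
lemma sg_zero (i : Fin 16) : sg 0 i = 1 := by revert i; decide

/-- reindexing equivalence -/
def shE (a : Fin 10) : Equiv.Perm (Fin 16) := ⟨sh a, sh a, sh_sh a, sh_sh a⟩

lemma sh_comm (a b : Fin 10) (i : Fin 16) : sh a (sh b i) = sh b (sh a i) := by
  revert a b i; decide

lemma cliff (a b : Fin 10) (ha : a ≠ 0) (hb : b ≠ 0) (hab : a ≠ b) (i : Fin 16) :
    sg a i * sg b (sh a i) = - (sg b i * sg a (sh b i)) := by
  revert a b i; decide

variable {R : Type*} [CommRing R]

/-- the gamma matrices acting on vectors -/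
def gm (a : Fin 10) (z : Fin 16 → R) : Fin 16 → R := fun i => (sg a i : R) * z (sh a i)

/-- bilinear dot product -/
def dt {R : Type*} [CommRing R] (x y : Fin 16 → R) : R := ∑ i, x i * y i

/-- the ten quadrics -/
def ph (a : Fin 10) (z : Fin 16 → R) : R := dt z (gm a z)

lemma gm_gm (a : Fin 10) (z : Fin 16 → R) : gm a (gm a z) = z := by
  funext i
  simp only [gm, sh_sh, sg_sh, ← mul_assoc, ← Int.cast_mul, sg_sq, Int.cast_one, one_mul]

lemma gm_zero (z : Fin 16 → R) : gm 0 z = z := by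
  funext i
  simp [gm, sh_zero, sg_zero]

lemma gm_anti (a b : Fin 10) (ha : a ≠ 0) (hb : b ≠ 0) (hab : a ≠ b) (z : Fin 16 → R) :
    gm a (gm b z) = - gm b (gm a z) := by
  funext i
  simp only [gm, Pi.neg_apply, ← mul_assoc, ← Int.cast_mul, cliff a b ha hb hab i, sh_comm b a i]
  push_cast; ring

lemma dt_gm (a : Fin 10) (x y : Fin 16 → R) : dt x (gm a y) = dt (gm a x) y := by
  unfold dt gm
  rw [← Equiv.sum_comp (shE a)]
  refine Finset.sum_congr rfl fun i _ => ?_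
  show x (sh a i) * (((sg a (sh a i) : ℤ) : R) * y (sh a (sh a i))) = _
  rw [sh_sh, sg_sh]; ring

lemma dt_comm (x y : Fin 16 → R) : dt x y = dt y x := by
  unfold dt; exact Finset.sum_congr rfl fun i _ => mul_comm _ _

lemma dt_neg (x y : Fin 16 → R) : dt x (-y) = - dt x y := by
  simp [dt]

lemma dt_anti2 [CharZero R] [NoZeroDivisors R] (a b : Fin 10) (ha : a ≠ 0) (hb : b ≠ 0) (hab : a ≠ b) (z : Fin 16 → R) :
    dt z (gm a (gm b z)) = 0 := by
  have h1 : dt z (gm a (gm b z)) = dt z (gm b (gm a z)) := by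
    rw [dt_gm, dt_comm, ← dt_gm, ]
  rw [gm_anti a b ha hb hab, dt_neg] at h1
  have h2 : dt z (gm b (gm a z)) = 0 := by
    have : (2:R) * dt z (gm b (gm a z)) = 0 := by linear_combination -h1
    simpa using this
  rw [gm_anti a b ha hb hab, dt_neg, h2, neg_zero]

lemma gm_neg (a : Fin 10) (z : Fin 16 → R) : gm a (-z) = - gm a z := by
  funext i; simp [gm]

lemma dt_anti3 [CharZero R] [NoZeroDivisors R] (a b c : Fin 10) (ha : a ≠ 0) (hb : b ≠ 0) (hc : c ≠ 0)
    (hab : a ≠ b) (hac : a ≠ c) (hbc : b ≠ c) (z : Fin 16 → R) :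
    dt z (gm a (gm b (gm c z))) = 0 := by
  have h1 : dt z (gm a (gm b (gm c z))) = dt z (gm c (gm b (gm a z))) := by
    rw [dt_gm, dt_gm, dt_gm, dt_comm]
  have h3 : gm c (gm b (gm a z)) = - gm a (gm b (gm c z)) := by
    rw [gm_anti b a hb ha hab.symm, gm_neg, gm_anti c a hc ha hac.symm, neg_neg,
      gm_anti c b hc hb hbc.symm, gm_neg]
  rw [h3, dt_neg] at h1
  have : (2:R) * dt z (gm a (gm b (gm c z))) = 0 := by linear_combination h1
  simpa using this

lemma et_cases (a : Fin 10) : (a = 0 ∧ et a = -1) ∨ (a ≠ 0 ∧ et a = 1) := by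
  revert a; decide

lemma ph_sum (a : Fin 10) (z : Fin 16 → R) : ph a z = ∑ i, z i * ((sg a i : R) * z (sh a i)) := rfl

/-- explicit form of the quadrics -/
lemma ph_expl (z : Fin 16 → R) : (fun a => ph a z) = ![
    z 0 ^ 2 + z 1 ^ 2 + z 2 ^ 2 + z 3 ^ 2 + z 4 ^ 2 + z 5 ^ 2 + z 6 ^ 2 + z 7 ^ 2 + z 8 ^ 2 + z 9 ^ 2 + z 10 ^ 2 + z 11 ^ 2 + z 12 ^ 2 + z 13 ^ 2 + z 14 ^ 2 + z 15 ^ 2,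
    2 * (z 0 * z 8 + z 1 * z 9 + z 2 * z 10 + z 3 * z 11 + z 4 * z 12 + z 5 * z 13 + z 6 * z 14 + z 7 * z 15),
    2 * (-z 0 * z 9 + z 1 * z 8 - z 2 * z 11 + z 3 * z 10 - z 4 * z 13 + z 5 * z 12 + z 6 * z 15 - z 7 * z 14),
    2 * (-z 0 * z 10 + z 1 * z 11 + z 2 * z 8 - z 3 * z 9 - z 4 * z 14 - z 5 * z 15 + z 6 * z 12 + z 7 * z 13),
    2 * (-z 0 * z 11 - z 1 * z 10 + z 2 * z 9 + z 3 * z 8 - z 4 * z 15 + z 5 * z 14 - z 6 * z 13 + z 7 * z 12),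
    2 * (-z 0 * z 12 + z 1 * z 13 + z 2 * z 14 + z 3 * z 15 + z 4 * z 8 - z 5 * z 9 - z 6 * z 10 - z 7 * z 11),
    2 * (-z 0 * z 13 - z 1 * z 12 + z 2 * z 15 - z 3 * z 14 + z 4 * z 9 + z 5 * z 8 + z 6 * z 11 - z 7 * z 10),
    2 * (-z 0 * z 14 - z 1 * z 15 - z 2 * z 12 + z 3 * z 13 + z 4 * z 10 - z 5 * z 11 + z 6 * z 8 + z 7 * z 9),
    2 * (-z 0 * z 15 + z 1 * z 14 - z 2 * z 13 - z 3 * z 12 + z 4 * z 11 + z 5 * z 10 - z 6 * z 9 + z 7 * z 8),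
    z 0 ^ 2 + z 1 ^ 2 + z 2 ^ 2 + z 3 ^ 2 + z 4 ^ 2 + z 5 ^ 2 + z 6 ^ 2 + z 7 ^ 2 - z 8 ^ 2 - z 9 ^ 2 - z 10 ^ 2 - z 11 ^ 2 - z 12 ^ 2 - z 13 ^ 2 - z 14 ^ 2 - z 15 ^ 2] := by
  funext a
  rw [ph_sum]
  fin_cases a <;> simp [Fin.sum_univ_succ, sh, msk, sg, Fin.succ] <;> ring

/-- exactness `D₁ D₀ = 0` as a cubic identity -/
lemma cubic (z : Fin 16 → R) (i : Fin 16) : ∑ a, (et a : R) * gm a z i * ph a z = 0 := by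
  have h : ∀ a, ph a z = _ := fun a => congrFun (ph_expl z) a
  simp only [h, gm]
  fin_cases i <;>
  · simp [Fin.sum_univ_succ, sh, msk, sg, et]
    ring
end OK

namespace OK
open Finset

section kos
variable {R : Type*} [CommRing R]

lemma dt_gm3 (a b c : Fin 10) (z : Fin 16 → R) :
    dt (gm c (gm b z)) (gm a z) = dt z (gm b (gm c (gm a z))) := by
  rw [dt_gm b, dt_gm c]

lemma koszul [CharZero R] [NoZeroDivisors R] (z : Fin 16 → R) (b c : Fin 10) :
    ∃ k : Fin 16 → R, ∀ a, ∑ i, k i * ((et a : R) * gm a z i)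
      = (if a = c then ph b z else 0) - (if a = b then ph c z else 0) := by
  have key : ∀ (k : Fin 16 → R) a, ∑ i, k i * ((et a : R) * gm a z i) = (et a : R) * dt k (gm a z) := by
    intro k a
    rw [dt, Finset.mul_sum]
    exact Finset.sum_congr rfl fun i _ => by ring
  have base : ∀ b : Fin 10, b ≠ 0 → ∀ a, ∑ i, (- gm b z) i * ((et a : R) * gm a z i)
      = (if a = 0 then ph b z else 0) - (if a = b then ph 0 z else 0) := by
    intro b hb a
    rw [key, dt_comm, dt_neg, dt_comm, ← dt_gm]
    rcases et_cases a with ⟨rfl, h⟩ | ⟨h0, h⟩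
    · rw [h, if_pos rfl, if_neg (Ne.symm hb), gm_zero, ph]; simp
    · rw [h, if_neg h0]
      by_cases hab : a = b
      · subst hab; rw [if_pos rfl, gm_gm]; simp [ph, gm_zero]
      · rw [if_neg hab, dt_anti2 b a hb h0 (Ne.symm hab)]; simp
  by_cases hbc : b = c
  · exact ⟨0, fun a => by subst hbc; simp⟩
  by_cases hb : b = 0
  · subst hb
    refine ⟨gm c z, fun a => ?_⟩
    have := base c (Ne.symm hbc) a
    simp only [Pi.neg_apply, neg_mul, Finset.sum_neg_distrib] at this
    linear_combination -this
  by_cases hc : c = 0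
  · subst hc
    exact ⟨_, base b hb⟩
  refine ⟨gm c (gm b z), fun a => ?_⟩
  rw [key, dt_gm3]
  rcases et_cases a with ⟨rfl, h⟩ | ⟨h0, h⟩
  · rw [h, gm_zero, dt_anti2 b c hb hc hbc, if_neg (Ne.symm hc), if_neg (Ne.symm hb)]; simp
  · rw [h]
    by_cases hac : a = c
    · subst hac; rw [gm_gm, if_pos rfl, if_neg (Ne.symm hbc)]; simp [ph]
    by_cases hab : a = b
    · subst hab; rw [if_neg hac, if_pos rfl, gm_anti c a hc hb (Ne.symm hac), gm_neg, gm_gm, dt_neg]; simp [ph]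
    · rw [if_neg hac, if_neg hab, dt_anti3 b c a hb hc h0 hbc (Ne.symm hab) (Ne.symm hac)]; simp

end kos

/-! constant coefficient operators -/
section opsec
variable {V : Type*} [AddCommGroup V] [Module ℝ V]

/-- polynomial functional calculus of commuting endomorphisms -/
def opOf (d : Fin 16 → Module.End ℝ V) (hd : ∀ i j, d i * d j = d j * d i) :
    MvPolynomial (Fin 16) ℝ →ₐ[ℝ] Module.End ℝ V :=
  letI : CommRing (Algebra.adjoin ℝ (Set.range d)) :=
    Algebra.adjoinCommRingOfComm ℝ (by rintro _ ⟨i, rfl⟩ _ ⟨j, rfl⟩; exact hd i j)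
  (Algebra.adjoin ℝ (Set.range d)).val.comp
    (MvPolynomial.aeval fun i => ⟨d i, Algebra.subset_adjoin ⟨i, rfl⟩⟩)

lemma opOf_X (d : Fin 16 → Module.End ℝ V) (hd : ∀ i j, d i * d j = d j * d i) (i : Fin 16) :
    opOf d hd (MvPolynomial.X i) = d i := by
  letI : CommRing (Algebra.adjoin ℝ (Set.range d)) :=
    Algebra.adjoinCommRingOfComm ℝ (by rintro _ ⟨i, rfl⟩ _ ⟨j, rfl⟩; exact hd i j)
  simp [opOf]

end opsec

/-- the polynomial ring -/
abbrev PR (K : Type*) [CommRing K] := MvPolynomial (Fin 16) K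

/-- the ten quadrics -/
def Q (K : Type*) [CommRing K] (a : Fin 10) : PR K := ph a MvPolynomial.X
/-- the relations -/
def rl (K : Type*) [CommRing K] (i : Fin 16) (a : Fin 10) : PR K := (et a : PR K) * gm a MvPolynomial.X i

lemma rl_Q (K : Type*) [CommRing K] (i : Fin 16) : ∑ a, rl K i a * Q K a = 0 :=
  cubic _ i

lemma koszulP (b c : Fin 10) : ∃ k : Fin 16 → PR ℝ, ∀ a, ∑ i, k i * rl ℝ i a
      = (if a = c then Q ℝ b else 0) - (if a = b then Q ℝ c else 0) :=
  koszul (MvPolynomial.X : Fin 16 → PR ℝ) b c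

section closed
variable {V : Type*} [AddCommGroup V] [Module ℝ V] (op : PR ℝ →ₐ[ℝ] Module.End ℝ V)

lemma closed_syz {T : Fin 10 → V} (hT : ∀ i, ∑ a, op (rl ℝ i a) (T a) = 0)
    {C : Fin 10 → PR ℝ} {k : Fin 16 → PR ℝ} (hC : ∀ a, C a = ∑ i, k i * rl ℝ i a) :
    ∑ a, op (C a) (T a) = 0 := by
  have : ∑ a, op (C a) (T a) = ∑ i, op (k i) (∑ a, op (rl ℝ i a) (T a)) := by
    simp only [hC, map_sum, map_mul, LinearMap.sum_apply, Module.End.mul_apply]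
    rw [Finset.sum_comm]
  rw [this]; simp [hT]

lemma closed_koszul {T : Fin 10 → V} (hT : ∀ i, ∑ a, op (rl ℝ i a) (T a) = 0) (b c : Fin 10) :
    op (Q ℝ b) (T c) = op (Q ℝ c) (T b) := by
  obtain ⟨k, hk⟩ := koszulP b c
  have := closed_syz op hT (C := fun a => (if a = c then Q ℝ b else 0) - (if a = b then Q ℝ c else 0))
    (k := k) (fun a => (hk a).symm)
  simp only [map_sub, LinearMap.sub_apply, Finset.sum_sub_distrib, apply_ite op, map_zero] at this
  have h : ∀ (c : Fin 10) (f : Module.End ℝ V), ∑ x, (if x = c then f else 0) (T x) = f (T c) := by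
    intro c f
    rw [Finset.sum_eq_single_of_mem c (Finset.mem_univ _)]
    · rw [if_pos rfl]
    · intro a _ h; rw [if_neg h]; rfl
  rw [h, h] at this
  exact sub_eq_zero.1 this
end closed

/-- Clifford identity used for the Fischer estimate -/
lemma cliff_sum {R : Type*} [CommRing R] (τ : Fin 10 → Fin 16 → R)
    (h : ∀ i, ∑ a, (et a : R) * gm a (τ a) i = 0) (b : Fin 10) (i : Fin 16) :
    ∑ a, gm a (gm b (τ a)) i = 2 * τ b i := by
  have e1 : ∀ i, ∑ a, gm a (τ a) i = 2 * τ 0 i := by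
    intro i
    have h1 : ∑ a, gm a (τ a) i - ∑ a, (et a : R) * gm a (τ a) i = 2 * τ 0 i := by
      rw [← Finset.sum_sub_distrib, Finset.sum_eq_single_of_mem 0 (Finset.mem_univ _)]
      · rw [gm_zero]; simp [et]; ring
      · intro a _ ha
        rcases et_cases a with ⟨h0, _⟩ | ⟨_, h'⟩
        · exact absurd h0 ha
        · rw [h']; simp
    rw [h, sub_zero] at h1; exact h1
  by_cases hb : b = 0
  · subst hb; simp only [gm_zero]; exact e1 i
  have e2 : ∑ a, (gm a (gm b (τ a)) i + gm b (gm a (τ a)) i) = 2 * gm b (τ 0) i + 2 * τ b i := by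
    have : ∀ a, (gm a (gm b (τ a)) i + gm b (gm a (τ a)) i)
        = (if a = 0 then 2 * gm b (τ 0) i else 0) + (if a = b then 2 * τ b i else 0) := by
      intro a
      by_cases ha : a = 0
      · subst ha; simp [gm_zero, Ne.symm hb]; ring
      by_cases hab : a = b
      · subst hab; simp [ha, gm_gm]; ring
      · rw [gm_anti a b ha hb hab]; simp [ha, hab]
    simp [this, Finset.sum_add_distrib]
  have e3 : ∑ a, gm b (gm a (τ a)) i = 2 * gm b (τ 0) i := by
    have := e1 (sh b i)
    simp only [gm] at this ⊢
    rw [← Finset.mul_sum, this]; ring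
  rw [Finset.sum_add_distrib, e3] at e2
  linear_combination e2

end OK

namespace OK
open Finset MvPolynomial

/-- orthogonal projection for a positive form -/
lemma proj_exists {V : Type*} [AddCommGroup V] [Module ℝ V] (B : V →ₗ[ℝ] V →ₗ[ℝ] ℝ)
    (hp : ∀ v, B v v = 0 → v = 0) (W : Submodule ℝ V) [FiniteDimensional ℝ W] (v : V) :
    ∃ w ∈ W, ∀ w' ∈ W, B (v - w) w' = 0 := by
  let L : W →ₗ[ℝ] (W →ₗ[ℝ] ℝ) := (B.domRestrict W).compr₂ LinearMap.id |>.compl₂ W.subtype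
  have hL : ∀ w w' : W, L w w' = B w w' := fun w w' => rfl
  have hinj : Function.Injective L := by
    rw [← LinearMap.ker_eq_bot, LinearMap.ker_eq_bot']
    intro w hw
    have := hL w w
    rw [hw] at this
    exact Subtype.ext (hp _ this.symm)
  have hsurj : Function.Surjective L :=
    (LinearMap.injective_iff_surjective_of_finrank_eq_finrank
      (by rw [show Module.finrank ℝ (W →ₗ[ℝ] ℝ) = Module.finrank ℝ (Module.Dual ℝ W) from rfl, Subspace.dual_finrank_eq])).1 hinj
  obtain ⟨w, hw⟩ := hsurj ((B v).comp W.subtype)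
  refine ⟨w, w.2, fun w' hw' => ?_⟩
  have := LinearMap.congr_fun hw ⟨w', hw'⟩
  rw [hL] at this
  simp only [LinearMap.comp_apply, Submodule.subtype_apply] at this
  rw [map_sub, LinearMap.sub_apply, this, sub_self]

/-- multi-factorial -/
def mf (α : Fin 16 →₀ ℕ) : ℝ := ∏ i, ((α i).factorial : ℝ)

lemma mf_pos (α : Fin 16 →₀ ℕ) : 0 < mf α := Finset.prod_pos fun i _ => by positivity

lemma mf_add (α : Fin 16 →₀ ℕ) (i : Fin 16) : mf (α + Finsupp.single i 1) = mf α * (α i + 1) := by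
  unfold mf
  rw [← Finset.mul_prod_erase _ _ (Finset.mem_univ i), ← Finset.mul_prod_erase univ (fun j => ((α j).factorial : ℝ)) (Finset.mem_univ i)]
  have : ∏ x ∈ univ.erase i, (((α + Finsupp.single i 1 : Fin 16 →₀ ℕ) x).factorial : ℝ) = ∏ x ∈ univ.erase i, ((α x).factorial : ℝ) := by
    refine Finset.prod_congr rfl fun j hj => ?_
    have : j ≠ i := Finset.ne_of_mem_erase hj
    simp [Finsupp.single_apply, this.symm]
  rw [this]
  simp [Nat.factorial_succ]
  ring

/-- the Fischer form -/
def fB : PR ℝ →ₗ[ℝ] PR ℝ →ₗ[ℝ] ℝ :=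
  (basisMonomials (Fin 16) ℝ).constr ℝ (fun α => mf α • lcoeff ℝ α)

lemma fB_monomial (α : Fin 16 →₀ ℕ) (c : ℝ) (q : PR ℝ) : fB (monomial α c) q = c * (mf α * coeff α q) := by
  have h1 : (monomial α c : PR ℝ) = c • monomial α 1 := by simp [smul_monomial]
  have h2 : fB (monomial α 1) = mf α • lcoeff ℝ α := by
    have := (basisMonomials (Fin 16) ℝ).constr_basis ℝ (fun α => mf α • lcoeff ℝ α) α
    rwa [coe_basisMonomials] at this
  rw [h1, map_smul, h2]; simp [lcoeff]

lemma fB_sum (p q : PR ℝ) : fB p q = ∑ α ∈ p.support, coeff α p * (mf α * coeff α q) := by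
  conv_lhs => rw [p.as_sum]
  rw [map_sum, LinearMap.sum_apply]
  exact Finset.sum_congr rfl fun α _ => fB_monomial _ _ _

lemma fB_nonneg (p : PR ℝ) : 0 ≤ fB p p := by
  rw [fB_sum]
  refine Finset.sum_nonneg fun α _ => ?_
  have := mf_pos α
  nlinarith [mul_nonneg this.le (mul_self_nonneg (coeff α p))]

lemma fB_def (p : PR ℝ) (h : fB p p ≤ 0) : p = 0 := by
  rw [fB_sum] at h
  by_contra hp
  have : 0 < ∑ α ∈ p.support, coeff α p * (mf α * coeff α p) := by
    refine Finset.sum_pos (fun α hα => ?_) (by rwa [Finset.nonempty_iff_ne_empty, Ne, support_eq_empty])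
    have h1 := mf_pos α
    have h2 : 0 < coeff α p * coeff α p := mul_self_pos.2 (mem_support_iff.1 hα)
    nlinarith [mul_pos h1 h2]
  linarith

lemma fB_X (i : Fin 16) (p q : PR ℝ) : fB (X i * p) q = fB p (pderiv i q) := by
  induction p using MvPolynomial.induction_on' with
  | monomial α c =>
    rw [X, monomial_mul, fB_monomial, fB_monomial, coeff_pderiv, add_comm, mf_add]
    ring
  | add p q hp hq => rw [mul_add, map_add, map_add, LinearMap.add_apply, LinearMap.add_apply, hp, hq]

lemma pd_comm (i j : Fin 16) (p : PR ℝ) : pderiv i (pderiv j p) = pderiv j (pderiv i p) := by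
  ext α
  simp only [coeff_pderiv]
  rw [add_right_comm]
  by_cases h : i = j
  · subst h; rfl
  · simp [Finsupp.single_apply, h, Ne.symm h]; ring

/-- derivations of the polynomial ring as commuting endomorphisms -/
def dP : PR ℝ →ₐ[ℝ] Module.End ℝ (PR ℝ) :=
  opOf (fun i => (pderiv i : Derivation ℝ (PR ℝ) (PR ℝ)).toLinearMap) (by
    intro i j
    apply LinearMap.ext; intro p
    exact pd_comm i j p)

lemma dP_X (i : Fin 16) (p : PR ℝ) : dP (X i) p = pderiv i p := by
  rw [dP, opOf_X]; rfl

lemma fB_adj (r p q : PR ℝ) : fB (r * p) q = fB p (dP r q) := by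
  induction r using MvPolynomial.induction_on generalizing p q with
  | C c => rw [C_mul', map_smul, ← algebraMap_eq, AlgHom.commutes]; simp [Module.algebraMap_end_apply]
  | add r s hr hs => rw [add_mul, map_add, LinearMap.add_apply, hr, hs, map_add, LinearMap.add_apply, map_add]
  | mul_X r i hr => rw [mul_assoc, hr, fB_X, ← dP_X, mul_comm r, map_mul, Module.End.mul_apply]

end OK

namespace OK
open Finset MvPolynomial

lemma dP_int (n : ℤ) (r p : PR ℝ) : dP ((n : PR ℝ) * r) p = (n : PR ℝ) * dP r p := by
  rw [map_mul, map_intCast, ← zsmul_one, ← zsmul_eq_mul]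
  simp

lemma dP_Q (b : Fin 10) (F : PR ℝ) :
    dP (Q ℝ b) F = ∑ j, (sg b j : PR ℝ) * pderiv j (pderiv (sh b j) F) := by
  rw [Q, ph_sum, map_sum, LinearMap.sum_apply]
  refine Finset.sum_congr rfl fun j _ => ?_
  rw [mul_left_comm, dP_int, map_mul, Module.End.mul_apply, dP_X, dP_X]

lemma dP_rl (i : Fin 16) (a : Fin 10) (p : PR ℝ) :
    dP (rl ℝ i a) p = (et a : PR ℝ) * gm a (fun j => pderiv j p) i := by
  rw [rl, dP_int, gm, dP_int, dP_X]; rfl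

lemma pd_int (n : ℤ) (k : Fin 16) (p : PR ℝ) : pderiv k ((n : PR ℝ) * p) = n * pderiv k p := by
  rw [← zsmul_eq_mul, map_zsmul, zsmul_eq_mul]

lemma pd_gm (a : Fin 10) (j k : Fin 16) :
    pderiv j (gm a (X : Fin 16 → PR ℝ) k) = if j = sh a k then (sg a k : PR ℝ) else 0 := by
  rw [gm, pd_int, pderiv_X, Pi.single_apply]
  by_cases h : j = sh a k
  · simp [h]
  · simp [h, Ne.symm h]

lemma pd_Q (a : Fin 10) (k : Fin 16) : pderiv k (Q ℝ a) = 2 * gm a (X : Fin 16 → PR ℝ) k := by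
  rw [Q, ph, dt, map_sum]
  simp only [pderiv_mul, Finset.sum_add_distrib, pd_gm, pderiv_X]
  have h1 : ∑ x, (Pi.single x (1 : PR ℝ) : Fin 16 → PR ℝ) k * gm a (X : Fin 16 → PR ℝ) x = gm a (X : Fin 16 → PR ℝ) k := by
    simp [Pi.single_apply]
  have h2 : ∑ x, (X x : PR ℝ) * (if k = sh a x then (sg a x : PR ℝ) else 0) = gm a (X : Fin 16 → PR ℝ) k := by
    rw [Finset.sum_eq_single_of_mem (sh a k) (Finset.mem_univ _)]
    · rw [sh_sh, if_pos rfl, sg_sh, gm, mul_comm]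
    · intro x _ hx
      rw [if_neg, mul_zero]
      rintro rfl; exact hx (sh_sh a x).symm
  rw [h2]
  have h3 : ∑ x, (Pi.single k (1 : PR ℝ) : Fin 16 → PR ℝ) x * gm a (X : Fin 16 → PR ℝ) x = gm a (X : Fin 16 → PR ℝ) k := by
    simp [Pi.single_apply]
  first | rw [h3, two_mul] | rw [h1, two_mul]

lemma pd2 (a : Fin 10) (j k : Fin 16) (T : PR ℝ) : pderiv j (pderiv k (Q ℝ a * T)) =
    Q ℝ a * pderiv j (pderiv k T) + 2 * gm a (X : Fin 16 → PR ℝ) j * pderiv k T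
      + 2 * gm a (X : Fin 16 → PR ℝ) k * pderiv j T + 2 * (if j = sh a k then (sg a k : PR ℝ) else 0) * T := by
  have e : pderiv j (2 : PR ℝ) = 0 := by
    have := (pderiv j : Derivation ℝ (PR ℝ) (PR ℝ)).map_natCast 2
    exact_mod_cast this
  rw [pderiv_mul, pd_Q, map_add, pderiv_mul, pderiv_mul, pderiv_mul, pd_Q, pd_gm, e]
  ring

lemma trace_gm : ∀ a b : Fin 10, (∑ j, sg b j * (if j = sh a (sh b j) then sg a (sh b j) else 0)) = if a = b then 16 else 0 := by
  decide +kernel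

lemma fischer_id (T : Fin 10 → PR ℝ) (hT : ∀ i, ∑ a, dP (rl ℝ i a) (T a) = 0) (b : Fin 10) :
    dP (Q ℝ b) (∑ a, Q ℝ a * T a) = ∑ a, Q ℝ a * dP (Q ℝ a) (T b) + 8 * ∑ j, X j * pderiv j (T b) + 32 * T b := by
  have hcl : ∀ i, ∑ a, (et a : PR ℝ) * gm a (fun j => pderiv j (T a)) i = 0 := by
    intro i; rw [← hT i]; exact Finset.sum_congr rfl fun a _ => (dP_rl i a _).symm
  have hc := cliff_sum (fun a j => pderiv j (T a)) hcl b
  have h1 : ∀ a, dP (Q ℝ b) (Q ℝ a * T a) = Q ℝ a * dP (Q ℝ a) (T b)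
      + 4 * ∑ j, X j * gm a (gm b (fun j => pderiv j (T a))) j + (if a = b then 32 * T b else 0) := by
    intro a
    rw [← closed_koszul dP hT b a, dP_Q, dP_Q]
    have e1 : ∑ j, (X j : PR ℝ) * gm a (gm b (fun j => pderiv j (T a))) j
        = ∑ j, gm a (X : Fin 16 → PR ℝ) j * ((sg b j : PR ℝ) * pderiv (sh b j) (T a)) := dt_gm a _ _
    have e2 : ∑ j, (X j : PR ℝ) * gm a (gm b (fun j => pderiv j (T a))) j
        = ∑ j, (sg b j : PR ℝ) * gm a (X : Fin 16 → PR ℝ) (sh b j) * pderiv j (T a) :=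
      (dt_gm a _ _).trans (dt_gm b _ _)
    have e3 : ∑ j, (sg b j : PR ℝ) * (if j = sh a (sh b j) then (sg a (sh b j) : PR ℝ) else 0) = if a = b then 16 else 0 := by
      have := congrArg (fun n : ℤ => (n : PR ℝ)) (trace_gm a b)
      push_cast at this
      exact this
    have e4 : (if a = b then 32 * T b else 0) = 2 * (if a = b then (16 : PR ℝ) else 0) * T a := by
      split_ifs with h
      · subst h; ring
      · simp
    rw [e4, ← e3, show (4 : PR ℝ) = 2 + 2 by norm_num, add_mul 2 2]
    nth_rewrite 1 [e1]
    rw [e2]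
    simp only [Finset.mul_sum, Finset.sum_mul]
    rw [← Finset.sum_add_distrib, ← Finset.sum_add_distrib, ← Finset.sum_add_distrib]
    refine Finset.sum_congr rfl fun j _ => ?_
    rw [pd2]
    ring
  rw [map_sum]
  simp only [h1, Finset.sum_add_distrib]
  rw [← Finset.mul_sum, Finset.sum_comm]
  simp only [← Finset.mul_sum]
  simp only [hc]
  simp only [Finset.sum_ite_eq', Finset.mem_univ, if_true, mul_left_comm _ (2 : PR ℝ), ← Finset.mul_sum]
  ring

lemma fB_comm_adj (r p q : PR ℝ) : fB p (dP r q) = fB (r * p) q := (fB_adj r p q).symm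

lemma fB_symm (p q : PR ℝ) : fB p q = fB q p := by
  induction p using MvPolynomial.induction_on' with
  | monomial α c =>
    induction q using MvPolynomial.induction_on' with
    | monomial β d =>
      rw [fB_monomial, fB_monomial, coeff_monomial, coeff_monomial]
      by_cases h : α = β
      · subst h; simp; ring
      · simp [h, Ne.symm h]
    | add p q hp hq => rw [map_add, hp, hq, map_add, LinearMap.add_apply]
  | add p q hp hq => rw [map_add, LinearMap.add_apply, hp, hq, map_add]

lemma closed_coclosed_zero (T : Fin 10 → PR ℝ) (hT : ∀ i, ∑ a, dP (rl ℝ i a) (T a) = 0)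
    (h0 : ∑ a, Q ℝ a * T a = 0) (b : Fin 10) : T b = 0 := by
  have h := fischer_id T hT b
  rw [h0, map_zero] at h
  have h2 := congrArg (fB (T b)) h
  rw [map_zero, map_add, map_add, map_sum] at h2
  have p1 : 0 ≤ ∑ a, fB (T b) (Q ℝ a * dP (Q ℝ a) (T b)) := by
    refine Finset.sum_nonneg fun a _ => ?_
    rw [fB_symm, fB_adj]; exact fB_nonneg _
  have p2 : 0 ≤ fB (T b) (8 * ∑ j, X j * pderiv j (T b)) := by
    have : (8 * ∑ j, X j * pderiv j (T b)) = (8 : ℝ) • ∑ j, X j * pderiv j (T b) := by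
      rw [smul_eq_C_mul]; rfl
    rw [this, map_smul, map_sum]
    refine smul_nonneg (by norm_num) (Finset.sum_nonneg fun j _ => ?_)
    rw [fB_symm, fB_X]; exact fB_nonneg _
  have p3 : fB (T b) (32 * T b) = 32 * fB (T b) (T b) := by
    have : 32 * T b = (32 : ℝ) • T b := by rw [smul_eq_C_mul]; rfl
    rw [this, map_smul]; rfl
  rw [p3] at h2
  exact fB_def _ (by linarith)

lemma totalDegree_pd (j : Fin 16) (p : PR ℝ) (N : ℕ) (h : p.totalDegree ≤ N + 1) :
    (pderiv j p).totalDegree ≤ N := by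
  refine Finset.sup_le fun α hα => ?_
  rw [mem_support_iff, coeff_pderiv] at hα
  have h1 : α + Finsupp.single j 1 ∈ p.support := mem_support_iff.2 (left_ne_zero_of_mul hα)
  have h2 := (le_totalDegree h1).trans h
  rw [Finsupp.sum_add_index' (by simp) (by simp)] at h2
  simp at h2
  exact h2

lemma totalDegree_int (n : ℤ) (p : PR ℝ) : ((n : PR ℝ) * p).totalDegree ≤ p.totalDegree := by
  rw [← zsmul_eq_mul]
  have : (n • p) = (n : ℝ) • p := (Int.cast_smul_eq_zsmul ℝ n p).symm
  rw [this]
  exact totalDegree_smul_le _ _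

/-- the syzygies of the ten quadrics are generated by `rl` -/
theorem syz (C : Fin 10 → PR ℝ) (hC : ∑ a, C a * Q ℝ a = 0) :
    ∃ k : Fin 16 → PR ℝ, ∀ a, C a = ∑ i, k i * rl ℝ i a := by
  obtain ⟨N, hN⟩ : ∃ N, ∀ a, (C a).totalDegree ≤ N + 1 :=
    ⟨univ.sup fun a => (C a).totalDegree, fun a => (Finset.le_sup (f := fun a => (C a).totalDegree) (Finset.mem_univ a)).trans (Nat.le_succ _)⟩
  let F : (Fin 16 → restrictTotalDegree (Fin 16) ℝ N) →ₗ[ℝ] (Fin 10 → PR ℝ) :=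
    { toFun := fun k a => ∑ i, (k i : PR ℝ) * rl ℝ i a
      map_add' := fun k l => by funext a; simp [add_mul, Finset.sum_add_distrib]
      map_smul' := fun c k => by funext a; simp [Finset.smul_sum] }
  let B : (Fin 10 → PR ℝ) →ₗ[ℝ] (Fin 10 → PR ℝ) →ₗ[ℝ] ℝ :=
    LinearMap.mk₂ ℝ (fun p q => ∑ a, fB (p a) (q a))
      (by intros; simp [Finset.sum_add_distrib]) (by intros; simp [Finset.mul_sum])
      (by intros; simp [Finset.sum_add_distrib]) (by intros; simp [Finset.mul_sum])
  have hB : ∀ p q, B p q = ∑ a, fB (p a) (q a) := fun p q => rfl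
  obtain ⟨w, ⟨k, rfl⟩, hw⟩ := proj_exists B (fun v hv => by
    funext a
    apply fB_def
    rw [hB] at hv
    exact ((Finset.sum_eq_zero_iff_of_nonneg fun a _ => fB_nonneg _).1 hv a (Finset.mem_univ a)).le) (LinearMap.range F) C
  set T := C - F k with hTdef
  have hF : ∀ k a, F k a = ∑ i, (k i : PR ℝ) * rl ℝ i a := fun _ _ => rfl
  have hrl : ∀ i a, (rl ℝ i a).totalDegree ≤ 1 := by
    intro i a
    rw [rl, gm, ← mul_assoc, ← Int.cast_mul]
    exact (totalDegree_int _ _).trans (by simp)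
  have hdeg : ∀ a, (T a).totalDegree ≤ N + 1 := by
    intro a
    rw [hTdef, Pi.sub_apply]
    refine (totalDegree_sub _ _).trans (max_le (hN a) ?_)
    rw [hF]
    refine totalDegree_finsetSum_le fun i _ => (totalDegree_mul _ _).trans ?_
    exact add_le_add ((mem_restrictTotalDegree _ _ _).1 (k i).2) (hrl i a)
  have hcl : ∀ i, ∑ a, dP (rl ℝ i a) (T a) = 0 := by
    have hd : ∀ i, (∑ a, dP (rl ℝ i a) (T a)).totalDegree ≤ N := by
      intro i
      refine totalDegree_finsetSum_le fun a _ => ?_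
      rw [dP_rl, gm, ← mul_assoc, ← Int.cast_mul]
      exact (totalDegree_int _ _).trans (totalDegree_pd _ _ _ (hdeg a))
    have h := hw (F fun i => ⟨∑ a, dP (rl ℝ i a) (T a), (mem_restrictTotalDegree _ _ _).2 (hd i)⟩) ⟨_, rfl⟩
    rw [hB] at h
    have h3 : ∑ i, fB (∑ a, dP (rl ℝ i a) (T a)) (∑ a, dP (rl ℝ i a) (T a)) = 0 := by
      rw [← h]
      simp only [hF, map_sum, LinearMap.sum_apply]
      have : ∀ a x, fB (T a) ((∑ a, dP (rl ℝ x a) (T a)) * rl ℝ x a) = ∑ x_1, fB (dP (rl ℝ x x_1) (T x_1)) (dP (rl ℝ x a) (T a)) := by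
        intro a x
        rw [fB_symm, mul_comm, fB_adj, map_sum, LinearMap.sum_apply]
      simp only [this]
      rw [Finset.sum_comm]
    intro i
    exact fB_def _ ((Finset.sum_eq_zero_iff_of_nonneg fun a _ => fB_nonneg _).1 h3 i (Finset.mem_univ i)).le
  have h0 : ∑ a, Q ℝ a * T a = 0 := by
    simp only [hTdef, Pi.sub_apply, hF, mul_sub, Finset.sum_sub_distrib]
    rw [show ∑ a, Q ℝ a * C a = 0 by rw [← hC]; exact Finset.sum_congr rfl fun a _ => mul_comm _ _]
    simp only [Finset.mul_sum]
    rw [Finset.sum_comm]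
    have : ∀ i, ∑ a, Q ℝ a * ((k i : PR ℝ) * rl ℝ i a) = k i * ∑ a, rl ℝ i a * Q ℝ a := by
      intro i; rw [Finset.mul_sum]; exact Finset.sum_congr rfl fun a _ => by ring
    simp [this, rl_Q]
  refine ⟨fun i => k i, fun a => ?_⟩
  have := closed_coclosed_zero T hcl h0 a
  rw [hTdef, Pi.sub_apply, sub_eq_zero] at this
  rw [this, hF]
end OK

namespace OK
open Finset MvPolynomial

/-- polynomials in five variables -/
abbrev P5 (K : Type*) [CommRing K] := MvPolynomial (Fin 5) K

section gen
variable {K : Type*} [CommRing K]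

/-- the twelve basis monomials -/
def bm (K : Type*) [CommRing K] : Fin 12 → P5 K :=
  ![1, X 0, X 1, X 2, X 3, X 4, X 2 * X 2, X 3 * X 3, X 4 * X 4, X 3 * X 4, X 1 * X 2, X 4 * (X 4 * X 4)]
/-- their degrees -/
def bd : Fin 12 → ℕ := ![0, 1, 1, 1, 1, 1, 2, 2, 2, 2, 2, 3]

/-- restricted quadrics -/
def qr (n : Fin 5 → Fin 16 → K) (a : Fin 10) : P5 K := ph a (fun p => ∑ i, C (n i p) * X i)

lemma map_ph {R S : Type*} [CommRing R] [CommRing S] (φ : R →+* S) (a : Fin 10) (z : Fin 16 → R) :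
    φ (ph a z) = ph a (fun p => φ (z p)) := by
  simp [ph_sum]

lemma map_qr {L : Type*} [CommRing L] (φ : K →+* L) (n : Fin 5 → Fin 16 → K) (a : Fin 10) :
    MvPolynomial.map φ (qr n a) = qr (fun i p => φ (n i p)) a := by
  rw [qr, map_ph]; simp [qr]

lemma map_bm {L : Type*} [CommRing L] (φ : K →+* L) (β : Fin 12) :
    MvPolynomial.map φ (bm K β) = bm L β := by
  fin_cases β <;> simp [bm]

lemma qr_homog (n : Fin 5 → Fin 16 → K) (a : Fin 10) : (qr n a).IsHomogeneous 2 := by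
  have h : ∀ p, (∑ i, C (n i p) * X i : P5 K).IsHomogeneous 1 := fun p =>
    IsHomogeneous.sum _ _ _ fun i _ => by
      have := (isHomogeneous_C (Fin 5) (n i p)).mul (isHomogeneous_X K i)
      simpa using this
  rw [qr, ph_sum]
  refine IsHomogeneous.sum _ _ _ fun p _ => ?_
  have h2 := (isHomogeneous_C (Fin 5) ((sg a p : ℤ) : K)).mul (h (sh a p))
  have := (h p).mul h2
  simpa using this

lemma bm_homog (β : Fin 12) : (bm K β).IsHomogeneous (bd β) := by
  have hX := fun i => isHomogeneous_X K (i : Fin 5)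
  fin_cases β
  · exact isHomogeneous_one _ _
  · exact hX 0
  · exact hX 1
  · exact hX 2
  · exact hX 3
  · exact hX 4
  · exact (hX 2).mul (hX 2)
  · exact (hX 3).mul (hX 3)
  · exact (hX 4).mul (hX 4)
  · exact (hX 3).mul (hX 4)
  · exact (hX 1).mul (hX 2)
  · exact (hX 4).mul ((hX 4).mul (hX 4))

/-- exponents of degree `d` -/
abbrev Ex (d : ℕ) := ↥(Finset.finsuppAntidiag (univ : Finset (Fin 5)) d)

lemma mem_Ex {d : ℕ} {α : Fin 5 →₀ ℕ} : α ∈ Finset.finsuppAntidiag (univ : Finset (Fin 5)) d ↔ α.degree = d := by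
  rw [Finset.mem_finsuppAntidiag, Finsupp.degree_eq_sum]
  simp

/-- column index -/
abbrev Ck (d : ℕ) := (Fin 10 × Ex d) ⊕ {β : Fin 12 // bd β = d + 2}

/-- columns in degree `d+2` -/
def col (n : Fin 5 → Fin 16 → K) (d : ℕ) : Ck d → P5 K
  | .inl (a, γ) => monomial γ.1 1 * qr n a
  | .inr β => bm K β.1

/-- reducible polynomials of degree `d+2` -/
def Rd (n : Fin 5 → Fin 16 → K) (d : ℕ) : Submodule K (P5 K) := Submodule.span K (Set.range (col n d))

lemma col_homog (n : Fin 5 → Fin 16 → K) (d : ℕ) (k : Ck d) : (col n d k).IsHomogeneous (d + 2) := by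
  rcases k with ⟨a, γ⟩ | β
  · exact (isHomogeneous_monomial _ (mem_Ex.1 γ.2)).mul (qr_homog n a)
  · have := bm_homog (K := K) β.1
    rw [β.2] at this
    exact this

lemma map_col {L : Type*} [CommRing L] (φ : K →+* L) (n : Fin 5 → Fin 16 → K) (d : ℕ) (k : Ck d) :
    MvPolynomial.map φ (col n d k) = col (fun i p => φ (n i p)) d k := by
  rcases k with ⟨a, γ⟩ | β
  · simp [col, map_qr]
  · simp [col, map_bm]

/-- coefficient matrix -/
def cM (n : Fin 5 → Fin 16 → K) (d : ℕ) : Matrix (Ex (d + 2)) (Ck d) K := fun α k => coeff α.1 (col n d k)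

lemma monomial_mem_of_right_inv (n : Fin 5 → Fin 16 → K) (d : ℕ) (R : Matrix (Ck d) (Ex (d + 2)) K)
    (h : cM n d * R = 1) (α : Ex (d + 2)) : monomial α.1 1 ∈ Rd n d := by
  have : (monomial α.1 1 : P5 K) = ∑ k, R k α • col n d k := by
    ext δ
    by_cases hδ : δ.degree = d + 2
    · have := congrFun (congrFun h ⟨δ, mem_Ex.2 hδ⟩) α
      rw [Matrix.mul_apply, Matrix.one_apply] at this
      rw [coeff_sum, coeff_monomial]
      simp only [coeff_smul, smul_eq_mul]
      have e : ∑ x, R x α * coeff δ (col n d x) = ∑ j, cM n d ⟨δ, mem_Ex.2 hδ⟩ j * R j α :=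
        Finset.sum_congr rfl fun k _ => mul_comm _ _
      rw [e, this]
      simp [Subtype.ext_iff, eq_comm]
    · have h1 : coeff δ (monomial α.1 1 : P5 K) = 0 := by
        rw [coeff_monomial, if_neg]; rintro rfl; exact hδ (mem_Ex.1 α.2)
      rw [h1, coeff_sum]
      symm
      refine Finset.sum_eq_zero fun k _ => ?_
      rw [coeff_smul, (col_homog n d k).coeff_eq_zero hδ, smul_zero]
  rw [this]
  exact Submodule.sum_mem _ fun k _ => Submodule.smul_mem _ _ (Submodule.subset_span ⟨k, rfl⟩)

lemma right_inv_of_monomial_mem (n : Fin 5 → Fin 16 → K) (d : ℕ)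
    (h : ∀ α : Ex (d + 2), (monomial α.1 1 : P5 K) ∈ Rd n d) :
    ∃ R : Matrix (Ck d) (Ex (d + 2)) K, cM n d * R = 1 := by
  choose r hr using fun α => (Submodule.mem_span_range_iff_exists_fun K).1 (h α)
  refine ⟨Matrix.of fun k α => r α k, ?_⟩
  ext δ α
  rw [Matrix.mul_apply, Matrix.one_apply]
  have := congrArg (coeff δ.1) (hr α)
  rw [coeff_sum, coeff_monomial] at this
  simp only [coeff_smul, smul_eq_mul] at this
  have e : ∑ x, r α x * coeff δ.1 (col n d x) = ∑ j, cM n d δ j * r α j :=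
        Finset.sum_congr rfl fun k _ => mul_comm _ _
  simp only [Matrix.of_apply]
  rw [← e, this]
  by_cases hh : δ = α
  · rw [if_pos hh, if_pos (by rw [hh])]
  · rw [if_neg hh, if_neg (fun h' => hh (Subtype.ext h'.symm))]

lemma homog_le_Rd (n : Fin 5 → Fin 16 → K) (d : ℕ)
    (h : ∀ α : Ex (d + 2), (monomial α.1 1 : P5 K) ∈ Rd n d) (f : P5 K) (hf : f.IsHomogeneous (d + 2)) :
    f ∈ Rd n d := by
  rw [f.as_sum]
  refine Submodule.sum_mem _ fun α hα => ?_
  have h1 : α.degree = d + 2 := by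
    by_contra hne
    exact (mem_support_iff.1 hα) (hf.coeff_eq_zero hne)
  have : (monomial α (coeff α f) : P5 K) = coeff α f • monomial α 1 := by simp [smul_monomial]
  rw [this]
  exact Submodule.smul_mem _ _ (h ⟨α, mem_Ex.2 h1⟩)
end gen

/-- generic surjectivity -/
lemma generic_G (F0 : Fin 5 → Fin 16 → ℚ) (d : ℕ)
    (h : ∀ α : Ex (d + 2), (monomial α.1 1 : P5 ℚ) ∈ Rd F0 d) :
    ∃ G : MvPolynomial (Fin 5 × Fin 16) ℚ, aeval (fun ip => F0 ip.1 ip.2) G ≠ 0 ∧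
      ∀ (K : Type) [Field K] [Algebra ℚ K] (n : Fin 5 → Fin 16 → K), aeval (fun ip => n ip.1 ip.2) G ≠ 0 →
        ∀ α : Ex (d + 2), (monomial α.1 1 : P5 K) ∈ Rd n d := by
  obtain ⟨R, hR⟩ := right_inv_of_monomial_mem F0 d h
  let U : Fin 5 → Fin 16 → MvPolynomial (Fin 5 × Fin 16) ℚ := fun i p => X (i, p)
  let RC : Matrix (Ck d) (Ex (d + 2)) (MvPolynomial (Fin 5 × Fin 16) ℚ) := R.map C
  let A : Matrix (Ex (d + 2)) (Ex (d + 2)) (MvPolynomial (Fin 5 × Fin 16) ℚ) := cM U d * RC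
  let G := A.det
  have hmap : ∀ (K : Type) [Field K] [Algebra ℚ K] (n : Fin 5 → Fin 16 → K),
      A.map (aeval (fun ip : Fin 5 × Fin 16 => n ip.1 ip.2) : _ →ₐ[ℚ] K)
        = cM n d * R.map (algebraMap ℚ K) := by
    intro K _ _ n
    ext α β
    simp only [A]
    rw [Matrix.map_apply, Matrix.mul_apply, Matrix.mul_apply, map_sum]
    refine Finset.sum_congr rfl fun k _ => ?_
    rw [map_mul]
    congr 1
    · have h1 := map_col ((aeval (fun ip : Fin 5 × Fin 16 => n ip.1 ip.2) : _ →ₐ[ℚ] K) : _ →+* K) U d k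
      have h2 := congrArg (coeff α.1) h1
      rw [coeff_map] at h2
      simp only [U, RingHom.coe_coe, aeval_X] at h2
      exact h2
    · simp [RC, aeval_C]
  have hdet : ∀ (K : Type) [Field K] [Algebra ℚ K] (n : Fin 5 → Fin 16 → K),
      aeval (fun ip : Fin 5 × Fin 16 => n ip.1 ip.2) G = (cM n d * R.map (algebraMap ℚ K)).det := by
    intro K _ _ n
    rw [← hmap]
    exact AlgHom.map_det _ _
  refine ⟨G, ?_, fun K _ _ n hn => ?_⟩
  · rw [hdet]
    have : R.map (algebraMap ℚ ℚ) = R := by ext; simp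
    rw [this, hR]; simp
  · rw [hdet] at hn
    refine monomial_mem_of_right_inv n d (R.map (algebraMap ℚ K) * (cM n d * R.map (algebraMap ℚ K))⁻¹) ?_
    rw [← Matrix.mul_assoc]
    exact Matrix.mul_nonsing_inv _ (isUnit_iff_ne_zero.2 hn)

end OK

namespace OK
open Finset MvPolynomial

/-- the explicit good 5-plane -/
def F0 : Fin 5 → Fin 16 → ℚ := ![
  ![0, 0, -1, 0, 0, 0, 0, 0, 0, 0, 0, 0, 0, 0, 0, 0],
  ![0, 0, 0, 0, 0, 0, 0, 0, 0, 0, 0, 0, 0, 1, 0, 0],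
  ![0, 0, 0, 1, 0, 0, 0, 0, -1, 0, 0, 0, 0, 0, 0, 0],
  ![0, 0, 0, 0, 0, 1, 0, 0, 0, 0, 0, 0, -1, 0, 0, 0],
  ![0, 1, 0, 0, 0, 0, 0, 0, 0, -1, 0, 0, 0, 0, 0, 0]]

lemma F0_z : (fun p => ∑ i, C (F0 i p) * X i : Fin 16 → P5 ℚ) =
    ![0, X 4, -X 0, X 2, 0, X 3, 0, 0, -X 2, -X 4, 0, 0, -X 3, X 1, 0, 0] := by
  funext p
  fin_cases p <;> simp [Fin.sum_univ_succ, F0] <;> rfl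

lemma qrF0 : (qr F0 : Fin 10 → P5 ℚ) = ![
    X 0 ^ 2 + X 1 ^ 2 + 2 * X 2 ^ 2 + 2 * X 3 ^ 2 + 2 * X 4 ^ 2,
    2 * X 1 * X 3 - 2 * X 4 ^ 2,
    -2 * X 2 * X 4 - 2 * X 3 ^ 2,
    2 * X 0 * X 2 + 2 * X 2 * X 4,
    2 * X 0 * X 4 - 2 * X 2 ^ 2,
    2 * X 1 * X 4 + 2 * X 3 * X 4,
    -2 * X 2 * X 3 + 2 * X 3 * X 4,
    -2 * X 0 * X 3 + 2 * X 1 * X 2,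
    2 * X 0 * X 1 + 2 * X 2 * X 3,
    X 0 ^ 2 - X 1 ^ 2] := by
  have h := ph_expl (![0, X 4, -X 0, X 2, 0, X 3, 0, 0, -X 2, -X 4, 0, 0, -X 3, X 1, 0, 0] : Fin 16 → P5 ℚ)
  funext a
  have ha := congrFun h a
  rw [qr, F0_z, ha]
  fin_cases a <;> simp <;> ring

lemma prod_X (l : List (Fin 5)) : ∃ γ : Fin 5 →₀ ℕ, γ.degree = l.length ∧
    (l.map (X : Fin 5 → P5 ℚ)).prod = monomial γ 1 := by
  induction l with
  | nil => exact ⟨0, by simp, by simp⟩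
  | cons j l ih =>
    obtain ⟨γ, h1, h2⟩ := ih
    refine ⟨Finsupp.single j 1 + γ, by simp [h1, add_comm], ?_⟩
    rw [List.map_cons, List.prod_cons, h2, X, monomial_mul, one_mul]

lemma lst_mem {d : ℕ} {f : P5 ℚ} (l : List (ℤ × List (Fin 5) × Fin 10)) (b : List (ℤ × Fin 12))
    (hl : ∀ x ∈ l, x.2.1.length = d) (hb : ∀ y ∈ b, bd y.2 = d + 2)
    (h : 4 * f = (l.map fun x => (x.1 : P5 ℚ) * ((x.2.1.map X).prod * qr F0 x.2.2)).sum
      + (b.map fun y => (y.1 : P5 ℚ) * bm ℚ y.2).sum) : f ∈ Rd F0 d := by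
  have hz : ∀ (z : ℤ) (g : P5 ℚ), g ∈ Rd F0 d → (z : P5 ℚ) * g ∈ Rd F0 d := by
    intro z g hg
    rw [← zsmul_eq_mul]
    exact zsmul_mem hg z
  have h4 : 4 * f ∈ Rd F0 d := by
    rw [h]
    refine Submodule.add_mem _ (list_sum_mem ?_) (list_sum_mem ?_)
    · intro x hx
      obtain ⟨y, hy, rfl⟩ := List.mem_map.1 hx
      apply hz
      obtain ⟨γ, h1, h2⟩ := prod_X y.2.1
      rw [h2]
      exact Submodule.subset_span ⟨.inl (y.2.2, ⟨γ, mem_Ex.2 (h1.trans (hl y hy))⟩), rfl⟩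
    · intro x hx
      obtain ⟨y, hy, rfl⟩ := List.mem_map.1 hx
      apply hz
      exact Submodule.subset_span ⟨.inr ⟨y.2, hb y hy⟩, rfl⟩
  have : f = (1 / 4 : ℚ) • (4 * f) := by
    rw [smul_eq_C_mul, ← mul_assoc, show (4 : P5 ℚ) = C 4 from rfl, ← C_mul]; norm_num
  rw [this]
  exact Submodule.smul_mem _ _ h4

lemma f_00 : (X 0 * X 0 : P5 ℚ) ∈ Rd F0 0 :=
  lst_mem [(2, [], 0), (2, [], 9)] [(-4, 6), (-4, 7), (-4, 8)] (by decide) (by decide) (by simp [qrF0, bm] <;> ring)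
lemma f_01 : (X 0 * X 1 : P5 ℚ) ∈ Rd F0 0 :=
  lst_mem [(2, [], 8), (2, [], 6)] [(-4, 9)] (by decide) (by decide) (by simp [qrF0, bm] <;> ring)
lemma f_02 : (X 0 * X 2 : P5 ℚ) ∈ Rd F0 0 :=
  lst_mem [(2, [], 3), (2, [], 2)] [(4, 7)] (by decide) (by decide) (by simp [qrF0, bm] <;> ring)
lemma f_03 : (X 0 * X 3 : P5 ℚ) ∈ Rd F0 0 :=
  lst_mem [(-2, [], 7)] [(4, 10)] (by decide) (by decide) (by simp [qrF0, bm] <;> ring)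
lemma f_04 : (X 0 * X 4 : P5 ℚ) ∈ Rd F0 0 :=
  lst_mem [(2, [], 4)] [(4, 6)] (by decide) (by decide) (by simp [qrF0, bm] <;> ring)
lemma f_11 : (X 1 * X 1 : P5 ℚ) ∈ Rd F0 0 :=
  lst_mem [(-2, [], 9), (2, [], 0)] [(-4, 6), (-4, 7), (-4, 8)] (by decide) (by decide) (by simp [qrF0, bm] <;> ring)
lemma f_12 : (X 1 * X 2 : P5 ℚ) ∈ Rd F0 0 :=
  lst_mem [] [(4, 10)] (by decide) (by decide) (by simp [qrF0, bm] <;> ring)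
lemma f_13 : (X 1 * X 3 : P5 ℚ) ∈ Rd F0 0 :=
  lst_mem [(2, [], 1)] [(4, 8)] (by decide) (by decide) (by simp [qrF0, bm] <;> ring)
lemma f_14 : (X 1 * X 4 : P5 ℚ) ∈ Rd F0 0 :=
  lst_mem [(2, [], 5)] [(-4, 9)] (by decide) (by decide) (by simp [qrF0, bm] <;> ring)
lemma f_22 : (X 2 * X 2 : P5 ℚ) ∈ Rd F0 0 :=
  lst_mem [] [(4, 6)] (by decide) (by decide) (by simp [qrF0, bm] <;> ring)
lemma f_23 : (X 2 * X 3 : P5 ℚ) ∈ Rd F0 0 :=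
  lst_mem [(-2, [], 6)] [(4, 9)] (by decide) (by decide) (by simp [qrF0, bm] <;> ring)
lemma f_24 : (X 2 * X 4 : P5 ℚ) ∈ Rd F0 0 :=
  lst_mem [(-2, [], 2)] [(-4, 7)] (by decide) (by decide) (by simp [qrF0, bm] <;> ring)
lemma f_33 : (X 3 * X 3 : P5 ℚ) ∈ Rd F0 0 :=
  lst_mem [] [(4, 7)] (by decide) (by decide) (by simp [qrF0, bm] <;> ring)
lemma f_34 : (X 3 * X 4 : P5 ℚ) ∈ Rd F0 0 :=
  lst_mem [] [(4, 9)] (by decide) (by decide) (by simp [qrF0, bm] <;> ring)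
lemma f_44 : (X 4 * X 4 : P5 ℚ) ∈ Rd F0 0 :=
  lst_mem [] [(4, 8)] (by decide) (by decide) (by simp [qrF0, bm] <;> ring)
lemma f_012 : (X 0 * X 1 * X 2 : P5 ℚ) ∈ Rd F0 1 :=
  lst_mem [(1, [2], 8), (1, [2], 6), (1, [1], 3), (-1, [2], 5)] [] (by decide) (by decide) (by simp [qrF0, bm] <;> ring)
lemma f_022 : (X 0 * X 2 * X 2 : P5 ℚ) ∈ Rd F0 1 :=
  lst_mem [(-2, [0], 4), (4, [4], 9), (2, [1], 5), (-2, [4], 1)] [(-4, 11)] (by decide) (by decide) (by simp [qrF0, bm] <;> ring)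
lemma f_033 : (X 0 * X 3 * X 3 : P5 ℚ) ∈ Rd F0 1 :=
  lst_mem [(-2, [3], 7), (-2, [1], 6), (2, [4], 1)] [(4, 11)] (by decide) (by decide) (by simp [qrF0, bm] <;> ring)
lemma f_034 : (X 0 * X 3 * X 4 : P5 ℚ) ∈ Rd F0 1 :=
  lst_mem [(1, [3], 4), (-1, [2], 6), (1, [0], 6), (1, [3], 3)] [] (by decide) (by decide) (by simp [qrF0, bm] <;> ring)
lemma f_044 : (X 0 * X 4 * X 4 : P5 ℚ) ∈ Rd F0 1 :=
  lst_mem [(2, [4], 4), (-2, [2], 2), (2, [3], 6), (2, [4], 1), (-2, [3], 5)] [(4, 11)] (by decide) (by decide) (by simp [qrF0, bm] <;> ring)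
lemma f_112 : (X 1 * X 1 * X 2 : P5 ℚ) ∈ Rd F0 1 :=
  lst_mem [(2, [1], 7), (2, [3], 8), (2, [3], 6), (2, [4], 1), (-2, [3], 5)] [(4, 11)] (by decide) (by decide) (by simp [qrF0, bm] <;> ring)
lemma f_122 : (X 1 * X 2 * X 2 : P5 ℚ) ∈ Rd F0 1 :=
  lst_mem [(1, [2], 7), (-1, [0], 6), (1, [0], 5), (-1, [1], 4)] [] (by decide) (by decide) (by simp [qrF0, bm] <;> ring)
lemma f_123 : (X 1 * X 2 * X 3 : P5 ℚ) ∈ Rd F0 1 :=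
  lst_mem [(-2, [1], 6), (2, [4], 1)] [(4, 11)] (by decide) (by decide) (by simp [qrF0, bm] <;> ring)
lemma f_124 : (X 1 * X 2 * X 4 : P5 ℚ) ∈ Rd F0 1 :=
  lst_mem [(1, [2], 5), (-1, [2], 8), (-1, [2], 6), (1, [1], 3)] [] (by decide) (by decide) (by simp [qrF0, bm] <;> ring)
lemma f_133 : (X 1 * X 3 * X 3 : P5 ℚ) ∈ Rd F0 1 :=
  lst_mem [(-1, [2], 5), (-2, [1], 2), (1, [2], 8), (1, [2], 6), (-1, [1], 3)] [] (by decide) (by decide) (by simp [qrF0, bm] <;> ring)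
lemma f_134 : (X 1 * X 3 * X 4 : P5 ℚ) ∈ Rd F0 1 :=
  lst_mem [(2, [4], 1)] [(4, 11)] (by decide) (by decide) (by simp [qrF0, bm] <;> ring)
lemma f_144 : (X 1 * X 4 * X 4 : P5 ℚ) ∈ Rd F0 1 :=
  lst_mem [(2, [4], 5), (-1, [0], 6), (-1, [3], 3), (-2, [4], 6), (1, [0], 5), (-1, [4], 8)] [] (by decide) (by decide) (by simp [qrF0, bm] <;> ring)
lemma f_222 : (X 2 * X 2 * X 2 : P5 ℚ) ∈ Rd F0 1 :=
  lst_mem [(-2, [2], 4), (2, [4], 3), (2, [4], 2), (-2, [4], 1), (2, [3], 5)] [(-4, 11)] (by decide) (by decide) (by simp [qrF0, bm] <;> ring)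
lemma f_223 : (X 2 * X 2 * X 3 : P5 ℚ) ∈ Rd F0 1 :=
  lst_mem [(-1, [2], 6), (1, [0], 6), (1, [3], 3), (-1, [3], 4)] [] (by decide) (by decide) (by simp [qrF0, bm] <;> ring)
lemma f_224 : (X 2 * X 2 * X 4 : P5 ℚ) ∈ Rd F0 1 :=
  lst_mem [(-2, [2], 2), (2, [3], 6), (2, [4], 1), (-2, [3], 5)] [(4, 11)] (by decide) (by decide) (by simp [qrF0, bm] <;> ring)
lemma f_233 : (X 2 * X 3 * X 3 : P5 ℚ) ∈ Rd F0 1 :=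
  lst_mem [(-2, [3], 6), (-2, [4], 1), (2, [3], 5)] [(-4, 11)] (by decide) (by decide) (by simp [qrF0, bm] <;> ring)
lemma f_234 : (X 2 * X 3 * X 4 : P5 ℚ) ∈ Rd F0 1 :=
  lst_mem [(1, [0], 6), (1, [3], 3), (-1, [3], 4), (1, [2], 6)] [] (by decide) (by decide) (by simp [qrF0, bm] <;> ring)
lemma f_244 : (X 2 * X 4 * X 4 : P5 ℚ) ∈ Rd F0 1 :=
  lst_mem [(-2, [4], 2), (2, [4], 1), (-2, [3], 5)] [(4, 11)] (by decide) (by decide) (by simp [qrF0, bm] <;> ring)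
lemma f_333 : (X 3 * X 3 * X 3 : P5 ℚ) ∈ Rd F0 1 :=
  lst_mem [(-1, [0], 6), (-1, [3], 3), (-2, [3], 2), (1, [3], 4), (-1, [2], 6)] [] (by decide) (by decide) (by simp [qrF0, bm] <;> ring)
lemma f_334 : (X 3 * X 3 * X 4 : P5 ℚ) ∈ Rd F0 1 :=
  lst_mem [(-2, [4], 1), (2, [3], 5)] [(-4, 11)] (by decide) (by decide) (by simp [qrF0, bm] <;> ring)
lemma f_344 : (X 3 * X 4 * X 4 : P5 ℚ) ∈ Rd F0 1 :=
  lst_mem [(1, [0], 6), (1, [3], 3), (2, [4], 6), (-1, [0], 5), (1, [4], 8)] [] (by decide) (by decide) (by simp [qrF0, bm] <;> ring)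
lemma f_444 : (X 4 * X 4 * X 4 : P5 ℚ) ∈ Rd F0 1 :=
  lst_mem [] [(4, 11)] (by decide) (by decide) (by simp [qrF0, bm] <;> ring)
lemma f_0444 : (X 0 * X 4 * X 4 * X 4 : P5 ℚ) ∈ Rd F0 2 :=
  lst_mem [(1, [3, 4], 7), (-1, [2, 3], 5), (1, [0, 3], 5), (-2, [0, 4], 1), (1, [3, 4], 8)] [] (by decide) (by decide) (by simp [qrF0, bm] <;> ring)
lemma f_1444 : (X 1 * X 4 * X 4 * X 4 : P5 ℚ) ∈ Rd F0 2 :=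
  lst_mem [(-2, [1, 4], 1), (-1, [0, 4], 8), (-4, [3, 4], 9), (1, [0, 0], 5), (1, [0, 3], 3), (1, [0, 0], 6)] [] (by decide) (by decide) (by simp [qrF0, bm] <;> ring)
lemma f_2444 : (X 2 * X 4 * X 4 * X 4 : P5 ℚ) ∈ Rd F0 2 :=
  lst_mem [(1, [1, 2], 5), (-2, [2, 4], 1), (-1, [1, 4], 7), (-1, [1, 3], 4), (1, [1, 2], 6)] [] (by decide) (by decide) (by simp [qrF0, bm] <;> ring)
lemma f_3444 : (X 3 * X 4 * X 4 * X 4 : P5 ℚ) ∈ Rd F0 2 :=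
  lst_mem [(-1, [4, 4], 7), (1, [2, 4], 5), (2, [4, 4], 6), (-1, [0, 4], 5), (1, [4, 4], 8)] [] (by decide) (by decide) (by simp [qrF0, bm] <;> ring)
lemma f_4444 : (X 4 * X 4 * X 4 * X 4 : P5 ℚ) ∈ Rd F0 2 :=
  lst_mem [(2, [1, 4], 6), (-2, [4, 4], 1), (1, [3, 4], 7), (1, [0, 3], 5), (-1, [0, 1], 5), (1, [1, 4], 8)] [] (by decide) (by decide) (by simp [qrF0, bm] <;> ring)

end OK

namespace OK
open Finset MvPolynomial

lemma X_mul_Rd {d : ℕ} (i : Fin 5) (h : ∀ β, bd β = d + 2 → X i * bm ℚ β ∈ Rd F0 (d + 1))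
    {f : P5 ℚ} (hf : f ∈ Rd F0 d) : X i * f ∈ Rd F0 (d + 1) := by
  have : Rd F0 d ≤ (Rd F0 (d + 1)).comap (LinearMap.mulLeft ℚ (X i : P5 ℚ)) := by
    rw [Rd, Submodule.span_le]
    rintro _ ⟨k, rfl⟩
    rcases k with ⟨a, γ⟩ | β
    · refine Submodule.subset_span ⟨.inl (a, ⟨Finsupp.single i 1 + γ.1, mem_Ex.2 ?_⟩), ?_⟩
      · simp [mem_Ex.1 γ.2, add_comm]
      · simp only [col, LinearMap.mulLeft_apply, ← mul_assoc]
        rw [X, monomial_mul, one_mul]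
    · exact h β.1 β.2
  exact this hf

lemma exists_deg_succ {d : ℕ} {α : Fin 5 →₀ ℕ} (h : α.degree = d + 1) :
    ∃ i α', α'.degree = d ∧ α = Finsupp.single i 1 + α' := by
  have hne : α ≠ 0 := by rintro rfl; simp at h
  obtain ⟨i, hi⟩ := Finsupp.ne_iff.1 hne
  have hle : Finsupp.single i 1 ≤ α := by
    rw [Finsupp.single_le_iff]; simp at hi; omega
  refine ⟨i, α - Finsupp.single i 1, ?_, (add_tsub_cancel_of_le hle).symm⟩
  have := congrArg Finsupp.degree (add_tsub_cancel_of_le hle)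
  simp only [map_add, Finsupp.degree_single, h] at this
  omega

lemma F0_step {d : ℕ} (h : ∀ i β, bd β = d + 2 → X i * bm ℚ β ∈ Rd F0 (d + 1))
    (h2 : ∀ α : Ex (d + 2), (monomial α.1 1 : P5 ℚ) ∈ Rd F0 d) (α : Ex (d + 1 + 2)) :
    (monomial α.1 1 : P5 ℚ) ∈ Rd F0 (d + 1) := by
  obtain ⟨i, α', h3, h4⟩ := exists_deg_succ (d := d + 2) (mem_Ex.1 α.2)
  have := X_mul_Rd i (h i) (h2 ⟨α', mem_Ex.2 h3⟩)
  rw [h4]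
  rwa [X, monomial_mul, one_mul] at this

lemma F0_XX (i j : Fin 5) : (X i * X j : P5 ℚ) ∈ Rd F0 0 := by
  have key : ∀ i j : Fin 5, (X j * X i : P5 ℚ) ∈ Rd F0 0 → (X i * X j : P5 ℚ) ∈ Rd F0 0 := by
    intro i j h; rwa [mul_comm]
  fin_cases i <;> fin_cases j
  · exact f_00
  · exact f_01
  · exact f_02
  · exact f_03
  · exact f_04
  · exact key _ _ f_01
  · exact f_11
  · exact f_12
  · exact f_13
  · exact f_14
  · exact key _ _ f_02
  · exact key _ _ f_12
  · exact f_22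
  · exact f_23
  · exact f_24
  · exact key _ _ f_03
  · exact key _ _ f_13
  · exact key _ _ f_23
  · exact f_33
  · exact f_34
  · exact key _ _ f_04
  · exact key _ _ f_14
  · exact key _ _ f_24
  · exact key _ _ f_34
  · exact f_44

lemma F0_0 (α : Ex (0 + 2)) : (monomial α.1 1 : P5 ℚ) ∈ Rd F0 0 := by
  obtain ⟨i, α', h3, h4⟩ := exists_deg_succ (d := 1) (mem_Ex.1 α.2)
  obtain ⟨j, α'', h5, h6⟩ := exists_deg_succ (d := 0) h3
  have h7 : α'' = 0 := (Finsupp.degree_eq_zero_iff _).1 h5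
  have := F0_XX i j
  rw [h4, h6, h7, add_zero]
  rwa [X, X, monomial_mul, one_mul] at this

lemma F0_s1 (i : Fin 5) (β : Fin 12) (hβ : bd β = 0 + 2) : X i * bm ℚ β ∈ Rd F0 (0 + 1) := by
  have h6 : β = 6 ∨ β = 7 ∨ β = 8 ∨ β = 9 ∨ β = 10 := by revert β; decide
  have e : ∀ {f g : P5 ℚ}, f ∈ Rd F0 1 → f = g → g ∈ Rd F0 (0 + 1) := by
    intro f g h h'; rw [← h']; exact h
  rcases h6 with rfl | rfl | rfl | rfl | rfl
  · rw [show bm ℚ 6 = X 2 * X 2 from rfl]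
    fin_cases i
    · exact e f_022 (show _ = X 0 * (X 2 * X 2) by ring)
    · exact e f_122 (show _ = X 1 * (X 2 * X 2) by ring)
    · exact e f_222 (show _ = X 2 * (X 2 * X 2) by ring)
    · exact e f_223 (show _ = X 3 * (X 2 * X 2) by ring)
    · exact e f_224 (show _ = X 4 * (X 2 * X 2) by ring)
  · rw [show bm ℚ 7 = X 3 * X 3 from rfl]
    fin_cases i
    · exact e f_033 (show _ = X 0 * (X 3 * X 3) by ring)
    · exact e f_133 (show _ = X 1 * (X 3 * X 3) by ring)
    · exact e f_233 (show _ = X 2 * (X 3 * X 3) by ring)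
    · exact e f_333 (show _ = X 3 * (X 3 * X 3) by ring)
    · exact e f_334 (show _ = X 4 * (X 3 * X 3) by ring)
  · rw [show bm ℚ 8 = X 4 * X 4 from rfl]
    fin_cases i
    · exact e f_044 (show _ = X 0 * (X 4 * X 4) by ring)
    · exact e f_144 (show _ = X 1 * (X 4 * X 4) by ring)
    · exact e f_244 (show _ = X 2 * (X 4 * X 4) by ring)
    · exact e f_344 (show _ = X 3 * (X 4 * X 4) by ring)
    · exact e f_444 (show _ = X 4 * (X 4 * X 4) by ring)
  · rw [show bm ℚ 9 = X 3 * X 4 from rfl]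
    fin_cases i
    · exact e f_034 (show _ = X 0 * (X 3 * X 4) by ring)
    · exact e f_134 (show _ = X 1 * (X 3 * X 4) by ring)
    · exact e f_234 (show _ = X 2 * (X 3 * X 4) by ring)
    · exact e f_334 (show _ = X 3 * (X 3 * X 4) by ring)
    · exact e f_344 (show _ = X 4 * (X 3 * X 4) by ring)
  · rw [show bm ℚ 10 = X 1 * X 2 from rfl]
    fin_cases i
    · exact e f_012 (show _ = X 0 * (X 1 * X 2) by ring)
    · exact e f_112 (show _ = X 1 * (X 1 * X 2) by ring)
    · exact e f_122 (show _ = X 2 * (X 1 * X 2) by ring)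
    · exact e f_123 (show _ = X 3 * (X 1 * X 2) by ring)
    · exact e f_124 (show _ = X 4 * (X 1 * X 2) by ring)

lemma F0_s2 (i : Fin 5) (β : Fin 12) (hβ : bd β = 1 + 2) : X i * bm ℚ β ∈ Rd F0 (1 + 1) := by
  have hβ : β = 11 := by revert β; decide
  subst hβ
  have e : (X i * X 4 * X 4 * X 4 : P5 ℚ) = X i * bm ℚ 11 := by
    rw [show bm ℚ 11 = X 4 * (X 4 * X 4) from rfl]; ring
  rw [← e]
  fin_cases i
  · exact f_0444
  · exact f_1444
  · exact f_2444
  · exact f_3444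
  · exact f_4444

lemma F0_1 (α : Ex (1 + 2)) : (monomial α.1 1 : P5 ℚ) ∈ Rd F0 1 := F0_step (d := 0) F0_s1 F0_0 α
lemma F0_2 (α : Ex (2 + 2)) : (monomial α.1 1 : P5 ℚ) ∈ Rd F0 2 := F0_step (d := 1) F0_s2 F0_1 α

/-- good 5-tuples of covectors -/
def Good {K : Type*} [CommRing K] (n : Fin 5 → Fin 16 → K) : Prop :=
  ∀ d, d ≤ 2 → ∀ α : Ex (d + 2), (monomial α.1 1 : P5 K) ∈ Rd n d

lemma good_generic : ∃ G : MvPolynomial (Fin 5 × Fin 16) ℚ, aeval (fun ip => F0 ip.1 ip.2) G ≠ 0 ∧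
      ∀ (K : Type) [Field K] [Algebra ℚ K] (n : Fin 5 → Fin 16 → K), aeval (fun ip => n ip.1 ip.2) G ≠ 0 →
        Good n := by
  obtain ⟨G0, a0, b0⟩ := generic_G F0 0 F0_0
  obtain ⟨G1, a1, b1⟩ := generic_G F0 1 F0_1
  obtain ⟨G2, a2, b2⟩ := generic_G F0 2 F0_2
  refine ⟨G0 * G1 * G2, ?_, ?_⟩
  · rw [map_mul, map_mul]; exact mul_ne_zero (mul_ne_zero a0 a1) a2
  · intro K _ _ n hn
    rw [map_mul, map_mul] at hn
    have h2 := right_ne_zero_of_mul hn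
    have h01 := left_ne_zero_of_mul hn
    intro d hd
    interval_cases d
    · exact b0 K n (left_ne_zero_of_mul h01)
    · exact b1 K n (right_ne_zero_of_mul h01)
    · exact b2 K n h2

end OK

namespace OK
open Finset MvPolynomial

section SP
variable {K : Type*} [Field K]

lemma bd_le (β : Fin 12) : bd β ≤ 3 := by revert β; decide

lemma good_all {n : Fin 5 → Fin 16 → K} (hn : Good n) (d : ℕ) (α : Ex (d + 2)) :
    (monomial α.1 1 : P5 K) ∈ Rd n d := by
  induction d with
  | zero => exact hn 0 (by norm_num) α
  | succ d ih =>
    by_cases hd : d + 1 ≤ 2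
    · exact hn _ hd α
    obtain ⟨i, α', h3, h4⟩ := exists_deg_succ (d := d + 2) (mem_Ex.1 α.2)
    have h5 := ih ⟨α', mem_Ex.2 h3⟩
    have : Rd n d ≤ (Rd n (d + 1)).comap (LinearMap.mulLeft K (X i : P5 K)) := by
      rw [Rd, Submodule.span_le]
      rintro _ ⟨k, rfl⟩
      rcases k with ⟨a, γ⟩ | β
      · refine Submodule.subset_span ⟨.inl (a, ⟨Finsupp.single i 1 + γ.1, mem_Ex.2 ?_⟩), ?_⟩
        · simp [mem_Ex.1 γ.2, add_comm]
        · simp only [col, LinearMap.mulLeft_apply, ← mul_assoc]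
          rw [X, monomial_mul, one_mul]
      · have := bd_le β.1
        have := β.2
        omega
    have h6 := this h5
    rw [h4]
    rwa [Submodule.mem_comap, LinearMap.mulLeft_apply, X, monomial_mul, one_mul] at h6

/-- adapted linear coordinates -/
structure Crd (K : Type*) [Field K] where
  n : Fin 5 → Fin 16 → K
  c : Fin 11 → Fin 16 → K
  v : Fin 5 → Fin 16 → K
  b : Fin 11 → Fin 16 → K
  hX : ∀ p q, ∑ i, n i p * v i q + ∑ k, c k p * b k q = if p = q then 1 else 0

variable (Z : Crd K)
/-- transversal directions -/
def Crd.sig (i : Fin 5) : PR K := ∑ p, C (Z.v i p) * X p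
/-- tangential directions -/
def Crd.eta (k : Fin 11) : PR K := ∑ p, C (Z.b k p) * X p

lemma Crd.X_eq (p : Fin 16) : (X p : PR K) = ∑ i, C (Z.n i p) * Z.sig i + ∑ k, C (Z.c k p) * Z.eta k := by
  have h : ∀ q, (C (∑ i, Z.n i p * Z.v i q + ∑ k, Z.c k p * Z.b k q) : PR K) * X q = if p = q then X q else 0 := by
    intro q; rw [Z.hX]; split_ifs <;> simp
  have h2 := Finset.sum_congr (rfl : (univ : Finset (Fin 16)) = univ) fun q _ => h q
  rw [Finset.sum_ite_eq, if_pos (mem_univ _)] at h2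
  rw [← h2]
  have e1 : ∑ i, C (Z.n i p) * Z.sig i = ∑ q, C (∑ i, Z.n i p * Z.v i q) * X q := by
    simp only [Crd.sig, Finset.mul_sum, map_sum, Finset.sum_mul, C_mul, mul_assoc]
    exact Finset.sum_comm
  have e2 : ∑ i, C (Z.c i p) * Z.eta i = ∑ q, C (∑ i, Z.c i p * Z.b i q) * X q := by
    simp only [Crd.eta, Finset.mul_sum, map_sum, Finset.sum_mul, C_mul, mul_assoc]
    exact Finset.sum_comm
  rw [e1, e2, ← Finset.sum_add_distrib]
  exact Finset.sum_congr rfl fun q _ => by rw [C_add, add_mul]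

/-- projected coordinate -/
def Crd.xs (p : Fin 16) : PR K := ∑ i, C (Z.n i p) * Z.sig i

/-- generators -/
def Crd.gen (e : Fin 11 →₀ ℕ) (β : Fin 12) : PR K :=
  aeval Z.eta (monomial e (1 : K)) * aeval Z.sig (bm K β)

/-- reducible polynomials -/
def Crd.W (m : ℕ) : Submodule K (PR K) :=
  Submodule.span K {g | ∃ e β, e.degree + bd β ≤ m ∧ g = Z.gen e β} ⊔
    Submodule.span K {g | ∃ D : PR K, ∃ a, D.totalDegree + 2 ≤ m ∧ g = D * Q K a}

lemma Crd.W_mono {m m' : ℕ} (h : m ≤ m') : Z.W m ≤ Z.W m' := by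
  refine sup_le_sup (Submodule.span_mono ?_) (Submodule.span_mono ?_)
  · rintro g ⟨e, β, h1, rfl⟩; exact ⟨e, β, h1.trans h, rfl⟩
  · rintro g ⟨e, β, h1, rfl⟩; exact ⟨e, β, h1.trans h, rfl⟩

lemma totalDegree_lin (w : Fin 16 → K) : (∑ p, C (w p) * X p : PR K).totalDegree ≤ 1 := by
  refine (totalDegree_finset_sum _ _).trans (Finset.sup_le fun p _ => ?_)
  refine (totalDegree_mul _ _).trans ?_
  rw [totalDegree_C, totalDegree_X]

lemma Crd.sig_deg (i) : (Z.sig i).totalDegree ≤ 1 := totalDegree_lin _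
lemma Crd.eta_deg (i) : (Z.eta i).totalDegree ≤ 1 := totalDegree_lin _

lemma Crd.eta_mul_W {m : ℕ} (k : Fin 11) {f : PR K} (hf : f ∈ Z.W m) : Z.eta k * f ∈ Z.W (m + 1) := by
  have : Z.W m ≤ (Z.W (m + 1)).comap (LinearMap.mulLeft K (Z.eta k)) := by
    refine sup_le (Submodule.span_le.2 ?_) (Submodule.span_le.2 ?_)
    · rintro g ⟨e, β, h1, rfl⟩
      refine Submodule.mem_sup_left (Submodule.subset_span ⟨Finsupp.single k 1 + e, β, ?_, ?_⟩)
      · simp; omega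
      · rw [LinearMap.mulLeft_apply, Crd.gen, Crd.gen, ← mul_assoc]
        congr 1
        rw [show (monomial (Finsupp.single k 1 + e) (1 : K)) = X k * monomial e 1 by
          rw [X, monomial_mul, one_mul], map_mul, aeval_X]
    · rintro g ⟨D, a, h1, rfl⟩
      refine Submodule.mem_sup_right (Submodule.subset_span ⟨Z.eta k * D, a, ?_, ?_⟩)
      · have := totalDegree_mul (Z.eta k) D
        have := Z.eta_deg k
        omega
      · rw [LinearMap.mulLeft_apply, mul_assoc]
  exact this hf

/-- degree filtration -/
abbrev Pm (K : Type*) [Field K] (m : ℕ) : Submodule K (PR K) := restrictTotalDegree (Fin 16) K m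

lemma Pm_mul {m m' : ℕ} {f g : PR K} (hf : f ∈ Pm K m) (hg : g ∈ Pm K m') : f * g ∈ Pm K (m + m') := by
  rw [mem_restrictTotalDegree] at *
  exact (totalDegree_mul _ _).trans (add_le_add hf hg)

/-- combination of tangential directions -/
def Crd.Nm (m : ℕ) : Submodule K (PR K) :=
  Submodule.span K {g | ∃ f ∈ Pm K m, ∃ k, g = Z.eta k * f}

lemma Crd.Nm_mul {m m' : ℕ} {f g : PR K} (hf : f ∈ Pm K m) (hg : g ∈ Z.Nm m') : f * g ∈ Z.Nm (m + m') := by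
  have : Z.Nm m' ≤ (Z.Nm (m + m')).comap (LinearMap.mulLeft K f) := by
    refine Submodule.span_le.2 ?_
    rintro g ⟨h, hh, k, rfl⟩
    refine Submodule.subset_span ⟨f * h, Pm_mul hf hh, k, ?_⟩
    rw [LinearMap.mulLeft_apply]; ring
  exact this hg

lemma Crd.Nm_mono {m m' : ℕ} (h : m ≤ m') : Z.Nm m ≤ Z.Nm m' := by
  refine Submodule.span_mono ?_
  rintro g ⟨f, hf, k, rfl⟩
  refine ⟨f, ?_, k, rfl⟩
  rw [mem_restrictTotalDegree] at *; omega

lemma Crd.xs_deg (p) : Z.xs p ∈ Pm K 1 := by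
  refine Submodule.sum_mem _ fun i _ => ?_
  rw [mem_restrictTotalDegree]
  refine (totalDegree_mul _ _).trans ?_
  rw [totalDegree_C]; have := Z.sig_deg i; omega

lemma Crd.X_sub (p) : (X p - Z.xs p : PR K) ∈ Z.Nm 0 := by
  rw [Z.X_eq p, Crd.xs, add_sub_cancel_left]
  refine Submodule.sum_mem _ fun k _ => ?_
  refine Submodule.subset_span ⟨C (Z.c k p), ?_, k, mul_comm _ _⟩
  rw [mem_restrictTotalDegree, totalDegree_C]

lemma aeval_deg {σ : Type*} (g : σ → PR K) (hg : ∀ i, g i ∈ Pm K 1) (f : MvPolynomial σ K) {m : ℕ} (hf : f.totalDegree ≤ m) :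
    aeval g f ∈ Pm K m := by
  rw [f.as_sum, map_sum]
  refine Submodule.sum_mem _ fun α hα => ?_
  rw [aeval_monomial]
  have h1 : α.degree ≤ m := (le_totalDegree hα).trans hf
  rw [mem_restrictTotalDegree]
  refine (totalDegree_mul _ _).trans ?_
  rw [algebraMap_eq, totalDegree_C, zero_add, Finsupp.prod]
  refine (totalDegree_finset_prod _ _).trans ?_
  refine le_trans (Finset.sum_le_sum fun i _ => ?_) (h1 : ∑ i ∈ α.support, α i ≤ m)
  refine (totalDegree_pow _ _).trans ?_
  have := hg i
  rw [mem_restrictTotalDegree] at this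
  nlinarith

lemma Crd.sub_mem (m : ℕ) (p : PR K) (hp : p.totalDegree ≤ m + 1) : p - aeval Z.xs p ∈ Z.Nm m := by
  have key : ∀ (α : Fin 16 →₀ ℕ) (m : ℕ), α.degree ≤ m + 1 →
      (monomial α 1 : PR K) - aeval Z.xs (monomial α (1 : K)) ∈ Z.Nm m := by
    intro α
    induction α using Finsupp.induction_linear with
    | zero => intro m _; simp
    | add f g hf hg =>
      intro m hm
      rw [map_add] at hm
      by_cases h0 : f.degree = 0
      · have : f = 0 := (Finsupp.degree_eq_zero_iff _).1 h0
        subst this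
        rw [zero_add]; exact hg m (by omega)
      by_cases h0' : g.degree = 0
      · have : g = 0 := (Finsupp.degree_eq_zero_iff _).1 h0'
        subst this
        rw [add_zero]; exact hf m (by omega)
      have e : (monomial (f + g) 1 : PR K) = monomial f 1 * monomial g 1 := by rw [monomial_mul, one_mul]
      rw [e, map_mul]
      have e2 : (monomial f 1 : PR K) * monomial g 1 - aeval Z.xs (monomial f (1 : K)) * aeval Z.xs (monomial g (1 : K)) =
        monomial f 1 * (monomial g 1 - aeval Z.xs (monomial g (1 : K))) +
         aeval Z.xs (monomial g (1 : K)) * (monomial f 1 - aeval Z.xs (monomial f (1 : K))) := by ring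
      rw [e2]
      refine Submodule.add_mem _ ?_ ?_
      · refine Z.Nm_mono ?_ (Z.Nm_mul (m := f.degree) ?_ (hg (g.degree - 1) (by omega)))
        · omega
        · rw [mem_restrictTotalDegree, totalDegree_monomial _ one_ne_zero]; exact le_rfl
      · refine Z.Nm_mono ?_ (Z.Nm_mul (m := g.degree) ?_ (hf (f.degree - 1) (by omega)))
        · omega
        · refine aeval_deg _ Z.xs_deg _ ?_
          rw [totalDegree_monomial _ one_ne_zero]; exact le_rfl
    | single p k =>
      induction k with
      | zero => intro m _; simp
      | succ k ih =>
        intro m hm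
        have e : (monomial (Finsupp.single p (k + 1)) 1 : PR K) = X p * monomial (Finsupp.single p k) 1 := by
          rw [X, monomial_mul, one_mul, ← Finsupp.single_add, add_comm]
        have e2 : (X p : PR K) * monomial (Finsupp.single p k) 1 - aeval Z.xs (X p : PR K) * aeval Z.xs (monomial (Finsupp.single p k) (1 : K)) =
          X p * (monomial (Finsupp.single p k) 1 - aeval Z.xs (monomial (Finsupp.single p k) (1 : K))) +
         aeval Z.xs (monomial (Finsupp.single p k) (1 : K)) * (X p - Z.xs p) := by rw [aeval_X]; ring
        rw [e, map_mul, e2]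
        simp at hm
        refine Submodule.add_mem _ ?_ ?_
        · cases k with
          | zero => simp
          | succ k =>
            refine Z.Nm_mono ?_ (Z.Nm_mul (m := 1) ?_ (ih k (by simp)))
            · omega
            · rw [mem_restrictTotalDegree, totalDegree_X]
        · refine Z.Nm_mono ?_ (Z.Nm_mul (m := k) ?_ (Z.X_sub p))
          · omega
          · refine aeval_deg _ Z.xs_deg _ ?_
            rw [totalDegree_monomial _ one_ne_zero]; simp
  have e0 : p - aeval Z.xs p = ∑ α ∈ p.support, ((monomial α (coeff α p) : PR K) - aeval Z.xs (monomial α (coeff α p))) := by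
    rw [Finset.sum_sub_distrib, ← map_sum, ← p.as_sum]
  rw [e0]
  refine Submodule.sum_mem _ fun α hα => ?_
  have : (monomial α (coeff α p) : PR K) - aeval Z.xs (monomial α (coeff α p)) =
      coeff α p • ((monomial α 1 : PR K) - aeval Z.xs (monomial α (1 : K))) := by
    have e1 : (monomial α (coeff α p) : PR K) = coeff α p • monomial α 1 := by
      rw [smul_monomial, smul_eq_mul, mul_one]
    rw [smul_sub, ← map_smul (aeval Z.xs : PR K →ₐ[K] PR K), ← e1]
  rw [this]
  exact Submodule.smul_mem _ _ (key α m ((le_totalDegree hα).trans hp))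

lemma Q_deg (a) : (Q K a).totalDegree ≤ 2 := by
  rw [Q, ph_sum]
  refine (totalDegree_finset_sum _ _).trans (Finset.sup_le fun p _ => ?_)
  refine (totalDegree_mul _ _).trans ?_
  have h2 : (((sg a p : ℤ) : PR K) * X (sh a p)).totalDegree ≤ 1 := by
    rw [show ((sg a p : ℤ) : PR K) = C ((sg a p : ℤ) : K) by simp]
    refine (totalDegree_mul _ _).trans ?_
    rw [totalDegree_C, totalDegree_X]
  rw [totalDegree_X]
  omega

lemma Crd.Q_xs (a) : aeval Z.xs (Q K a) = aeval Z.sig (qr Z.n a) := by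
  have h1 := map_ph ((aeval Z.xs : _ →ₐ[K] PR K) : _ →+* PR K) a (X : Fin 16 → PR K)
  have h2 := map_ph ((aeval Z.sig : P5 K →ₐ[K] PR K) : P5 K →+* PR K) a (fun p => ∑ i, C (Z.n i p) * X i)
  simp only [RingHom.coe_coe, aeval_X] at h1 h2
  rw [Q, qr, h1, h2]
  congr 1
  funext p
  simp [Crd.xs, algebraMap_eq]

/-- spanning statement SP -/
theorem Crd.SP (hn : Good Z.n) (m : ℕ) (p : PR K) (hp : p.totalDegree ≤ m) : p ∈ Z.W m := by
  induction m using Nat.strong_induction_on generalizing p with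
  | _ m ih =>
  have hN : ∀ m', m' < m → ∀ g ∈ Z.Nm m', g ∈ Z.W (m' + 1) := by
    intro m' hm' g hg
    have : Z.Nm m' ≤ Z.W (m' + 1) := by
      refine Submodule.span_le.2 ?_
      rintro g ⟨f, hf, k, rfl⟩
      exact Z.eta_mul_W k (ih m' hm' f ((mem_restrictTotalDegree _ _ _).1 hf))
    exact this hg
  rcases m with _ | m
  · have h0 : p.totalDegree = 0 := by omega
    rw [totalDegree_eq_zero_iff_eq_C] at h0
    rw [h0]
    have : (C (coeff 0 p) : PR K) = coeff 0 p • Z.gen 0 0 := by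
      simp [Crd.gen, bm, smul_eq_C_mul]
    rw [this]
    exact Submodule.smul_mem _ _ (Submodule.mem_sup_left (Submodule.subset_span ⟨0, 0, by simp [bd], rfl⟩))
  have h1 := hN m (Nat.lt_succ_self m) _ (Z.sub_mem m p hp)
  have h2 : p = (p - aeval Z.xs p) + aeval Z.xs p := by ring
  rw [h2]
  refine Submodule.add_mem _ h1 ?_
  -- the transversal part
  set f : P5 K := aeval (fun q => ∑ i, C (Z.n i q) * X i) p with hf
  have hfe : aeval Z.xs p = aeval Z.sig f := by
    have : (aeval Z.sig).comp (aeval (fun q => ∑ i, C (Z.n i q) * X i : Fin 16 → P5 K)) = (aeval Z.xs : PR K →ₐ[K] PR K) := by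
      apply MvPolynomial.algHom_ext
      intro q
      simp [Crd.xs, algebraMap_eq]
    rw [hf, ← this]; rfl
  have hfd : f.totalDegree ≤ m + 1 := by
    rw [hf, p.as_sum, map_sum]
    refine (totalDegree_finset_sum _ _).trans (Finset.sup_le fun α hα => ?_)
    rw [aeval_monomial]
    refine (totalDegree_mul _ _).trans ?_
    rw [algebraMap_eq, totalDegree_C, zero_add, Finsupp.prod]
    refine (totalDegree_finset_prod _ _).trans ?_
    refine le_trans (Finset.sum_le_sum fun i _ => ?_) ((le_totalDegree hα).trans hp)
    refine (totalDegree_pow _ _).trans ?_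
    have : (∑ j, C (Z.n j i) * X j : P5 K).totalDegree ≤ 1 := by
      refine (totalDegree_finset_sum _ _).trans (Finset.sup_le fun p _ => ?_)
      refine (totalDegree_mul _ _).trans ?_
      rw [totalDegree_C, totalDegree_X]
    nlinarith
  rw [hfe, ← sum_homogeneousComponent f, map_sum]
  refine Submodule.sum_mem _ fun j hj => ?_
  have hj' : j ≤ m + 1 := by rw [Finset.mem_range] at hj; omega
  have hh := homogeneousComponent_isHomogeneous j f
  rcases hj'.lt_or_eq with hlt | rfl
  · refine Z.W_mono hj' (ih j hlt _ ?_)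
    exact (mem_restrictTotalDegree _ _ _).1 (aeval_deg _ (fun i => (mem_restrictTotalDegree _ _ _).2 (Z.sig_deg i)) _ (hh.totalDegree_le))
  rcases m with _ | d
  · -- degree one
    set g := homogeneousComponent (0 + 1) f
    rw [g.as_sum, map_sum]
    refine Submodule.sum_mem _ fun α hα => ?_
    have hd : α.degree = 0 + 1 := by
      by_contra hne
      exact (mem_support_iff.1 hα) (hh.coeff_eq_zero hne)
    obtain ⟨i, α', h3, h4⟩ := exists_deg_succ hd
    have h5 : α' = 0 := (Finsupp.degree_eq_zero_iff _).1 h3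
    rw [h4, h5, add_zero]
    have hb : ∃ β, bd β = 1 ∧ bm K β = X i := by
      fin_cases i
      exacts [⟨1, rfl, rfl⟩, ⟨2, rfl, rfl⟩, ⟨3, rfl, rfl⟩, ⟨4, rfl, rfl⟩, ⟨5, rfl, rfl⟩]
    obtain ⟨β, hβ, hβ2⟩ := hb
    have : aeval Z.sig (monomial (Finsupp.single i 1) (coeff (Finsupp.single i 1) g)) =
      coeff (Finsupp.single i 1) g • Z.gen 0 β := by
      rw [aeval_monomial]; simp [Crd.gen, hβ2, Algebra.smul_def]
    rw [this]
    exact Submodule.smul_mem _ _ (Submodule.mem_sup_left (Submodule.subset_span ⟨0, β, by simp [hβ], rfl⟩))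
  · have h6 := homog_le_Rd Z.n d (good_all hn d) _ hh
    have : Rd Z.n d ≤ (Z.W (d + 2)).comap (aeval Z.sig : P5 K →ₐ[K] PR K).toLinearMap := by
      rw [Rd, Submodule.span_le]
      rintro _ ⟨k, rfl⟩
      rcases k with ⟨a, γ⟩ | β
      · show aeval Z.sig (monomial γ.1 1 * qr Z.n a) ∈ Z.W (d + 2)
        rw [map_mul, ← Z.Q_xs]
        have hγ : aeval Z.sig (monomial γ.1 (1 : K)) ∈ Pm K d := by
          refine aeval_deg _ (fun i => (mem_restrictTotalDegree _ _ _).2 (Z.sig_deg i)) _ ?_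
          rw [totalDegree_monomial _ one_ne_zero]
          exact (mem_Ex.1 γ.2).le
        have e : aeval Z.sig (monomial γ.1 (1 : K)) * aeval Z.xs (Q K a) =
          aeval Z.sig (monomial γ.1 (1 : K)) * Q K a - aeval Z.sig (monomial γ.1 (1 : K)) * (Q K a - aeval Z.xs (Q K a)) := by ring
        rw [e]
        refine Submodule.sub_mem _ ?_ ?_
        · refine Submodule.mem_sup_right (Submodule.subset_span ⟨_, a, ?_, rfl⟩)
          have := (mem_restrictTotalDegree _ _ _).1 hγ
          omega
        · exact hN (d + 1) (by omega) _ (Z.Nm_mul hγ (Z.sub_mem 1 _ (Q_deg a)))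
      · show aeval Z.sig (bm K β.1) ∈ Z.W (d + 2)
        refine Submodule.mem_sup_left (Submodule.subset_span ⟨0, β.1, by simp [β.2], by simp [Crd.gen]⟩)
    exact this h6
end SP
end OK

namespace OK
open Finset MvPolynomial

/-- chains -/
def Ch : Fin 12 → Fin 11 → Fin 16 := ![
  ![0, 1, 2, 4, 5, 6, 8, 10, 11, 12, 15],
  ![0, 1, 2, 4, 6, 8, 9, 10, 11, 12, 15],
  ![0, 2, 4, 6, 8, 9, 10, 11, 12, 14, 15],
  ![0, 1, 2, 4, 6, 8, 9, 10, 11, 13, 15],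
  ![0, 1, 2, 4, 5, 7, 8, 10, 11, 13, 15],
  ![0, 1, 2, 3, 4, 5, 7, 8, 11, 12, 15],
  ![0, 1, 2, 4, 5, 6, 8, 10, 11, 13, 15],
  ![0, 2, 4, 6, 8, 9, 10, 11, 13, 14, 15],
  ![0, 1, 2, 4, 5, 7, 8, 10, 11, 12, 15],
  ![0, 1, 2, 3, 4, 5, 6, 8, 11, 12, 15],
  ![0, 1, 2, 4, 7, 8, 9, 10, 11, 13, 15],
  ![0, 1, 2, 4, 7, 8, 9, 10, 11, 12, 15]]
/-- restriction sets -/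
def Rl : Fin 12 → List (Fin 16) := ![
  [], [9], [14], [13], [7], [3], [5, 13], [13, 14], [7, 12], [3, 6], [7, 9], [7, 9, 12]]
/-- leading exponents -/
def Lx : Fin 16 → Fin 11 → ℕ := ![
  ![2, 0, 0, 0, 0, 0, 0, 0, 0, 0, 0],
  ![0, 0, 0, 0, 0, 1, 1, 0, 0, 0, 0],
  ![1, 1, 0, 0, 0, 0, 0, 0, 0, 0, 0],
  ![1, 0, 1, 0, 0, 0, 0, 0, 0, 0, 0],
  ![1, 0, 0, 1, 0, 0, 0, 0, 0, 0, 0],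
  ![1, 0, 0, 0, 1, 0, 0, 0, 0, 0, 0],
  ![1, 0, 0, 0, 0, 1, 0, 0, 0, 0, 0],
  ![1, 0, 0, 0, 0, 0, 1, 0, 0, 0, 0],
  ![1, 0, 0, 0, 0, 0, 0, 1, 0, 0, 0],
  ![0, 0, 0, 0, 0, 0, 1, 0, 0, 0, 1],
  ![0, 0, 0, 0, 1, 0, 0, 0, 0, 0, 1],
  ![1, 0, 0, 0, 0, 0, 0, 0, 1, 0, 0],
  ![0, 0, 1, 0, 0, 0, 0, 0, 0, 0, 1],
  ![1, 0, 0, 0, 0, 0, 0, 0, 0, 1, 0],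
  ![1, 0, 0, 0, 0, 0, 0, 0, 0, 0, 1],
  ![0, 0, 1, 0, 0, 0, 0, 0, 0, 1, 0]]

/-- exponent of the leading monomial -/
def Ee (e : Fin 11 →₀ ℕ) (β : Fin 12) (i : Fin 11) : ℕ := ((Rl β).map fun r => Lx r i).sum + ∑ j, e j * Lx (Ch β j) i

/-- explicit table of the exponents -/
def Et (x : Fin 11 → ℕ) : Fin 12 → Fin 11 → ℕ := ![
  ![x 0 * 2 + x 2 + x 3 + x 4 + x 5 + x 6 + x 8, x 2, x 9 + x 10, x 3, x 4 + x 7, x 1 + x 5, x 1, x 6, x 8, x 10, x 7 + x 9],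
  ![x 0 * 2 + x 2 + x 3 + x 4 + x 5 + x 8, x 2, x 9 + x 10, x 3, x 7, x 1 + x 4, 1 + x 1 + x 6, x 5, x 8, x 10, 1 + x 6 + x 7 + x 9],
  ![1 + x 0 * 2 + x 1 + x 2 + x 3 + x 4 + x 7 + x 9, x 1, x 8 + x 10, x 2, x 6, x 3, x 5, x 4, x 7, x 10, 1 + x 5 + x 6 + x 8 + x 9],
  ![1 + x 0 * 2 + x 2 + x 3 + x 4 + x 5 + x 8 + x 9, x 2, x 10, x 3, x 7, x 1 + x 4, x 1 + x 6, x 5, x 8, 1 + x 9 + x 10, x 6 + x 7],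
  ![1 + x 0 * 2 + x 2 + x 3 + x 4 + x 5 + x 6 + x 8 + x 9, x 2, x 10, x 3, x 4 + x 7, x 1, 1 + x 1 + x 5, x 6, x 8, x 9 + x 10, x 7],
  ![1 + x 0 * 2 + x 2 + x 3 + x 4 + x 5 + x 6 + x 7 + x 8, x 2, 1 + x 3 + x 9 + x 10, x 4, x 5, x 1, x 1 + x 6, x 7, x 8, x 10, x 9],
  ![2 + x 0 * 2 + x 2 + x 3 + x 4 + x 5 + x 6 + x 8 + x 9, x 2, x 10, x 3, 1 + x 4 + x 7, x 1 + x 5, x 1, x 6, x 8, 1 + x 9 + x 10, x 7],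
  ![2 + x 0 * 2 + x 1 + x 2 + x 3 + x 4 + x 7 + x 8 + x 9, x 1, x 10, x 2, x 6, x 3, x 5, x 4, x 7, 1 + x 8 + x 10, 1 + x 5 + x 6 + x 9],
  ![1 + x 0 * 2 + x 2 + x 3 + x 4 + x 5 + x 6 + x 8, x 2, 1 + x 9 + x 10, x 3, x 4 + x 7, x 1, 1 + x 1 + x 5, x 6, x 8, x 10, 1 + x 7 + x 9],
  ![2 + x 0 * 2 + x 2 + x 3 + x 4 + x 5 + x 6 + x 7 + x 8, x 2, 1 + x 3 + x 9 + x 10, x 4, x 5, 1 + x 1 + x 6, x 1, x 7, x 8, x 10, x 9],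
  ![1 + x 0 * 2 + x 2 + x 3 + x 4 + x 5 + x 8 + x 9, x 2, x 10, x 3, x 7, x 1, 2 + x 1 + x 4 + x 6, x 5, x 8, x 9 + x 10, 1 + x 6 + x 7],
  ![1 + x 0 * 2 + x 2 + x 3 + x 4 + x 5 + x 8, x 2, 1 + x 9 + x 10, x 3, x 7, x 1, 2 + x 1 + x 4 + x 6, x 5, x 8, x 10, 2 + x 6 + x 7 + x 9]]

lemma sum11 (f : Fin 11 → ℕ) : ∑ j, f j = f 0 + f 1 + f 2 + f 3 + f 4 + f 5 + f 6 + f 7 + f 8 + f 9 + f 10 := by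
  rw [Fin.sum_univ_castSucc, Fin.sum_univ_castSucc, Fin.sum_univ_castSucc, Fin.sum_univ_eight]; rfl

set_option maxHeartbeats 4000000 in
lemma Ee_Et (e : Fin 11 →₀ ℕ) (β : Fin 12) (i : Fin 11) : Ee e β i = Et e β i := by
  fin_cases β <;> fin_cases i <;>
  simp only [Ee, Rl, Ch, Lx, Et, sum11, Matrix.cons_val, List.map_cons, List.map_nil, List.sum_cons, List.sum_nil,
    Nat.mul_zero, Nat.mul_one, Nat.add_zero, Nat.zero_add, Fin.zero_eta, Fin.mk_one, Fin.reduceFinMk] <;> omega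

set_option maxHeartbeats 8000000 in
lemma Et_inj (e e' : Fin 11 → ℕ) (β β' : Fin 12) (hb : β ≤ β')
    (h : ∀ i, Et e β i = Et e' β' i) : β = β' ∧ ∀ j, e j = e' j := by
  have h0 := h 0
  have h1 := h 1
  have h2 := h 2
  have h3 := h 3
  have h4 := h 4
  have h5 := h 5
  have h6 := h 6
  have h7 := h 7
  have h8 := h 8
  have h9 := h 9
  have h10 := h 10
  clear h
  by_cases hbb : β = β'
  · subst hbb
    have key : ∀ j : Fin 11, e j = e' j ↔ ![e 0 = e' 0, e 1 = e' 1, e 2 = e' 2, e 3 = e' 3, e 4 = e' 4, e 5 = e' 5,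
      e 6 = e' 6, e 7 = e' 7, e 8 = e' 8, e 9 = e' 9, e 10 = e' 10] j := by
      intro j; fin_cases j <;> rfl
    suffices hs : e 0 = e' 0 ∧ e 1 = e' 1 ∧ e 2 = e' 2 ∧ e 3 = e' 3 ∧ e 4 = e' 4 ∧ e 5 = e' 5 ∧ e 6 = e' 6 ∧
        e 7 = e' 7 ∧ e 8 = e' 8 ∧ e 9 = e' 9 ∧ e 10 = e' 10 by
      obtain ⟨k0, k1, k2, k3, k4, k5, k6, k7, k8, k9, k10⟩ := hs
      refine ⟨rfl, fun j => ?_⟩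
      fin_cases j <;> assumption
    fin_cases β <;>
    · simp only [Et, Matrix.cons_val, Fin.zero_eta, Fin.mk_one, Fin.reduceFinMk] at h0 h1 h2 h3 h4 h5 h6 h7 h8 h9 h10
      refine ⟨?_, ?_, ?_, ?_, ?_, ?_, ?_, ?_, ?_, ?_, ?_⟩ <;> omega
  · exfalso
    fin_cases β <;> fin_cases β' <;> first
      | exact absurd hb (by decide)
      | exact hbb rfl
      | (simp only [Et, Matrix.cons_val, Fin.zero_eta, Fin.mk_one, Fin.reduceFinMk] at h0 h1 h2 h3 h4 h5 h6 h7 h8 h9 h10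
         clear hb hbb
         omega)
end OK

namespace OK
open Finset MvPolynomial

/-- the target ring of the parametrisation -/
abbrev BR := MvPolynomial (Fin 11) ℂ
/-- with a weight variable -/
abbrev BS := Polynomial BR

/-- variables -/
abbrev xv (i : Fin 11) : BR := X i

/-- constants -/
abbrev pc (a : BR) : BS := Polynomial.C a

/-- parametrisation in split coordinates -/
def zz : Fin 16 → BS := ![
  pc (xv 0 * xv 0),
  pc (-(xv 5 * xv 6)) * Polynomial.X + pc (-(xv 1 * xv 2 + xv 3 * xv 4)),
  pc (xv 0 * xv 1), pc (xv 0 * xv 2), pc (xv 0 * xv 3), pc (xv 0 * xv 4), pc (xv 0 * xv 5) * Polynomial.X, pc (xv 0 * xv 6),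
  pc (xv 0 * xv 7),
  pc (-(xv 6 * xv 10)) * Polynomial.X ^ 3 + (pc (-(xv 3 * xv 9)) * Polynomial.X + pc (-(xv 1 * xv 8))),
  pc (-(xv 4 * xv 10)) * Polynomial.X ^ 3 + (pc (xv 5 * xv 9) * Polynomial.X ^ 2 + pc (xv 1 * xv 7)),
  pc (xv 0 * xv 8),
  pc (xv 2 * xv 10) * Polynomial.X ^ 3 + (pc (-(xv 5 * xv 8)) * Polynomial.X + pc (xv 3 * xv 7)),
  pc (xv 0 * xv 9) * Polynomial.X, pc (xv 0 * xv 10) * Polynomial.X ^ 3,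
  pc (-(xv 2 * xv 9)) * Polynomial.X + pc (xv 4 * xv 8 + xv 6 * xv 7)]

/-- signs of the leading coefficients -/
def es : Fin 16 → ℂ := ![1, -1, 1, 1, 1, 1, 1, 1, 1, -1, -1, 1, 1, 1, 1, -1]

lemma es_ne (r) : es r ≠ 0 := by fin_cases r <;> simp [es]

/-- leading exponent as a finsupp -/
def Lf (r : Fin 16) : Fin 11 →₀ ℕ := Finsupp.equivFunOnFinite.symm (Lx r)

lemma mono_two (i j : Fin 11) : (xv i * xv j : BR) = monomial (Finsupp.single i 1 + Finsupp.single j 1) 1 := by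
  rw [xv, xv, X, X, monomial_mul, one_mul]

lemma Lf_two (r : Fin 16) (i j : Fin 11) (h : ∀ k, Lx r k = (if i = k then 1 else 0) + (if j = k then 1 else 0)) :
    xv i * xv j = (monomial (Lf r) 1 : BR) := by
  rw [mono_two]
  have e : Finsupp.single i 1 + Finsupp.single j 1 = Lf r := by
    ext k
    rw [Finsupp.add_apply, Finsupp.single_apply, Finsupp.single_apply]
    exact (h k).symm
  rw [e]

lemma lead_aux {a : BR} (ha : a ≠ 0) {k : ℕ} {r : BS} (hr : r.natDegree < k) :
    (Polynomial.C a * Polynomial.X ^ k + r).leadingCoeff = a := by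
  have h1 : (Polynomial.C a * Polynomial.X ^ k : BS).natDegree = k := Polynomial.natDegree_C_mul_X_pow k a ha
  rw [Polynomial.leadingCoeff_add_of_degree_lt', Polynomial.leadingCoeff_C_mul_X_pow]
  exact Polynomial.degree_lt_degree (by rw [h1]; exact hr)

lemma nd_aux (a b : BR) (k : ℕ) : (Polynomial.C a * Polynomial.X ^ k + Polynomial.C b : BS).natDegree ≤ k := by
  refine (Polynomial.natDegree_add_le _ _).trans (max_le (Polynomial.natDegree_C_mul_X_pow_le _ _) ?_)
  rw [Polynomial.natDegree_C]; exact Nat.zero_le _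

lemma lead_zz (r : Fin 16) : (zz r).leadingCoeff = C (es r) * monomial (Lf r) 1 := by
  have hne : ∀ i j, (xv i * xv j : BR) ≠ 0 := fun i j => mul_ne_zero (X_ne_zero _) (X_ne_zero _)
  have hC : ∀ a : BR, (Polynomial.C a : BS).leadingCoeff = a := Polynomial.leadingCoeff_C
  fin_cases r
  · exact (hC _).trans (by rw [Lf_two 0 0 0 (by decide)]; simp [es])
  · refine Eq.trans ?_ (show -(xv 5 * xv 6) = _ by rw [Lf_two 1 5 6 (by decide)]; simp [es])
    exact Polynomial.leadingCoeff_linear (neg_ne_zero.2 (hne _ _))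
  · exact (hC _).trans (by rw [Lf_two 2 0 1 (by decide)]; simp [es])
  · exact (hC _).trans (by rw [Lf_two 3 0 2 (by decide)]; simp [es])
  · exact (hC _).trans (by rw [Lf_two 4 0 3 (by decide)]; simp [es])
  · exact (hC _).trans (by rw [Lf_two 5 0 4 (by decide)]; simp [es])
  · exact (Polynomial.leadingCoeff_C_mul_X _).trans (by rw [Lf_two 6 0 5 (by decide)]; simp [es])
  · exact (hC _).trans (by rw [Lf_two 7 0 6 (by decide)]; simp [es])
  · exact (hC _).trans (by rw [Lf_two 8 0 7 (by decide)]; simp [es])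
  · refine Eq.trans ?_ (show -(xv 6 * xv 10) = _ by rw [Lf_two 9 6 10 (by decide)]; simp [es])
    refine lead_aux (neg_ne_zero.2 (hne _ _)) (lt_of_le_of_lt (b := 1) ?_ (by norm_num))
    simpa only [pow_one] using nd_aux (-(xv 3 * xv 9)) (-(xv 1 * xv 8)) 1
  · refine Eq.trans ?_ (show -(xv 4 * xv 10) = _ by rw [Lf_two 10 4 10 (by decide)]; simp [es])
    refine lead_aux (neg_ne_zero.2 (hne _ _)) (lt_of_le_of_lt (b := 2) ?_ (by norm_num))
    exact nd_aux (xv 5 * xv 9) (xv 1 * xv 7) 2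
  · exact (hC _).trans (by rw [Lf_two 11 0 8 (by decide)]; simp [es])
  · refine Eq.trans ?_ (show (xv 2 * xv 10) = _ by rw [Lf_two 12 2 10 (by decide)]; simp [es])
    refine lead_aux (hne _ _) (lt_of_le_of_lt (b := 1) ?_ (by norm_num))
    simpa only [pow_one] using nd_aux (-(xv 5 * xv 8)) (xv 3 * xv 7) 1
  · exact (Polynomial.leadingCoeff_C_mul_X _).trans (by rw [Lf_two 13 0 9 (by decide)]; simp [es])
  · exact (Polynomial.leadingCoeff_C_mul_X_pow _ _).trans (by rw [Lf_two 14 0 10 (by decide)]; simp [es])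
  · refine Eq.trans ?_ (show -(xv 2 * xv 9) = _ by rw [Lf_two 15 2 9 (by decide)]; simp [es])
    exact Polynomial.leadingCoeff_linear (neg_ne_zero.2 (hne _ _))

/-- the imaginary unit -/
def II : BS := Polynomial.C (C Complex.I)
lemma II_sq : II * II = -1 := by
  rw [II, ← Polynomial.C_mul, ← C_mul, Complex.I_mul_I]; simp

section par
variable {R : Type*} [CommRing R] (J : R)
/-- real coordinates from split ones -/
def toR (z : Fin 16 → R) : Fin 16 → R := ![
  z 0 + z 1, -J * (z 0 - z 1), z 2 + z 3, -J * (z 2 - z 3), z 4 + z 5, -J * (z 4 - z 5),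
  z 6 + z 7, -J * (z 6 - z 7), z 8 + z 9, -J * (z 8 - z 9), z 10 + z 11, -J * (z 10 - z 11),
  z 12 + z 13, -J * (z 12 - z 13), z 14 + z 15, -J * (z 14 - z 15)]

/-- the parametrisation over an arbitrary ring -/
def zpar (l b2 b3 b4 b5 b6 b7 b8 b11 b13 b14 : R) : Fin 16 → R := ![l * l, -(b2 * b3 + b4 * b5 + b6 * b7),
  l * b2, l * b3, l * b4, l * b5, l * b6, l * b7, l * b8, -(b2 * b11 + b4 * b13 + b7 * b14),
  b2 * b8 - b5 * b14 + b6 * b13, l * b11, b3 * b14 + b4 * b8 - b6 * b11, l * b13, l * b14,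
  -(b3 * b13) + b5 * b11 + b7 * b8]

lemma ph_zpar (hJ : J * J = -1) (l b2 b3 b4 b5 b6 b7 b8 b11 b13 b14 : R) (a : Fin 10) :
    ph a (toR J (zpar l b2 b3 b4 b5 b6 b7 b8 b11 b13 b14)) = 0 := by
  have h := congrFun (ph_expl (toR J (zpar l b2 b3 b4 b5 b6 b7 b8 b11 b13 b14))) a
  rw [h]
  clear h
  fin_cases a
  · simp [toR, zpar]
    linear_combination (((l*l-(-(b2*b3+b4*b5+b6*b7)))^2+(l*b2-l*b3)^2+(l*b4-l*b5)^2+(l*b6-l*b7)^2+(l*b8-(-(b2*b11+b4*b13+b7*b14)))^2+((b2*b8-b5*b14+b6*b13)-l*b11)^2+((b3*b14+b4*b8-b6*b11)-l*b13)^2+(l*b14-(-(b3*b13)+b5*b11+b7*b8))^2)) * hJ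
  · simp [toR, zpar]
    linear_combination (2*((l*l-(-(b2*b3+b4*b5+b6*b7)))*(l*b8-(-(b2*b11+b4*b13+b7*b14)))+(l*b2-l*b3)*((b2*b8-b5*b14+b6*b13)-l*b11)+(l*b4-l*b5)*((b3*b14+b4*b8-b6*b11)-l*b13)+(l*b6-l*b7)*(l*b14-(-(b3*b13)+b5*b11+b7*b8)))) * hJ
  · simp [toR, zpar]
    ring
  · simp [toR, zpar]
    linear_combination (2*((l*l-(-(b2*b3+b4*b5+b6*b7)))*((b2*b8-b5*b14+b6*b13)-l*b11)-(l*b2-l*b3)*(l*b8-(-(b2*b11+b4*b13+b7*b14)))-(l*b4-l*b5)*(l*b14-(-(b3*b13)+b5*b11+b7*b8))+(l*b6-l*b7)*((b3*b14+b4*b8-b6*b11)-l*b13))) * hJ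
  · simp [toR, zpar]
    ring
  · simp [toR, zpar]
    linear_combination (2*((l*l-(-(b2*b3+b4*b5+b6*b7)))*((b3*b14+b4*b8-b6*b11)-l*b13)+(l*b2-l*b3)*(l*b14-(-(b3*b13)+b5*b11+b7*b8))-(l*b4-l*b5)*(l*b8-(-(b2*b11+b4*b13+b7*b14)))-(l*b6-l*b7)*((b2*b8-b5*b14+b6*b13)-l*b11))) * hJ
  · simp [toR, zpar]
    ring
  · simp [toR, zpar]
    linear_combination (2*(-(l*l-(-(b2*b3+b4*b5+b6*b7)))*(l*b14-(-(b3*b13)+b5*b11+b7*b8))+(l*b2-l*b3)*((b3*b14+b4*b8-b6*b11)-l*b13)-(l*b4-l*b5)*((b2*b8-b5*b14+b6*b13)-l*b11)+(l*b6-l*b7)*(l*b8-(-(b2*b11+b4*b13+b7*b14))))) * hJ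
  · simp [toR, zpar]
    ring
  · simp [toR, zpar]
    linear_combination (((l*l-(-(b2*b3+b4*b5+b6*b7)))^2+(l*b2-l*b3)^2+(l*b4-l*b5)^2+(l*b6-l*b7)^2-(l*b8-(-(b2*b11+b4*b13+b7*b14)))^2-((b2*b8-b5*b14+b6*b13)-l*b11)^2-((b3*b14+b4*b8-b6*b11)-l*b13)^2-(l*b14-(-(b3*b13)+b5*b11+b7*b8))^2)) * hJ
end par
end OK

namespace OK
open Finset MvPolynomial

lemma zz_eq : zz = zpar (pc (xv 0)) (pc (xv 1)) (pc (xv 2)) (pc (xv 3)) (pc (xv 4)) (pc (xv 5) * Polynomial.X)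
    (pc (xv 6)) (pc (xv 7)) (pc (xv 8)) (pc (xv 9) * Polynomial.X) (pc (xv 10) * Polynomial.X ^ 3) := by
  funext r
  fin_cases r <;> simp [zz, zpar] <;> ring

/-- real parametrisation -/
def zt : Fin 16 → BS := toR II zz

lemma ph_zt (a) : ph a zt = 0 := by
  rw [zt, zz_eq]; exact ph_zpar _ II_sq _ _ _ _ _ _ _ _ _ _ _ a

/-- products along chains -/
def pp (k : (Fin 11 →₀ ℕ) × Fin 12) : BS := ((Rl k.2).map zz).prod * ∏ j, zz (Ch k.2 j) ^ k.1 j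

lemma lead_zz' (r) : Polynomial.leadingCoeffHom (zz r) = monomial (Lf r) (es r) := by
  rw [Polynomial.leadingCoeffHom_apply, lead_zz, C_mul_monomial, mul_one]

lemma lead_list (l : List (Fin 16)) : (l.map fun r => (monomial (Lf r) (es r) : BR)).prod =
    monomial (l.map Lf).sum (l.map es).prod := by
  induction l with
  | nil => simp
  | cons r l ih => simp only [List.map_cons, List.prod_cons, List.sum_cons, ih, monomial_mul]

lemma lead_fin (s : Finset (Fin 11)) (c : Fin 11 → Fin 16) (e : Fin 11 →₀ ℕ) :
    ∏ j ∈ s, (monomial (Lf (c j)) (es (c j)) : BR) ^ e j = monomial (∑ j ∈ s, e j • Lf (c j)) (∏ j ∈ s, es (c j) ^ e j) := by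
  induction s using Finset.induction_on with
  | empty => simp
  | insert a s ha ih => rw [prod_insert ha, prod_insert ha, sum_insert ha, ih, monomial_pow, monomial_mul]

/-- leading exponent of a product -/
def Ef (k : (Fin 11 →₀ ℕ) × Fin 12) : Fin 11 →₀ ℕ := ((Rl k.2).map Lf).sum + ∑ j, k.1 j • Lf (Ch k.2 j)
/-- leading constant of a product -/
def ec (k : (Fin 11 →₀ ℕ) × Fin 12) : ℂ := ((Rl k.2).map es).prod * ∏ j, es (Ch k.2 j) ^ k.1 j

lemma ec_ne (k) : ec k ≠ 0 := by
  refine mul_ne_zero (List.prod_ne_zero ?_) (prod_ne_zero_iff.2 fun j _ => pow_ne_zero _ (es_ne _))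
  simp only [List.mem_map, not_exists, not_and]
  exact fun r _ => es_ne r

lemma lead_pp (k) : (pp k).leadingCoeff = monomial (Ef k) (ec k) := by
  rw [← Polynomial.leadingCoeffHom_apply, pp, map_mul, map_list_prod, map_prod, List.map_map]
  simp only [map_pow, lead_zz']
  rw [show (Polynomial.leadingCoeffHom (R := BR) ∘ zz) = fun r => monomial (Lf r) (es r) from funext lead_zz', lead_list, lead_fin,
    monomial_mul]
  rfl

lemma Ef_eq (k i) : Ef k i = Ee k.1 k.2 i := by
  rw [Ef, Ee, Finsupp.add_apply]
  congr 1
  · induction Rl k.2 with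
    | nil => rfl
    | cons r l ih => simp only [List.map_cons, List.sum_cons, Finsupp.add_apply, ih]; rfl

lemma Ef_inj : Function.Injective Ef := by
  rintro ⟨e, β⟩ ⟨e', β'⟩ h
  have h1 : ∀ i, Et e β i = Et e' β' i := fun i => by
    rw [← Ee_Et, ← Ee_Et, ← Ef_eq (e, β), ← Ef_eq (e', β'), h]
  rcases le_total β β' with hb | hb
  · obtain ⟨h2, h3⟩ := Et_inj e e' β β' hb h1
    exact Prod.ext (Finsupp.ext h3) h2
  · obtain ⟨h2, h3⟩ := Et_inj e' e β' β hb fun i => (h1 i).symm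
    exact Prod.ext (Finsupp.ext fun j => (h3 j).symm) h2.symm

lemma pp_li : LinearIndependent ℂ pp := by
  rw [linearIndependent_iff']
  intro s g hg
  by_contra hc
  push Not at hc
  obtain ⟨k, hk, hk0⟩ := hc
  obtain ⟨k0, hk0, hmax⟩ := Finset.exists_max_image (s.filter fun k => g k ≠ 0) (fun k => (pp k).natDegree)
    ⟨k, mem_filter.2 ⟨hk, hk0⟩⟩
  have h1 := congrArg (fun q : BS => (q.coeff (pp k0).natDegree).coeff (Ef k0)) hg
  simp only [Polynomial.finset_sum_coeff, Polynomial.coeff_smul, MvPolynomial.coeff_sum, Polynomial.coeff_zero,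
    MvPolynomial.coeff_smul, MvPolynomial.coeff_zero] at h1
  rw [Finset.sum_eq_single k0] at h1
  · rw [Polynomial.coeff_natDegree, lead_pp, coeff_monomial, if_pos rfl, smul_eq_mul] at h1
    exact (mul_ne_zero (mem_filter.1 hk0).2 (ec_ne _)) h1
  · intro k' hk' hne
    by_cases hg0 : g k' = 0
    · rw [hg0, zero_smul]
    have h2 := hmax k' (mem_filter.2 ⟨hk', hg0⟩)
    rcases h2.lt_or_eq with h3 | h3
    · rw [Polynomial.coeff_eq_zero_of_natDegree_lt h3]; simp
    · rw [← h3, Polynomial.coeff_natDegree, lead_pp, coeff_monomial, if_neg fun h => hne (Ef_inj h), smul_zero]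
  · intro h; exact absurd (mem_filter.1 hk0).1 h

/-- evaluation on the parametrisation -/
def psi : PR ℝ →ₐ[ℝ] BS := aeval zt

lemma psi_Q (a) : psi (Q ℝ a) = 0 := by
  have := map_ph (psi : PR ℝ →+* BS) a X
  rw [Q]
  refine this.trans ?_
  rw [← ph_zt a]
  congr 1
  funext p
  simp [psi]

/-- complex span of evaluations of bounded degree -/
def Tm (m : ℕ) : Submodule ℂ BS := Submodule.span ℂ (psi '' (Pm ℝ m : Set (PR ℝ)))

lemma Tm_mul {m m' : ℕ} {f g : BS} (hf : f ∈ Tm m) (hg : g ∈ Tm m') : f * g ∈ Tm (m + m') := by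
  have := Submodule.mul_mem_mul hf hg
  rw [Tm, Tm, Submodule.span_mul_span] at this
  refine Submodule.span_mono ?_ this
  rintro _ ⟨_, ⟨a, ha, rfl⟩, _, ⟨b, hb, rfl⟩, rfl⟩
  exact ⟨a * b, Pm_mul ha hb, map_mul _ _ _⟩

lemma one_Tm : (1 : BS) ∈ Tm 0 := by
  refine Submodule.subset_span ⟨1, ?_, map_one _⟩
  simp [Pm, mem_restrictTotalDegree]

lemma zt_Tm (p) : zt p ∈ Tm 1 := by
  refine Submodule.subset_span ⟨X p, ?_, aeval_X _ _⟩
  simp [Pm, mem_restrictTotalDegree]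

lemma II_smul (c : ℂ) (f : BS) : c • f = Polynomial.C (C c) * f := by
  rw [← Polynomial.smul_eq_C_mul, ← algebraMap_eq, algebraMap_smul]

lemma zz_aux (z w : BS) : (1 / 2 : ℂ) • ((z + w) + Complex.I • (-II * (z - w))) = z ∧
    (1 / 2 : ℂ) • ((z + w) + (-Complex.I) • (-II * (z - w))) = w := by
  have h2 : Polynomial.C (C (1 / 2 : ℂ)) * (2 : BS) = 1 := by
    have : (2 : BS) = Polynomial.C (C 2) := by rw [map_ofNat, map_ofNat]
    rw [this, ← Polynomial.C_mul, ← C_mul]; norm_num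
  have h3 : Polynomial.C (C (-Complex.I)) = -II := by simp [II]
  have h4 : Polynomial.C (C (Complex.I)) = II := rfl
  simp only [II_smul]
  rw [h3, h4]
  constructor
  · linear_combination z * h2 - Polynomial.C (C (1 / 2)) * (z - w) * II_sq
  · linear_combination w * h2 + Polynomial.C (C (1 / 2)) * (z - w) * II_sq

lemma zz_Tm_aux (p q : Fin 16) (hp : zt p = zz p + zz q) (hq : zt q = -II * (zz p - zz q)) : zz p ∈ Tm 1 ∧ zz q ∈ Tm 1 := by
  obtain ⟨h1, h2⟩ := zz_aux (zz p) (zz q)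
  rw [← hp, ← hq] at h1 h2
  constructor
  · rw [← h1]
    exact Submodule.smul_mem _ _ (Submodule.add_mem _ (zt_Tm _) (Submodule.smul_mem _ _ (zt_Tm _)))
  · rw [← h2]
    exact Submodule.smul_mem _ _ (Submodule.add_mem _ (zt_Tm _) (Submodule.smul_mem _ _ (zt_Tm _)))

lemma zz_Tm (r) : zz r ∈ Tm 1 := by
  have a0 := zz_Tm_aux 0 1 rfl rfl
  have a2 := zz_Tm_aux 2 3 rfl rfl
  have a4 := zz_Tm_aux 4 5 rfl rfl
  have a6 := zz_Tm_aux 6 7 rfl rfl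
  have a8 := zz_Tm_aux 8 9 rfl rfl
  have a10 := zz_Tm_aux 10 11 rfl rfl
  have a12 := zz_Tm_aux 12 13 rfl rfl
  have a14 := zz_Tm_aux 14 15 rfl rfl
  fin_cases r
  exacts [a0.1, a0.2, a2.1, a2.2, a4.1, a4.2, a6.1, a6.2, a8.1, a8.2, a10.1, a10.2, a12.1, a12.2, a14.1, a14.2]

lemma list_Tm (l : List (Fin 16)) : (l.map zz).prod ∈ Tm l.length := by
  induction l with
  | nil => simpa using one_Tm
  | cons r l ih => simpa [add_comm] using Tm_mul (zz_Tm r) ih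

lemma pow_Tm (r) (k : ℕ) : zz r ^ k ∈ Tm k := by
  induction k with
  | zero => simpa using one_Tm
  | succ k ih => rw [pow_succ]; exact Tm_mul ih (zz_Tm r)

lemma prod_Tm (s : Finset (Fin 11)) (c : Fin 11 → Fin 16) (e : Fin 11 →₀ ℕ) : ∏ j ∈ s, zz (c j) ^ e j ∈ Tm (∑ j ∈ s, e j) := by
  induction s using Finset.induction_on with
  | empty => simpa using one_Tm
  | insert a s ha ih => rw [prod_insert ha, sum_insert ha]; exact Tm_mul (pow_Tm _ _) ih

lemma Tm_mono {m m' : ℕ} (h : m ≤ m') : Tm m ≤ Tm m' := by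
  refine Submodule.span_mono (Set.image_mono ?_)
  intro f hf
  simp only [SetLike.mem_coe, Pm, mem_restrictTotalDegree] at hf ⊢
  omega

lemma Rl_len (β) : (Rl β).length = bd β := by revert β; decide

lemma pp_Tm (k) : pp k ∈ Tm (k.1.degree + bd k.2) := by
  have := Tm_mul (list_Tm (Rl k.2)) (prod_Tm univ (Ch k.2) k.1)
  rw [Rl_len, add_comm, ← Finsupp.degree_eq_sum] at this
  exact this

/-- index set of bounded degree -/
def Si (m : ℕ) : Set ((Fin 11 →₀ ℕ) × Fin 12) := {k | k.1.degree + bd k.2 ≤ m}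

lemma Si_fin (m) : (Si m).Finite := by
  refine ((Finsupp.finite_of_degree_le (σ := Fin 11) m).prod (Set.finite_univ (α := Fin 12))).subset ?_
  rintro ⟨e, β⟩ h
  exact ⟨le_trans (Nat.le_add_right _ _) h, trivial⟩

theorem Crd.gen_li (Z : Crd ℝ) (hn : Good Z.n) (m : ℕ) : LinearIndepOn ℂ (fun k => psi (Z.gen k.1 k.2)) (Si m) := by
  have := (Si_fin m).fintype
  rw [LinearIndepOn, linearIndependent_iff_card_le_finrank_span]
  have h1 : LinearIndependent ℂ (fun k : Si m => pp k) := pp_li.comp _ Subtype.val_injective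
  rw [← finrank_span_eq_card h1]
  have : Module.Finite ℂ (Submodule.span ℂ (Set.range fun k : Si m => psi (Z.gen k.1.1 k.1.2))) :=
    FiniteDimensional.span_of_finite ℂ (Set.finite_range _)
  refine Submodule.finrank_mono ?_
  rw [Submodule.span_le]
  rintro _ ⟨k, rfl⟩
  have h2 := Tm_mono k.2 (pp_Tm k.1)
  refine (Submodule.span_le.2 ?_ : Tm m ≤ _) h2
  rintro _ ⟨f, hf, rfl⟩
  have hf2 := Z.SP hn m f ((mem_restrictTotalDegree _ _ _).1 hf)
  have h3 : Z.W m ≤ ((Submodule.span ℂ (Set.range fun k : Si m => psi (Z.gen k.1.1 k.1.2))).restrictScalars ℝ).comap psi.toLinearMap := by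
    refine sup_le (Submodule.span_le.2 ?_) (Submodule.span_le.2 ?_)
    · rintro _ ⟨e, β, h, rfl⟩
      exact Submodule.subset_span ⟨⟨(e, β), h⟩, rfl⟩
    · rintro _ ⟨D, a, _, rfl⟩
      simp [psi_Q]
  exact h3 hf2

/-- independence of the normal form -/
theorem Crd.Ind (Z : Crd ℝ) (hn : Good Z.n) (α : Fin 12 → MvPolynomial (Fin 11) ℝ) (D : Fin 10 → PR ℝ)
    (h : ∑ β, aeval Z.eta (α β) * aeval Z.sig (bm ℝ β) = ∑ a, D a * Q ℝ a) : ∀ β, α β = 0 := by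
  have h1 := congrArg psi h
  simp only [map_sum, map_mul, psi_Q, mul_zero, sum_const_zero] at h1
  let s : Finset ((Fin 11 →₀ ℕ) × Fin 12) := (univ.biUnion fun β => (α β).support) ×ˢ univ
  let m : ℕ := s.sup fun k => k.1.degree + bd k.2
  have hs : (s : Set _) ⊆ Si m := fun k hk => Finset.le_sup (f := fun k : (Fin 11 →₀ ℕ) × Fin 12 => k.1.degree + bd k.2) hk
  have h2 := linearIndepOn_iff'.1 (Z.gen_li hn m) s (fun k => (((α k.2).coeff k.1 : ℝ) : ℂ)) hs
  have h3 : ∑ k ∈ s, (((α k.2).coeff k.1 : ℝ) : ℂ) • psi (Z.gen k.1 k.2) = 0 := by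
    rw [← h1, Finset.sum_product_right]
    refine sum_congr rfl fun β _ => ?_
    rw [← map_mul]
    have e1 : α β = ∑ e ∈ univ.biUnion fun β => (α β).support, monomial e ((α β).coeff e) := by
      conv_lhs => rw [(α β).as_sum]
      refine Finset.sum_subset (Finset.subset_biUnion_of_mem (fun β => (α β).support) (mem_univ β)) ?_
      intro e _ he
      rw [notMem_support_iff.1 he, monomial_zero]
    conv_rhs => rw [e1]
    rw [map_sum, Finset.sum_mul, map_sum]
    refine sum_congr rfl fun e _ => ?_
    simp only [Crd.gen]
    rw [Complex.coe_smul, ← map_smul, ← smul_mul_assoc, ← map_smul, smul_monomial, smul_eq_mul, mul_one]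
  intro β
  ext e
  rw [coeff_zero]
  by_cases he : e ∈ (α β).support
  · have := h2 h3 (e, β) (mem_product.2 ⟨mem_biUnion.2 ⟨β, mem_univ _, he⟩, mem_univ _⟩)
    exact_mod_cast this
  · exact notMem_support_iff.1 he
end OK

namespace OK
open Finset MvPolynomial

lemma Good.li {K : Type*} [Field K] {n : Fin 5 → Fin 16 → K} (hn : Good n) : LinearIndependent K n := by
  rw [Fintype.linearIndependent_iff]
  intro t ht i
  have hα : (Finsupp.single i 4 : Fin 5 →₀ ℕ).degree = 2 + 2 := by simp
  have h1 := hn 2 le_rfl ⟨Finsupp.single i 4, mem_Ex.2 hα⟩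
  have h2 : Rd n 2 ≤ LinearMap.ker (aeval t : P5 K →ₐ[K] K).toLinearMap := by
    rw [Rd, Submodule.span_le]
    rintro _ ⟨k, rfl⟩
    rcases k with ⟨a, γ⟩ | β
    · have : aeval t (qr n a) = 0 := by
        rw [qr]
        refine (map_ph (aeval t : P5 K →ₐ[K] K).toRingHom a _).trans ?_
        have : (fun p => (aeval t : P5 K →ₐ[K] K).toRingHom (∑ i, C (n i p) * X i)) = 0 := by
          funext p
          have := congrFun ht p
          simp only [Finset.sum_apply, Pi.smul_apply, smul_eq_mul, Pi.zero_apply] at this ⊢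
          rw [← this]
          simp [mul_comm]
        rw [this, ph_sum]
        simp
      have h5 : aeval t (col n 2 (Sum.inl (a, γ))) = 0 := by rw [col, map_mul, this, mul_zero]
      exact h5
    · have := bd_le β.1
      have := β.2
      omega
  have h3 := h2 h1
  simpa [aeval_monomial] using h3

lemma Crd.exists_of_li {K : Type*} [Field K] (n : Fin 5 → Fin 16 → K) (hn : LinearIndependent K n) : ∃ Z : Crd K, Z.n = n := by
  classical
  let B := Module.Basis.sumExtend hn
  have hB : ∀ i, B (Sum.inl i) = n i := fun i => by
    simp [B, Module.Basis.sumExtend]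
    rfl
  have : Finite (Fin 5 ⊕ Module.Basis.sumExtendIndex hn) := Module.Finite.finite_basis B
  have := Fintype.ofFinite (Fin 5 ⊕ Module.Basis.sumExtendIndex hn)
  have : Finite (Module.Basis.sumExtendIndex hn) := Finite.of_injective (Sum.inr : _ → Fin 5 ⊕ Module.Basis.sumExtendIndex hn) Sum.inr_injective
  have f2 := Fintype.ofFinite (Module.Basis.sumExtendIndex hn)
  have hc : Fintype.card (Fin 5 ⊕ Module.Basis.sumExtendIndex hn) = 16 := by
    rw [← Module.finrank_eq_card_basis B]; simp
  have hc2 : Fintype.card (Module.Basis.sumExtendIndex hn) = 11 := by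
    have := hc
    rw [← Nat.card_eq_fintype_card, Nat.card_sum, Nat.card_eq_fintype_card, Nat.card_eq_fintype_card, Fintype.card_fin] at this
    omega
  let e := Fintype.equivFinOfCardEq hc2
  let B' := B.reindex (Equiv.sumCongr (Equiv.refl (Fin 5)) e)
  refine ⟨⟨n, fun k => B' (Sum.inr k), fun i q => B'.repr (Pi.single q 1) (Sum.inl i),
    fun k q => B'.repr (Pi.single q 1) (Sum.inr k), ?_⟩, rfl⟩
  intro p q
  have h := congrFun (B'.sum_repr (Pi.single q 1)) p
  rw [Fintype.sum_sum_type, Pi.add_apply, Finset.sum_apply, Finset.sum_apply] at h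
  simp only [Pi.smul_apply, smul_eq_mul] at h
  have hl : ∀ i, B' (Sum.inl i) = n i := fun i => by simp [B', hB]
  simp only [hl] at h
  rw [Pi.single_apply] at h
  rw [← h]
  congr 1 <;> exact Finset.sum_congr rfl fun _ _ => mul_comm _ _

lemma good_F0 : Good F0 := by
  intro d hd
  interval_cases d
  · exact F0_0
  · exact F0_1
  · exact F0_2

/-- exponents of degree at most `m` -/
def Dx (r m : ℕ) : Finset (Fin r →₀ ℕ) := (range (m + 1)).biUnion fun j => finsuppAntidiag univ j

lemma mem_Dx {r m : ℕ} {e : Fin r →₀ ℕ} : e ∈ Dx r m ↔ e.degree ≤ m := by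
  simp [Dx, Finset.mem_finsuppAntidiag, Finsupp.degree_eq_sum, Nat.lt_succ_iff]

lemma card_Dx (r m : ℕ) : (Dx (r + 1) m).card = (m + r + 1).choose (r + 1) := by
  rw [Dx, card_biUnion, ← Nat.sum_range_add_choose]
  · refine sum_congr rfl fun i _ => ?_
    rw [card_finsuppAntidiag_nat_eq_choose, card_univ, Fintype.card_fin, show r + 1 + i - 1 = i + r by omega, Nat.choose_symm_add]
  · intro i _ j _ hij
    refine Finset.disjoint_left.2 ?_
    intro e h1 h2
    rw [Finset.mem_finsuppAntidiag] at h1 h2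
    exact hij (h1.1.symm.trans h2.1)

attribute [local instance] MvPolynomial.gradedAlgebra

/-- the ideal of the quadrics -/
def IQ : Ideal (PR ℚ) := Ideal.span (Set.range (Q ℚ))

lemma Q_homog (a) : (Q ℚ a).IsHomogeneous 2 := by
  rw [Q, ph_sum]
  refine IsHomogeneous.sum _ _ _ fun i _ => ?_
  refine IsHomogeneous.mul (m := 1) (n := 1) (isHomogeneous_X _ _) ?_
  have := (isHomogeneous_C (Fin 16) ((sg a i : ℤ) : ℚ)).mul (isHomogeneous_X ℚ (sh a i))
  simpa using this

lemma IQ_homog : IQ.IsHomogeneous (homogeneousSubmodule (Fin 16) ℚ) := by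
  refine Ideal.homogeneous_span _ _ ?_
  rintro _ ⟨a, rfl⟩
  exact ⟨2, Q_homog a⟩

/-- substitution of linear forms -/
def lf {K : Type*} [CommRing K] {r : ℕ} (b : Fin r → Fin 16 → K) (i : Fin r) : PR K := ∑ p, C (b i p) * X p

lemma lf_homog {r : ℕ} (b : Fin r → Fin 16 → ℚ) (i : Fin r) : (lf b i).IsHomogeneous 1 := by
  refine IsHomogeneous.sum _ _ _ fun p _ => ?_
  exact (isHomogeneous_X ℚ p).C_mul _

lemma disc_exists_aux (b : Fin 12 → Fin 16 → ℚ) (m : ℕ) (hm : (Dx 11 m).card * 12 < (Dx 12 m).card) : ∃ D : MvPolynomial (Fin 12) ℚ, D ≠ 0 ∧ aeval (lf b) D ∈ IQ := by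
  obtain ⟨Z, hZ⟩ := Crd.exists_of_li F0 good_F0.li
  have hG : Good Z.n := hZ ▸ good_F0
  classical
  let L : (↥(Dx 12 m) → ℚ) →ₗ[ℚ] PR ℚ ⧸ (IQ.restrictScalars ℚ) :=
    (Submodule.mkQ (IQ.restrictScalars ℚ)) ∘ₗ (aeval (lf b)).toLinearMap ∘ₗ
      (Fintype.linearCombination ℚ fun e : ↥(Dx 12 m) => (monomial e.1 (1 : ℚ)))
  let U : Submodule ℚ (PR ℚ ⧸ (IQ.restrictScalars ℚ)) :=
    Submodule.span ℚ (((Dx 11 m ×ˢ univ).image fun k : (Fin 11 →₀ ℕ) × Fin 12 => Submodule.mkQ (IQ.restrictScalars ℚ) (Z.gen k.1 k.2) : Finset _) : Set _)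
  have hU : Module.finrank ℚ U ≤ (Dx 11 m).card * 12 := by
    refine (finrank_span_finset_le_card _).trans (card_image_le.trans ?_)
    rw [card_product]; simp
  have hW : Z.W m ≤ U.comap (Submodule.mkQ (IQ.restrictScalars ℚ)) := by
    refine sup_le (Submodule.span_le.2 ?_) (Submodule.span_le.2 ?_)
    · rintro _ ⟨e, β, h, rfl⟩
      refine Submodule.subset_span ?_
      simp only [coe_image, Set.mem_image]
      exact ⟨(e, β), by simpa [mem_Dx] using le_trans (Nat.le_add_right _ _) h, rfl⟩
    · rintro _ ⟨D, a, _, rfl⟩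
      have : (D * Q ℚ a) ∈ IQ.restrictScalars ℚ := IQ.mul_mem_left _ (Ideal.subset_span ⟨a, rfl⟩)
      have h2 : Submodule.mkQ (IQ.restrictScalars ℚ) (D * Q ℚ a) = 0 := (Submodule.Quotient.mk_eq_zero _).2 this
      show Submodule.mkQ (IQ.restrictScalars ℚ) (D * Q ℚ a) ∈ U
      rw [h2]; exact U.zero_mem
  have hL : ∀ f, L f ∈ U := by
    intro f
    apply hW
    apply Z.SP hG m
    show (aeval (lf b) (Fintype.linearCombination ℚ (fun e : ↥(Dx 12 m) => (monomial e.1 (1 : ℚ))) f)).totalDegree ≤ m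
    refine (mem_restrictTotalDegree _ _ _).1 (aeval_deg (lf b) (fun i => ?_) _ ?_)
    · rw [mem_restrictTotalDegree]
      exact (lf_homog b i).totalDegree_le
    · rw [Fintype.linearCombination_apply]
      refine (totalDegree_finset_sum _ _).trans (Finset.sup_le fun e _ => ?_)
      refine (totalDegree_smul_le _ _).trans ((totalDegree_monomial_le _ _).trans ?_)
      exact mem_Dx.1 e.2
  have hker : ¬ Function.Injective (L.codRestrict U hL) := by
    intro hi
    have : Module.Finite ℚ U := FiniteDimensional.span_of_finite ℚ (Finset.finite_toSet _)
    have h1 := LinearMap.finrank_le_finrank_of_injective hi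
    rw [Module.finrank_fintype_fun_eq_card, Fintype.card_coe] at h1
    exact absurd (h1.trans hU) (not_le.2 hm)
  rw [← LinearMap.ker_eq_bot, ← ne_eq, Submodule.ne_bot_iff] at hker
  obtain ⟨f, hf, hf0⟩ := hker
  refine ⟨Fintype.linearCombination ℚ (fun e : ↥(Dx 12 m) => (monomial e.1 (1 : ℚ))) f, ?_, ?_⟩
  · intro h
    apply hf0
    funext e
    have := congrArg (coeff e.1) h
    rw [Fintype.linearCombination_apply, coeff_sum, Finset.sum_eq_single e] at this
    · simpa using this
    · intro e' _ hne
      rw [coeff_smul, coeff_monomial, if_neg fun h => hne (Subtype.ext h), smul_zero]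
    · simp
  · have := congrArg Subtype.val (LinearMap.mem_ker.1 hf)
    exact (Submodule.Quotient.mk_eq_zero (IQ.restrictScalars ℚ)).1 this

lemma card_ineq (m : ℕ) (hm : 133 ≤ m) : (Dx 11 m).card * 12 < (Dx 12 m).card := by
  rw [card_Dx 10, card_Dx 11]
  have e1 := Nat.add_one_mul_choose_eq (m + 11) 11
  have e2 : 0 < (m + 11).choose 11 := Nat.choose_pos (by omega)
  have e3 : m + 10 + 1 = m + 11 := rfl
  rw [e3]
  generalize (m + 11 + 1).choose (11 + 1) = x at *
  generalize (m + 11).choose 11 = y at *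
  show y * 12 < x
  nlinarith

lemma disc_exists (b : Fin 12 → Fin 16 → ℚ) : ∃ D : MvPolynomial (Fin 12) ℚ, D ≠ 0 ∧ aeval (lf b) D ∈ IQ := by
  exact disc_exists_aux b 144 (card_ineq 144 (by norm_num))

lemma disc_homog (b : Fin 12 → Fin 16 → ℚ) : ∃ (d : ℕ) (D : MvPolynomial (Fin 12) ℚ), D ≠ 0 ∧ D.IsHomogeneous d ∧ aeval (lf b) D ∈ IQ := by
  obtain ⟨D, hD, h⟩ := disc_exists b
  have : ∃ d, homogeneousComponent d D ≠ 0 := by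
    by_contra hc
    push Not at hc
    apply hD
    rw [← sum_homogeneousComponent D]
    exact Finset.sum_eq_zero fun i _ => hc i
  obtain ⟨d, hd⟩ := this
  refine ⟨d, _, hd, homogeneousComponent_isHomogeneous d D, ?_⟩
  have h2 := homogeneousComponent_mem_of_mem IQ_homog h d
  have hh : ∀ i, (aeval (lf b) (homogeneousComponent i D)).IsHomogeneous i := fun i => by
    simpa using (homogeneousComponent_isHomogeneous i D).aeval _ (lf_homog b)
  convert h2 using 1
  conv_rhs => rw [← sum_homogeneousComponent D, map_sum, map_sum]
  by_cases hdr : d ∈ range (D.totalDegree + 1)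
  · rw [Finset.sum_eq_single d]
    · rw [homogeneousComponent_eq_self (hh d)]
    · intro i _ hi
      rw [homogeneousComponent_of_mem (hh i), if_neg (Ne.symm hi)]
    · exact fun h => absurd hdr h
  · exact absurd (homogeneousComponent_eq_zero _ _ (by simpa using hdr)) hd

lemma clear_den {σ : Type*} (f : MvPolynomial σ ℚ) : ∃ N : ℤ, N ≠ 0 ∧ ∃ g : MvPolynomial σ ℤ, map (Int.castRingHom ℚ) g = C (N : ℚ) * f := by
  induction f using MvPolynomial.induction_on with
  | C a =>
    refine ⟨a.den, by exact_mod_cast a.den_nz, C a.num, ?_⟩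
    rw [map_C, ← C_mul]
    congr 1
    simp [Rat.den_mul_eq_num]
  | add p q hp hq =>
    obtain ⟨N, hN, g, hg⟩ := hp
    obtain ⟨M, hM, k, hk⟩ := hq
    refine ⟨N * M, mul_ne_zero hN hM, C M * g + C N * k, ?_⟩
    simp only [map_add, map_mul, map_C, hg, hk]
    push_cast
    simp only [C_mul, eq_intCast]
    ring
  | mul_X p n hp =>
    obtain ⟨N, hN, g, hg⟩ := hp
    refine ⟨N, hN, g * X n, ?_⟩
    rw [map_mul, hg, map_X, mul_assoc]

/-- discriminant -/
theorem Disc (b : Fin 12 → Fin 16 → ℤ) : ∃ (d : ℕ) (D : MvPolynomial (Fin 12) ℤ), D ≠ 0 ∧ D.IsHomogeneous d ∧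
    ∃ A : Fin 10 → PR ℝ, aeval (lf fun i p => (b i p : ℝ)) D = ∑ a, A a * Q ℝ a := by
  obtain ⟨d, D, hD, hd, h⟩ := disc_homog fun i p => (b i p : ℚ)
  obtain ⟨N, hN, g, hg⟩ := clear_den D
  have hNQ : (N : ℚ) ≠ 0 := by exact_mod_cast hN
  refine ⟨d, g, ?_, ?_, ?_⟩
  · rintro rfl
    rw [map_zero] at hg
    rcases mul_eq_zero.1 hg.symm with h1 | h1
    · exact hNQ (C_eq_zero.1 h1)
    · exact hD h1
  · refine IsHomogeneous.of_map (f := Int.castRingHom ℚ) (Int.cast_injective) ?_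
    rw [hg]
    exact hd.C_mul _
  · obtain ⟨c, hc⟩ := Ideal.mem_span_range_iff_exists_fun.1 h
    refine ⟨fun a => C (N : ℝ) * map (algebraMap ℚ ℝ) (c a), ?_⟩
    have e1 : aeval (lf fun i p => (b i p : ℝ)) g = map (algebraMap ℚ ℝ) (aeval (lf fun i p => (b i p : ℚ)) (map (Int.castRingHom ℚ) g)) := by
      have := RingHom.congr_fun (MvPolynomial.ringHom_ext (f := (aeval (lf fun i p => (b i p : ℝ)) : MvPolynomial (Fin 12) ℤ →ₐ[ℤ] PR ℝ).toRingHom)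
        (g := (map (algebraMap ℚ ℝ)).comp ((aeval (lf fun i p => (b i p : ℚ)) : MvPolynomial (Fin 12) ℚ →ₐ[ℚ] PR ℚ).toRingHom.comp
          (map (Int.castRingHom ℚ)))) (fun r => by simp) (fun i => by simp [lf])) g
      exact this
    have e2 : ∀ a, map (algebraMap ℚ ℝ) (Q ℚ a) = Q ℝ a := by
      intro a
      rw [Q, Q]
      refine (map_ph (map (algebraMap ℚ ℝ)) a _).trans ?_
      simp
    rw [e1, hg, map_mul, map_mul, ← hc, map_sum, aeval_C]
    simp only [map_mul, e2, algebraMap_eq, map_C, mul_assoc, Finset.mul_sum]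
    simp
end OK

namespace OK
open Finset MvPolynomial
open scoped ContDiff Topology

/-- the point space with flat index -/
abbrev E16 := Fin 16 → ℝ

/-- smooth complex functions -/
def Sm : Subalgebra ℂ (E16 → ℂ) where
  carrier := {f | ContDiff ℝ ∞ f}
  mul_mem' := fun {a b} (ha : ContDiff ℝ ∞ a) (hb : ContDiff ℝ ∞ b) => (ha.mul hb : ContDiff ℝ ∞ (a * b))
  add_mem' := fun {a b} (ha : ContDiff ℝ ∞ a) (hb : ContDiff ℝ ∞ b) => (ha.add hb : ContDiff ℝ ∞ (a + b))
  algebraMap_mem' := fun r => (contDiff_const : ContDiff ℝ ∞ (fun _ : E16 => r))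

instance : CoeFun Sm (fun _ => E16 → ℂ) := ⟨fun f => f.1⟩

lemma cdS (f : Sm) : ContDiff ℝ ∞ f := f.2
lemma contS (f : Sm) : Continuous f := (cdS f).continuous
lemma diffS (f : Sm) : Differentiable ℝ f := (cdS f).differentiable (by simp)
lemma Sm.add_apply (f g : Sm) (x : E16) : (f + g) x = f x + g x := rfl
lemma Sm.sub_apply (f g : Sm) (x : E16) : (f - g) x = f x - g x := rfl
lemma Sm.neg_apply (f : Sm) (x : E16) : (-f) x = - f x := rfl
lemma Sm.mul_apply (f g : Sm) (x : E16) : (f * g) x = f x * g x := rfl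
lemma Sm.zero_apply (x : E16) : (0 : Sm) x = 0 := rfl
lemma Sm.one_apply (x : E16) : (1 : Sm) x = 1 := rfl
lemma Sm.smul_apply (c : ℂ) (f : Sm) (x : E16) : (c • f) x = c * f x := rfl
lemma Sm.rsmul_apply (c : ℝ) (f : Sm) (x : E16) : (c • f) x = c * f x := by
  change c • f.1 x = _
  simp
lemma Sm.sum_apply {ι : Type*} (s : Finset ι) (f : ι → Sm) (x : E16) :
    (∑ i ∈ s, f i : Sm) x = ∑ i ∈ s, f i x := by
  classical
  induction s using Finset.induction_on with
  | empty => simp [Sm.zero_apply]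
  | insert a s ha ih => rw [Finset.sum_insert ha, Finset.sum_insert ha, Sm.add_apply, ih]
@[ext] lemma Sm.ext {f g : Sm} (h : ∀ x, f x = g x) : f = g := Subtype.ext (funext h)

/-- directional derivative -/
def dd (v : E16) : Module.End ℝ Sm where
  toFun f := ⟨fun x => fderiv ℝ f x v, by
    have h := (cdS f).fderiv_right (m := ∞) (by simp)
    exact h.clm_apply contDiff_const⟩
  map_add' f g := by
    ext x
    change fderiv ℝ (f.1 + g.1) x v = fderiv ℝ f.1 x v + fderiv ℝ g.1 x v
    rw [fderiv_add (diffS f x) (diffS g x)]; rfl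
  map_smul' c f := by
    ext x
    change fderiv ℝ (c • f.1) x v = c • fderiv ℝ f.1 x v
    rw [fderiv_const_smul (diffS f x)]; rfl

lemma dd_apply (v : E16) (f : Sm) (x : E16) : dd v f x = fderiv ℝ f x v := rfl

lemma dd_comm (v w : E16) : dd v * dd w = dd w * dd v := by
  ext f x
  change fderiv ℝ (fun y => fderiv ℝ f y w) x v = fderiv ℝ (fun y => fderiv ℝ f y v) x w
  have h : DifferentiableAt ℝ (fderiv ℝ f) x :=
    ((cdS f).fderiv_right (m := ∞) (by simp)).differentiable (by simp) x
  rw [fderiv_clm_apply h (differentiableAt_const _), fderiv_clm_apply h (differentiableAt_const _)]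
  have hs : IsSymmSndFDerivAt ℝ f x :=
    (cdS f).contDiffAt.isSymmSndFDerivAt (by simp only [minSmoothness_of_isRCLikeNormedField]; exact WithTop.coe_le_coe.2 (le_top : (2 : ℕ∞) ≤ ⊤))
  simp [ContinuousLinearMap.flip_apply]
  exact hs.eq v w

/-- constant coefficient operators -/
def op : PR ℝ →ₐ[ℝ] Module.End ℝ Sm :=
  opOf (fun p => dd (Pi.single p 1)) (fun i j => dd_comm _ _)

lemma op_X (p : Fin 16) : op (X p) = dd (Pi.single p 1) := opOf_X _ _ _

/-- linear form -/
def lin (v : E16) : PR ℝ := ∑ p, C (v p) * X p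

lemma dd_add (v w : E16) : dd (v + w) = dd v + dd w := by
  ext f x; simp only [LinearMap.add_apply, Sm.add_apply, dd_apply, map_add]
lemma dd_smul (c : ℝ) (v : E16) : dd (c • v) = c • dd v := by
  ext f x; simp only [LinearMap.smul_apply, Sm.rsmul_apply, dd_apply, map_smul, Complex.real_smul]
lemma dd_sum {ι : Type*} (s : Finset ι) (v : ι → E16) : dd (∑ i ∈ s, v i) = ∑ i ∈ s, dd (v i) := by
  classical
  induction s using Finset.induction_on with
  | empty => ext f x; simp [dd_apply, Sm.zero_apply]
  | insert a s ha ih => rw [Finset.sum_insert ha, Finset.sum_insert ha, dd_add, ih]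

lemma op_lin (v : E16) : op (lin v) = dd v := by
  have : v = ∑ p, v p • (Pi.single p 1 : E16) := by
    ext q; simp [Finset.sum_apply, Pi.single_apply]
  conv_rhs => rw [this, dd_sum]
  rw [lin, map_sum]
  refine Finset.sum_congr rfl fun p _ => ?_
  rw [map_mul, op_X, dd_smul, ← MvPolynomial.algebraMap_eq, AlgHom.commutes, Algebra.smul_def]

lemma lin_add (v w : E16) : lin (v + w) = lin v + lin w := by
  simp [lin, add_mul, Finset.sum_add_distrib]
lemma lin_smul (c : ℝ) (v : E16) : lin (c • v) = C c * lin v := by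
  simp [lin, Finset.mul_sum, mul_assoc]
lemma lin_single (p : Fin 16) : lin (Pi.single p 1) = X p := by
  rw [lin, Finset.sum_eq_single p]
  · simp
  · intro q _ h; simp [Pi.single_apply, h]
  · simp

lemma op_C (c : ℝ) : op (C c) = c • 1 := by
  rw [← MvPolynomial.algebraMap_eq, AlgHom.commutes, Algebra.algebraMap_eq_smul_one]
lemma op_mul (p q : PR ℝ) (f : Sm) : op (p * q) f = op p (op q f) := by
  rw [map_mul]; rfl
lemma op_add (p q : PR ℝ) (f : Sm) : op (p + q) f = op p f + op q f := by
  rw [map_add]; rfl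
lemma op_sub (p q : PR ℝ) (f : Sm) : op (p - q) f = op p f - op q f := by
  rw [map_sub]; rfl
lemma op_one (f : Sm) : op 1 f = f := by rw [map_one]; rfl
lemma op_zero (f : Sm) : op 0 f = 0 := by rw [map_zero]; rfl
lemma op_Cf (c : ℝ) (f : Sm) : op (C c) f = c • f := by rw [op_C]; rfl
lemma op_sum {ι : Type*} (s : Finset ι) (p : ι → PR ℝ) (f : Sm) :
    op (∑ i ∈ s, p i) f = ∑ i ∈ s, op (p i) f := by
  rw [map_sum, LinearMap.sum_apply]

/-- operators commuting with the coordinate derivatives commute with op -/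
lemma op_commute (A : Sm →ₗ[ℝ] Sm)
    (hA : ∀ p f, A (dd (Pi.single p 1) f) = dd (Pi.single p 1) (A f)) (P : PR ℝ) (f : Sm) :
    A (op P f) = op P (A f) := by
  induction P using MvPolynomial.induction_on generalizing f with
  | C a => rw [op_Cf, op_Cf, map_smul]
  | add p q hp hq => rw [op_add, op_add, map_add, hp, hq]
  | mul_X p i hp => rw [op_mul, op_mul, hp, op_X, hA]

/-- submodules stable under coordinate derivatives are stable under op -/
lemma op_stable (N : Submodule ℝ Sm) (hN : ∀ p, ∀ f ∈ N, dd (Pi.single p 1) f ∈ N)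
    (P : PR ℝ) {f : Sm} (hf : f ∈ N) : op P f ∈ N := by
  induction P using MvPolynomial.induction_on generalizing f with
  | C a => rw [op_Cf]; exact N.smul_mem _ hf
  | add p q hp hq => rw [op_add]; exact N.add_mem (hp hf) (hq hf)
  | mul_X p i hp => rw [op_mul, op_X]; exact hp (hN _ _ hf)

/-- functions vanishing near X -/
def Nl (X : Set E16) : Submodule ℝ Sm where
  carrier := {f | ∀ᶠ x in 𝓝ˢ X, f x = 0}
  add_mem' := by
    intro a b ha hb
    change ∀ᶠ x in 𝓝ˢ X, (a + b) x = 0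
    have ha : ∀ᶠ x in 𝓝ˢ X, a x = 0 := ha
    have hb : ∀ᶠ x in 𝓝ˢ X, b x = 0 := hb
    filter_upwards [ha, hb] with x h1 h2
    rw [Sm.add_apply, h1, h2, add_zero]
  zero_mem' := by
    change ∀ᶠ x in 𝓝ˢ X, (0 : Sm) x = 0
    exact Filter.Eventually.of_forall fun x => rfl
  smul_mem' := by
    intro c f hf
    change ∀ᶠ x in 𝓝ˢ X, (c • f) x = 0
    have hf : ∀ᶠ x in 𝓝ˢ X, f x = 0 := hf
    filter_upwards [hf] with x h
    rw [Sm.rsmul_apply, h, mul_zero]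

lemma mem_Nl {X : Set E16} {f : Sm} : f ∈ Nl X ↔ ∀ᶠ x in 𝓝ˢ X, f x = 0 := Iff.rfl

lemma mem_Nl' {X : Set E16} {f : Sm} : f ∈ Nl X ↔ ∀ x ∈ X, ∀ᶠ y in 𝓝 x, f y = 0 := by
  rw [mem_Nl, eventually_nhdsSet_iff_forall]

lemma Nl_mono {X Y : Set E16} (h : X ⊆ Y) : Nl Y ≤ Nl X := by
  intro f hf; rw [mem_Nl'] at *; exact fun x hx => hf x (h hx)

lemma Nl_mem {X : Set E16} {f : Sm} (hf : f ∈ Nl X) {x : E16} (hx : x ∈ X) : f x = 0 :=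
  (mem_Nl'.1 hf x hx).self_of_nhds

lemma Nl_dd (X : Set E16) (v : E16) {f : Sm} (hf : f ∈ Nl X) : dd v f ∈ Nl X := by
  rw [mem_Nl'] at *
  intro x hx
  filter_upwards [eventually_eventually_nhds.2 (hf x hx)] with y hy
  rw [dd_apply, Filter.EventuallyEq.fderiv_eq (f := fun _ => (0:ℂ)) hy]
  simp

lemma Nl_op {X : Set E16} (P : PR ℝ) {f : Sm} (hf : f ∈ Nl X) : op P f ∈ Nl X :=
  op_stable _ (fun _ _ h => Nl_dd _ _ h) P hf

lemma Nl_mul {X : Set E16} (g : Sm) {f : Sm} (hf : f ∈ Nl X) : g * f ∈ Nl X := by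
  rw [mem_Nl] at *
  filter_upwards [hf] with x h
  rw [Sm.mul_apply, h, mul_zero]

/-- closed near X -/
def Clo (X : Set E16) (T : Fin 10 → Sm) : Prop := ∀ i, ∑ a, op (rl ℝ i a) (T a) ∈ Nl X

lemma Clo.syz {X : Set E16} {T : Fin 10 → Sm} (hT : Clo X T)
    {C : Fin 10 → PR ℝ} (hC : ∑ a, C a * Q ℝ a = 0) : ∑ a, op (C a) (T a) ∈ Nl X := by
  obtain ⟨k, hk⟩ := OK.syz C hC
  have : ∑ a, op (C a) (T a) = ∑ i, op (k i) (∑ a, op (rl ℝ i a) (T a)) := by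
    simp only [hk, map_sum, map_mul, LinearMap.sum_apply, Module.End.mul_apply]
    rw [Finset.sum_comm]
  rw [this]
  exact Submodule.sum_mem _ fun i _ => Nl_op _ (hT i)

lemma Clo.koszul {X : Set E16} {T : Fin 10 → Sm} (hT : Clo X T) (b c : Fin 10) :
    op (Q ℝ b) (T c) - op (Q ℝ c) (T b) ∈ Nl X := by
  have h0 : ∀ (c : Fin 10) (f : PR ℝ) (g : Fin 10 → PR ℝ),
      ∑ x, (if x = c then f else 0) * g x = f * g c := by
    intro c f g
    simp [ite_mul]
  have h : ∀ (c : Fin 10) (f : Module.End ℝ Sm), ∑ x, (if x = c then f else 0) (T x) = f (T c) := by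
    intro c f
    rw [Finset.sum_eq_single_of_mem c (Finset.mem_univ _)]
    · rw [if_pos rfl]
    · intro a _ h; rw [if_neg h]; rfl
  have := hT.syz (C := fun a => (if a = c then Q ℝ b else 0) - (if a = b then Q ℝ c else 0))
    (by simp only [sub_mul, Finset.sum_sub_distrib, h0]; ring)
  simp only [map_sub, LinearMap.sub_apply, Finset.sum_sub_distrib, apply_ite op, map_zero] at this
  rwa [h, h] at this

/-- u solves near X -/
def Sol (X : Set E16) (T : Fin 10 → Sm) (u : Sm) : Prop := ∀ a, op (Q ℝ a) u - T a ∈ Nl X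

lemma Clo.D0 (X : Set E16) (u : Sm) : Clo X (fun a => op (Q ℝ a) u) := by
  intro i
  have : ∑ a, op (rl ℝ i a) (op (Q ℝ a) u) = op (∑ a, rl ℝ i a * Q ℝ a) u := by
    rw [op_sum]; simp only [op_mul]
  rw [this, rl_Q, op_zero]
  exact Submodule.zero_mem _

lemma Clo.sub {X : Set E16} {T S : Fin 10 → Sm} (hT : Clo X T) (hS : Clo X S) :
    Clo X (fun a => T a - S a) := by
  intro i
  simp only [map_sub, Finset.sum_sub_distrib]
  exact Submodule.sub_mem _ (hT i) (hS i)

lemma Clo.of_Nl {X : Set E16} {T : Fin 10 → Sm} (h : ∀ a, T a ∈ Nl X) : Clo X T :=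
  fun _ => Submodule.sum_mem _ fun _ _ => Nl_op _ (h _)

lemma Clo.congr {X : Set E16} {T S : Fin 10 → Sm} (hT : Clo X T) (h : ∀ a, T a - S a ∈ Nl X) :
    Clo X S := by
  have := hT.sub (Clo.of_Nl h)
  simpa using this

lemma Clo.mono {X Y : Set E16} {T : Fin 10 → Sm} (hT : Clo Y T) (h : X ⊆ Y) : Clo X T :=
  fun i => Nl_mono h (hT i)

/-! translations, quasi-periodicity -/
/-- translation -/
def tr (v : E16) : Sm →ₗ[ℝ] Sm where
  toFun f := ⟨fun x => f (x + v), (cdS f).comp (contDiff_id.add contDiff_const)⟩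
  map_add' f g := rfl
  map_smul' c f := rfl

lemma tr_apply (v : E16) (f : Sm) (x : E16) : tr v f x = f (x + v) := rfl

lemma tr_op (v : E16) (P : PR ℝ) (f : Sm) : tr v (op P f) = op P (tr v f) := by
  refine op_commute _ (fun p f => ?_) P f
  ext x
  rw [tr_apply, dd_apply, dd_apply]
  change _ = fderiv ℝ (fun y => f (y + v)) x _
  rw [fderiv_comp_add_right]

lemma smul_op (c : ℂ) (P : PR ℝ) (f : Sm) : c • (op P f) = op P (c • f) := by
  refine op_commute ⟨⟨fun f => c • f, fun f g => smul_add _ _ _⟩, fun a f => smul_comm _ _ _⟩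
    (fun p f => ?_) P f
  ext x
  change c * dd _ f x = fderiv ℝ (fun y => c • f y) x _
  rw [fderiv_fun_const_smul (diffS f x)]
  rfl

/-- integer vectors as points -/
def iv (l : Fin 16 → ℤ) : E16 := fun p => (l p : ℝ)

/-- quasi-periodic functions -/
def QP (θ : E16) : Submodule ℝ Sm where
  carrier := {f | ∀ (l : Fin 16 → ℤ), tr (iv l) f = Complex.exp (2 * Real.pi * Complex.I * (θ ⬝ᵥ iv l : ℝ)) • f}
  add_mem' := by
    intro f g hf hg l
    rw [map_add, hf l, hg l, smul_add]
  zero_mem' := by intro l; simp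
  smul_mem' := by
    intro c f hf l
    rw [map_smul, hf l, smul_comm]

lemma mem_QP {θ : E16} {f : Sm} : f ∈ QP θ ↔ ∀ (l : Fin 16 → ℤ) x,
    f (x + iv l) = Complex.exp (2 * Real.pi * Complex.I * (θ ⬝ᵥ iv l : ℝ)) * f x := by
  constructor
  · intro h l x
    exact congrFun (congrArg Subtype.val (h l)) x
  · intro h l
    ext x
    exact h l x

lemma QP_op {θ : E16} (P : PR ℝ) {f : Sm} (hf : f ∈ QP θ) : op P f ∈ QP θ := by
  intro l
  rw [tr_op, hf l, smul_op]

/-- periodic smooth functions -/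
def Per (χ : Sm) : Prop := ∀ (l : Fin 16 → ℤ) x, χ (x + iv l) = χ x

lemma QP_mul {θ : E16} {χ f : Sm} (hχ : Per χ) (hf : f ∈ QP θ) : χ * f ∈ QP θ := by
  rw [mem_QP] at *
  intro l x
  rw [Sm.mul_apply, hχ, hf l, Sm.mul_apply]; ring

end OK

namespace OK
open Finset MvPolynomial
open scoped ContDiff Topology

/-- derivative from partials -/
def gr (c : Fin 16 → ℂ) : E16 →L[ℝ] ℂ :=
  ∑ p, (ContinuousLinearMap.proj (R := ℝ) (φ := fun _ : Fin 16 => ℝ) p).smulRight (c p)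

lemma gr_apply (c : Fin 16 → ℂ) (v : E16) : gr c v = ∑ p, (v p : ℂ) * c p := by
  simp [gr]

lemma gr_single (c : Fin 16 → ℂ) (p : Fin 16) : gr c (Pi.single p 1) = c p := by
  rw [gr_apply, Finset.sum_eq_single p]
  · simp
  · intro q _ h; simp [Pi.single_apply, h]
  · simp

lemma gr_eta (L : E16 →L[ℝ] ℂ) : gr (fun p => L (Pi.single p 1)) = L := by
  ext v
  rw [gr_apply]
  have : v = ∑ p, v p • (Pi.single p 1 : E16) := by
    ext q; simp [Finset.sum_apply, Pi.single_apply]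
  conv_rhs => rw [this, map_sum]
  exact Finset.sum_congr rfl fun p _ => by rw [map_smul, Complex.real_smul]

lemma hasFDerivAt_S (f : Sm) (x : E16) :
    HasFDerivAt f (gr fun p => dd (Pi.single p 1) f x) x := by
  have := (diffS f x).hasFDerivAt
  convert this using 1
  exact gr_eta _

lemma contDiffOn_gr {U : Set E16} {n : WithTop ℕ∞} {c : Fin 16 → E16 → ℂ}
    (h : ∀ p, ContDiffOn ℝ n (c p) U) : ContDiffOn ℝ n (fun x => gr fun p => c p x) U := by
  unfold gr
  refine ContDiffOn.sum fun p _ => ?_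
  exact (ContinuousLinearMap.contDiff
    (ContinuousLinearMap.smulRightL ℝ E16 ℂ (ContinuousLinearMap.proj p))).comp_contDiffOn (h p)

lemma fam_on {ι : Type*} (nx : Fin 16 → ι → ι) {U : Set E16} (hU : IsOpen U) (F : ι → E16 → ℂ)
    (h : ∀ P, ∀ x ∈ U, HasFDerivAt (F P) (gr fun p => F (nx p P) x) x) (P : ι) :
    ContDiffOn ℝ ∞ (F P) U := by
  rw [contDiffOn_infty]
  intro n
  induction n generalizing P with
  | zero =>
    exact contDiffOn_zero.2 fun x hx => (h P x hx).continuousAt.continuousWithinAt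
  | succ n ih =>
    have := (contDiffOn_succ_iff_fderiv_of_isOpen (𝕜 := ℝ) (n := n) (f := F P) hU).2
      ⟨fun x hx => (h P x hx).differentiableAt.differentiableWithinAt, by simp, ?_⟩
    · exact_mod_cast this
    · refine (contDiffOn_gr (fun p => ih (nx p P))).congr fun x hx => ?_
      exact (h P x hx).fderiv

lemma fam_S {ι : Type*} (nx : Fin 16 → ι → ι) (F : ι → E16 → ℂ)
    (h : ∀ P, ∀ x, HasFDerivAt (F P) (gr fun p => F (nx p P) x) x) (P : ι) :
    ContDiff ℝ ∞ (F P) :=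
  contDiffOn_univ.1 (fam_on nx isOpen_univ F (fun P x _ => h P x) P)

open MeasureTheory Set

/-- cube -/
def cb (r : ℕ) (a : Fin r → ℝ) : Set (Fin r → ℝ) := {x | ∀ i, x i ∈ Ioc (a i) (a i + 1)}

lemma cb_eq (r : ℕ) (a : Fin r → ℝ) : cb r a = Set.univ.pi fun i => Ioc (a i) (a i + 1) := by
  ext x; simp [cb]
lemma cb_meas (r : ℕ) (a : Fin r → ℝ) : MeasurableSet (cb r a) := by
  rw [cb_eq]; exact MeasurableSet.univ_pi fun i => measurableSet_Ioc
lemma cb_sub (r : ℕ) (a : Fin r → ℝ) : cb r a ⊆ Icc a (a + 1) := by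
  intro x hx
  exact ⟨fun i => (hx i).1.le, fun i => (hx i).2⟩
lemma cb_vol (r : ℕ) (a : Fin r → ℝ) : volume (cb r a) = 1 := by
  rw [cb_eq, Real.volume_pi_Ioc]; simp

lemma cb_int {r : ℕ} (a : Fin r → ℝ) {E : Type*} [NormedAddCommGroup E] {h : (Fin r → ℝ) → E}
    (hh : Continuous h) : IntegrableOn h (cb r a) :=
  (hh.continuousOn.integrableOn_compact isCompact_Icc).mono_set (cb_sub r a)

instance (r : ℕ) (a : Fin r → ℝ) : IsFiniteMeasure (volume.restrict (cb r a)) :=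
  ⟨by rw [Measure.restrict_apply_univ, cb_vol]; simp⟩

variable {r : ℕ}

/-- averaging -/
def avg0 (B : (Fin r → ℝ) → E16) (G : (Fin r → ℝ) → ℂ) (f : E16 → ℂ) (x : E16) : ℂ :=
  ∫ t in cb r 0, G t * f (x + B t)

lemma avg0_fderiv {B : (Fin r → ℝ) → E16} {G : (Fin r → ℝ) → ℂ} (hB : Continuous B)
    (hG : Continuous G) (f : Sm) (x : E16) :
    HasFDerivAt (avg0 B G f) (gr fun p => avg0 B G (dd (Pi.single p 1) f) x) x := by
  have hf' : Continuous (fderiv ℝ f) := (cdS f).continuous_fderiv (by simp)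
  have hc : Continuous fun q : E16 × (Fin r → ℝ) => G q.2 • fderiv ℝ f (q.1 + B q.2) := by fun_prop
  obtain ⟨Cb, hCb⟩ := ((isCompact_closedBall x 1).prod (isCompact_Icc (a := (0 : Fin r → ℝ)) (b := 0 + 1))).exists_bound_of_continuousOn
    hc.continuousOn
  have key := hasFDerivAt_integral_of_dominated_of_fderiv_le (𝕜 := ℝ) (μ := volume.restrict (cb r 0))
    (F := fun y t => G t * f (y + B t)) (F' := fun y t => G t • fderiv ℝ f (y + B t)) (x₀ := x)
    (s := Metric.closedBall x 1) (bound := fun _ => Cb) (Metric.closedBall_mem_nhds x one_pos)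
    (Filter.Eventually.of_forall fun y => by
      have := contS f
      exact (Continuous.aestronglyMeasurable (by fun_prop)))
    (by have := contS f
        exact cb_int _ (by fun_prop))
    (by exact Continuous.aestronglyMeasurable (by fun_prop))
    (by
      filter_upwards [ae_restrict_mem (cb_meas r 0)] with t ht y hy
      exact hCb (y, t) ⟨hy, cb_sub _ _ ht⟩)
    (integrable_const _)
    (Filter.Eventually.of_forall fun t y _ => by
      have h1 : HasFDerivAt (fun z => f (z + B t)) (fderiv ℝ f (y + B t)) y :=
        (hasFDerivAt_comp_add_right _).2 ((diffS f _).hasFDerivAt)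
      exact h1.const_mul _)
  have e1 : (gr fun p => avg0 B G (dd (Pi.single p 1) f) x)
      = ∫ t in cb r 0, G t • fderiv ℝ f (x + B t) := by
    rw [← gr_eta (∫ t in cb r 0, G t • fderiv ℝ f (x + B t))]
    congr 1
    ext p
    have hi : Integrable (fun t => G t • fderiv ℝ f (x + B t)) (volume.restrict (cb r 0)) :=
      cb_int 0 (by fun_prop)
    rw [ContinuousLinearMap.integral_apply hi]
    rfl
  rw [e1]
  exact key

/-- averaging operator on smooth functions -/
def avg (B : (Fin r → ℝ) → E16) (hB : Continuous B) (G : (Fin r → ℝ) → ℂ) (hG : Continuous G) :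
    Sm →ₗ[ℝ] Sm where
  toFun f := ⟨avg0 B G f, fam_S (fun p f => dd (Pi.single p 1) f) (fun f : Sm => avg0 B G f)
    (fun f x => avg0_fderiv hB hG f x) f⟩
  map_add' f g := by
    ext x
    change ∫ t in cb r 0, G t * (f (x + B t) + g (x + B t)) = _
    have := contS f
    have := contS g
    simp only [mul_add]
    rw [integral_add (cb_int _ (by fun_prop)) (cb_int _ (by fun_prop))]
    rfl
  map_smul' c f := by
    ext x
    change ∫ t in cb r 0, G t * (c • f (x + B t)) = c • ∫ t in cb r 0, G t * (f (x + B t))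
    simp only [mul_smul_comm]
    rw [integral_smul]

section
variable (B : (Fin r → ℝ) → E16) (hB : Continuous B) (G : (Fin r → ℝ) → ℂ) (hG : Continuous G)
lemma avg_apply (f : Sm) (x : E16) :
    avg B hB G hG f x = ∫ t in cb r 0, G t * f (x + B t) := rfl

lemma avg_op (P : PR ℝ) (f : Sm) : avg B hB G hG (op P f) = op P (avg B hB G hG f) := by
  refine op_commute _ (fun p f => ?_) P f
  ext x
  rw [dd_apply]
  change _ = fderiv ℝ (avg0 B G f) x _
  rw [(avg0_fderiv hB hG f x).fderiv, gr_single]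
  rfl

lemma avg_QP {θ : E16} {f : Sm} (hf : f ∈ QP θ) : avg B hB G hG f ∈ QP θ := by
  rw [mem_QP] at *
  intro l x
  rw [avg_apply, avg_apply, ← integral_const_mul]
  congr 1
  ext t
  rw [add_right_comm, hf]; ring

lemma avg_Nl {X : Set E16} (hX : ∀ x ∈ X, ∀ t, x + B t ∈ X) {f : Sm} (hf : f ∈ Nl X) :
    avg B hB G hG f ∈ Nl X := by
  rw [mem_Nl'] at *
  intro x hx
  have : ∀ᶠ y in 𝓝 x, ∀ t ∈ Icc (0 : Fin r → ℝ) (0 + 1), f (y + B t) = 0 := by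
    refine isCompact_Icc.eventually_forall_of_forall_eventually fun t _ => ?_
    have h1 : Filter.Tendsto (fun z : (E16 × (Fin r → ℝ)) => z.1 + B z.2) (𝓝 (x, t)) (𝓝 (x + B t)) := by
      have : Continuous (fun z : (E16 × (Fin r → ℝ)) => z.1 + B z.2) := by fun_prop
      exact this.tendsto (x, t)
    exact h1.eventually (hf _ (hX x hx t))
  filter_upwards [this] with y hy
  rw [avg_apply]
  rw [setIntegral_congr_fun (g := fun _ => (0 : ℂ)) (cb_meas r 0)]
  · simp
  · intro t ht
    simp [hy t (cb_sub _ _ ht)]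
end

/-! periodic functions on the cube -/
/-- periodic lift -/
lemma lift_per {h : (Fin r → ℝ) → ℂ} (hc : Continuous h)
    (hp : ∀ (k : Fin r → ℤ) t, h (t + fun i => (k i : ℝ)) = h t) :
    ∃ H : C(UnitAddTorus (Fin r), ℂ), ∀ t : Fin r → ℝ, H (fun i => (t i : UnitAddCircle)) = h t := by
  have hq : IsOpenQuotientMap (Pi.map (fun (_ : Fin r) (s : ℝ) => (s : UnitAddCircle))) :=
    IsOpenQuotientMap.piMap fun i => QuotientAddGroup.isOpenQuotientMap_mk
  have hs := hq.surjective
  choose g hg using hs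
  have hval : ∀ t : Fin r → ℝ, h (g (Pi.map (fun (_ : Fin r) (s : ℝ) => (s : UnitAddCircle)) t)) = h t := by
    intro t
    have h1 := hg (Pi.map (fun (_ : Fin r) (s : ℝ) => (s : UnitAddCircle)) t)
    have h2 : ∀ i, ∃ k : ℤ, g (Pi.map (fun (_ : Fin r) (s : ℝ) => (s : UnitAddCircle)) t) i = t i + k := by
      intro i
      have := congrFun h1 i
      simp only [Pi.map_apply] at this
      rw [← sub_eq_zero, ← AddCircle.coe_sub, AddCircle.coe_eq_zero_iff] at this
      obtain ⟨n, hn⟩ := this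
      refine ⟨n, ?_⟩
      simp only [zsmul_eq_mul, mul_one] at hn
      linarith
    choose k hk using h2
    rw [show g (Pi.map (fun (_ : Fin r) (s : ℝ) => (s : UnitAddCircle)) t) = t + fun i => (k i : ℝ) from funext hk, hp]
  refine ⟨⟨fun y => h (g y), ?_⟩, fun t => hval t⟩
  rw [hq.isQuotientMap.continuous_iff]
  convert hc using 1
  ext t
  exact hval t

lemma cube_shift {h : (Fin r → ℝ) → ℂ} (hc : Continuous h)
    (hp : ∀ (k : Fin r → ℤ) t, h (t + fun i => (k i : ℝ)) = h t) (s : Fin r → ℝ) :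
    ∫ t in cb r 0, h (t + s) = ∫ t in cb r 0, h t := by
  obtain ⟨H, hH⟩ := lift_per hc hp
  have e1 := (UnitAddTorus.integral_preimage H s).symm.trans (UnitAddTorus.integral_preimage H 0)
  simp only [hH] at e1
  refine Eq.trans ?_ e1
  have := (measurePreserving_add_right (volume : Measure (Fin r → ℝ)) s).setIntegral_preimage_emb
    (measurableEmbedding_addRight s) h (cb r s)
  rw [← cb, ← this]
  congr 2
  ext t
  simp only [cb, Set.mem_setOf_eq, Set.mem_preimage, Pi.zero_apply, Pi.add_apply, Set.mem_Ioc]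
  refine forall_congr' fun i => ⟨fun h => ⟨by linarith, by linarith⟩, fun h => ⟨by linarith, by linarith⟩⟩
end OK

namespace OK
open Finset MvPolynomial
open scoped ContDiff Topology
open MeasureTheory

lemma summ_prod : ∀ (r : ℕ) (a : Fin r → ℤ → ℝ), (∀ i n, 0 ≤ a i n) → (∀ i, Summable (a i)) →
    Summable fun k : Fin r → ℤ => ∏ i, a i (k i)
  | 0, a, _, _ => by
    exact summable_of_finite_support (Set.toFinite _)
  | r + 1, a, h0, hs => by
    have ih := summ_prod r (fun i => a i.succ) (fun i n => h0 _ n) (fun i => hs _)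
    have h1 := (hs 0).mul_of_nonneg ih (h0 0) (fun k => Finset.prod_nonneg fun i _ => h0 _ _)
    rw [← (Fin.consEquiv fun _ => ℤ).summable_iff]
    refine h1.congr fun x => ?_
    simp [Fin.prod_univ_succ, Fin.consEquiv]

lemma summ_one (w : ℝ) : Summable fun n : ℤ => (1 + 4 * Real.pi ^ 2 * ((n : ℝ) + w) ^ 2)⁻¹ := by
  have h := (Real.summable_one_div_int_add_rpow w 2).2 (by norm_num)
  refine h.of_norm_bounded_eventually ?_
  have hfin : {n : ℤ | ((n : ℝ) + w) = 0}.Finite := by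
    refine Set.Subsingleton.finite fun n hn m hm => ?_
    simp only [Set.mem_setOf_eq] at hn hm
    have : (n : ℝ) = m := by linarith
    exact_mod_cast this
  rw [Filter.eventually_cofinite]
  refine hfin.subset fun n hn => ?_
  simp only [Set.mem_setOf_eq] at hn ⊢
  by_contra hne
  apply hn
  have hp : (1:ℝ) ≤ 4 * Real.pi ^ 2 := by nlinarith [Real.pi_gt_three]
  have h2 : 0 < ((n : ℝ) + w) ^ 2 := by positivity
  rw [Real.norm_of_nonneg (by positivity), one_div]
  have : |(n : ℝ) + w| ^ (2 : ℝ) = ((n : ℝ) + w) ^ 2 := by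
    rw [show (2 : ℝ) = ((2 : ℕ) : ℝ) by norm_num, Real.rpow_natCast, sq_abs]
  rw [this]
  gcongr
  nlinarith

section
variable {r : ℕ} (θ : E16) (b : Fin r → Fin 16 → ℤ)

/-- directions -/
def Bm (t : Fin r → ℝ) : E16 := ∑ i, t i • iv (b i)
lemma Bm_cont : Continuous (Bm b) := by unfold Bm; fun_prop
lemma Bm_add (t s : Fin r → ℝ) : Bm b (t + s) = Bm b t + Bm b s := by
  simp [Bm, add_smul, Finset.sum_add_distrib]

/-- frequency -/
def om (i : Fin r) : ℝ := θ ⬝ᵥ iv (b i)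
/-- complex frequency -/
def fr (k : Fin r → ℤ) (i : Fin r) : ℂ := 2 * Real.pi * Complex.I * ((k i : ℝ) + om θ b i : ℝ)

/-- exponential -/
def ek (k : Fin r → ℤ) (t : Fin r → ℝ) : ℂ := Complex.exp (-∑ i, fr θ b k i * (t i : ℂ))
lemma ek_cont (k : Fin r → ℤ) : Continuous (ek θ b k) := by unfold ek; fun_prop
lemma ek_norm (k : Fin r → ℤ) (t : Fin r → ℝ) : ‖ek θ b k t‖ = 1 := by
  have : -∑ i, fr θ b k i * (t i : ℂ) = ((-∑ i, 2 * Real.pi * ((k i : ℝ) + om θ b i) * t i : ℝ) : ℂ) * Complex.I := by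
    push_cast
    rw [neg_mul, Finset.sum_mul]
    congr 1
    exact Finset.sum_congr rfl fun i _ => by simp [fr]; ring
  rw [ek, this, Complex.norm_exp_ofReal_mul_I]
lemma ek_add (k : Fin r → ℤ) (t s : Fin r → ℝ) : ek θ b k (t + s) = ek θ b k t * ek θ b k s := by
  rw [ek, ek, ek, ← Complex.exp_add]
  congr 1
  simp [mul_add, Finset.sum_add_distrib]; ring

lemma Bm_int (m : Fin r → ℤ) : Bm b (fun i => (m i : ℝ)) = iv (fun p => ∑ i, m i * b i p) := by
  ext p; simp [Bm, iv, Finset.sum_apply]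

lemma hper (k : Fin r → ℤ) {f : Sm} (hf : f ∈ QP θ) (x : E16) (m : Fin r → ℤ) (t : Fin r → ℝ) :
    ek θ b k (t + fun i => (m i : ℝ)) * f (x + Bm b (t + fun i => (m i : ℝ))) =
      ek θ b k t * f (x + Bm b t) := by
  rw [ek_add, Bm_add, ← add_assoc, Bm_int, mem_QP.1 hf, ← Bm_int]
  have h1 : ek θ b k (fun i => (m i : ℝ)) * Complex.exp (2 * Real.pi * Complex.I * (θ ⬝ᵥ Bm b (fun i => (m i : ℝ)) : ℝ)) = 1 := by
    rw [ek, ← Complex.exp_add, Complex.exp_eq_one_iff]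
    refine ⟨-∑ i, k i * m i, ?_⟩
    have : (θ ⬝ᵥ Bm b (fun i => (m i : ℝ)) : ℝ) = ∑ i, (m i : ℝ) * om θ b i := by
      simp [Bm, dotProduct_sum, om, dotProduct_smul]
    rw [this]
    push_cast
    rw [neg_mul, Finset.sum_mul, Finset.mul_sum, ← Finset.sum_neg_distrib, ← Finset.sum_neg_distrib,
      ← Finset.sum_add_distrib]
    exact Finset.sum_congr rfl fun i _ => by simp [fr]; ring
  linear_combination (ek θ b k t * f (x + Bm b t)) * h1

/-- Fourier coefficient operators -/
def cf (k : Fin r → ℤ) : Sm →ₗ[ℝ] Sm := avg (Bm b) (Bm_cont b) (ek θ b k) (ek_cont θ b k)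

lemma cf_shift (k : Fin r → ℤ) {f : Sm} (hf : f ∈ QP θ) (x : E16) (s : Fin r → ℝ) :
    cf θ b k f (x + Bm b s) = Complex.exp (∑ i, fr θ b k i * (s i : ℂ)) * cf θ b k f x := by
  have hc : Continuous fun t => ek θ b k t * f (x + Bm b t) := by
    have := contS f
    have := Bm_cont b
    have := ek_cont θ b k
    fun_prop
  have h := cube_shift hc (hper θ b k hf x) s
  rw [cf, avg_apply, avg_apply, ← h, ← integral_const_mul]
  congr 1
  ext t
  rw [ek_add, Bm_add, ek, ek, ← add_assoc, add_right_comm, Complex.exp_neg (∑ i, fr θ b k i * (s i : ℂ))]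
  field_simp

lemma cf_dd (k : Fin r → ℤ) {f : Sm} (hf : f ∈ QP θ) (i : Fin r) :
    dd (iv (b i)) (cf θ b k f) = fr θ b k i • cf θ b k f := by
  ext x
  have h1 : HasDerivAt (fun s : ℝ => cf θ b k f (x + s • iv (b i))) (dd (iv (b i)) (cf θ b k f) x) 0 := by
    have h0 : HasFDerivAt (cf θ b k f) (fderiv ℝ (cf θ b k f) x) (x + (0 : ℝ) • iv (b i)) := by
      rw [zero_smul, add_zero]; exact (diffS _ x).hasFDerivAt
    have h2 : HasDerivAt (fun s : ℝ => x + s • iv (b i)) (iv (b i)) 0 := by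
      simpa using ((hasDerivAt_id (0:ℝ)).smul_const (iv (b i))).const_add x
    exact h0.comp_hasDerivAt (0 : ℝ) h2
  have h3 : (fun s : ℝ => cf θ b k f (x + s • iv (b i))) =
      fun s : ℝ => Complex.exp (fr θ b k i * (s : ℂ)) * cf θ b k f x := by
    ext s
    have := cf_shift θ b k hf x (Pi.single i s)
    have e1 : Bm b (Pi.single i s) = s • iv (b i) := by
      rw [Bm, Finset.sum_eq_single i]
      · simp
      · intro j _ hj; simp [Pi.single_apply, hj]
      · simp
    have e2 : ∑ j, fr θ b k j * ((Pi.single i s : Fin r → ℝ) j : ℂ) = fr θ b k i * s := by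
      rw [Finset.sum_eq_single i]
      · simp
      · intro j _ hj; simp [Pi.single_apply, hj]
      · simp
    rw [e1, e2] at this
    exact this
  rw [h3] at h1
  have h4 : HasDerivAt (fun s : ℝ => Complex.exp (fr θ b k i * (s : ℂ)) * cf θ b k f x)
      (fr θ b k i * cf θ b k f x) 0 := by
    have h5 : HasDerivAt (fun s : ℝ => fr θ b k i * (s : ℂ)) (fr θ b k i) 0 := by
      simpa using (Complex.ofRealCLM.hasDerivAt (x := (0:ℝ))).const_mul (fr θ b k i)
    have := (h5.cexp).mul_const (cf θ b k f x)
    simpa using this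
  exact h1.unique h4

/-- symbol along b -/
def sy (D : MvPolynomial (Fin r) ℤ) : PR ℝ := aeval (lf fun i p => (b i p : ℝ)) D

lemma cf_sy (k : Fin r → ℤ) {f : Sm} (hf : f ∈ QP θ) (D : MvPolynomial (Fin r) ℤ) :
    cf θ b k (op (sy b D) f) = (aeval (fr θ b k) D : ℂ) • cf θ b k f := by
  rw [cf, avg_op, ← cf]
  induction D using MvPolynomial.induction_on with
  | C a =>
    rw [sy, aeval_C, aeval_C]
    simp only [algebraMap_int_eq, eq_intCast, map_intCast]
    ext x
    rw [Sm.smul_apply, Module.End.intCast_apply]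
    rw [← Int.cast_smul_eq_zsmul ℝ, Sm.rsmul_apply]; simp
  | add p q hp hq =>
    have : sy b (p + q) = sy b p + sy b q := by simp only [sy, map_add]
    rw [this, map_add (aeval (fr θ b k)), op_add, hp, hq, add_smul]
  | mul_X p i hp =>
    have : sy b (p * X i) = sy b p * lin (iv (b i)) := by
      simp only [sy, map_mul, aeval_X]; rfl
    rw [this, mul_comm, op_mul, hp, ← smul_op, op_lin, cf_dd θ b k hf, map_mul, aeval_X, mul_smul]

/-- regularizing symbol -/
def Mr (r : ℕ) : MvPolynomial (Fin r) ℤ := ∏ i, (1 - X i ^ 2)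

/-- its values -/
def mk (k : Fin r → ℤ) : ℝ := ∏ i, (1 + 4 * Real.pi ^ 2 * ((k i : ℝ) + om θ b i) ^ 2)

lemma Mr_val (k : Fin r → ℤ) : aeval (fr θ b k) (Mr r) = (mk θ b k : ℂ) := by
  rw [Mr, mk, map_prod]
  push_cast
  refine Finset.prod_congr rfl fun i _ => ?_
  simp only [map_sub, map_one, map_pow, aeval_X, fr]
  push_cast
  linear_combination (-4 * (Real.pi:ℂ) ^ 2 * (((k i : ℂ)) + om θ b i) ^ 2) * Complex.I_sq

lemma mk_pos (k : Fin r → ℤ) : 0 < mk θ b k := Finset.prod_pos fun i _ => by positivity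

lemma mk_summ : Summable fun k => (mk θ b k)⁻¹ := by
  have := summ_prod r (fun i n => (1 + 4 * Real.pi ^ 2 * ((n : ℝ) + om θ b i) ^ 2)⁻¹)
    (fun i n => by positivity) (fun i => summ_one _)
  refine this.congr fun k => ?_
  rw [mk, Finset.prod_inv_distrib]

lemma cf_bound (f : Sm) (x : E16) : ∃ C, ∀ k, ‖cf θ b k f x‖ ≤ C := by
  have hc : Continuous fun t => f (x + Bm b t) := by
    have := contS f
    have := Bm_cont b
    fun_prop
  refine ⟨∫ t in cb r 0, ‖f (x + Bm b t)‖, fun k => ?_⟩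
  rw [cf, avg_apply]
  refine (norm_integral_le_integral_norm _).trans (le_of_eq ?_)
  congr 1
  ext t
  rw [norm_mul, ek_norm, one_mul]

lemma cf_summ {f : Sm} (hf : f ∈ QP θ) (x : E16) : Summable fun k => cf θ b k f x := by
  obtain ⟨C, hC⟩ := cf_bound θ b (op (sy b (Mr r)) f) x
  refine Summable.of_norm_bounded ((mk_summ θ b).mul_left C) fun k => ?_
  have h := hC k
  rw [cf_sy θ b k hf, Sm.smul_apply, Mr_val, norm_mul, Complex.norm_real,
    Real.norm_of_nonneg (mk_pos θ b k).le] at h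
  have := mk_pos θ b k
  rw [← div_eq_mul_inv, le_div_iff₀ this]
  linarith

lemma cf_inv {f : Sm} (hf : f ∈ QP θ) (x : E16) : HasSum (fun k => cf θ b k f x) (f x) := by
  have hc : Continuous fun t => ek θ b 0 t * f (x + Bm b t) := by
    have := contS f
    have := Bm_cont b
    have := ek_cont θ b 0
    fun_prop
  obtain ⟨H, hH⟩ := lift_per hc (hper θ b 0 hf x)
  have hco : ∀ k, UnitAddTorus.mFourierCoeff H k = cf θ b k f x := by
    intro k
    rw [UnitAddTorus.mFourierCoeff_eq_integral H k 0, cf, avg_apply]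
    simp only [hH]
    refine setIntegral_congr_fun (cb_meas r 0) fun t _ => ?_
    simp only [smul_eq_mul, ← mul_assoc]
    congr 1
    simp only [UnitAddTorus.mFourier, ContinuousMap.coe_mk, fourier_coe_apply, ← Complex.exp_sum, ek,
      ← Complex.exp_add]
    congr 1
    rw [← Finset.sum_neg_distrib, ← Finset.sum_neg_distrib, ← Finset.sum_add_distrib]
    refine Finset.sum_congr rfl fun i _ => ?_
    simp [fr]; ring
  have h1 := UnitAddTorus.hasSum_mFourier_series_apply_of_summable (f := H)
    (by simp only [funext hco]; exact cf_summ θ b hf x) (fun i => ((0 : ℝ) : UnitAddCircle))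
  have e0 := hH 0
  have e1 : (fun i : Fin r => (((0 : Fin r → ℝ) i : ℝ) : UnitAddCircle)) = fun i => ((0 : ℝ) : UnitAddCircle) := rfl
  rw [e1] at e0
  rw [e0] at h1
  have e2 : ek θ b 0 0 * f (x + Bm b 0) = f x := by simp [ek, Bm]
  rw [e2] at h1
  convert h1 using 2 with k
  rw [hco, UnitAddTorus.mFourier]
  simp

theorem exR (D : MvPolynomial (Fin r) ℤ) {c : ℝ} (hc0 : 0 < c)
    (hc : ∀ k, c ≤ ‖(aeval (fr θ b k) D : ℂ)‖) :
    ∃ R : Sm →ₗ[ℝ] Sm, (∀ f ∈ QP θ, R (op (sy b D) f) = f) ∧ (∀ P f, R (op P f) = op P (R f)) ∧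
      (∀ f ∈ QP θ, R f ∈ QP θ) ∧
      ∀ X : Set E16, (∀ x ∈ X, ∀ t, x + Bm b t ∈ X) → ∀ f ∈ Nl X, R f ∈ Nl X := by
  set g : (Fin r → ℤ) → ℂ := fun k => ((aeval (fr θ b k) D : ℂ) * mk θ b k)⁻¹ with hg
  have hgb : ∀ k, ‖g k‖ ≤ c⁻¹ * (mk θ b k)⁻¹ := by
    intro k
    have := mk_pos θ b k
    rw [hg]
    simp only [norm_inv, norm_mul, Complex.norm_real, Real.norm_of_nonneg this.le, mul_inv]
    gcongr
    exact hc k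
  have hgs : Summable fun k => c⁻¹ * (mk θ b k)⁻¹ := (mk_summ θ b).mul_left _
  have hgn : ∀ k t, ‖g k * ek θ b k t‖ ≤ c⁻¹ * (mk θ b k)⁻¹ := fun k t => by
    rw [norm_mul, ek_norm, mul_one]; exact hgb k
  have hGc : Continuous fun t => ∑' k, g k * ek θ b k t :=
    continuous_tsum (fun k => continuous_const.mul (ek_cont θ b k)) hgs hgn
  refine ⟨(avg (Bm b) (Bm_cont b) _ hGc).comp (op (sy b (Mr r))), ?_, ?_, ?_, ?_⟩
  · intro f hf
    ext x
    rw [LinearMap.comp_apply, avg_apply]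
    obtain ⟨F, hF⟩ : ∃ F, F = op (sy b (Mr r)) (op (sy b D) f) := ⟨_, rfl⟩
    rw [← hF]
    have hFc : Continuous fun t => F (x + Bm b t) := by
      have := contS F
      have := Bm_cont b
      fun_prop
    have hi := hasSum_integral_of_summable_integral_norm (μ := volume.restrict (cb r 0))
      (F := fun k t => g k * ek θ b k t * F (x + Bm b t))
      (fun k => cb_int 0 ((continuous_const.mul (ek_cont θ b k)).mul hFc))
      (by
        refine Summable.of_nonneg_of_le (fun k => integral_nonneg fun t => norm_nonneg _)
          (fun k => ?_) (hgs.mul_right (∫ t in cb r 0, ‖F (x + Bm b t)‖))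
        rw [← integral_const_mul]
        refine integral_mono (cb_int 0 ((continuous_const.mul (ek_cont θ b k)).mul hFc).norm) (cb_int 0 (continuous_const.mul hFc.norm)) fun t => ?_
        change ‖g k * ek θ b k t * F (x + Bm b t)‖ ≤ _
        rw [norm_mul]
        gcongr
        exact hgn k t)
    have e1 : ∀ k, ∫ t in cb r 0, g k * ek θ b k t * F (x + Bm b t) = cf θ b k f x := by
      intro k
      simp only [mul_assoc]
      rw [integral_const_mul, ← avg_apply (Bm b) (Bm_cont b) (ek θ b k) (ek_cont θ b k), ← cf, hF,
        cf_sy θ b k (QP_op _ hf), Sm.smul_apply, cf_sy θ b k hf, Sm.smul_apply, Mr_val, hg]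
      have h1 : (mk θ b k : ℂ) ≠ 0 := by exact_mod_cast (mk_pos θ b k).ne'
      have h2 : (aeval (fr θ b k) D : ℂ) ≠ 0 := by
        intro h; have := hc k; rw [h, norm_zero] at this; linarith
      field_simp
    simp only [e1] at hi
    have e2 := (cf_inv θ b hf x).unique hi
    rw [e2]
    congr 1
    ext t
    rw [tsum_mul_right]
  · intro P f
    rw [LinearMap.comp_apply, LinearMap.comp_apply, ← op_mul, mul_comm, op_mul, avg_op]
  · intro f hf
    exact avg_QP _ (Bm_cont b) _ hGc (QP_op _ hf)
  · intro X hX f hf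
    exact avg_Nl _ (Bm_cont b) _ hGc hX (Nl_op _ hf)
end
end OK

namespace OK
open Finset MvPolynomial
open scoped ContDiff Topology

/-- evaluate homogeneous polynomial with scaled arguments -/
lemma homog_scale {r d : ℕ} {D : MvPolynomial (Fin r) ℤ} (hD : D.IsHomogeneous d) {A : Type*} [CommRing A]
    (c : A) (y : Fin r → A) : aeval (fun i => c * y i) D = c ^ d * aeval y D := by
  conv_lhs => rw [D.as_sum]
  conv_rhs => rw [D.as_sum]
  rw [map_sum, map_sum, Finset.mul_sum]
  refine Finset.sum_congr rfl fun m hm => ?_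
  rw [aeval_monomial, aeval_monomial]
  have hdeg : m.degree = d := by
    have := hD (mem_support_iff.1 hm)
    rw [← this, Finsupp.degree_eq_weight_one]
    rfl
  simp only [Finsupp.prod, mul_pow, Finset.prod_mul_distrib, Finset.prod_pow_eq_pow_sum]
  have hs : ∑ i ∈ m.support, m i = d := by rw [← hdeg]; rfl
  rw [hs]
  ring

lemma aeval_dvd {r : ℕ} (D : MvPolynomial (Fin r) ℤ) (N : ℤ) (y z : Fin r → ℤ) (h : ∀ i, N ∣ y i - z i) :
    N ∣ (aeval y D - aeval z D : ℤ) := by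
  induction D using MvPolynomial.induction_on with
  | C a => simp
  | add p q hp hq =>
    rw [map_add, map_add, add_sub_add_comm]
    exact dvd_add hp hq
  | mul_X p i hp =>
    rw [map_mul, map_mul, aeval_X, aeval_X]
    have : (aeval y p * y i - aeval z p * z i : ℤ) = (aeval y p - aeval z p) * y i + aeval z p * (y i - z i) := by ring
    rw [this]
    exact dvd_add (hp.mul_right _) ((h i).mul_left _)

lemma aeval_aeval {r s : ℕ} {A : Type*} [CommRing A] [Algebra ℤ A] (a : Fin s → A) (g : Fin r → MvPolynomial (Fin s) ℤ)
    (D : MvPolynomial (Fin r) ℤ) : aeval a (aeval g D) = aeval (fun i => aeval a (g i)) D := by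
  induction D using MvPolynomial.induction_on with
  | C a => simp
  | add p q hp hq => simp only [map_add, hp, hq]
  | mul_X p i hp => simp only [map_mul, hp, aeval_X]

/-- integer pairing -/
def dpz (a b : Fin 16 → ℤ) : ℤ := ∑ p, a p * b p

lemma bound_of_mod {r d : ℕ} {D : MvPolynomial (Fin r) ℤ} (hD : D.IsHomogeneous d)
    (b : Fin r → Fin 16 → ℤ) (a : Fin 16 → ℤ) (N : ℕ) (hN : 0 < N)
    (h : ¬ (N : ℤ) ∣ aeval (fun i => dpz a (b i)) D) :
    ∃ c > 0, ∀ k, c ≤ ‖(aeval (fr (fun p => (a p : ℝ) / N) b k) D : ℂ)‖ := by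
  refine ⟨‖(2 * Real.pi * Complex.I / N : ℂ) ^ d‖, ?_, ?_⟩
  · have : (N : ℂ) ≠ 0 := by exact_mod_cast hN.ne'
    have h2 := Real.pi_ne_zero
    rw [gt_iff_lt, norm_pos_iff]
    refine pow_ne_zero _ (div_ne_zero ?_ this)
    simp [h2]
  · intro k
    have e1 : fr (fun p => (a p : ℝ) / N) b k = fun i => (2 * Real.pi * Complex.I / N : ℂ) * ((N * k i + dpz a (b i) : ℤ) : ℂ) := by
      ext i
      have hNC : (N : ℂ) ≠ 0 := by exact_mod_cast hN.ne'
      have : om (fun p => (a p : ℝ) / N) b i = (dpz a (b i) : ℝ) / N := by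
        simp only [om, dotProduct, iv, dpz]
        push_cast
        rw [Finset.sum_div]
        exact Finset.sum_congr rfl fun p _ => by ring
      rw [fr, this]
      push_cast
      field_simp
    rw [e1, homog_scale hD, norm_mul]
    have e2 : (aeval (fun i => ((N * k i + dpz a (b i) : ℤ) : ℂ)) D : ℂ) = ((aeval (fun i => (N * k i + dpz a (b i) : ℤ)) D : ℤ) : ℂ) := by
      have := aeval_algebraMap_apply (B := ℂ) (fun i => (N * k i + dpz a (b i) : ℤ)) D
      exact this
    rw [e2, Complex.norm_intCast]
    have e3 : (aeval (fun i => (N * k i + dpz a (b i) : ℤ)) D : ℤ) ≠ 0 := by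
      intro h0
      apply h
      have := aeval_dvd D N (fun i => dpz a (b i)) (fun i => (N * k i + dpz a (b i) : ℤ)) (fun i => ⟨- k i, by ring⟩)
      rwa [h0, sub_zero] at this
    have e4 : (1 : ℝ) ≤ |((aeval (fun i => (N * k i + dpz a (b i) : ℤ)) D : ℤ) : ℝ)| := by
      rw [← Int.cast_abs]
      exact_mod_cast Int.one_le_abs e3
    exact le_mul_of_one_le_right (norm_nonneg _) e4

/-- the rational dual problem -/
lemma exists_dual {r : ℕ} {b : Fin r → Fin 16 → ℚ} (hb : LinearIndependent ℚ b) (y : Fin r → ℚ) :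
    ∃ a : Fin 16 → ℚ, ∀ i, ∑ p, a p * b i p = y i := by
  obtain ⟨g, hg⟩ := LinearMap.exists_extend ((Module.Basis.span hb).constr ℚ y)
  refine ⟨fun p => g (Pi.single p 1), fun i => ?_⟩
  have h1 : g (b i) = y i := by
    have := congrArg (fun F => F (Module.Basis.span hb i)) hg
    simp only [LinearMap.comp_apply, Module.Basis.constr_basis, Submodule.subtype_apply] at this
    rwa [Module.Basis.span_apply] at this
  rw [← h1]
  conv_rhs => rw [pi_eq_sum_univ' (b i)]
  rw [map_sum]
  refine Finset.sum_congr rfl fun p _ => ?_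
  rw [map_smul, smul_eq_mul, mul_comm]

lemma sy_ne {r : ℕ} {D : MvPolynomial (Fin r) ℤ} (hD : D ≠ 0) {b : Fin r → Fin 16 → ℤ}
    (hb : LinearIndependent ℚ (fun i p => (b i p : ℚ))) :
    (aeval (fun i => ∑ p, C (b i p) * X p : Fin r → MvPolynomial (Fin 16) ℤ) D) ≠ 0 := by
  intro h0
  have : ∃ y : Fin r → ℤ, eval y D ≠ 0 := by
    by_contra hcon
    push Not at hcon
    exact hD (MvPolynomial.funext fun y => by rw [hcon y, map_zero])
  obtain ⟨y, hy⟩ := this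
  obtain ⟨a, ha⟩ := exists_dual hb (fun i => (y i : ℚ))
  apply hy
  have h1 := congrArg (aeval (R := ℤ) a) h0
  rw [map_zero, aeval_aeval] at h1
  have e1 : (fun i => aeval (R := ℤ) a (∑ p, C (b i p) * X p : MvPolynomial (Fin 16) ℤ)) = fun i => (y i : ℚ) := by
    ext i
    rw [← ha i, map_sum]
    refine Finset.sum_congr rfl fun p _ => ?_
    simp [mul_comm]
  rw [e1] at h1
  have e2 := aeval_algebraMap_apply (B := ℚ) y D
  have e3 : (aeval (fun i => (y i : ℚ)) D : ℚ) = ((aeval y D : ℤ) : ℚ) := e2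
  rw [e3] at h1
  have h2 : (aeval y D : ℤ) = 0 := by exact_mod_cast h1
  rw [← h2]; rfl

lemma kerb {ι : Type*} (n : ι → Fin 16 → ℤ) (I : Finset ι) (hI : I.card ≤ 4) :
    ∃ b : Fin 12 → Fin 16 → ℤ, LinearIndependent ℚ (fun i p => (b i p : ℚ)) ∧
      ∀ i ∈ I, ∀ j, dpz (n i) (b j) = 0 := by
  let L : (Fin 16 → ℚ) →ₗ[ℚ] (I → ℚ) := LinearMap.pi fun i => ∑ p, (n i p : ℚ) • LinearMap.proj p
  have h1 := L.finrank_range_add_finrank_ker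
  have h2 : Module.finrank ℚ (LinearMap.range L) ≤ 4 := by
    refine (Submodule.finrank_le _).trans ?_
    simpa using hI
  have h3 : 12 ≤ Module.finrank ℚ (LinearMap.ker L) := by
    simp at h1; omega
  obtain ⟨v, hv⟩ := exists_linearIndependent_of_le_finrank h3
  have hv' : LinearIndependent ℚ (fun i => (v i : Fin 16 → ℚ)) :=
    hv.map' (Submodule.subtype _) (Submodule.ker_subtype _)
  have hd : ∀ i, ∃ (N : ℤ) (w : Fin 16 → ℤ), N ≠ 0 ∧ ∀ p, (w p : ℚ) = N * (v i : Fin 16 → ℚ) p := by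
    intro i
    refine ⟨∏ p, ((v i : Fin 16 → ℚ) p).den, fun p => (∏ q ∈ univ.erase p, ((v i : Fin 16 → ℚ) q).den) * ((v i : Fin 16 → ℚ) p).num, ?_, ?_⟩
    · exact_mod_cast Finset.prod_ne_zero_iff.2 fun p _ => ((v i : Fin 16 → ℚ) p).den_nz
    · intro p
      rw [← Finset.mul_prod_erase univ _ (mem_univ p)]
      push_cast
      have := Rat.den_mul_eq_num ((v i : Fin 16 → ℚ) p)
      rw [← this]; ring
  choose N w hN hw using hd
  refine ⟨w, ?_, ?_⟩
  · have := hv'.units_smul (fun i => Units.mk0 (N i : ℚ) (by exact_mod_cast hN i))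
    convert this using 1
    ext i p
    rw [hw]; rfl
  · intro i hi j
    have hk := (v j).2
    rw [LinearMap.mem_ker] at hk
    have hk := congrFun hk ⟨i, hi⟩
    simp [L, LinearMap.sum_apply] at hk
    have : ((dpz (n i) (w j) : ℤ) : ℚ) = 0 := by
      rw [dpz]; push_cast
      simp only [hw]
      calc ∑ p, (n i p : ℚ) * (N j * (v j : Fin 16 → ℚ) p) = N j * ∑ p, (n i p : ℚ) * (v j : Fin 16 → ℚ) p := by
            rw [Finset.mul_sum]; exact Finset.sum_congr rfl fun p _ => by ring
        _ = 0 := by rw [hk, mul_zero]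
    exact_mod_cast this

lemma exTheta {S : Type*} [Fintype S] (r d : S → ℕ) (D : ∀ s, MvPolynomial (Fin (r s)) ℤ)
    (b : ∀ s, Fin (r s) → Fin 16 → ℤ) (hD : ∀ s, D s ≠ 0) (hh : ∀ s, (D s).IsHomogeneous (d s))
    (hb : ∀ s, LinearIndependent ℚ (fun i p => (b s i p : ℚ))) :
    ∃ θ : E16, ∀ s, ∃ c > 0, ∀ k, c ≤ ‖(aeval (fr θ (b s) k) (D s) : ℂ)‖ := by
  have h1 : ∏ s, (aeval (fun i => ∑ p, C (b s i p) * X p : Fin (r s) → MvPolynomial (Fin 16) ℤ) (D s)) ≠ 0 :=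
    Finset.prod_ne_zero_iff.2 fun s _ => sy_ne (hD s) (hb s)
  have : ∃ a : Fin 16 → ℤ, aeval a (∏ s, (aeval (fun i => ∑ p, C (b s i p) * X p : Fin (r s) → MvPolynomial (Fin 16) ℤ) (D s))) ≠ 0 := by
    by_contra hcon
    push Not at hcon
    exact h1 (MvPolynomial.funext fun y => by rw [map_zero]; exact hcon y)
  obtain ⟨a, ha⟩ := this
  rw [map_prod, Finset.prod_ne_zero_iff] at ha
  have ha' : ∀ s, (aeval (fun i => dpz a (b s i)) (D s) : ℤ) ≠ 0 := by
    intro s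
    have := ha s (mem_univ _)
    rw [aeval_aeval] at this
    have e : (fun i => (aeval a) (∑ p, C (b s i p) * X p)) = fun i => dpz a (b s i) := by
      ext i
      simp [dpz, mul_comm]
    rwa [e] at this
  set N : ℕ := 1 + ∑ s, (aeval (fun i => dpz a (b s i)) (D s) : ℤ).natAbs with hN
  refine ⟨fun p => (a p : ℝ) / N, fun s => bound_of_mod (hh s) (b s) a N (by omega) ?_⟩
  intro hdvd
  have h2 := Int.natAbs_dvd_natAbs.2 hdvd
  have h3 := Nat.le_of_dvd (Int.natAbs_pos.2 (ha' s)) h2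
  have h4 : (aeval (fun i => dpz a (b s i)) (D s) : ℤ).natAbs ≤ ∑ s, (aeval (fun i => dpz a (b s i)) (D s) : ℤ).natAbs :=
    Finset.single_le_sum (f := fun s => (aeval (fun i => dpz a (b s i)) (D s) : ℤ).natAbs) (fun _ _ => Nat.zero_le _) (mem_univ s)
  simp only [Int.natAbs_natCast] at h3
  omega

/-- package of an operator -/
structure ROp (θ : E16) (P : PR ℝ) (V : Set E16) where
  R : Sm →ₗ[ℝ] Sm
  inv : ∀ f ∈ QP θ, R (op P f) = f
  comm : ∀ P f, R (op P f) = op P (R f)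
  qp : ∀ f ∈ QP θ, R f ∈ QP θ
  loc : ∀ X : Set E16, (∀ x ∈ X, ∀ v ∈ V, x + v ∈ X) → ∀ f ∈ Nl X, R f ∈ Nl X

theorem exROp {ι : Type*} [Fintype ι] [DecidableEq ι] (n : ι → Fin 16 → ℤ) :
    ∃ θ : E16, Nonempty (ROp θ (Q ℝ 0) Set.univ) ∧ ∀ I : Finset ι, I.card ≤ 4 →
      ∃ A : Fin 10 → PR ℝ, Nonempty (ROp θ (∑ a, A a * Q ℝ a) {v | ∀ i ∈ I, iv (n i) ⬝ᵥ v = 0}) := by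
  choose b hbl hbk using fun I : {I : Finset ι // I.card ≤ 4} => kerb n I.1 I.2
  choose d D hD hh A hA using fun I : {I : Finset ι // I.card ≤ 4} => Disc (b I)
  obtain ⟨θ, hθ⟩ := exTheta (S := Option {I : Finset ι // I.card ≤ 4})
    (fun s => s.elim 16 (fun _ => 12)) (fun s => s.elim 2 d)
    (fun s => match s with | none => (∑ p : Fin 16, X p ^ 2 : MvPolynomial (Fin 16) ℤ) | some I => D I)
    (fun s => match s with | none => (fun i : Fin 16 => Pi.single i 1) | some I => b I)
    (by
      rintro (_ | I)
      · intro h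
        change (∑ p : Fin 16, X p ^ 2 : MvPolynomial (Fin 16) ℤ) = 0 at h
        have := congrArg (aeval (R := ℤ) (fun _ => (1:ℤ))) h
        simp at this
      · exact hD I)
    (by
      rintro (_ | I)
      · refine IsHomogeneous.sum _ _ _ fun p _ => ?_
        exact (isHomogeneous_X ℤ p).pow 2
      · exact hh I)
    (by
      rintro (_ | I)
      · have := (Pi.basisFun ℚ (Fin 16)).linearIndependent
        have e : (fun (i p : Fin 16) => (((Pi.single i 1 : Fin 16 → ℤ) p : ℤ):ℚ)) = ⇑(Pi.basisFun ℚ (Fin 16)) := by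
          ext i p
          simp [Pi.single_apply]
        rw [← e] at this
        exact this
      · exact hbl I)
  refine ⟨θ, ?_, ?_⟩
  · obtain ⟨c, hc0, hc⟩ := hθ none
    obtain ⟨R, h1, h2, h3, h4⟩ := exR (r := 16) θ (fun i => Pi.single i 1) (∑ p, X p ^ 2) hc0 hc
    have e1 : sy (fun i : Fin 16 => Pi.single i 1) (∑ p, X p ^ 2) = Q ℝ 0 := by
      rw [sy, map_sum]
      have : ∀ p, lf (fun i p => (((Pi.single i 1 : Fin 16 → ℤ) p : ℤ) : ℝ)) p = X p := by
        intro p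
        rw [lf, Finset.sum_eq_single p]
        · simp
        · intro q _ h; simp [Pi.single_apply, h]
        · simp
      simp only [map_pow, aeval_X, this, Q, ph, dt, gm_zero]
      exact Finset.sum_congr rfl fun p _ => by ring
    rw [e1] at h1
    exact ⟨R, h1, h2, h3, fun X hX f hf => h4 X (fun x hx t => hX x hx _ trivial) f hf⟩
  · intro I hI
    obtain ⟨c, hc0, hc⟩ := hθ (some ⟨I, hI⟩)
    obtain ⟨R, h1, h2, h3, h4⟩ := exR (r := 12) θ (b ⟨I, hI⟩) (D ⟨I, hI⟩) hc0 hc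
    rw [sy, hA ⟨I, hI⟩] at h1
    refine ⟨A ⟨I, hI⟩, ⟨R, h1, h2, h3, fun X hX f hf => h4 X (fun x hx t => hX x hx _ ?_) f hf⟩⟩
    intro i hi
    rw [Bm, dotProduct_sum]
    refine Finset.sum_eq_zero fun j _ => ?_
    rw [dotProduct_smul]
    have := hbk ⟨I, hI⟩ i hi j
    have h0 : iv (n i) ⬝ᵥ iv (b ⟨I, hI⟩ j) = ((dpz (n i) (b ⟨I, hI⟩ j) : ℤ) : ℝ) := by
      simp [dpz, iv, dotProduct]
    rw [h0, this]; simp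
end OK

namespace OK
open Finset MvPolynomial
open scoped ContDiff Topology
open MeasureTheory Set

/-- periodic sets -/
def PerS (X : Set E16) : Prop := ∀ x ∈ X, ∀ l, x + iv l ∈ X

lemma PerS.mem_iff {X : Set E16} (h : PerS X) (x : E16) (l : Fin 16 → ℤ) : x + iv l ∈ X ↔ x ∈ X := by
  refine ⟨fun hx => ?_, fun hx => h x hx l⟩
  have := h _ hx (-l)
  have e : x + iv l + iv (-l) = x := by ext p; simp [iv]
  rwa [e] at this

/-- the torus embedding -/
def tau (x : E16) : Fin 16 → ℂ := fun p => Complex.exp (2 * Real.pi * Complex.I * (x p : ℝ))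

lemma tau_cd : ContDiff ℝ ∞ tau := by
  rw [contDiff_pi]
  intro p
  have h1 : ContDiff ℝ ∞ (fun x : E16 => (2 * Real.pi * Complex.I * ((x p : ℝ) : ℂ))) := by
    have h2 : ContDiff ℝ ∞ (fun x : E16 => ((x p : ℝ) : ℂ)) :=
      Complex.ofRealCLM.contDiff.comp (contDiff_apply ℝ ℝ p)
    exact contDiff_const.mul h2
  exact h1.cexp

lemma tau_eq {x y : E16} (h : tau x = tau y) : ∃ l, y = x + iv l := by
  have : ∀ p, ∃ n : ℤ, y p = x p + n := by
    intro p
    have h1 := congrFun h p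
    simp only [tau] at h1
    rw [eq_comm, Complex.exp_eq_exp_iff_exists_int] at h1
    obtain ⟨n, hn⟩ := h1
    refine ⟨n, ?_⟩
    have hpi : (2 * Real.pi * Complex.I : ℂ) ≠ 0 := Complex.two_pi_I_ne_zero
    have h2 : ((y p : ℝ) : ℂ) = ((x p + n : ℝ) : ℂ) := by
      apply mul_left_cancel₀ hpi
      push_cast
      linear_combination hn
    exact_mod_cast h2
  choose l hl using this
  exact ⟨l, funext hl⟩

lemma tau_per (x : E16) (l) : tau (x + iv l) = tau x := by
  ext p
  simp only [tau, iv, Pi.add_apply]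
  rw [Complex.exp_eq_exp_iff_exists_int]
  exact ⟨l p, by push_cast; ring⟩

/-- reduction to the unit cube -/
lemma exists_cube (x : E16) : ∃ l, x + iv l ∈ Set.Icc (0 : E16) 1 := by
  refine ⟨fun p => - ⌊x p⌋, ?_, ?_⟩ <;> intro p <;> simp only [iv, Pi.add_apply, Pi.zero_apply, Pi.one_apply]
  · have := Int.floor_le (x p); push_cast; linarith
  · have := Int.lt_floor_add_one (x p); push_cast; linarith

lemma tau_closed {A : Set E16} (hA : IsClosed A) (hp : PerS A) : IsClosed (tau '' A) := by
  have : tau '' A = tau '' (A ∩ Set.Icc 0 1) := by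
    ext z; constructor
    · rintro ⟨x, hx, rfl⟩
      obtain ⟨l, hl⟩ := exists_cube x
      exact ⟨_, ⟨hp x hx l, hl⟩, tau_per x l⟩
    · rintro ⟨x, hx, rfl⟩
      exact ⟨x, hx.1, rfl⟩
  rw [this]
  exact ((isCompact_Icc.inter_left hA).image tau_cd.continuous).isClosed

open scoped Manifold in
theorem urysohn {A B : Set E16} (hA : IsClosed A) (hB : IsClosed B) (pA : PerS A) (pB : PerS B)
    (hd : Disjoint A B) : ∃ χ : Sm, Per χ ∧ χ - 1 ∈ Nl A ∧ χ ∈ Nl B := by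
  have hd' : Disjoint (tau '' B) (tau '' A) := by
    rw [Set.disjoint_left]
    rintro _ ⟨x, hx, rfl⟩ ⟨y, hy, h⟩
    obtain ⟨l, rfl⟩ := tau_eq h
    exact Set.disjoint_left.1 hd ((pA.mem_iff _ _).2 hy) hx
  obtain ⟨f, hf0, hf1, -⟩ := exists_contMDiffMap_zero_one_nhds_of_isClosed (n := ⊤) 𝓘(ℝ, Fin 16 → ℂ) (tau_closed hB pB) (tau_closed hA pA) hd'
  have hf := f.contMDiff.contDiff
  have hχ : ContDiff ℝ ∞ (fun x : E16 => ((f (tau x) : ℝ) : ℂ)) :=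
    Complex.ofRealCLM.contDiff.comp (hf.comp tau_cd)
  refine ⟨⟨_, hχ⟩, ?_, ?_, ?_⟩
  · intro l x
    change ((f (tau (x + iv l)) : ℝ) : ℂ) = ((f (tau x) : ℝ) : ℂ)
    rw [tau_per]
  · rw [mem_Nl']
    intro x hx
    rw [eventually_nhdsSet_iff_forall] at hf1
    have := tau_cd.continuous.continuousAt.eventually (hf1 _ (mem_image_of_mem _ hx))
    filter_upwards [this] with y hy
    rw [Sm.sub_apply, Sm.one_apply]
    change ((f (tau y) : ℝ) : ℂ) - 1 = 0
    rw [hy]; simp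
  · rw [mem_Nl']
    intro x hx
    rw [eventually_nhdsSet_iff_forall] at hf0
    have := tau_cd.continuous.continuousAt.eventually (hf0 _ (mem_image_of_mem _ hx))
    filter_upwards [this] with y hy
    change ((f (tau y) : ℝ) : ℂ) = 0
    rw [hy]; simp
end OK

namespace OK
open Finset MvPolynomial
open scoped ContDiff Topology
open MeasureTheory Set

lemma Nl_pt {X : Set E16} {f : Sm} : f ∈ Nl X ↔ ∀ x ∈ X, f ∈ Nl {x} := by
  simp only [mem_Nl', mem_singleton_iff, forall_eq]

/-- periodic slab -/
def slab (n : Fin 16 → ℤ) (a b : ℝ) : Set E16 := {x | ∃ k : ℤ, a ≤ iv n ⬝ᵥ x - k ∧ iv n ⬝ᵥ x - k ≤ b}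

lemma cont_dot (v : E16) : Continuous fun x : E16 => v ⬝ᵥ x := by
  unfold dotProduct; fun_prop

lemma slab_closed (n : Fin 16 → ℤ) (a b : ℝ) : IsClosed (slab n a b) := by
  have hc : Continuous (fun t : ℝ => (t : UnitAddCircle)) := AddCircle.continuous_mk' 1
  have : slab n a b = (fun x : E16 => ((iv n ⬝ᵥ x : ℝ) : UnitAddCircle)) ⁻¹' ((fun t : ℝ => (t : UnitAddCircle)) '' Set.Icc a b) := by
    ext x
    constructor
    · rintro ⟨k, h1, h2⟩
      refine ⟨iv n ⬝ᵥ x - k, ⟨h1, h2⟩, ?_⟩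
      simp only [AddCircle.coe_sub, sub_eq_self]
      rw [AddCircle.coe_eq_zero_iff]
      exact ⟨k, by simp⟩
    · rintro ⟨t, ⟨h1, h2⟩, h⟩
      have h : ((t : ℝ) : UnitAddCircle) = ((iv n ⬝ᵥ x : ℝ) : UnitAddCircle) := h
      rw [← sub_eq_zero, ← AddCircle.coe_sub, AddCircle.coe_eq_zero_iff] at h
      obtain ⟨k, hk⟩ := h
      have hk : (k : ℝ) = t - iv n ⬝ᵥ x := by simpa using hk
      refine ⟨-k, ?_, ?_⟩ <;> push_cast <;> linarith
  rw [this]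
  exact ((isCompact_Icc.image hc).isClosed).preimage (hc.comp (cont_dot _))

lemma slab_per (n : Fin 16 → ℤ) (a b : ℝ) : PerS (slab n a b) := by
  rintro x ⟨k, h1, h2⟩ l
  have e : iv n ⬝ᵥ (x + iv l) = iv n ⬝ᵥ x + (dpz n l : ℤ) := by
    rw [dotProduct_add]; congr 1
    simp [dotProduct, iv, dpz]
  refine ⟨k + dpz n l, ?_, ?_⟩ <;> rw [e] <;> push_cast <;> linarith

/-- the cell -/
def cell {ι : Type*} (n : ι → Fin 16 → ℤ) (I : Finset ι) (c : ι → ℝ) (J : Finset ι) (a b : ι → ℝ) : Set E16 :=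
  {x | (∀ i ∈ I, x ∈ slab (n i) (c i) (c i)) ∧ ∀ j ∈ J, x ∈ slab (n j) (a j) (b j)}

section
variable {ι : Type*} {n : ι → Fin 16 → ℤ} {I J : Finset ι} {c a b : ι → ℝ}

lemma cell_closed : IsClosed (cell n I c J a b) := by
  have : cell n I c J a b = (⋂ i ∈ I, slab (n i) (c i) (c i)) ∩ ⋂ j ∈ J, slab (n j) (a j) (b j) := by
    ext x; simp [cell]
  rw [this]
  exact (isClosed_biInter fun i _ => slab_closed _ _ _).inter (isClosed_biInter fun i _ => slab_closed _ _ _)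

lemma cell_per : PerS (cell n I c J a b) := fun x hx l =>
  ⟨fun i hi => slab_per _ _ _ x (hx.1 i hi) l, fun i hi => slab_per _ _ _ x (hx.2 i hi) l⟩
end

/-- solvability near X -/
def Exs (θ : E16) (X : Set E16) : Prop :=
  ∀ T : Fin 10 → Sm, (∀ a, T a ∈ QP θ) → Clo X T → ∃ u ∈ QP θ, Sol X T u

lemma Ex_ROp {θ : E16} {A : Fin 10 → PR ℝ} {V X : Set E16} (R : ROp θ (∑ a, A a * Q ℝ a) V)
    (hX : ∀ x ∈ X, ∀ v ∈ V, x + v ∈ X) : Exs θ X := by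
  intro T hT hc
  refine ⟨R.R (∑ a, op (A a) (T a)), R.qp _ (Submodule.sum_mem _ fun a _ => QP_op _ (hT a)), fun b => ?_⟩
  have h1 : R.R (op (∑ a, A a * Q ℝ a) (T b)) = T b := R.inv _ (hT b)
  have h2 : op (Q ℝ b) (R.R (∑ a, op (A a) (T a))) - T b
      = R.R (∑ a, op (A a) (op (Q ℝ b) (T a) - op (Q ℝ a) (T b))) := by
    rw [← R.comm, map_sum]
    nth_rewrite 1 [← h1]
    rw [← map_sub, op_sum, ← Finset.sum_sub_distrib]
    congr 1
    refine Finset.sum_congr rfl fun a _ => ?_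
    rw [op_mul, map_sub, ← op_mul, ← op_mul, ← op_mul, mul_comm]
  rw [h2]
  exact R.loc X hX _ (Submodule.sum_mem _ fun a _ => Nl_op _ (hc.koszul b a))

set_option maxHeartbeats 1600000 in
/-- gluing step -/
lemma Ex_step {θ : E16} {n : Fin 16 → ℤ} {a b : ℝ} (hab : a < b) (hab1 : b - a < 1) {Y : Set E16}
    (hY : IsClosed Y) (pY : PerS Y) (hE : Exs θ Y) (hEa : Exs θ (Y ∩ slab n a a)) (hEb : Exs θ (Y ∩ slab n b b)) :
    Exs θ (Y ∩ slab n a b) := by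
  intro T hT hc
  have sa : slab n a a ⊆ slab n a b := fun x ⟨k, h1, h2⟩ => ⟨k, h1, h2.trans hab.le⟩
  have sb : slab n b b ⊆ slab n a b := fun x ⟨k, h1, h2⟩ => ⟨k, hab.le.trans h1, h2⟩
  obtain ⟨wa, qa, hwa⟩ := hEa T hT (hc.mono (inter_subset_inter_right _ sa))
  obtain ⟨wb, qb, hwb⟩ := hEb T hT (hc.mono (inter_subset_inter_right _ sb))
  have pab : ∀ a b, PerS (Y ∩ slab n a b) := fun a b x hx l => ⟨pY x hx.1 l, slab_per _ _ _ x hx.2 l⟩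
  have hdis : Disjoint (Y ∩ slab n a a) (Y ∩ slab n b b) := by
    rw [Set.disjoint_left]
    rintro x ⟨-, k, h1, h2⟩ ⟨-, l, h3, h4⟩
    have e : b - a = ((k - l : ℤ) : ℝ) := by push_cast; linarith
    have h5 : (0:ℝ) < ((k - l : ℤ) : ℝ) := by rw [← e]; linarith
    have h6 : ((k - l : ℤ) : ℝ) < 1 := by rw [← e]; linarith
    have h7 : 0 < k - l := by exact_mod_cast h5
    have h8 : k - l < 1 := by exact_mod_cast h6
    omega
  obtain ⟨χ, pχ, hχa, hχb⟩ := urysohn (hY.inter (slab_closed n a a)) (hY.inter (slab_closed n b b)) (pab _ _) (pab _ _) hdis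
  have pχ' : Per (1 - χ) := fun l x => by rw [Sm.sub_apply, Sm.sub_apply, pχ]; rfl
  obtain ⟨w, hw⟩ : ∃ w, w = χ * wa + (1 - χ) * wb := ⟨_, rfl⟩
  have qw : w ∈ QP θ := by
    rw [hw]; exact Submodule.add_mem _ (QP_mul pχ qa) (QP_mul pχ' qb)
  obtain ⟨T', hT'⟩ : ∃ T' : Fin 10 → Sm, T' = fun a => T a - op (Q ℝ a) w := ⟨_, rfl⟩
  have qT' : ∀ a, T' a ∈ QP θ := fun a => by rw [hT']; exact Submodule.sub_mem _ (hT a) (QP_op _ qw)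
  have cT' : Clo (Y ∩ slab n a b) T' := by rw [hT']; exact hc.sub (Clo.D0 _ _)
  have h1 : ∀ i, T' i ∈ Nl (Y ∩ slab n a a) := by
    intro i
    have e1 : w - wa ∈ Nl (Y ∩ slab n a a) := by
      have : w - wa = wa * (χ - 1) - wb * (χ - 1) := by rw [hw]; ring
      rw [this]
      exact Submodule.sub_mem _ (Nl_mul _ hχa) (Nl_mul _ hχa)
    have e2 : T' i = - (op (Q ℝ i) wa - T i) - op (Q ℝ i) (w - wa) := by
      rw [hT', map_sub]; dsimp only; abel
    rw [e2]
    exact Submodule.sub_mem _ (Submodule.neg_mem _ (hwa i)) (Nl_op _ e1)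
  have h2 : ∀ i, T' i ∈ Nl (Y ∩ slab n b b) := by
    intro i
    have e1 : w - wb ∈ Nl (Y ∩ slab n b b) := by
      have : w - wb = wa * χ - wb * χ := by rw [hw]; ring
      rw [this]
      exact Submodule.sub_mem _ (Nl_mul _ hχb) (Nl_mul _ hχb)
    have e2 : T' i = - (op (Q ℝ i) wb - T i) - op (Q ℝ i) (w - wb) := by
      rw [hT', map_sub]; dsimp only; abel
    rw [e2]
    exact Submodule.sub_mem _ (Submodule.neg_mem _ (hwb i)) (Nl_op _ e1)
  let N : Set E16 := {x | ∀ i, T' i ∈ Nl {x}}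
  have hN : IsOpen N := by
    have : N = ⋂ i, {x | ∀ᶠ y in 𝓝 x, T' i y = 0} := by
      ext x
      simp only [N, mem_Nl', mem_singleton_iff, forall_eq, mem_setOf_eq, mem_iInter]
    rw [this]
    exact isOpen_iInter_of_finite fun i => isOpen_setOf_eventually_nhds
  have pN : PerS N := by
    intro x hx l i
    have hx := hx i
    rw [mem_Nl'] at hx ⊢
    simp only [mem_singleton_iff, forall_eq] at hx ⊢
    have ht : Filter.Tendsto (fun y : E16 => y + iv (-l)) (𝓝 (x + iv l)) (𝓝 x) := by
      have e : x = x + iv l + iv (-l) := by ext p; simp [iv]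
      nth_rewrite 2 [e]
      exact (continuous_add_const (iv (-l))).tendsto _
    filter_upwards [ht.eventually hx] with y hy
    have := (mem_QP.1 (qT' i)) l (y + iv (-l))
    have e : y + iv (-l) + iv l = y := by ext p; simp [iv]
    rw [e, hy, mul_zero] at this
    exact this
  have pNc : PerS Nᶜ := fun x hx l h => hx ((pN.mem_iff x l).1 h)
  have pSc : PerS (closure (slab n a b)ᶜ) := by
    intro x hx l
    have : MapsTo (fun y : E16 => y + iv l) ((slab n a b)ᶜ) ((slab n a b)ᶜ) :=
      fun y hy h => hy (((slab_per n a b).mem_iff y l).1 h)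
    exact map_mem_closure (f := fun y : E16 => y + iv l) (by fun_prop) hx this
  have hd : Disjoint ((Y ∩ slab n a b) ∩ Nᶜ) ((Y ∩ closure (slab n a b)ᶜ) ∩ Nᶜ) := by
    rw [Set.disjoint_left]
    rintro x ⟨⟨hxY, k, h3, h4⟩, hxN⟩ ⟨⟨-, hx⟩, -⟩
    have hxN' : ¬ (x ∈ Y ∩ slab n a a) ∧ ¬ (x ∈ Y ∩ slab n b b) :=
      ⟨fun h => hxN fun i => Nl_pt.1 (h1 i) x h, fun h => hxN fun i => Nl_pt.1 (h2 i) x h⟩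
    have h5 : a < iv n ⬝ᵥ x - k := lt_of_le_of_ne h3 fun h => hxN'.1 ⟨hxY, k, h.le, h.ge⟩
    have h6 : iv n ⬝ᵥ x - k < b := lt_of_le_of_ne h4 fun h => hxN'.2 ⟨hxY, k, h.ge, h.le⟩
    rw [mem_closure_iff] at hx
    obtain ⟨y, ⟨h7, h8⟩, h9⟩ := hx {y | a < iv n ⬝ᵥ y - k ∧ iv n ⬝ᵥ y - k < b}
      ((isOpen_lt continuous_const ((cont_dot _).sub continuous_const)).inter
        (isOpen_lt ((cont_dot _).sub continuous_const) continuous_const)) ⟨h5, h6⟩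
    exact h9 ⟨k, h7.le, h8.le⟩
  obtain ⟨ψ, pψ, hψ1, hψ0⟩ := urysohn ((hY.inter (slab_closed n a b)).inter hN.isClosed_compl)
    ((hY.inter isClosed_closure).inter hN.isClosed_compl)
    (fun x hx l => ⟨pab _ _ x hx.1 l, pNc x hx.2 l⟩)
    (fun x hx l => ⟨⟨pY x hx.1.1 l, pSc x hx.1.2 l⟩, pNc x hx.2 l⟩) hd
  have hX : ∀ x ∈ Y ∩ slab n a b, ∀ i, T' i - ψ * T' i ∈ Nl {x} := by
    intro x hx i
    have e : T' i - ψ * T' i = - (T' i * (ψ - 1)) := by ring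
    have e' : T' i - ψ * T' i = - ((ψ - 1) * T' i) := by ring
    by_cases hxN : x ∈ N
    · rw [e']; exact Submodule.neg_mem _ (Nl_mul _ (hxN i))
    · rw [e]; exact Submodule.neg_mem _ (Nl_mul _ (Nl_pt.1 hψ1 x ⟨hx, hxN⟩))
  have cψ : Clo Y (fun i => ψ * T' i) := by
    intro i
    rw [Nl_pt]
    intro x hx
    suffices h : Clo {x} (fun i => ψ * T' i) from h i
    by_cases hxS : x ∈ slab n a b
    · exact (cT'.mono (singleton_subset_iff.2 ⟨hx, hxS⟩)).congr (hX x ⟨hx, hxS⟩)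
    · refine Clo.of_Nl fun i => ?_
      by_cases hxN : x ∈ N
      · exact Nl_mul _ (hxN i)
      · rw [mul_comm]
        exact Nl_mul _ (Nl_pt.1 hψ0 x ⟨⟨hx, subset_closure hxS⟩, hxN⟩)
  obtain ⟨v, qv, hv⟩ := hE _ (fun i => QP_mul pψ (qT' i)) cψ
  refine ⟨v + w, Submodule.add_mem _ qv qw, fun i => ?_⟩
  have e : op (Q ℝ i) (v + w) - T i = (op (Q ℝ i) v - ψ * T' i) - (T' i - ψ * T' i) := by
    rw [map_add, hT']; dsimp only; abel
  rw [e]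
  exact Submodule.sub_mem _ (Nl_mono Set.inter_subset_left (hv i)) (Nl_pt.2 fun x hx => hX x hx i)

theorem Ex_cell {ι : Type*} [DecidableEq ι] {θ : E16} (n : ι → Fin 16 → ℤ) (a b : ι → ℝ)
    (hab : ∀ j, a j < b j) (hab1 : ∀ j, b j - a j < 1)
    (hR : ∀ I : Finset ι, I.card ≤ 4 →
      ∃ A : Fin 10 → PR ℝ, Nonempty (ROp θ (∑ a, A a * Q ℝ a) {v | ∀ i ∈ I, iv (n i) ⬝ᵥ v = 0}))
    (hB : ∀ (I : Finset ι) (c : ι → ℝ), I.card = 5 → ∀ X : Set E16, IsClosed X → PerS X →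
      (∀ x ∈ X, ∀ i ∈ I, x ∈ slab (n i) (c i) (c i)) → Exs θ X) (J : Finset ι) :
    ∀ (I : Finset ι) (c : ι → ℝ), I.card ≤ 5 → Disjoint I J → Exs θ (cell n I c J a b) := by
  induction J using Finset.induction_on with
  | empty =>
    intro I c hI _
    rcases hI.lt_or_eq with h | h
    · obtain ⟨A, ⟨R⟩⟩ := hR I (by omega)
      refine Ex_ROp R ?_
      intro x hx v hv
      refine ⟨fun i hi => ?_, fun j hj => by simp at hj⟩
      obtain ⟨k, h1, h2⟩ := hx.1 i hi
      have e : iv (n i) ⬝ᵥ (x + v) = iv (n i) ⬝ᵥ x := by rw [dotProduct_add, hv i hi, add_zero]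
      exact ⟨k, by rwa [e], by rwa [e]⟩
    · exact hB I c h _ cell_closed cell_per fun x hx => hx.1
  | insert j J hj ih =>
    intro I c hI hd
    rw [Finset.disjoint_insert_right] at hd
    rcases hI.lt_or_eq with h | h
    · have e1 : cell n I c (insert j J) a b = cell n I c J a b ∩ slab (n j) (a j) (b j) := by
        ext x; simp only [cell, Finset.forall_mem_insert, mem_setOf_eq, mem_inter_iff]; tauto
      have e2 : ∀ t, cell n I c J a b ∩ slab (n j) t t = cell n (insert j I) (Function.update c j t) J a b := by
        intro t
        ext x
        simp only [cell, Finset.forall_mem_insert, mem_setOf_eq, mem_inter_iff, Function.update_self]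
        have : ∀ i ∈ I, Function.update c j t i = c i := fun i hi =>
          Function.update_of_ne (by rintro rfl; exact hd.1 hi) _ _
        constructor
        · rintro ⟨⟨h1, h2⟩, h3⟩
          exact ⟨⟨h3, fun i hi => by rw [this i hi]; exact h1 i hi⟩, h2⟩
        · rintro ⟨⟨h3, h1⟩, h2⟩
          exact ⟨⟨fun i hi => by have := this i hi; rw [← this]; exact h1 i hi, h2⟩, h3⟩
      rw [e1]
      have hE : ∀ t, Exs θ (cell n I c J a b ∩ slab (n j) t t) := by
        intro t
        rw [e2]
        refine ih _ _ ?_ ?_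
        · exact (Finset.card_insert_le _ _).trans (by omega)
        · rw [Finset.disjoint_insert_left]; exact ⟨hj, hd.2⟩
      exact Ex_step (hab j) (hab1 j) cell_closed cell_per (ih I c hI hd.2) (hE _) (hE _)
    · exact hB I c h _ cell_closed cell_per fun x hx => hx.1
end OK

namespace OK
open Finset MvPolynomial
open scoped ContDiff Topology
open MeasureTheory Set

/-- Euclidean square -/
def esq (y : E16) : ℝ := ∑ p, y p ^ 2

lemma esq_cd : ContDiff ℝ ∞ esq := by
  unfold esq
  exact ContDiff.sum fun p _ => (contDiff_apply ℝ ℝ p).pow 2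

lemma esq_gt {y : E16} (h : 1 < ‖y‖) : 1 < esq y := by
  by_contra hc
  push Not at hc
  refine absurd h (not_lt.2 ?_)
  rw [pi_norm_le_iff_of_nonneg zero_le_one]
  intro p
  rw [Real.norm_eq_abs, abs_le_one_iff_mul_self_le_one, ← pow_two]
  exact (Finset.single_le_sum (f := fun p => y p ^ 2) (fun p _ => sq_nonneg _) (mem_univ p)).trans hc

lemma moll : ∃ ρ τ : Sm, (∀ y, 1 < ‖y‖ → ρ y = 0) ∧ (∀ y, 1 < ‖y‖ → τ y = 0) ∧
    (∀ p y, dd (Pi.single p 1) τ y = (y p : ℂ) * ρ y) ∧ ∫ y, ρ y ≠ 0 := by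
  have hst : ContDiff ℝ ∞ Real.smoothTransition := Real.smoothTransition.contDiff
  have hst' : ContDiff ℝ ∞ (deriv Real.smoothTransition) := by
    have := (contDiff_infty_iff_deriv.1 hst).2
    exact this
  have h1 : ContDiff ℝ ∞ (fun y : E16 => 1 - esq y) := contDiff_const.sub esq_cd
  have hρ : ContDiff ℝ ∞ (fun y : E16 => ((deriv Real.smoothTransition (1 - esq y) : ℝ) : ℂ)) :=
    Complex.ofRealCLM.contDiff.comp (hst'.comp h1)
  have hτ : ContDiff ℝ ∞ (fun y : E16 => ((-(1/2) * Real.smoothTransition (1 - esq y) : ℝ) : ℂ)) :=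
    Complex.ofRealCLM.contDiff.comp (contDiff_const.mul (hst.comp h1))
  have hz : ∀ s < 0, deriv Real.smoothTransition s = 0 := by
    intro s hs
    have : Real.smoothTransition =ᶠ[𝓝 s] fun _ => 0 := by
      filter_upwards [gt_mem_nhds hs] with t ht
      exact Real.smoothTransition.zero_of_nonpos ht.le
    rw [this.deriv_eq]; simp
  have hρ0 : ∀ y : E16, 1 < ‖y‖ → deriv Real.smoothTransition (1 - esq y) = 0 := fun y hy =>
    hz _ (by have := esq_gt hy; linarith)
  refine ⟨⟨_, hρ⟩, ⟨_, hτ⟩, ?_, ?_, ?_, ?_⟩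
  · intro y hy
    change ((deriv Real.smoothTransition (1 - esq y) : ℝ) : ℂ) = 0
    rw [hρ0 y hy]; simp
  · intro y hy
    change ((-(1/2) * Real.smoothTransition (1 - esq y) : ℝ) : ℂ) = 0
    rw [Real.smoothTransition.zero_of_nonpos (by have := esq_gt hy; linarith)]; simp
  · intro p y
    change fderiv ℝ (fun y : E16 => ((-(1/2) * Real.smoothTransition (1 - esq y) : ℝ) : ℂ)) y (Pi.single p 1) = (y p : ℂ) * ((deriv Real.smoothTransition (1 - esq y) : ℝ) : ℂ)
    have hd : HasFDerivAt esq (∑ q, (2 * y q) • ContinuousLinearMap.proj (R := ℝ) (φ := fun _ : Fin 16 => ℝ) q) y := by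
      unfold esq
      refine HasFDerivAt.fun_sum fun q _ => ?_
      have := (hasFDerivAt_apply (𝕜 := ℝ) (F' := fun _ : Fin 16 => ℝ) q y).pow 2
      simpa using this
    have hd2 := ((hst.differentiable (by simp)) (1 - esq y)).hasDerivAt.comp_hasFDerivAt y (hd.const_sub 1)
    have hd3 := Complex.ofRealCLM.hasFDerivAt.comp y (hd2.const_mul (-(1/2)))
    have e := hd3.fderiv
    have e2 : fderiv ℝ (fun y : E16 => ((-(1/2) * Real.smoothTransition (1 - esq y) : ℝ) : ℂ)) y = _ := e
    rw [e2]
    have e3 : (∑ q, (2 * y q) • ContinuousLinearMap.proj (R := ℝ) (φ := fun _ : Fin 16 => ℝ) q) (Pi.single p 1) = 2 * y p := by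
      rw [ContinuousLinearMap.sum_apply, Finset.sum_eq_single p]
      · simp
      · intro q _ h; simp [Pi.single_apply, h]
      · simp
    simp only [ContinuousLinearMap.comp_apply, ContinuousLinearMap.smul_apply, ContinuousLinearMap.neg_apply, e3,
      Complex.ofRealCLM_apply, smul_eq_mul]
    push_cast; ring
  · change ∫ y : E16, ((deriv Real.smoothTransition (1 - esq y) : ℝ) : ℂ) ≠ 0
    rw [integral_complex_ofReal]
    obtain ⟨s, hs, hs1⟩ := exists_deriv_eq_slope Real.smoothTransition (zero_lt_one)
      hst.continuous.continuousOn (hst.differentiable (by simp)).differentiableOn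
    rw [Real.smoothTransition.one, Real.smoothTransition.zero] at hs1
    have hpos : 0 < ∫ y : E16, deriv Real.smoothTransition (1 - esq y) := by
      refine Continuous.integral_pos_of_hasCompactSupport_nonneg_nonzero (x := Pi.single 0 (Real.sqrt (1 - s)))
        (hst'.comp h1).continuous ?_ ?_ ?_
      · refine HasCompactSupport.intro (isCompact_closedBall (0 : E16) 1) fun y hy => hρ0 y ?_
        simpa using hy
      · intro y; exact Real.smoothTransition.monotone.deriv_nonneg
      · have : esq (Pi.single 0 (Real.sqrt (1 - s))) = 1 - s := by
          rw [esq, Finset.sum_eq_single 0]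
          · simp [Real.sq_sqrt (sub_nonneg.2 hs.2.le)]
          · intro q _ h; simp [Pi.single_apply, h]
          · simp
        rw [this, sub_sub_cancel, hs1]; simp
    exact_mod_cast hpos.ne'

/-- affine pullback -/
def af (x : E16) (t : ℝ) (f : Sm) : Sm := ⟨fun y => f (x + t • y),
  (cdS f).comp (by fun_prop : ContDiff ℝ ∞ fun y : E16 => x + t • y)⟩

lemma af_apply (x : E16) (t : ℝ) (f : Sm) (y : E16) : af x t f y = f (x + t • y) := rfl

lemma dd_af (x : E16) (t : ℝ) (f : Sm) (v : E16) : dd v (af x t f) = t • af x t (dd v f) := by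
  apply Sm.ext; intro y
  rw [Sm.rsmul_apply, af_apply, dd_apply, dd_apply]
  have h1 : HasFDerivAt (fun y : E16 => x + t • y) (t • ContinuousLinearMap.id ℝ E16) y :=
    ((hasFDerivAt_id y).const_smul t).const_add x
  have h2 := ((diffS f) (x + t • y)).hasFDerivAt.comp y h1
  have e : fderiv ℝ (af x t f) y = _ := h2.fderiv
  rw [e]
  simp

lemma cs_of {ρ : Sm} (h : ∀ y, 1 < ‖y‖ → ρ y = 0) : HasCompactSupport ρ :=
  HasCompactSupport.intro (isCompact_closedBall (0 : E16) 1) fun y hy => h y (by simpa using hy)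

lemma dd_cs {ρ : Sm} (h : ∀ y, 1 < ‖y‖ → ρ y = 0) (v : E16) : ∀ y, 1 < ‖y‖ → dd v ρ y = 0 := by
  intro y hy
  rw [dd_apply]
  have : (ρ : E16 → ℂ) =ᶠ[𝓝 y] fun _ => 0 := by
    filter_upwards [(isOpen_lt continuous_const continuous_norm).mem_nhds hy] with z hz
    exact h z hz
  rw [this.fderiv_eq]; simp

lemma int_S {ρ : Sm} (h : ∀ y, 1 < ‖y‖ → ρ y = 0) (g : Sm) : Integrable fun y => ρ y * g y :=
  ((contS ρ).mul (contS g)).integrable_of_hasCompactSupport (cs_of h).mul_right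

lemma ibp {ρ : Sm} (h : ∀ y, 1 < ‖y‖ → ρ y = 0) (g : Sm) (v : E16) :
    ∫ y, dd v ρ y * g y = - ∫ y, ρ y * dd v g y := by
  rw [eq_neg_iff_add_eq_zero, add_comm, ← eq_neg_iff_add_eq_zero]
  exact integral_mul_fderiv_eq_neg_fderiv_mul_of_integrable (μ := volume) (𝕜 := ℂ) (int_S (dd_cs h v) g) (int_S h (dd v g)) (int_S h g)
    (fun x _ => diffS ρ x) (fun x _ => diffS g x)

lemma fderiv_sum (f : Sm) (x y : E16) : fderiv ℝ f x y = ∑ p, (y p : ℂ) * dd (Pi.single p 1) f x := by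
  rw [(hasFDerivAt_S f x).fderiv, gr_apply]

lemma opQ0 (f : Sm) (x : E16) : op (Q ℝ 0) f x = ∑ p, dd (Pi.single p 1) (dd (Pi.single p 1) f) x := by
  have : Q ℝ 0 = ∑ p, X p * X p := by
    simp only [Q, ph, dt, gm_zero]
  rw [this, op_sum, Sm.sum_apply]
  refine Finset.sum_congr rfl fun p _ => ?_
  rw [op_mul, op_X]

/-- mean value property -/
lemma mvp {ρ τ : Sm} (hρ : ∀ y, 1 < ‖y‖ → ρ y = 0) (hτ : ∀ y, 1 < ‖y‖ → τ y = 0)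
    (hd : ∀ p y, dd (Pi.single p 1) τ y = (y p : ℂ) * ρ y) (f : Sm) (x : E16) (r : ℝ)
    (hf : ∀ y, ‖y - x‖ ≤ |r| → op (Q ℝ 0) f y = 0) :
    ∫ y, ρ y * f (x + r • y) = (∫ y, ρ y) * f x := by
  have hder : ∀ t : ℝ, HasDerivAt (fun t : ℝ => ∫ y, ρ y * f (x + t • y)) (∫ y, ρ y * fderiv ℝ f (x + t • y) y) t := by
    intro t
    have hcF : Continuous fun z : ℝ × E16 => ρ z.2 * fderiv ℝ f (x + z.1 • z.2) z.2 := by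
      have e : (fun z : ℝ × E16 => ρ z.2 * fderiv ℝ f (x + z.1 • z.2) z.2) = fun z : ℝ × E16 => ρ z.2 * ∑ p, (z.2 p : ℂ) * dd (Pi.single p 1) f (x + z.1 • z.2) := by
        ext z; rw [fderiv_sum]
      rw [e]
      have h1 := contS ρ
      have h2 : ∀ p, Continuous (dd (Pi.single p 1) f) := fun p => contS _
      have h3 : Continuous fun z : ℝ × E16 => x + z.1 • z.2 := by fun_prop
      refine (h1.comp continuous_snd).mul (continuous_finset_sum _ fun p _ => ?_)
      refine Continuous.mul ?_ ((h2 p).comp h3)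
      exact Complex.continuous_ofReal.comp ((continuous_apply p).comp continuous_snd)
    obtain ⟨B, hB⟩ := (isCompact_closedBall t (1:ℝ)).prod (isCompact_closedBall (0 : E16) 1) |>.exists_bound_of_continuousOn hcF.continuousOn
    have hBi : Integrable (fun y : E16 => (Metric.closedBall (0 : E16) 1).indicator (fun _ => B) y) :=
      (integrable_indicator_iff measurableSet_closedBall).2 (integrableOn_const (by exact (isCompact_closedBall (0 : E16) 1).measure_lt_top.ne))
    refine (hasDerivAt_integral_of_dominated_loc_of_deriv_le (s := Metric.closedBall t 1) (Metric.closedBall_mem_nhds t one_pos) (F := fun t y => ρ y * f (x + t • y))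
      (F' := fun t y => ρ y * fderiv ℝ f (x + t • y) y)
      (Filter.Eventually.of_forall fun s => (int_S hρ (af x s f)).aestronglyMeasurable) (int_S hρ (af x t f)) ?_ ?_ hBi ?_).2
    · exact (hcF.comp (continuous_const.prodMk continuous_id)).aestronglyMeasurable
    · refine Filter.Eventually.of_forall fun y s hs => ?_
      by_cases hy : y ∈ Metric.closedBall (0 : E16) 1
      · rw [indicator_of_mem hy]
        exact hB (s, y) ⟨hs, hy⟩
      · rw [indicator_of_notMem hy, hρ y (by simpa using hy)]; simp
    · refine Filter.Eventually.of_forall fun y s _ => ?_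
      have h1 : HasDerivAt (fun s : ℝ => x + s • y) y s := by
        simpa using ((hasDerivAt_id s).smul_const y).const_add x
      have h2 := ((diffS f) (x + s • y)).hasFDerivAt.comp_hasDerivAt s h1
      exact h2.const_mul (ρ y)
  have hz : ∀ t ∈ Set.uIcc 0 r, ∫ y, ρ y * fderiv ℝ f (x + t • y) y = 0 := by
    intro t ht
    have ht' : |t| ≤ |r| := by
      have := abs_sub_left_of_mem_uIcc ht
      simpa using this
    have e1 : ∀ y, ρ y * fderiv ℝ f (x + t • y) y = ∑ p, dd (Pi.single p 1) τ y * af x t (dd (Pi.single p 1) f) y := by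
      intro y
      rw [fderiv_sum, Finset.mul_sum]
      refine Finset.sum_congr rfl fun p _ => ?_
      rw [hd, af_apply]; ring
    simp only [e1]
    rw [integral_finset_sum _ fun p _ => int_S (dd_cs hτ _) _]
    simp only [ibp hτ, dd_af]
    rw [Finset.sum_neg_distrib, ← integral_finset_sum _ fun p _ => int_S hτ _]
    rw [neg_eq_zero, ← integral_zero E16 ℂ]
    congr 1
    ext y
    by_cases hy : 1 < ‖y‖
    · simp [hτ y hy]
    · rw [← Finset.mul_sum]
      have : ∑ p, (t • af x t (dd (Pi.single p 1) (dd (Pi.single p 1) f))) y = t * op (Q ℝ 0) f (x + t • y) := by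
        rw [opQ0, Finset.mul_sum]
        refine Finset.sum_congr rfl fun p _ => ?_
        rw [Sm.rsmul_apply, af_apply]
      rw [this, hf, mul_zero, mul_zero]
      rw [add_sub_cancel_left, norm_smul, Real.norm_eq_abs]
      push Not at hy
      calc |t| * ‖y‖ ≤ |t| * 1 := by gcongr
        _ ≤ |r| := by linarith
  have hc : (∫ y, ρ y * f (x + r • y)) = ∫ y, ρ y * f (x + (0:ℝ) • y) := by
    have := intervalIntegral.integral_eq_sub_of_hasDerivAt (a := 0) (b := r) (f := fun t : ℝ => ∫ y, ρ y * f (x + t • y))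
      (f' := fun t : ℝ => ∫ y, ρ y * fderiv ℝ f (x + t • y) y) (fun t _ => hder t) ?_
    · rw [intervalIntegral.integral_congr (g := fun _ => (0:ℂ)) hz, intervalIntegral.integral_zero] at this
      exact (sub_eq_zero.1 this.symm)
    · refine (intervalIntegrable_const (c := (0:ℂ))).congr ?_
      intro t ht
      exact (hz t (Set.uIoc_subset_uIcc ht)).symm
  rw [hc]
  simp only [zero_smul, add_zero]
  rw [integral_mul_const]

lemma harm_deriv : ∃ C > 0, ∀ (f : Sm) (x : E16) (r M : ℝ), 0 < r → (∀ y ∈ Metric.ball x r, op (Q ℝ 0) f y = 0) →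
    (∀ y ∈ Metric.ball x r, ‖f y‖ ≤ M) → ∀ p, ‖dd (Pi.single p 1) f x‖ ≤ C / r * M := by
  obtain ⟨ρ, τ, hρ, hτ, hd, h0⟩ := moll
  refine ⟨2 * (1 + ∑ p, ∫ y, ‖dd (Pi.single p 1) ρ y‖) / ‖∫ y, ρ y‖, ?_, ?_⟩
  · have := norm_pos_iff.2 h0
    have h2 : 0 ≤ ∑ p, ∫ y, ‖dd (Pi.single p 1) ρ y‖ := Finset.sum_nonneg fun p _ => integral_nonneg fun y => norm_nonneg _
    positivity
  · intro f x r M hr hf hM p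
    have hM0 : 0 ≤ M := (norm_nonneg _).trans (hM x (Metric.mem_ball_self hr))
    have h0' := norm_pos_iff.2 h0
    have hz : ∀ y ∈ Metric.ball x r, op (Q ℝ 0) (dd (Pi.single p 1) f) y = 0 := by
      intro y hy
      rw [← op_X, ← op_mul, mul_comm, op_mul, op_X]
      have : op (Q ℝ 0) f ∈ Nl {y} := by
        rw [mem_Nl']; simp only [mem_singleton_iff, forall_eq]
        filter_upwards [Metric.isOpen_ball.mem_nhds hy] with z hz
        exact hf z hz
      exact Nl_mem (Nl_dd _ _ this) rfl
    have hb : ∀ y : E16, ‖y‖ ≤ 1 → x + (r/2) • y ∈ Metric.ball x r := by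
      intro y hy
      rw [mem_ball_iff_norm, add_sub_cancel_left, norm_smul, Real.norm_eq_abs, abs_of_pos (by positivity)]
      nlinarith
    have h1 := mvp hρ hτ hd (dd (Pi.single p 1) f) x (r/2) (by
      intro y hy
      refine hz y ?_
      rw [mem_ball_iff_norm]
      rw [abs_of_pos (by positivity)] at hy
      linarith)
    have h2 := ibp hρ (af x (r/2) f) (Pi.single p 1)
    have h3 : ∫ y, ρ y * dd (Pi.single p 1) (af x (r/2) f) y = ((r/2 : ℝ):ℂ) * ((∫ y, ρ y) * dd (Pi.single p 1) f x) := by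
      rw [← h1, ← integral_const_mul]
      congr 1; ext y
      rw [dd_af, Sm.rsmul_apply, af_apply]; ring
    rw [h3] at h2
    have h4 : ‖∫ y, dd (Pi.single p 1) ρ y * af x (r/2) f y‖ ≤ (∫ y, ‖dd (Pi.single p 1) ρ y‖) * M := by
      rw [← integral_mul_const]
      refine norm_integral_le_of_norm_le (Integrable.mul_const ?_ _) (Filter.Eventually.of_forall fun y => ?_)
      · exact ((contS _).integrable_of_hasCompactSupport (cs_of (dd_cs hρ (Pi.single p 1)))).norm
      · rw [norm_mul]
        by_cases hy : 1 < ‖y‖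
        · rw [dd_cs hρ _ y hy]; simp
        · push Not at hy
          gcongr
          exact hM _ (hb y hy)
    rw [h2, norm_neg, norm_mul, norm_mul, Complex.norm_real, Real.norm_eq_abs, abs_of_pos (by positivity : 0 < r/2)] at h4
    have h5 : (∫ y, ‖dd (Pi.single p 1) ρ y‖) ≤ 1 + ∑ p, ∫ y, ‖dd (Pi.single p 1) ρ y‖ := by
      have := Finset.single_le_sum (f := fun p => ∫ y, ‖dd (Pi.single p 1) ρ y‖) (fun p _ => integral_nonneg fun y => norm_nonneg _) (mem_univ p)
      linarith
    rw [div_div, div_mul_eq_mul_div, le_div_iff₀ (by positivity)]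
    have h6 := h4.trans (mul_le_mul_of_nonneg_right h5 hM0)
    linarith
end OK

namespace OK
open Finset MvPolynomial
open scoped ContDiff Topology
open MeasureTheory Set

/-- coefficient norm -/
def l1 (P : PR ℝ) : ℝ := ∑ m ∈ P.support, |P.coeff m|

lemma l1_eq {P : PR ℝ} {s : Finset (Fin 16 →₀ ℕ)} (h : P.support ⊆ s) : l1 P = ∑ m ∈ s, |P.coeff m| := by
  refine Finset.sum_subset h fun m _ hm => ?_
  rw [notMem_support_iff.1 hm, abs_zero]

lemma l1_nonneg (P : PR ℝ) : 0 ≤ l1 P := Finset.sum_nonneg fun _ _ => abs_nonneg _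

lemma l1_add (P R : PR ℝ) : l1 (P + R) ≤ l1 P + l1 R := by
  classical
  rw [l1_eq (support_add (p := P) (q := R)), l1_eq (s := P.support ∪ R.support) Finset.subset_union_left, l1_eq (s := P.support ∪ R.support) Finset.subset_union_right,
    ← Finset.sum_add_distrib]
  refine Finset.sum_le_sum fun m _ => ?_
  rw [coeff_add]; exact abs_add_le _ _

lemma l1_zero : l1 0 = 0 := by simp [l1]

lemma l1_sum {ι : Type*} (s : Finset ι) (f : ι → PR ℝ) : l1 (∑ i ∈ s, f i) ≤ ∑ i ∈ s, l1 (f i) := by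
  classical
  induction s using Finset.induction_on with
  | empty => simp [l1_zero]
  | insert i s hi ih =>
    rw [Finset.sum_insert hi, Finset.sum_insert hi]
    exact (l1_add _ _).trans (by gcongr)

lemma l1_monomial (m : Fin 16 →₀ ℕ) (c : ℝ) : l1 (monomial m c) ≤ |c| := by
  classical
  rw [l1_eq (s := {m}) support_monomial_subset]
  simp

lemma l1_mul (P R : PR ℝ) : l1 (P * R) ≤ l1 P * l1 R := by
  have e : P * R = ∑ m ∈ P.support, ∑ k ∈ R.support, monomial (m + k) (P.coeff m * R.coeff k) := by
    conv_lhs => rw [P.as_sum, R.as_sum]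
    rw [Finset.sum_mul_sum]
    refine Finset.sum_congr rfl fun m _ => Finset.sum_congr rfl fun k _ => ?_
    rw [monomial_mul]
  rw [e]
  refine (l1_sum _ _).trans ?_
  rw [l1, l1, Finset.sum_mul_sum]
  refine Finset.sum_le_sum fun m _ => (l1_sum _ _).trans (Finset.sum_le_sum fun k _ => ?_)
  exact (l1_monomial _ _).trans (abs_mul _ _).le

lemma l1_C (c : ℝ) : l1 (C c) ≤ |c| := l1_monomial _ _
lemma l1_X (p : Fin 16) : l1 (X p) ≤ 1 := by
  have := l1_monomial (Finsupp.single p 1) 1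
  rwa [abs_one] at this

lemma l1_one : l1 1 ≤ 1 := by
  have := l1_monomial 0 1
  rwa [abs_one] at this

lemma l1_pow (P : PR ℝ) (n : ℕ) : l1 (P ^ n) ≤ l1 P ^ n := by
  induction n with
  | zero => simpa using l1_one
  | succ n ih =>
    rw [pow_succ, pow_succ]
    exact (l1_mul _ _).trans (mul_le_mul_of_nonneg_right ih (l1_nonneg _))

lemma l1_lin (v : E16) : l1 (lin v) ≤ 16 * ‖v‖ := by
  rw [lin]
  refine (l1_sum _ _).trans ?_
  calc ∑ p, l1 (C (v p) * X p) ≤ ∑ p : Fin 16, ‖v‖ := by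
        refine Finset.sum_le_sum fun p _ => (l1_mul _ _).trans ?_
        calc l1 (C (v p)) * l1 (X p) ≤ |v p| * 1 :=
              mul_le_mul (l1_C _) (l1_X _) (l1_nonneg _) (abs_nonneg _)
          _ ≤ ‖v‖ := by rw [mul_one]; exact norm_le_pi_norm v p
    _ = 16 * ‖v‖ := by simp

lemma op_bound_of_monomial (f : Sm) (x : E16) (d : ℕ) (K : ℝ)
    (h : ∀ s : Multiset (Fin 16), s.card ≤ d → ‖op ((s.map X).prod) f x‖ ≤ K) (D : PR ℝ) (hD : D.totalDegree ≤ d) :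
    ‖op D f x‖ ≤ l1 D * K := by
  have e : op D f x = ∑ m ∈ D.support, ((D.coeff m : ℝ) : ℂ) * op ((m.toMultiset.map X).prod) f x := by
    conv_lhs => rw [D.as_sum]
    rw [op_sum, Sm.sum_apply]
    refine Finset.sum_congr rfl fun m _ => ?_
    have : (monomial m (D.coeff m) : PR ℝ) = C (D.coeff m) * (m.toMultiset.map X).prod := by
      rw [monomial_eq, Finsupp.toMultiset_map, Finsupp.prod_toMultiset, Finsupp.prod_mapDomain_index]
      · simp
      · intros; rw [pow_add]
    rw [this, op_mul, op_Cf, Sm.rsmul_apply]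
  rw [e, l1, Finset.sum_mul]
  refine (norm_sum_le _ _).trans (Finset.sum_le_sum fun m hm => ?_)
  rw [norm_mul, Complex.norm_real, Real.norm_eq_abs]
  refine mul_le_mul_of_nonneg_left (h _ ?_) (abs_nonneg _)
  rw [Finsupp.card_toMultiset]
  exact (le_totalDegree hm).trans hD

lemma harm_poly : ∃ C ≥ 1, ∀ (f : Sm) (x : E16) (r M : ℝ), 0 < r → r ≤ 1 → (∀ y ∈ Metric.ball x r, op (Q ℝ 0) f y = 0) →
    (∀ y ∈ Metric.ball x r, ‖f y‖ ≤ M) → ∀ (D : PR ℝ) (d : ℕ), D.totalDegree ≤ d →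
    ‖op D f x‖ ≤ l1 D * ((C / r) ^ d * d.factorial * M) := by
  obtain ⟨C, hC, H⟩ := harm_deriv
  have key : ∀ (s : Multiset (Fin 16)) (f : Sm) (x : E16) (ε M : ℝ), 0 < ε →
      (∀ y ∈ Metric.ball x (s.card * ε), op (Q ℝ 0) f y = 0) →
      (∀ y ∈ Metric.ball x (s.card * ε), ‖f y‖ ≤ M) → ‖f x‖ ≤ M → ‖op ((s.map X).prod) f x‖ ≤ (C / ε) ^ s.card * M := by
    intro s
    induction s using Multiset.induction_on with
    | empty => intro f x ε M hε h1 h2 h3; simpa [op_one] using h3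
    | cons p s ih =>
      intro f x ε M hε h1 h2 h3
      rw [Multiset.map_cons, Multiset.prod_cons, op_mul, op_X, Multiset.card_cons, pow_succ', mul_assoc]
      have hb : ∀ y ∈ Metric.ball x ε, Metric.ball y (s.card * ε) ⊆ Metric.ball x ((s.card + 1 : ℕ) * ε) := by
        intro y hy
        apply Metric.ball_subset_ball'
        rw [Metric.mem_ball] at hy
        push_cast; linarith
      have hb' : Metric.ball x ε ⊆ Metric.ball x ((s.card + 1 : ℕ) * ε) := by
        apply Metric.ball_subset_ball
        push_cast
        have : 0 ≤ (s.card : ℝ) * ε := by positivity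
        linarith
      rw [Multiset.card_cons] at h1 h2
      refine H _ x ε _ hε ?_ ?_ p
      · intro y hy
        rw [← op_mul, mul_comm, op_mul]
        have : op (Q ℝ 0) f ∈ Nl {y} := by
          rw [mem_Nl']; simp only [mem_singleton_iff, forall_eq]
          filter_upwards [Metric.isOpen_ball.mem_nhds (hb' hy)] with z hz
          exact h1 z hz
        exact Nl_mem (Nl_op _ this) rfl
      · intro y hy
        exact ih f y ε M hε (fun z hz => h1 z (hb y hy hz)) (fun z hz => h2 z (hb y hy hz)) (h2 y (hb' hy))
  refine ⟨3 * C + 1, by linarith, ?_⟩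
  intro f x r M hr hr1 h1 h2 D d hD
  have hM : 0 ≤ M := (norm_nonneg _).trans (h2 x (Metric.mem_ball_self hr))
  have h1r : 1 ≤ (3 * C + 1) / r := by rw [le_div_iff₀ hr]; linarith
  refine op_bound_of_monomial f x d _ (fun s hs => ?_) D hD
  have h4 : ‖op ((s.map X).prod) f x‖ ≤ ((3 * C + 1) / r) ^ s.card * s.card.factorial * M := by
    rcases Nat.eq_zero_or_pos s.card with h0 | h0
    · rw [Multiset.card_eq_zero] at h0
      subst h0
      simpa [op_one] using h2 x (Metric.mem_ball_self hr)
    · have h0' : (0:ℝ) < s.card := by exact_mod_cast h0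
      have e : (s.card : ℝ) * (r / s.card) = r := by field_simp
      have := key s f x (r / s.card) M (by positivity) (by rwa [e]) (by rwa [e]) (h2 x (Metric.mem_ball_self hr))
      refine this.trans (mul_le_mul_of_nonneg_right ?_ hM)
      have h5 := Real.pow_div_factorial_le_exp (s.card : ℝ) h0'.le s.card
      rw [div_le_iff₀ (by positivity)] at h5
      have h6 : Real.exp s.card ≤ 3 ^ s.card := by
        rw [← Real.exp_one_pow]
        gcongr
        exact Real.exp_one_lt_d9.le.trans (by norm_num)
      calc (C / (r / s.card)) ^ s.card = (C / r) ^ s.card * (s.card : ℝ) ^ s.card := by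
            rw [← mul_pow]; congr 1; field_simp
        _ ≤ (C / r) ^ s.card * (3 ^ s.card * s.card.factorial) := by
            gcongr
            exact h5.trans (by gcongr)
        _ = (3 * C / r) ^ s.card * s.card.factorial := by rw [← mul_assoc, ← mul_pow]; congr 2; ring
        _ ≤ _ := by gcongr; linarith
  refine h4.trans (mul_le_mul_of_nonneg_right ?_ hM)
  have := Nat.factorial_le hs
  gcongr

/-- Taylor expansion of a chain of derivatives -/
lemma taylor_chain {φ : ℕ → ℝ → ℂ} (hd : ∀ n, ∀ t ∈ Set.Icc (0:ℝ) 1, HasDerivAt (φ n) (φ (n+1) t) t)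
    {A c : ℝ} (hc0 : 0 ≤ c) (hc : c < 1) (hb : ∀ n, ∀ t ∈ Set.Icc (0:ℝ) 1, ‖φ n t‖ ≤ A * c ^ n * n.factorial) :
    HasSum (fun n => ((n.factorial : ℂ))⁻¹ * φ n 0) (φ 0 1) := by
  have key : ∀ (n m : ℕ) (K : ℝ), (∀ t ∈ Set.Icc (0:ℝ) 1, ‖φ (m + n) t‖ ≤ K) → ∀ t ∈ Set.Icc (0:ℝ) 1,
      ‖φ m t - ∑ k ∈ Finset.range n, ((k.factorial : ℂ))⁻¹ * φ (m + k) 0 * (t : ℂ) ^ k‖ ≤ K * (t ^ n / n.factorial) := by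
    intro n
    induction n with
    | zero => intro m K hK t ht; simpa using hK t ht
    | succ n ih =>
      intro m K hK t ht
      have hs : ∀ t ∈ Set.Icc (0:ℝ) 1, HasDerivAt (fun t : ℝ => φ m t - ∑ k ∈ Finset.range (n+1), ((k.factorial : ℂ))⁻¹ * φ (m + k) 0 * (t : ℂ) ^ k)
          (φ (m+1) t - ∑ k ∈ Finset.range n, ((k.factorial : ℂ))⁻¹ * φ (m + 1 + k) 0 * (t : ℂ) ^ k) t := by
        intro t ht
        refine (hd m t ht).sub ?_
        have h1 : ∀ k, HasDerivAt (fun t : ℝ => ((k.factorial : ℂ))⁻¹ * φ (m + k) 0 * (t : ℂ) ^ k) (((k.factorial : ℂ))⁻¹ * φ (m + k) 0 * (k * (t : ℂ) ^ (k - 1))) t := by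
          intro k
          have h2 := ((hasDerivAt_id t).ofReal_comp.pow k).const_mul (((k.factorial : ℂ))⁻¹ * φ (m + k) 0)
          simpa using h2
        have h3 := HasDerivAt.fun_sum (u := Finset.range (n+1)) (fun k _ => h1 k)
        rw [Finset.sum_range_succ'] at h3
        simp only [Nat.cast_zero, zero_mul, mul_zero, add_zero, Nat.add_sub_cancel] at h3
        convert h3 using 1
        refine Finset.sum_congr rfl fun k _ => ?_
        rw [Nat.factorial_succ, show m + 1 + k = m + (k + 1) by ring]
        have : ((k : ℂ) + 1) ≠ 0 := Nat.cast_add_one_ne_zero k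
        push_cast
        rw [mul_inv]
        field_simp
      have hB : ∀ t : ℝ, HasDerivAt (fun t : ℝ => K * (t ^ (n+1) / (n+1).factorial)) (K * (t ^ n / n.factorial)) t := by
        intro t
        have h2 := (((hasDerivAt_id t).pow (n+1)).div_const ((n+1).factorial : ℝ)).const_mul K
        have e : K * (((n+1 : ℕ) : ℝ) * id t ^ (n + 1 - 1) * 1 / ((n + 1).factorial : ℝ)) = K * (t ^ n / n.factorial) := by
          rw [Nat.factorial_succ]
          have : ((n : ℝ) + 1) ≠ 0 := Nat.cast_add_one_ne_zero n
          push_cast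
          simp only [id, Nat.add_sub_cancel, mul_one]
          field_simp
        rw [e] at h2
        exact h2
      refine image_norm_le_of_norm_deriv_right_le_deriv_boundary (a := 0) (b := 1)
        (fun t ht => (hs t ht).continuousAt.continuousWithinAt)
        (fun t ht => (hs t ⟨ht.1, ht.2.le⟩).hasDerivWithinAt) (B := fun t : ℝ => K * (t ^ (n+1) / (n+1).factorial)) ?_ hB ?_ ht
      · rw [Finset.sum_range_succ']
        simp
      · intro t ht
        refine ih (m+1) K (fun s hs => ?_) t ⟨ht.1, ht.2.le⟩
        rw [show m + 1 + n = m + (n+1) by ring]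
        exact hK s hs
  have hA : 0 ≤ A := by
    have := (norm_nonneg _).trans (hb 0 0 (by simp))
    simpa using this
  have hsum : Summable (fun n => ((n.factorial : ℂ))⁻¹ * φ n 0) := by
    refine Summable.of_norm_bounded (g := fun n => A * c ^ n) ((summable_geometric_of_lt_one hc0 hc).mul_left A) fun n => ?_
    rw [norm_mul, norm_inv, Complex.norm_natCast]
    have := hb n 0 (by simp)
    rw [inv_mul_le_iff₀ (by positivity)]
    linarith
  rw [hsum.hasSum_iff_tendsto_nat, tendsto_iff_norm_sub_tendsto_zero]
  have h0 : Filter.Tendsto (fun n => A * c ^ n) Filter.atTop (𝓝 0) := by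
    have := (tendsto_pow_atTop_nhds_zero_of_lt_one hc0 hc).const_mul A
    simpa using this
  refine squeeze_zero (fun n => norm_nonneg _) (fun n => ?_) h0
  have := key n 0 (A * c ^ n * n.factorial) (fun t ht => by rw [zero_add]; exact hb n t ht) 1 (by simp)
  rw [norm_sub_rev]
  simp only [zero_add, Complex.ofReal_one, one_pow, mul_one] at this
  refine this.trans (le_of_eq ?_)
  field_simp
end OK

namespace OK
open Finset MvPolynomial
open scoped ContDiff Topology
open MeasureTheory Set

/-- weighted degree filtration -/
def dgS (m k : ℕ) : Submodule ℝ (PR ℝ) where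
  carrier := {P | P = 0 ∨ P.totalDegree + k ≤ m}
  zero_mem' := Or.inl rfl
  add_mem' := by
    rintro P R (rfl | hP) (rfl | hR)
    · left; simp
    · right; simpa using hR
    · right; simpa using hP
    · right
      have := totalDegree_add P R
      omega
  smul_mem' := by
    rintro c P (rfl | hP)
    · left; simp
    · right
      have := totalDegree_smul_le c P
      omega

lemma mem_dgS {m k : ℕ} {P : PR ℝ} : P ∈ dgS m k ↔ P = 0 ∨ P.totalDegree + k ≤ m := Iff.rfl

lemma dgS_mul {m k j k' : ℕ} {P R : PR ℝ} (hP : P ∈ dgS m k) (hR : R ∈ dgS (k + j) k') : P * R ∈ dgS (m + j) k' := by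
  rcases hP with rfl | hP
  · left; simp
  rcases hR with rfl | hR
  · left; simp
  right
  have := totalDegree_mul P R
  omega

lemma dgS_mono {m m' k : ℕ} (h : m ≤ m') : dgS m k ≤ dgS m' k := by
  rintro P (hP | hP)
  · exact Or.inl hP
  · exact Or.inr (hP.trans h)

variable (Z : Crd ℝ)

/-- the value of a decomposition -/
def Crd.val (α : Fin 12 → MvPolynomial (Fin 11) ℝ) (D : Fin 10 → PR ℝ) : PR ℝ :=
  ∑ β, aeval Z.eta (α β) * aeval Z.sig (bm ℝ β) + ∑ a, D a * Q ℝ a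

lemma Crd.val_add (α α' : Fin 12 → MvPolynomial (Fin 11) ℝ) (D D' : Fin 10 → PR ℝ) :
    Z.val (α + α') (D + D') = Z.val α D + Z.val α' D' := by
  simp only [Crd.val, Pi.add_apply, map_add, add_mul, Finset.sum_add_distrib]
  ring

lemma Crd.val_sub (α α' : Fin 12 → MvPolynomial (Fin 11) ℝ) (D D' : Fin 10 → PR ℝ) :
    Z.val (α - α') (D - D') = Z.val α D - Z.val α' D' := by
  simp only [Crd.val, Pi.sub_apply, map_sub, sub_mul, Finset.sum_sub_distrib]
  ring

lemma Crd.val_mul (g : MvPolynomial (Fin 11) ℝ) (α : Fin 12 → MvPolynomial (Fin 11) ℝ) (D : Fin 10 → PR ℝ) :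
    Z.val (fun β => g * α β) (fun a => aeval Z.eta g * D a) = aeval Z.eta g * Z.val α D := by
  simp only [Crd.val, map_mul, mul_add, Finset.mul_sum, mul_assoc]

lemma Crd.val_smul (c : ℝ) (α : Fin 12 → MvPolynomial (Fin 11) ℝ) (D : Fin 10 → PR ℝ) :
    Z.val (c • α) (c • D) = c • Z.val α D := by
  simp only [Crd.val, Pi.smul_apply, map_smul, smul_add, Finset.smul_sum, smul_mul_assoc]

lemma Crd.val_D (D : Fin 10 → PR ℝ) : Z.val 0 D = ∑ a, D a * Q ℝ a := by
  simp [Crd.val]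

lemma Crd.val_sum {ι : Type*} (s : Finset ι) (α : ι → Fin 12 → MvPolynomial (Fin 11) ℝ) (D : ι → Fin 10 → PR ℝ) :
    Z.val (∑ i ∈ s, α i) (∑ i ∈ s, D i) = ∑ i ∈ s, Z.val (α i) (D i) := by
  classical
  induction s using Finset.induction_on with
  | empty => simp [Crd.val]
  | insert i s hi ih => rw [Finset.sum_insert hi, Finset.sum_insert hi, Finset.sum_insert hi, Crd.val_add, ih]

lemma Crd.val_single (e : MvPolynomial (Fin 11) ℝ) (β : Fin 12) :
    Z.val (Pi.single β e) 0 = aeval Z.eta e * aeval Z.sig (bm ℝ β) := by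
  rw [Crd.val, Finset.sum_eq_single β]
  · simp
  · intro b _ hb; simp [Pi.single_eq_of_ne hb]
  · simp

lemma Crd.val_singleD (D : PR ℝ) (a : Fin 10) : Z.val 0 (Pi.single a D) = D * Q ℝ a := by
  rw [Crd.val_D, Finset.sum_eq_single a]
  · simp
  · intro b _ hb; simp [Pi.single_eq_of_ne hb]
  · simp

/-- degree bounds for a decomposition -/
def Crd.Bd (m : ℕ) (α : Fin 12 → MvPolynomial (Fin 11) ℝ) (D : Fin 10 → PR ℝ) : Prop :=
  (∀ β, aeval Z.eta (α β) ∈ dgS m (bd β)) ∧ ∀ a, D a ∈ dgS m 2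

lemma Crd.W_dec {m : ℕ} {p : PR ℝ} (hp : p ∈ Z.W m) : ∃ α D, p = Z.val α D ∧ Z.Bd m α D := by
  let S : Submodule ℝ (PR ℝ) :=
    { carrier := {p | ∃ α D, p = Z.val α D ∧ Z.Bd m α D}
      zero_mem' := ⟨0, 0, by simp [Crd.val], fun β => by simp, fun a => by simp⟩
      add_mem' := by
        rintro p q ⟨α, D, rfl, h1, h2⟩ ⟨α', D', rfl, h1', h2'⟩
        exact ⟨α + α', D + D', (Z.val_add _ _ _ _).symm, fun β => by
          rw [Pi.add_apply, map_add]; exact add_mem (h1 β) (h1' β), fun a => add_mem (h2 a) (h2' a)⟩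
      smul_mem' := by
        rintro c p ⟨α, D, rfl, h1, h2⟩
        exact ⟨c • α, c • D, (Z.val_smul _ _ _).symm, fun β => by
          rw [Pi.smul_apply, map_smul]; exact Submodule.smul_mem _ _ (h1 β), fun a => Submodule.smul_mem _ _ (h2 a)⟩ }
  have hS : Z.W m ≤ S := by
    refine sup_le (Submodule.span_le.2 ?_) (Submodule.span_le.2 ?_)
    · rintro g ⟨e, β, h, rfl⟩
      refine ⟨Pi.single β (monomial e 1), 0, (Z.val_single _ _).symm, fun b => ?_, fun a => by simp⟩
      by_cases hb : b = β
      · subst hb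
        rw [Pi.single_eq_same]
        right
        have : aeval Z.eta (monomial e (1:ℝ)) ∈ Pm ℝ e.degree := by
          refine aeval_deg _ (fun i => ?_) _ ?_
          · rw [mem_restrictTotalDegree]; exact Z.eta_deg i
          · exact (totalDegree_monomial_le _ _).trans_eq rfl
        rw [mem_restrictTotalDegree] at this
        omega
      · rw [Pi.single_eq_of_ne hb]; simp
    · rintro g ⟨D, a, h, rfl⟩
      refine ⟨0, Pi.single a D, (Z.val_singleD _ _).symm, fun b => by simp, fun b => ?_⟩
      by_cases hb : b = a
      · subst hb; rw [Pi.single_eq_same]; exact Or.inr h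
      · rw [Pi.single_eq_of_ne hb]; simp
  exact hS hp

/-- degree and size bounds -/
def Crd.Dec (m : ℕ) (L : ℝ) (p : PR ℝ) : Prop := ∃ α D, p = Z.val α D ∧ Z.Bd m α D ∧
  (∀ β, l1 (aeval Z.eta (α β)) ≤ L) ∧ ∀ a, l1 (D a) ≤ L

variable {Z}

lemma Crd.Dec.mono {m m' : ℕ} {L L' : ℝ} {p : PR ℝ} (h : Z.Dec m L p) (hm : m ≤ m') (hL : L ≤ L') : Z.Dec m' L' p := by
  obtain ⟨α, D, h1, ⟨h2, h3⟩, h4, h5⟩ := h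
  exact ⟨α, D, h1, ⟨fun β => dgS_mono hm (h2 β), fun a => dgS_mono hm (h3 a)⟩, fun β => (h4 β).trans hL,
    fun a => (h5 a).trans hL⟩

lemma Crd.Dec.add {m : ℕ} {L L' : ℝ} {p q : PR ℝ} (h : Z.Dec m L p) (h' : Z.Dec m L' q) : Z.Dec m (L + L') (p + q) := by
  obtain ⟨α, D, rfl, ⟨h2, h3⟩, h4, h5⟩ := h
  obtain ⟨α', D', rfl, ⟨h2', h3'⟩, h4', h5'⟩ := h'
  refine ⟨α + α', D + D', (Z.val_add _ _ _ _).symm, ⟨fun β => ?_, fun a => add_mem (h3 a) (h3' a)⟩, fun β => ?_, fun a => ?_⟩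
  · rw [Pi.add_apply, map_add]; exact add_mem (h2 β) (h2' β)
  · rw [Pi.add_apply, map_add]; exact (l1_add _ _).trans (add_le_add (h4 β) (h4' β))
  · exact (l1_add _ _).trans (add_le_add (h5 a) (h5' a))

lemma Crd.Dec.smul {m : ℕ} {L : ℝ} {p : PR ℝ} (h : Z.Dec m L p) (c : ℝ) : Z.Dec m (|c| * L) (c • p) := by
  obtain ⟨α, D, rfl, ⟨h2, h3⟩, h4, h5⟩ := h
  have hl : ∀ P : PR ℝ, l1 P ≤ L → l1 (c • P) ≤ |c| * L := by
    intro P hP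
    rw [smul_eq_C_mul]
    exact (l1_mul _ _).trans (mul_le_mul (l1_C c) hP (l1_nonneg _) (abs_nonneg _))
  refine ⟨c • α, c • D, (Z.val_smul _ _ _).symm, ⟨fun β => ?_, fun a => Submodule.smul_mem _ _ (h3 a)⟩, fun β => ?_, fun a => ?_⟩
  · rw [Pi.smul_apply, map_smul]; exact Submodule.smul_mem _ _ (h2 β)
  · rw [Pi.smul_apply, map_smul]; exact hl _ (h4 β)
  · exact hl _ (h5 a)

lemma Crd.Dec.zero (m : ℕ) : Z.Dec m 0 0 :=
  ⟨0, 0, by simp [Crd.val], ⟨fun β => by simp, fun a => by simp⟩, fun β => by simp [l1_zero], fun a => by simp [l1_zero]⟩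

variable (Z)

lemma bm_deg (β : Fin 12) : (bm ℝ β).totalDegree ≤ bd β := by
  have h1 : ∀ i : Fin 5, (X i : P5 ℝ).totalDegree ≤ 1 := fun i => (totalDegree_X i).le
  have h2 : ∀ i j : Fin 5, (X i * X j : P5 ℝ).totalDegree ≤ 2 := fun i j => (totalDegree_mul _ _).trans (add_le_add (h1 _) (h1 _))
  have h3 : ∀ i j k : Fin 5, (X i * (X j * X k) : P5 ℝ).totalDegree ≤ 3 := fun i j k =>
    (totalDegree_mul _ _).trans (add_le_add (h1 _) (h2 _ _))
  fin_cases β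
  · exact (totalDegree_one (R := ℝ) (σ := Fin 5)).le
  · exact h1 0
  · exact h1 1
  · exact h1 2
  · exact h1 3
  · exact h1 4
  · exact h2 2 2
  · exact h2 3 3
  · exact h2 4 4
  · exact h2 3 4
  · exact h2 1 2
  · exact h3 4 4 4

lemma Crd.dec_step (hn : Good Z.n) : ∃ K ≥ 1, ∀ (p : Fin 16) m L P, Z.Dec m L P → Z.Dec (m + 1) (K * L) (X p * P) := by
  have h0 : ∀ (p : Fin 16) (β : Fin 12), ∃ α D, X p * aeval Z.sig (bm ℝ β) = Z.val α D ∧ Z.Bd (bd β + 1) α D := by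
    intro p β
    refine Z.W_dec (Z.SP hn _ _ ?_)
    have h1 : aeval Z.sig (bm ℝ β) ∈ Pm ℝ (bd β) := by
      refine aeval_deg _ (fun i => ?_) _ ?_
      · rw [mem_restrictTotalDegree]; exact Z.sig_deg i
      · exact bm_deg β
    rw [mem_restrictTotalDegree] at h1
    have := totalDegree_mul (X p) (aeval Z.sig (bm ℝ β))
    rw [totalDegree_X] at this
    omega
  choose α' D' hv hb using h0
  set κ : Fin 16 → Fin 12 → ℝ := fun p β => ∑ b, l1 (aeval Z.eta (α' p β b)) + ∑ a, l1 (D' p β a) with hκ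
  have κ1 : ∀ p β b, l1 (aeval Z.eta (α' p β b)) ≤ κ p β := fun p β b =>
    (Finset.single_le_sum (f := fun b => l1 (aeval Z.eta (α' p β b))) (fun _ _ => l1_nonneg _) (mem_univ b)).trans
      (le_add_of_nonneg_right (Finset.sum_nonneg fun _ _ => l1_nonneg _))
  have κ2 : ∀ p β a, l1 (D' p β a) ≤ κ p β := fun p β b =>
    (Finset.single_le_sum (f := fun a => l1 (D' p β a)) (fun _ _ => l1_nonneg _) (mem_univ b)).trans
      (le_add_of_nonneg_left (Finset.sum_nonneg fun _ _ => l1_nonneg _))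
  have κ0 : ∀ p β, 0 ≤ κ p β := fun p β => (l1_nonneg _).trans (κ1 p β 0)
  have κs : ∀ p, ∑ β, κ p β ≤ ∑ p, ∑ β, κ p β := fun p =>
    Finset.single_le_sum (f := fun p => ∑ β, κ p β) (fun p _ => Finset.sum_nonneg fun β _ => κ0 p β) (mem_univ p)
  refine ⟨1 + ∑ p, ∑ β, κ p β, le_add_of_nonneg_right (Finset.sum_nonneg fun p _ => Finset.sum_nonneg fun β _ => κ0 p β), ?_⟩
  rintro p m L P ⟨α, D, rfl, ⟨h2, h3⟩, h4, h5⟩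
  have hL : 0 ≤ L := (l1_nonneg _).trans (h4 0)
  refine ⟨∑ β, (fun b => α β * α' p β b), ∑ β, (fun a => aeval Z.eta (α β) * D' p β a) + fun a => X p * D a, ?_, ⟨?_, ?_⟩, ?_, ?_⟩
  · have e1 := Z.val_add (∑ β, (fun b => α β * α' p β b)) 0 (∑ β, (fun a => aeval Z.eta (α β) * D' p β a)) (fun a => X p * D a)
    rw [add_zero] at e1
    rw [e1, Z.val_sum univ (fun β => (fun b => α β * α' p β b)) (fun β => (fun a => aeval Z.eta (α β) * D' p β a)), Z.val_D,
      Crd.val, mul_add, Finset.mul_sum, Finset.mul_sum]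
    have e2 : ∀ β, Z.val (fun b => α β * α' p β b) (fun a => aeval Z.eta (α β) * D' p β a) =
        X p * (aeval Z.eta (α β) * aeval Z.sig (bm ℝ β)) := by
      intro β
      rw [Z.val_mul, ← hv]
      ring
    have e3 : ∀ a, X p * D a * Q ℝ a = X p * (D a * Q ℝ a) := fun a => mul_assoc _ _ _
    simp only [e2, e3]
  · intro b
    rw [Finset.sum_apply, map_sum]
    refine Submodule.sum_mem _ fun β _ => ?_
    rw [map_mul]
    exact dgS_mul (h2 β) ((hb p β).1 b)
  · intro a
    rw [Pi.add_apply, Finset.sum_apply]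
    refine add_mem (Submodule.sum_mem _ fun β _ => dgS_mul (h2 β) ((hb p β).2 a)) ?_
    rcases h3 a with h | h
    · simp [h]
    · right
      have := totalDegree_mul (X p) (D a)
      rw [totalDegree_X] at this
      omega
  · intro b
    rw [Finset.sum_apply, map_sum]
    calc _ ≤ ∑ β, l1 (aeval Z.eta (α β * α' p β b)) := l1_sum _ _
      _ ≤ ∑ β, L * κ p β := Finset.sum_le_sum fun β _ => by
        rw [map_mul]; exact (l1_mul _ _).trans (mul_le_mul (h4 β) (κ1 p β b) (l1_nonneg _) hL)
      _ = (∑ β, κ p β) * L := by rw [← Finset.mul_sum, mul_comm]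
      _ ≤ _ := mul_le_mul_of_nonneg_right ((κs p).trans (by linarith)) hL
  · intro a
    rw [Pi.add_apply, Finset.sum_apply]
    calc _ ≤ ∑ β, l1 (aeval Z.eta (α β) * D' p β a) + l1 (X p * D a) :=
          (l1_add _ _).trans (add_le_add (l1_sum _ _) le_rfl)
      _ ≤ ∑ β, L * κ p β + 1 * L := add_le_add (Finset.sum_le_sum fun β _ => 
            (l1_mul _ _).trans (mul_le_mul (h4 β) (κ2 p β a) (l1_nonneg _) hL))
            ((l1_mul _ _).trans (mul_le_mul (l1_X p) (h5 a) (l1_nonneg _) zero_le_one))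
      _ = (1 + ∑ β, κ p β) * L := by rw [← Finset.mul_sum]; ring
      _ ≤ _ := mul_le_mul_of_nonneg_right (by linarith [κs p]) hL

lemma Crd.dec_all (hn : Good Z.n) : ∃ K ≥ 1, ∀ (P : PR ℝ), Z.Dec P.totalDegree (l1 P * K ^ P.totalDegree) P := by
  obtain ⟨K, hK, hs⟩ := Z.dec_step hn
  have hm : ∀ s : Multiset (Fin 16), Z.Dec s.card (K ^ s.card) ((s.map X).prod) := by
    intro s
    induction s using Multiset.induction_on with
    | empty =>
      refine ⟨Pi.single 0 1, 0, ?_, ⟨fun b => ?_, fun a => by simp⟩, fun b => ?_, fun a => by simp [l1_zero]⟩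
      · rw [Z.val_single]; simp [bm]
      · by_cases hb : b = 0
        · subst hb; right; simp [bd]
        · rw [Pi.single_eq_of_ne hb]; simp
      · by_cases hb : b = 0
        · subst hb; simpa using l1_one
        · rw [Pi.single_eq_of_ne hb]; simp [l1_zero]
    | cons a s ih =>
      rw [Multiset.map_cons, Multiset.prod_cons, Multiset.card_cons, pow_succ']
      exact hs _ _ _ _ ih
  refine ⟨K, hK, fun P => ?_⟩
  have key : ∀ S ⊆ P.support, Z.Dec P.totalDegree (∑ e ∈ S, |P.coeff e| * K ^ P.totalDegree) (∑ e ∈ S, monomial e (P.coeff e)) := by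
    intro S
    classical
    induction S using Finset.induction_on with
    | empty => intro _; simpa using Crd.Dec.zero _
    | insert e S he ih =>
      intro hS
      rw [Finset.sum_insert he, Finset.sum_insert he]
      refine Crd.Dec.add ?_ (ih ((Finset.subset_insert _ _).trans hS))
      have h1 := hm (Finsupp.toMultiset e)
      have h2 : ((Finsupp.toMultiset e).map (X : Fin 16 → PR ℝ)).prod = monomial e 1 := by
        rw [monomial_eq, Finsupp.toMultiset_map, Finsupp.prod_toMultiset, Finsupp.prod_mapDomain_index]
        · simp
        · simp
        · intros; rw [pow_add]
      have h3 : (Finsupp.toMultiset e).card ≤ P.totalDegree := by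
        rw [Finsupp.card_toMultiset]
        exact le_totalDegree (hS (Finset.mem_insert_self _ _))
      rw [h2] at h1
      have h4 := (h1.mono h3 (pow_le_pow_right₀ hK h3)).smul (P.coeff e)
      rwa [smul_monomial, smul_eq_mul, mul_one] at h4
  have := key _ subset_rfl
  rwa [← Finset.sum_mul, support_sum_monomial_coeff] at this

lemma Crd.exN (hn : Good Z.n) : ∃ K ≥ 1, ∀ (G : Set E16) (T : Fin 10 → Sm), Clo G T → ∃ N : PR ℝ → Sm,
    (∀ P R, N (P + R) - (N P + N R) ∈ Nl G) ∧ (∀ (c : ℝ) P, N (c • P) - c • N P ∈ Nl G) ∧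
    (∀ k P, N (Z.eta k * P) - op (Z.eta k) (N P) ∈ Nl G) ∧ (∀ P b, N (P * Q ℝ b) - op P (T b) ∈ Nl G) ∧
    (∀ P, ∃ D : Fin 10 → PR ℝ, N P = ∑ a, op (D a) (T a) ∧
      ∀ a, l1 (D a) ≤ l1 P * K ^ P.totalDegree ∧ (D a).totalDegree ≤ P.totalDegree) := by
  obtain ⟨K, hK, h⟩ := Z.dec_all hn
  refine ⟨K, hK, fun G T hT => ?_⟩
  choose α D hv hB _ hl using h
  let N : PR ℝ → Sm := fun P => ∑ a, op (D P a) (T a)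
  have key : ∀ P α' D', P = Z.val α' D' → N P - ∑ a, op (D' a) (T a) ∈ Nl G := by
    intro P α' D' h
    have h1 : Z.val (α P - α') (D P - D') = 0 := by rw [Z.val_sub, ← hv, ← h, sub_self]
    have h2 := Z.Ind hn (α P - α') (fun a => - (D P - D') a) (by
      simp only [neg_mul, Finset.sum_neg_distrib]
      exact eq_neg_of_add_eq_zero_left h1)
    have h3 : α P - α' = 0 := funext h2
    rw [h3, Z.val_D] at h1
    have h4 := hT.syz h1
    simp only [Pi.sub_apply, op_sub, Finset.sum_sub_distrib] at h4
    exact h4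
  refine ⟨N, fun P R => ?_, fun c P => ?_, fun k P => ?_, fun P b => ?_, fun P => ⟨D P, rfl, fun a => ⟨hl P a, ?_⟩⟩⟩
  · have := key (P + R) (α P + α R) (D P + D R) (by rw [Z.val_add, ← hv, ← hv])
    simpa only [Pi.add_apply, op_add, Finset.sum_add_distrib] using this
  · have := key (c • P) (c • α P) (c • D P) (by rw [Z.val_smul, ← hv])
    have e : ∑ a, op ((c • D P) a) (T a) = c • N P := by
      rw [Finset.smul_sum]
      exact Finset.sum_congr rfl fun a _ => by rw [Pi.smul_apply, map_smul]; rfl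
    rwa [e] at this
  · have := key (Z.eta k * P) (fun β => X k * α P β) (fun a => aeval Z.eta (X k : MvPolynomial (Fin 11) ℝ) * D P a) (by rw [Z.val_mul, ← hv, aeval_X])
    have e : ∑ a, op (aeval Z.eta (X k : MvPolynomial (Fin 11) ℝ) * D P a) (T a) = op (Z.eta k) (N P) := by
      rw [map_sum]
      exact Finset.sum_congr rfl fun a _ => by rw [aeval_X, op_mul]
    rwa [e] at this
  · have := key (P * Q ℝ b) 0 (Pi.single b P) (Z.val_singleD _ _).symm
    have e : ∑ a, op ((Pi.single b P : Fin 10 → PR ℝ) a) (T a) = op P (T b) := by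
      rw [Finset.sum_eq_single b]
      · simp
      · intro c _ hc; rw [Pi.single_eq_of_ne hc, op_zero]
      · simp
    rwa [e] at this
  · rcases (hB P).2 a with h | h
    · rw [h]; simp
    · omega
end OK

namespace OK
open Finset MvPolynomial
open scoped ContDiff Topology
open MeasureTheory Set

lemma gr_op (f : Sm) (y v : E16) : gr (fun p => dd (Pi.single p 1) f y) v = op (lin v) f y := by
  rw [op_lin, dd_apply, fderiv_sum, gr_apply]

lemma gr_norm (c : Fin 16 → ℂ) : ‖gr c‖ ≤ ∑ p, ‖c p‖ := by
  refine ContinuousLinearMap.opNorm_le_bound _ (Finset.sum_nonneg fun _ _ => norm_nonneg _) fun v => ?_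
  rw [gr_apply, Finset.sum_mul]
  refine (norm_sum_le _ _).trans (Finset.sum_le_sum fun p _ => ?_)
  rw [norm_mul, mul_comm, Complex.norm_real]
  exact mul_le_mul_of_nonneg_left (norm_le_pi_norm v p) (norm_nonneg _)

variable (Z : Crd ℝ)

/-- transversal displacement -/
def Crd.w (s : Fin 5 → ℝ) : E16 := ∑ i, s i • Z.v i
/-- its symbol -/
def Crd.ell (s : Fin 5 → ℝ) : PR ℝ := ∑ i, C (s i) * Z.sig i
/-- local transversal coordinates -/
def Crd.sl (x0 x : E16) : Fin 5 → ℝ := fun i => Z.n i ⬝ᵥ (x - x0)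
/-- projection -/
def Crd.pj (x0 x : E16) : E16 := x - Z.w (Z.sl x0 x)

lemma lin_sum {ι : Type*} (s : Finset ι) (v : ι → E16) : lin (∑ i ∈ s, v i) = ∑ i ∈ s, lin (v i) := by
  classical
  induction s using Finset.induction_on with
  | empty => simp [lin]
  | insert i s hi ih => rw [Finset.sum_insert hi, Finset.sum_insert hi, lin_add, ih]

lemma Crd.ell_eq (s : Fin 5 → ℝ) : Z.ell s = lin (Z.w s) := by
  rw [Crd.w, lin_sum, Crd.ell]
  exact Finset.sum_congr rfl fun i _ => by rw [lin_smul]; rfl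

lemma Crd.xs_lin (h : E16) : lin (Z.w fun i => Z.n i ⬝ᵥ h) = ∑ q, C (h q) * Z.xs q := by
  rw [← Z.ell_eq, Crd.ell]
  simp only [Crd.xs, Finset.mul_sum]
  rw [Finset.sum_comm]
  refine Finset.sum_congr rfl fun i _ => ?_
  simp only [dotProduct, map_sum, Finset.sum_mul, C_mul]
  exact Finset.sum_congr rfl fun q _ => by ring

/-- linear projection -/
def Crd.wL : E16 →ₗ[ℝ] E16 where
  toFun h := Z.w fun i => Z.n i ⬝ᵥ h
  map_add' h k := by
    simp only [Crd.w, dotProduct_add, add_smul, Finset.sum_add_distrib]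
  map_smul' c h := by
    simp only [Crd.w, dotProduct_smul, smul_eq_mul, mul_smul, Finset.smul_sum, RingHom.id_apply]

lemma Crd.pj_eq (x0 x : E16) : Z.pj x0 x = x - Z.wL (x - x0) := rfl

/-- derivative of the projection -/
def Crd.pL : E16 →L[ℝ] E16 := ContinuousLinearMap.id ℝ E16 - LinearMap.toContinuousLinearMap Z.wL

lemma Crd.pj_deriv (x0 x : E16) : HasFDerivAt (Z.pj x0) Z.pL x := by
  have h1 : HasFDerivAt (fun x => (LinearMap.toContinuousLinearMap Z.wL) (x - x0)) (LinearMap.toContinuousLinearMap Z.wL) x :=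
    (LinearMap.toContinuousLinearMap Z.wL).hasFDerivAt.comp x ((hasFDerivAt_id x).sub_const x0)
  exact (hasFDerivAt_id x).sub h1

lemma Crd.sl_deriv (x0 x : E16) (i : Fin 5) :
    HasFDerivAt (fun x => ((Z.sl x0 x i : ℝ) : ℂ)) (gr fun q => ((Z.n i q : ℝ) : ℂ)) x := by
  have h1 : (fun x => ((Z.sl x0 x i : ℝ) : ℂ)) = fun x => gr (fun q => ((Z.n i q : ℝ) : ℂ)) (x - x0) := by
    funext x
    rw [gr_apply, Crd.sl, dotProduct]
    push_cast
    exact Finset.sum_congr rfl fun q _ => mul_comm _ _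
  rw [h1]
  exact (gr fun q => ((Z.n i q : ℝ) : ℂ)).hasFDerivAt.comp x ((hasFDerivAt_id x).sub_const x0)

/-- formal derivative jets on an open set -/
structure LD (G : Set E16) (N : PR ℝ → Sm) : Prop where
  lnr : ∀ y ∈ G, ∃ E : PR ℝ →ₗ[ℝ] ℂ, ∀ P, N P y = E P
  der : ∀ y ∈ G, ∀ q P, op (X q - Z.xs q) (N P) y = N ((X q - Z.xs q) * P) y

/-- Taylor terms -/
def Crd.gg (N : PR ℝ → Sm) (x0 : E16) (n : ℕ) (P : PR ℝ) (x : E16) : ℂ := N (P * Z.ell (Z.sl x0 x) ^ n) (Z.pj x0 x)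

variable {Z} {G : Set E16} {N : PR ℝ → Sm}

lemma LD.gg_succ (h : LD Z G N) (x0 x : E16) (hx : Z.pj x0 x ∈ G) (n : ℕ) (P : PR ℝ) :
    Z.gg N x0 (n + 1) P x = ∑ i, ((Z.sl x0 x i : ℝ) : ℂ) * Z.gg N x0 n (Z.sig i * P) x := by
  obtain ⟨E, hE⟩ := h.lnr _ hx
  simp only [Crd.gg, hE]
  have : P * Z.ell (Z.sl x0 x) ^ (n + 1) = ∑ i, (Z.sl x0 x i) • (Z.sig i * P * Z.ell (Z.sl x0 x) ^ n) := by
    rw [pow_succ]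
    generalize Z.ell (Z.sl x0 x) ^ n = R
    rw [mul_comm R, Crd.ell, Finset.sum_mul, Finset.mul_sum]
    exact Finset.sum_congr rfl fun i _ => by rw [smul_eq_C_mul]; ring
  rw [this, map_sum]
  exact Finset.sum_congr rfl fun i _ => by rw [map_smul, Complex.real_smul]

lemma LD.gg_deriv (h : LD Z G N) (hG : IsOpen G) (x0 : E16) (n : ℕ) : ∀ (P : PR ℝ) (x : E16), Z.pj x0 x ∈ G →
    HasFDerivAt (Z.gg N x0 n P) (gr fun q => (n : ℂ) * Z.gg N x0 (n - 1) (Z.xs q * P) x +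
      Z.gg N x0 n ((X q - Z.xs q) * P) x) x := by
  induction n with
  | zero =>
    intro P x hx
    have e : Z.gg N x0 0 P = fun x => N P (Z.pj x0 x) := by
      funext x; simp [Crd.gg]
    have h1 := (hasFDerivAt_S (N P) (Z.pj x0 x)).comp x (Z.pj_deriv x0 x)
    rw [e]
    refine h1.congr_fderiv ?_
    refine ContinuousLinearMap.ext fun v => ?_
    rw [ContinuousLinearMap.comp_apply, gr_op, gr_apply]
    have e2 : lin (Z.pL v) = ∑ q, C (v q) * (X q - Z.xs q) := by
      have : Z.pL v = v + (-1:ℝ) • (Z.w fun i => Z.n i ⬝ᵥ v) := by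
        rw [neg_one_smul, ← sub_eq_add_neg]; rfl
      rw [this, lin_add, lin_smul, Z.xs_lin, lin, ← sub_eq_zero]
      simp only [mul_sub, Finset.sum_sub_distrib, C_neg, C_1]
      ring
    rw [e2, op_sum, Sm.sum_apply]
    refine Finset.sum_congr rfl fun q _ => ?_
    rw [op_mul, op_Cf, Sm.rsmul_apply, h.der _ hx]
    simp [Crd.gg]
  | succ n ih =>
    intro P x hx
    have hev : ∀ᶠ y in 𝓝 x, Z.gg N x0 (n + 1) P y = ∑ i, ((Z.sl x0 y i : ℝ) : ℂ) * Z.gg N x0 n (Z.sig i * P) y := by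
      filter_upwards [(Z.pj_deriv x0 x).continuousAt.preimage_mem_nhds (hG.mem_nhds hx)] with y hy
      exact h.gg_succ x0 y hy n P
    have h1 := HasFDerivAt.fun_sum (u := univ) fun i _ => (Z.sl_deriv x0 x i).mul (ih (Z.sig i * P) x hx)
    refine (h1.congr_of_eventuallyEq hev).congr_fderiv ?_
    refine ContinuousLinearMap.ext fun v => ?_
    obtain ⟨E, hE⟩ := h.lnr _ hx
    have hsm : ∀ c : ℝ, ∀ p m, Z.gg N x0 m (C c * p) x = c * Z.gg N x0 m p x := by
      intro c p m
      simp only [Crd.gg, hE]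
      rw [mul_assoc, ← smul_eq_C_mul, map_smul, Complex.real_smul]
    have hsu : ∀ (p : Fin 5 → PR ℝ) m, Z.gg N x0 m (∑ i, p i) x = ∑ i, Z.gg N x0 m (p i) x := by
      intro p m
      simp only [Crd.gg, hE, Finset.sum_mul, map_sum]
    have hxs : ∀ q, Z.gg N x0 n (Z.xs q * P) x = ∑ i, (Z.n i q : ℂ) * Z.gg N x0 n (Z.sig i * P) x := by
      intro q
      rw [Crd.xs, Finset.sum_mul, hsu]
      exact Finset.sum_congr rfl fun i _ => by rw [mul_assoc, hsm]
    have h2 : ∀ q, ∑ i, ((Z.sl x0 x i : ℝ) : ℂ) * ((n : ℂ) * Z.gg N x0 (n - 1) (Z.xs q * (Z.sig i * P)) x) =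
        n * Z.gg N x0 n (Z.xs q * P) x := by
      intro q
      rcases n with _ | n
      · simp
      · rw [h.gg_succ x0 x hx, Finset.mul_sum]
        refine Finset.sum_congr rfl fun i _ => ?_
        rw [Nat.add_sub_cancel, mul_left_comm (Z.xs q)]
        ring
    have h3 : ∀ q, ∑ i, ((Z.sl x0 x i : ℝ) : ℂ) * Z.gg N x0 n ((X q - Z.xs q) * (Z.sig i * P)) x =
        Z.gg N x0 (n + 1) ((X q - Z.xs q) * P) x := by
      intro q
      rw [h.gg_succ x0 x hx]
      exact Finset.sum_congr rfl fun i _ => by rw [mul_left_comm (X q - Z.xs q)]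
    have h4 : ∀ q, ((n + 1 : ℕ) : ℂ) * Z.gg N x0 (n + 1 - 1) (Z.xs q * P) x + Z.gg N x0 (n + 1) ((X q - Z.xs q) * P) x =
      ∑ i, (((Z.sl x0 x i : ℝ) : ℂ) * ((n : ℂ) * Z.gg N x0 (n - 1) (Z.xs q * (Z.sig i * P)) x +
        Z.gg N x0 n ((X q - Z.xs q) * (Z.sig i * P)) x) + (Z.n i q : ℂ) * Z.gg N x0 n (Z.sig i * P) x) := by
      intro q
      rw [Finset.sum_add_distrib, ← hxs]
      simp only [mul_add]
      rw [Finset.sum_add_distrib, h2, h3, Nat.add_sub_cancel]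
      push_cast
      ring
    simp only [h4, ContinuousLinearMap.sum_apply, ContinuousLinearMap.add_apply, ContinuousLinearMap.smul_apply, gr_apply,
      smul_eq_mul, Finset.mul_sum]
    rw [Finset.sum_comm]
    refine Finset.sum_congr rfl fun i _ => ?_
    rw [← Finset.sum_add_distrib]
    exact Finset.sum_congr rfl fun q _ => by ring
end OK

namespace OK
open Finset MvPolynomial
open scoped ContDiff Topology
open MeasureTheory Set

lemma fact_add_le (d n : ℕ) : ((d + n).factorial : ℝ) ≤ 2 ^ (d + n) * d.factorial * n.factorial := by
  have h1 := Nat.add_choose_mul_factorial_mul_factorial d n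
  have h2 : (d + n).choose n ≤ 2 ^ (d + n) := Nat.choose_le_two_pow _ _
  have : (d + n).factorial ≤ 2 ^ (d + n) * d.factorial * n.factorial := by
    rw [← h1]
    exact Nat.mul_le_mul_right _ (Nat.mul_le_mul_right _ h2)
  exact_mod_cast this

lemma totalDegree_lin' (v : E16) : (lin v).totalDegree ≤ 1 := totalDegree_lin v

lemma totalDegree_lin_pow (P : PR ℝ) (v : E16) (n : ℕ) : (P * lin v ^ n).totalDegree ≤ P.totalDegree + n := by
  refine (totalDegree_mul _ _).trans (Nat.add_le_add_left ?_ _)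
  refine (totalDegree_pow _ _).trans ?_
  calc n * (lin v).totalDegree ≤ n * 1 := Nat.mul_le_mul_left _ (totalDegree_lin' v)
    _ = n := mul_one n

lemma _root_.HasSum.congr_fun' {f g : ℕ → ℂ} {a : ℂ} (h : HasSum f a) (hg : ∀ n, g n = f n) : HasSum g a := by
  rwa [funext hg]

/-- growth constants -/
def gc (A B : ℝ) (P : PR ℝ) : ℝ := A * l1 P * (2 * B) ^ P.totalDegree * P.totalDegree.factorial

lemma gc_nonneg {A B : ℝ} (hA : 0 ≤ A) (hB : 1 ≤ B) (P : PR ℝ) : 0 ≤ gc A B P := by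
  have := l1_nonneg P
  unfold gc; positivity

/-- factorial growth of jets, one step -/
lemma jet_bound {A B : ℝ} (hA : 0 ≤ A) (hB : 1 ≤ B) {z : PR ℝ → ℂ}
    (hz : ∀ P d, P.totalDegree ≤ d → ‖z P‖ ≤ A * l1 P * B ^ d * d.factorial) (P : PR ℝ) (v : E16)
    (hv : 4 * B * l1 (lin v) ≤ 1) (n : ℕ) : ‖z (P * lin v ^ n)‖ ≤ gc A B P * (1 / 2) ^ n * n.factorial := by
  have h0 := l1_nonneg P
  have h1 := l1_nonneg (lin v)
  calc _ ≤ A * l1 (P * lin v ^ n) * B ^ (P.totalDegree + n) * (P.totalDegree + n).factorial :=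
        hz _ _ (totalDegree_lin_pow _ _ _)
    _ ≤ A * (l1 P * l1 (lin v) ^ n) * B ^ (P.totalDegree + n) * (2 ^ (P.totalDegree + n) * P.totalDegree.factorial * n.factorial) := by
        gcongr
        · exact (l1_mul _ _).trans (mul_le_mul_of_nonneg_left (l1_pow _ _) h0)
        · exact fact_add_le _ _
    _ = gc A B P * (2 * B * l1 (lin v)) ^ n * n.factorial := by
        unfold gc; rw [pow_add, pow_add, mul_pow, mul_pow, mul_pow]; ring
    _ ≤ _ := by
        have := gc_nonneg hA hB P
        gcongr
        linarith

variable {Z : Crd ℝ} {G : Set E16} {N : PR ℝ → Sm}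

/-- Taylor sum -/
def Crd.Uf (Z : Crd ℝ) (N : PR ℝ → Sm) (x0 : E16) (P : PR ℝ) (x : E16) : ℂ :=
  ∑' n : ℕ, (n.factorial : ℂ)⁻¹ * Z.gg N x0 n P x

section

lemma gg_bound {A B : ℝ} (hA : 0 ≤ A) (hB : 1 ≤ B)
  (hb : ∀ y ∈ G, ∀ P d, P.totalDegree ≤ d → ‖N P y‖ ≤ A * l1 P * B ^ d * d.factorial)
  {x0 : E16} {s : Set E16} (hs1 : ∀ x ∈ s, Z.pj x0 x ∈ G) (hs2 : ∀ x ∈ s, 4 * B * l1 (Z.ell (Z.sl x0 x)) ≤ 1)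
    (P : PR ℝ) {x : E16} (hx : x ∈ s) (n : ℕ) : ‖Z.gg N x0 n P x‖ ≤ gc A B P * (1 / 2) ^ n * n.factorial := by
  have h2 := hs2 x hx
  rw [Z.ell_eq] at h2
  have := jet_bound hA hB (z := fun P => N P (Z.pj x0 x)) (hb _ (hs1 x hx)) P _ h2 n
  rw [Crd.gg, Z.ell_eq]
  exact this

lemma gg_bound' {A B : ℝ} (hA : 0 ≤ A) (hB : 1 ≤ B)
  (hb : ∀ y ∈ G, ∀ P d, P.totalDegree ≤ d → ‖N P y‖ ≤ A * l1 P * B ^ d * d.factorial)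
  {x0 : E16} {s : Set E16} (hs1 : ∀ x ∈ s, Z.pj x0 x ∈ G) (hs2 : ∀ x ∈ s, 4 * B * l1 (Z.ell (Z.sl x0 x)) ≤ 1)
    (P : PR ℝ) {x : E16} (hx : x ∈ s) (n : ℕ) :
    ‖(n.factorial : ℂ)⁻¹ * Z.gg N x0 n P x‖ ≤ gc A B P * (1 / 2) ^ n := by
  have h := gg_bound hA hB hb hs1 hs2 P hx n
  have hn : (0:ℝ) < n.factorial := by exact_mod_cast n.factorial_pos
  rw [norm_mul, norm_inv, Complex.norm_natCast, inv_mul_le_iff₀ hn]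
  linarith

lemma gg_sum {A B : ℝ} (hA : 0 ≤ A) (hB : 1 ≤ B)
  (hb : ∀ y ∈ G, ∀ P d, P.totalDegree ≤ d → ‖N P y‖ ≤ A * l1 P * B ^ d * d.factorial)
  {x0 : E16} {s : Set E16} (hs1 : ∀ x ∈ s, Z.pj x0 x ∈ G) (hs2 : ∀ x ∈ s, 4 * B * l1 (Z.ell (Z.sl x0 x)) ≤ 1)
    (P : PR ℝ) {x : E16} (hx : x ∈ s) : Summable fun n : ℕ => (n.factorial : ℂ)⁻¹ * Z.gg N x0 n P x :=
  Summable.of_norm_bounded ((summable_geometric_of_lt_one (by norm_num) (by norm_num)).mul_left _)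
    (gg_bound' hA hB hb hs1 hs2 P hx)

lemma gg_bound1 {A B : ℝ} (hA : 0 ≤ A) (hB : 1 ≤ B)
  (hb : ∀ y ∈ G, ∀ P d, P.totalDegree ≤ d → ‖N P y‖ ≤ A * l1 P * B ^ d * d.factorial)
  {x0 : E16} {s : Set E16} (hs1 : ∀ x ∈ s, Z.pj x0 x ∈ G) (hs2 : ∀ x ∈ s, 4 * B * l1 (Z.ell (Z.sl x0 x)) ≤ 1)
    (P : PR ℝ) {x : E16} (hx : x ∈ s) (n : ℕ) :
    ‖(n.factorial : ℂ)⁻¹ * ((n : ℂ) * Z.gg N x0 (n - 1) P x)‖ ≤ 2 * gc A B P * (1 / 2) ^ n := by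
  rcases n with _ | n
  · simpa using gc_nonneg hA hB P
  · have e : (((n + 1).factorial : ℕ) : ℂ)⁻¹ * (((n + 1 : ℕ) : ℂ) * Z.gg N x0 (n + 1 - 1) P x) =
        (n.factorial : ℂ)⁻¹ * Z.gg N x0 n P x := by
      rw [Nat.add_sub_cancel, Nat.factorial_succ]
      have h1 : ((n + 1 : ℕ) : ℂ) ≠ 0 := Nat.cast_ne_zero.2 (Nat.succ_ne_zero n)
      push_cast at h1 ⊢
      field_simp
    rw [e]
    refine (gg_bound' hA hB hb hs1 hs2 P hx n).trans_eq ?_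
    rw [pow_succ]; ring

lemma gg_sum1 {A B : ℝ} (hA : 0 ≤ A) (hB : 1 ≤ B)
  (hb : ∀ y ∈ G, ∀ P d, P.totalDegree ≤ d → ‖N P y‖ ≤ A * l1 P * B ^ d * d.factorial)
  {x0 : E16} {s : Set E16} (hs1 : ∀ x ∈ s, Z.pj x0 x ∈ G) (hs2 : ∀ x ∈ s, 4 * B * l1 (Z.ell (Z.sl x0 x)) ≤ 1)
    (P : PR ℝ) {x : E16} (hx : x ∈ s) :
    HasSum (fun n : ℕ => (n.factorial : ℂ)⁻¹ * ((n : ℂ) * Z.gg N x0 (n - 1) P x)) (Z.Uf N x0 P x) := by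
  have h1 := (gg_sum hA hB hb hs1 hs2 P hx).hasSum
  have h2 : HasSum (fun n : ℕ => (((n + 1).factorial : ℕ) : ℂ)⁻¹ * (((n + 1 : ℕ) : ℂ) * Z.gg N x0 (n + 1 - 1) P x)) (Z.Uf N x0 P x) := by
    refine h1.congr_fun' fun n => ?_
    rw [Nat.add_sub_cancel, Nat.factorial_succ]
    have h1 : ((n + 1 : ℕ) : ℂ) ≠ 0 := Nat.cast_ne_zero.2 (Nat.succ_ne_zero n)
    push_cast at h1 ⊢
    field_simp
  have h3 := (hasSum_nat_add_iff (f := fun n : ℕ => (n.factorial : ℂ)⁻¹ * ((n : ℂ) * Z.gg N x0 (n - 1) P x)) 1).1 h2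
  simpa using h3

lemma Uf_lin {A B : ℝ} (hA : 0 ≤ A) (hB : 1 ≤ B)
  (hb : ∀ y ∈ G, ∀ P d, P.totalDegree ≤ d → ‖N P y‖ ≤ A * l1 P * B ^ d * d.factorial)
  {x0 : E16} {s : Set E16} (hs1 : ∀ x ∈ s, Z.pj x0 x ∈ G) (hs2 : ∀ x ∈ s, 4 * B * l1 (Z.ell (Z.sl x0 x)) ≤ 1)
    (hN : LD Z G N) {x : E16} (hx : x ∈ s) : ∃ E : PR ℝ →ₗ[ℝ] ℂ, ∀ P, Z.Uf N x0 P x = E P := by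
  obtain ⟨E, hE⟩ := hN.lnr _ (hs1 x hx)
  refine ⟨{ toFun := fun P => Z.Uf N x0 P x, map_add' := ?_, map_smul' := ?_ }, fun P => rfl⟩
  · intro P R
    rw [Crd.Uf, Crd.Uf, Crd.Uf, ← (gg_sum hA hB hb hs1 hs2 P hx).tsum_add (gg_sum hA hB hb hs1 hs2 R hx)]
    refine tsum_congr fun n => ?_
    simp only [Crd.gg, hE, add_mul, map_add, mul_add]
  · intro c P
    rw [Crd.Uf, Crd.Uf, RingHom.id_apply, Complex.real_smul, ← tsum_mul_left]
    refine tsum_congr fun n => ?_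
    simp only [Crd.gg, hE, smul_mul_assoc, map_smul, Complex.real_smul]
    ring

lemma Uf_deriv {A B : ℝ} (hA : 0 ≤ A) (hB : 1 ≤ B)
  (hb : ∀ y ∈ G, ∀ P d, P.totalDegree ≤ d → ‖N P y‖ ≤ A * l1 P * B ^ d * d.factorial)
  {x0 : E16} {s : Set E16} (hs1 : ∀ x ∈ s, Z.pj x0 x ∈ G) (hs2 : ∀ x ∈ s, 4 * B * l1 (Z.ell (Z.sl x0 x)) ≤ 1)
    (hN : LD Z G N) (hG : IsOpen G) (hso : IsOpen s) (hsp : IsPreconnected s) (P : PR ℝ) {x : E16} (hx : x ∈ s) :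
    HasFDerivAt (Z.Uf N x0 P) (gr fun q => Z.Uf N x0 (X q * P) x) x := by
  let f' : ℕ → E16 → E16 →L[ℝ] ℂ := fun n x => gr fun q => (n.factorial : ℂ)⁻¹ * ((n : ℂ) * Z.gg N x0 (n - 1) (Z.xs q * P) x) +
      (n.factorial : ℂ)⁻¹ * Z.gg N x0 n ((X q - Z.xs q) * P) x
  have hf : ∀ n x, x ∈ s → HasFDerivAt (fun x => (n.factorial : ℂ)⁻¹ * Z.gg N x0 n P x) (f' n x) x := by
    intro n x hx
    refine ((hN.gg_deriv hG x0 n P x (hs1 x hx)).const_mul _).congr_fderiv ?_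
    refine ContinuousLinearMap.ext fun v => ?_
    rw [ContinuousLinearMap.smul_apply, gr_apply, gr_apply, smul_eq_mul, Finset.mul_sum]
    exact Finset.sum_congr rfl fun q _ => by ring
  let M : ℝ := ∑ q, (2 * gc A B (Z.xs q * P) + gc A B ((X q - Z.xs q) * P))
  have hf' : ∀ n x, x ∈ s → ‖f' n x‖ ≤ M * (1 / 2) ^ n := by
    intro n x hx
    refine (gr_norm _).trans ?_
    rw [Finset.sum_mul]
    refine Finset.sum_le_sum fun q _ => (norm_add_le _ _).trans ?_
    rw [add_mul]
    exact add_le_add (gg_bound1 hA hB hb hs1 hs2 _ hx n) (gg_bound' hA hB hb hs1 hs2 _ hx n)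
  have h := hasFDerivAt_tsum_of_isPreconnected
    ((summable_geometric_of_lt_one (r := (1/2:ℝ)) (by norm_num) (by norm_num)).mul_left M) hso hsp hf hf' hx
    (gg_sum hA hB hb hs1 hs2 P hx) hx
  refine h.congr_fderiv ?_
  obtain ⟨E, hE⟩ := Uf_lin hA hB hb hs1 hs2 hN hx
  refine HasSum.tsum_eq ?_
  have h2 : ∀ q, HasSum (fun n : ℕ => (n.factorial : ℂ)⁻¹ * ((n : ℂ) * Z.gg N x0 (n - 1) (Z.xs q * P) x) +
      (n.factorial : ℂ)⁻¹ * Z.gg N x0 n ((X q - Z.xs q) * P) x) (Z.Uf N x0 (X q * P) x) := by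
    intro q
    have e : Z.Uf N x0 (X q * P) x = Z.Uf N x0 (Z.xs q * P) x + Z.Uf N x0 ((X q - Z.xs q) * P) x := by
      rw [hE, hE, hE, ← map_add]; congr 1; ring
    rw [e]
    exact (gg_sum1 hA hB hb hs1 hs2 _ hx).add (gg_sum hA hB hb hs1 hs2 _ hx).hasSum
  unfold gr
  refine hasSum_sum fun q _ => ?_
  exact (h2 q).mapL ((ContinuousLinearMap.smulRightL ℝ E16 ℂ (ContinuousLinearMap.proj q)))

end
end OK

namespace OK
open Finset MvPolynomial
open scoped ContDiff Topology
open MeasureTheory Set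

/-- common local zero set -/
def zs {κ : Type*} (f : κ → Sm) : Set E16 := {x | ∀ i, f i ∈ Nl {x}}

lemma zs_open {κ : Type*} [Finite κ] (f : κ → Sm) : IsOpen (zs f) := by
  have : zs f = ⋂ i, {x | ∀ᶠ y in 𝓝 x, f i y = 0} := by
    ext x
    simp only [zs, mem_Nl', mem_singleton_iff, forall_eq, mem_setOf_eq, mem_iInter]
  rw [this]
  exact isOpen_iInter_of_finite fun i => isOpen_setOf_eventually_nhds

lemma zs_per {κ : Type*} {f : κ → Sm} {θ : E16} (hf : ∀ i, f i ∈ QP θ) : PerS (zs f) := by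
  intro x hx l i
  have hx := hx i
  rw [mem_Nl'] at hx ⊢
  simp only [mem_singleton_iff, forall_eq] at hx ⊢
  have ht : Filter.Tendsto (fun y : E16 => y + iv (-l)) (𝓝 (x + iv l)) (𝓝 x) := by
    have e : x = x + iv l + iv (-l) := by ext p; simp [iv]
    nth_rewrite 2 [e]
    exact (continuous_add_const (iv (-l))).tendsto _
  filter_upwards [ht.eventually hx] with y hy
  have := (mem_QP.1 (hf i)) l (y + iv (-l))
  have e : y + iv (-l) + iv l = y := by ext p; simp [iv]
  rw [e, hy, mul_zero] at this
  exact this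

lemma QP_norm {θ : E16} {f : Sm} (hf : f ∈ QP θ) (x : E16) (l : Fin 16 → ℤ) : ‖f (x + iv l)‖ = ‖f x‖ := by
  rw [mem_QP.1 hf, norm_mul]
  have : 2 * Real.pi * Complex.I * ((θ ⬝ᵥ iv l : ℝ) : ℂ) = ((2 * Real.pi * (θ ⬝ᵥ iv l) : ℝ) : ℂ) * Complex.I := by
    push_cast; ring
  rw [this, Complex.norm_exp_ofReal_mul_I, one_mul]

lemma QP_bdd {θ : E16} {f : Sm} (hf : f ∈ QP θ) : ∃ M, 0 ≤ M ∧ ∀ x, ‖f x‖ ≤ M := by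
  obtain ⟨M, hM⟩ := (isCompact_Icc (a := (0 : E16)) (b := 1)).exists_bound_of_continuousOn (contS f).continuousOn
  refine ⟨M, (norm_nonneg _).trans (hM 0 ⟨le_rfl, zero_le_one⟩), fun x => ?_⟩
  obtain ⟨l, hl⟩ := exists_cube x
  rw [← QP_norm hf x l]
  exact hM _ hl

lemma iv_neg_add (x : E16) (l : Fin 16 → ℤ) : x + iv l + iv (-l) = x := by ext p; simp [iv]

lemma per_thick {X G : Set E16} (hX : IsClosed X) (pX : PerS X) (hG : IsOpen G) (pG : PerS G) (h : X ⊆ G) :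
    ∃ r, 0 < r ∧ r ≤ 1 ∧ ∀ x ∈ X, Metric.ball x (2 * r) ⊆ G := by
  have hc : IsCompact (X ∩ Set.Icc (0 : E16) 1) := isCompact_Icc.inter_left hX
  obtain ⟨δ, hδ, hs⟩ := hc.exists_thickening_subset_open hG (Set.inter_subset_left.trans h)
  refine ⟨min (δ / 2) 1, by positivity, min_le_right _ _, fun x hx y hy => ?_⟩
  obtain ⟨l, hl⟩ := exists_cube x
  have h1 : y + iv l ∈ G := by
    refine hs (Metric.mem_thickening_iff.2 ⟨x + iv l, ⟨pX x hx l, hl⟩, ?_⟩)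
    rw [dist_add_right]
    have := min_le_left (δ / 2) 1
    exact (Metric.mem_ball.1 hy).trans_le (by linarith)
  exact (pG.mem_iff y l).1 h1

lemma taylor_line {A B : ℝ} (hA : 0 ≤ A) (hB : 1 ≤ B) (f : Sm) (y v : E16)
    (hb : ∀ t ∈ Set.Icc (0:ℝ) 1, ∀ P d, P.totalDegree ≤ d → ‖op P f (y + t • v)‖ ≤ A * l1 P * B ^ d * d.factorial)
    (hv : 4 * B * l1 (lin v) ≤ 1) : HasSum (fun n : ℕ => (n.factorial : ℂ)⁻¹ * op (lin v ^ n) f y) (f (y + v)) := by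
  have h := taylor_chain (φ := fun n t => op (lin v ^ n) f (y + t • v)) (A := gc A B 1) (c := 1 / 2) ?_ (by norm_num) (by norm_num) ?_
  · simpa [op_one] using h
  · intro n t _
    have h1 : HasDerivAt (fun t : ℝ => y + t • v) v t := by
      simpa using ((hasDerivAt_id t).smul_const v).const_add y
    have h2 := (diffS (op (lin v ^ n) f) (y + t • v)).hasFDerivAt.comp_hasDerivAt t h1
    rw [pow_succ', op_mul, op_lin]
    exact h2
  · intro n t ht
    have := jet_bound hA hB (z := fun P => op P f (y + t • v)) (hb t ht) 1 v hv n
    rwa [one_mul] at this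

lemma fam_op {U : PR ℝ → E16 → ℂ} {V : Set E16} (hV : IsOpen V) {u : Sm} (h1 : ∀ x ∈ V, u x = U 1 x)
    (hl : ∀ x ∈ V, ∃ E : PR ℝ →ₗ[ℝ] ℂ, ∀ P, U P x = E P)
    (hd : ∀ P, ∀ x ∈ V, HasFDerivAt (U P) (gr fun q => U (X q * P) x) x) (P : PR ℝ) : ∀ x ∈ V, op P u x = U P x := by
  induction P using MvPolynomial.induction_on with
  | C c =>
    intro x hx
    obtain ⟨E, hE⟩ := hl x hx
    rw [op_Cf, Sm.rsmul_apply, h1 x hx, hE, hE, ← mul_one (C c), ← smul_eq_C_mul, map_smul, Complex.real_smul]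
  | add P R hP hR =>
    intro x hx
    obtain ⟨E, hE⟩ := hl x hx
    rw [op_add, Sm.add_apply, hP x hx, hR x hx, hE, hE, hE, map_add]
  | mul_X P q hP =>
    intro x hx
    rw [mul_comm, op_mul, op_X, dd_apply]
    have : (op P u : E16 → ℂ) =ᶠ[𝓝 x] U P := Filter.eventually_of_mem (hV.mem_nhds hx) hP
    rw [this.fderiv_eq, (hd P x hx).fderiv, gr_single]

lemma glue {O : Set E16} (hO : IsOpen O) {χ : Sm} (hχ : χ ∈ Nl Oᶜ) {f : E16 → ℂ} (hf : ContDiffOn ℝ ∞ f O) :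
    ∃ u : Sm, ∀ x, u x = χ x * f x := by
  refine ⟨⟨fun x => χ x * f x, ?_⟩, fun x => rfl⟩
  change ContDiff ℝ ∞ _
  rw [contDiff_iff_contDiffAt]
  intro x
  by_cases hx : x ∈ O
  · exact (cdS χ).contDiffAt.mul (hf.contDiffAt (hO.mem_nhds hx))
  · have h := (mem_Nl'.1 hχ) x hx
    have : (fun x => χ x * f x) =ᶠ[𝓝 x] fun _ => 0 := by
      filter_upwards [h] with y hy
      rw [hy, zero_mul]
    exact contDiffAt_const.congr_of_eventuallyEq this

end OK

namespace OK
open Finset MvPolynomial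
open scoped ContDiff Topology
open MeasureTheory Set

variable (Z : Crd ℝ)

/-- the jet family attached to harmonic data -/
lemma exJet (hn : Good Z.n) {θ : E16} {G0 : Set E16} {S : Fin 10 → Sm} (qS : ∀ a, S a ∈ QP θ) (hS : Clo G0 S) (h0 : S 0 = 0)
    {r : ℝ} (hr : 0 < r) (hr1 : r ≤ 1) : ∃ N : PR ℝ → Sm, LD Z G0 N ∧ (∀ P, N P ∈ QP θ) ∧
      (∀ y ∈ G0, ∀ P b, N (P * Q ℝ b) y = op P (S b) y) ∧ ∃ A ≥ 0, ∃ B ≥ 1, ∀ y, Metric.ball y r ⊆ G0 →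
        (∀ P d, P.totalDegree ≤ d → ‖N P y‖ ≤ A * l1 P * B ^ d * d.factorial) ∧
        ∀ b P d, P.totalDegree ≤ d → ‖op P (S b) y‖ ≤ A * l1 P * B ^ d * d.factorial := by
  obtain ⟨K, hK, hN⟩ := Z.exN hn
  obtain ⟨N, n1, n2, n3, n4, n5⟩ := hN G0 S hS
  obtain ⟨C, hC, hh⟩ := harm_poly
  choose M0 M00 hM0 using fun a => QP_bdd (qS a)
  obtain ⟨M, hMd⟩ : ∃ M, M = ∑ a, M0 a := ⟨_, rfl⟩
  have hM : ∀ a x, ‖S a x‖ ≤ M := fun a x => (hM0 a x).trans (by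
    rw [hMd]; exact Finset.single_le_sum (f := M0) (fun a _ => M00 a) (mem_univ a))
  have hM1 : 0 ≤ M := (norm_nonneg _).trans (hM 0 0)
  have harm : ∀ b, ∀ y ∈ G0, op (Q ℝ 0) (S b) y = 0 := by
    intro b y hy
    have := Nl_mem (hS.koszul 0 b) hy
    rwa [h0, map_zero, sub_zero] at this
  have hCr : 1 ≤ C / r := by rw [le_div_iff₀ hr]; linarith
  have hS1 : ∀ y, Metric.ball y r ⊆ G0 → ∀ b P d, P.totalDegree ≤ d → ‖op P (S b) y‖ ≤ l1 P * ((C / r) ^ d * d.factorial * M) :=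
    fun y hy b P d hd => hh (S b) y r M hr hr1 (fun z hz => harm b z (hy hz)) (fun z _ => hM b z) P d hd
  have hKC : 1 ≤ K * (C / r) := one_le_mul_of_one_le_of_one_le hK hCr
  refine ⟨N, ⟨fun y hy => ?_, fun y hy q P => ?_⟩, fun P => ?_, fun y hy P b => ?_, 10 * M, by positivity, K * (C / r), hKC,
    fun y hy => ⟨fun P d hd => ?_, fun b P d hd => ?_⟩⟩
  · refine ⟨{ toFun := fun P => N P y, map_add' := fun P R => ?_, map_smul' := fun c P => ?_ }, fun P => rfl⟩
    · have := Nl_mem (n1 P R) hy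
      rw [Sm.sub_apply, sub_eq_zero] at this
      rw [this, Sm.add_apply]
    · have := Nl_mem (n2 c P) hy
      rw [Sm.sub_apply, sub_eq_zero] at this
      rw [this, Sm.rsmul_apply, RingHom.id_apply, Complex.real_smul]
  · have e : X q - Z.xs q = ∑ k, MvPolynomial.C (Z.c k q) * Z.eta k := by
      rw [Z.X_eq q, Crd.xs]; ring
    have key : N ((X q - Z.xs q) * P) - op (X q - Z.xs q) (N P) ∈ Nl G0 := by
      rw [e, Finset.sum_mul, op_sum]
      have hsum : ∀ (s : Finset (Fin 11)) (p : Fin 11 → PR ℝ), N (∑ k ∈ s, p k) - ∑ k ∈ s, N (p k) ∈ Nl G0 := by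
        intro s p
        classical
        induction s using Finset.induction_on with
        | empty =>
          have := n2 0 0
          simpa using this
        | insert i s hi ih =>
          rw [Finset.sum_insert hi, Finset.sum_insert hi]
          have := Submodule.add_mem _ (n1 (p i) (∑ k ∈ s, p k)) ih
          have e : N (p i + ∑ k ∈ s, p k) - (N (p i) + ∑ k ∈ s, N (p k)) =
            (N (p i + ∑ k ∈ s, p k) - (N (p i) + N (∑ k ∈ s, p k))) + (N (∑ k ∈ s, p k) - ∑ k ∈ s, N (p k)) := by abel
          rw [e]; exact this
      have h1 := hsum univ fun k => MvPolynomial.C (Z.c k q) * Z.eta k * P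
      have h2 : ∑ k, (N (MvPolynomial.C (Z.c k q) * Z.eta k * P) - op (MvPolynomial.C (Z.c k q) * Z.eta k) (N P)) ∈ Nl G0 := by
        refine Submodule.sum_mem _ fun k _ => ?_
        have a1 := n2 (Z.c k q) (Z.eta k * P)
        have a2 := Submodule.smul_mem _ (Z.c k q) (n3 k P)
        have a3 := Submodule.add_mem _ a1 a2
        rw [smul_eq_C_mul, smul_sub, sub_add_sub_cancel, ← mul_assoc] at a3
        rwa [op_mul, op_Cf]
      have h3 := Submodule.add_mem _ h1 h2
      rwa [Finset.sum_sub_distrib, sub_add_sub_cancel] at h3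
    have := Nl_mem key hy
    rw [Sm.sub_apply, sub_eq_zero] at this
    exact this.symm
  · obtain ⟨D, hD, -⟩ := n5 P
    rw [hD]
    exact Submodule.sum_mem _ fun a _ => QP_op _ (qS a)
  · have := Nl_mem (n4 P b) hy
    rwa [Sm.sub_apply, sub_eq_zero] at this
  · obtain ⟨D, hD, hl⟩ := n5 P
    rw [hD, Sm.sum_apply]
    have l0 := l1_nonneg P
    calc _ ≤ ∑ a, ‖op (D a) (S a) y‖ := norm_sum_le _ _
      _ ≤ ∑ a : Fin 10, (l1 P * K ^ d) * ((C / r) ^ d * d.factorial * M) := by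
        refine Finset.sum_le_sum fun a _ => (hS1 y hy a (D a) d ((hl a).2.trans hd)).trans ?_
        refine mul_le_mul_of_nonneg_right ((hl a).1.trans ?_) (by positivity)
        exact mul_le_mul_of_nonneg_left (pow_le_pow_right₀ hK hd) l0
      _ = _ := by
        rw [Finset.sum_const, Finset.card_univ, Fintype.card_fin, nsmul_eq_mul, mul_pow]; push_cast; ring
  · refine (hS1 y hy b P d hd).trans ?_
    have l0 := l1_nonneg P
    have h3 : (C / r) ^ d ≤ (K * (C / r)) ^ d := by
      gcongr
      exact le_mul_of_one_le_left (by positivity) hK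
    calc _ ≤ l1 P * ((K * (C / r)) ^ d * d.factorial * M) := by gcongr
      _ = M * l1 P * (K * (C / r)) ^ d * d.factorial := by ring
      _ ≤ _ := by gcongr; linarith

/-- rounded transversal coordinates -/
def Crd.sg (c : Fin 5 → ℝ) (x : E16) : Fin 5 → ℝ := fun i => (Z.n i ⬝ᵥ x - c i) - round (Z.n i ⬝ᵥ x - c i)

/-- periodic Taylor sum -/
def Crd.Ug (N : PR ℝ → Sm) (c : Fin 5 → ℝ) (P : PR ℝ) (x : E16) : ℂ :=
  ∑' n : ℕ, (n.factorial : ℂ)⁻¹ * N (P * Z.ell (Z.sg c x) ^ n) (x - Z.w (Z.sg c x))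

variable {Z}

lemma Ug_per {m : Fin 5 → Fin 16 → ℤ} (hm : ∀ i, Z.n i = iv (m i)) {N : PR ℝ → Sm} {θ : E16} (hN : ∀ P, N P ∈ QP θ)
    (c : Fin 5 → ℝ) (P : PR ℝ) (l : Fin 16 → ℤ) (x : E16) :
    Z.Ug N c P (x + iv l) = Complex.exp (2 * Real.pi * Complex.I * (θ ⬝ᵥ iv l : ℝ)) * Z.Ug N c P x := by
  have hs : Z.sg c (x + iv l) = Z.sg c x := by
    funext i
    have : Z.n i ⬝ᵥ (x + iv l) - c i = (Z.n i ⬝ᵥ x - c i) + ((m i ⬝ᵥ l : ℤ) : ℝ) := by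
      rw [dotProduct_add, hm]
      have : iv (m i) ⬝ᵥ iv l = ((m i ⬝ᵥ l : ℤ) : ℝ) := by simp [iv, dotProduct]
      rw [this]; ring
    rw [Crd.sg, Crd.sg, this, round_add_intCast]
    push_cast; ring
  rw [Crd.Ug, Crd.Ug, hs, ← tsum_mul_left]
  refine tsum_congr fun n => ?_
  rw [add_sub_right_comm, mem_QP.1 (hN _)]
  ring

lemma sg_eq {c : Fin 5 → ℝ} {x0 x : E16} (h0 : ∀ i, ∃ k : ℤ, Z.n i ⬝ᵥ x0 - c i = k)
    (h : ∀ i, |Z.n i ⬝ᵥ (x - x0)| < 1 / 2) : Z.sg c x = Z.sl x0 x := by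
  funext i
  obtain ⟨k, hk⟩ := h0 i
  have e : Z.n i ⬝ᵥ x - c i = Z.n i ⬝ᵥ (x - x0) + k := by
    rw [← hk, dotProduct_sub]; ring
  have h1 : round (Z.n i ⬝ᵥ (x - x0)) = 0 := by
    rw [round_eq_zero_iff]
    have := abs_lt.1 (h i)
    exact ⟨by linarith [this.1], this.2⟩
  rw [Crd.sg, Crd.sl, e, round_add_intCast, h1]
  push_cast; ring

end OK

namespace OK
open Finset MvPolynomial
open scoped ContDiff Topology
open MeasureTheory Set

variable {Z : Crd ℝ}

lemma dot_bound (n : E16) : ∃ ν, 0 ≤ ν ∧ ∀ h : E16, |n ⬝ᵥ h| ≤ ν * ‖h‖ := by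
  refine ⟨∑ p, |n p|, Finset.sum_nonneg fun _ _ => abs_nonneg _, fun h => ?_⟩
  rw [dotProduct, Finset.sum_mul]
  refine (Finset.abs_sum_le_sum_abs _ _).trans (Finset.sum_le_sum fun p _ => ?_)
  rw [abs_mul]
  exact mul_le_mul_of_nonneg_left (norm_le_pi_norm h p) (abs_nonneg _)

/-- solving when the zeroth component vanishes -/
lemma ck_harm (hn : Good Z.n) {m : Fin 5 → Fin 16 → ℤ} (hm : ∀ i, Z.n i = iv (m i)) {c : Fin 5 → ℝ} {θ : E16}
    {X : Set E16} (hX : IsClosed X) (pX : PerS X) (hXs : ∀ x ∈ X, ∀ i, x ∈ slab (m i) (c i) (c i))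
    {S : Fin 10 → Sm} (qS : ∀ a, S a ∈ QP θ) (hS : Clo X S) (h0 : S 0 = 0) : ∃ u ∈ QP θ, Sol X S u := by
  obtain ⟨f, hf⟩ : ∃ f : Fin 16 → Sm, f = fun i => ∑ a, op (rl ℝ i a) (S a) := ⟨_, rfl⟩
  have qf : ∀ i, f i ∈ QP θ := fun i => by rw [hf]; exact Submodule.sum_mem _ fun a _ => QP_op _ (qS a)
  obtain ⟨G0, hG0⟩ : ∃ G0, G0 = zs f := ⟨_, rfl⟩
  have oG0 : IsOpen G0 := hG0 ▸ zs_open f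
  have pG0 : PerS G0 := hG0 ▸ zs_per qf
  have cS : Clo G0 S := by
    intro i
    rw [Nl_pt]
    intro x hx
    rw [hG0] at hx
    have := hx i
    rwa [hf] at this
  have XG : X ⊆ G0 := by
    intro x hx
    rw [hG0]
    intro i
    rw [hf]
    exact Nl_pt.1 (hS i) x hx
  obtain ⟨r, hr, hr1, hrX⟩ := per_thick hX pX oG0 pG0 XG
  obtain ⟨N, hN, qN, nQ, A, hA, B, hB, hb⟩ := exJet Z hn qS cS h0 hr hr1
  -- geometric constants
  obtain ⟨κ, hκ⟩ : ∃ κ, κ = ‖LinearMap.toContinuousLinearMap Z.wL‖ := ⟨_, rfl⟩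
  have hκ0 : 0 ≤ κ := hκ ▸ norm_nonneg _
  have hκ1 : ∀ h, ‖Z.wL h‖ ≤ κ * ‖h‖ := fun h => hκ ▸ (LinearMap.toContinuousLinearMap Z.wL).le_opNorm h
  choose ν ν0 hν using fun i => dot_bound (Z.n i)
  have hν' : ∀ i, ν i ≤ ∑ i, ν i := fun i => Finset.single_le_sum (fun i _ => ν0 i) (mem_univ i)
  have hν0 : 0 ≤ ∑ i, ν i := Finset.sum_nonneg fun i _ => ν0 i
  obtain ⟨δ, hδ0, hδ1, hδ2, hδ3⟩ : ∃ δ > 0, (1 + κ) * δ ≤ r ∧ 64 * B * κ * δ ≤ 1 ∧ (∑ i, ν i) * δ ≤ 1 / 2 := by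
    obtain ⟨M, hM⟩ : ∃ M, M = (1 + κ) / r + 64 * B * κ + 2 * (∑ i, ν i) := ⟨_, rfl⟩
    have hM0 : 0 < M := by
      have : 0 < (1 + κ) / r := by positivity
      have : 0 ≤ 64 * B * κ := by positivity
      linarith
    have q1 : (1 + κ) / r ≤ M := by
      have : 0 ≤ 64 * B * κ := by positivity
      linarith
    have q2 : 64 * B * κ ≤ M := by
      have : 0 < (1 + κ) / r := by positivity
      linarith
    have q3 : 2 * (∑ i, ν i) ≤ M := by
      have : 0 < (1 + κ) / r := by positivity
      have : 0 ≤ 64 * B * κ := by positivity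
      linarith
    refine ⟨1 / M, by positivity, ?_, ?_, ?_⟩
    · rw [mul_one_div, div_le_iff₀ hM0]
      rw [div_le_iff₀ hr] at q1
      linarith
    · rw [mul_one_div, div_le_iff₀ hM0]; linarith
    · rw [mul_one_div, div_le_iff₀ hM0]; linarith
  obtain ⟨G, hG⟩ : ∃ G, G = Metric.thickening r X := ⟨_, rfl⟩
  have oG : IsOpen G := hG ▸ Metric.isOpen_thickening
  have GG : ∀ y ∈ G, Metric.ball y r ⊆ G0 := by
    intro y hy z hz
    rw [hG, Metric.mem_thickening_iff] at hy
    obtain ⟨x, hx, hxy⟩ := hy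
    refine hrX x hx ?_
    rw [Metric.mem_ball] at hz ⊢
    linarith [dist_triangle z y x]
  have GG0 : G ⊆ G0 := fun y hy => GG y hy (Metric.mem_ball_self hr)
  have hN' : LD Z G N := ⟨fun y hy => hN.lnr y (GG0 hy), fun y hy => hN.der y (GG0 hy)⟩
  have hb1 : ∀ y ∈ G, ∀ P d, P.totalDegree ≤ d → ‖N P y‖ ≤ A * l1 P * B ^ d * d.factorial := fun y hy => (hb y (GG y hy)).1
  -- local facts
  have loc0 : ∀ x0 ∈ X, ∀ x ∈ Metric.ball x0 δ, ∀ t ∈ Set.Icc (0:ℝ) 1, Z.pj x0 x + t • Z.w (Z.sl x0 x) ∈ G := by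
    intro x0 hx0 x hx t ht
    rw [hG, Metric.mem_thickening_iff]
    refine ⟨x0, hx0, ?_⟩
    rw [dist_eq_norm]
    rw [Metric.mem_ball, dist_eq_norm] at hx
    have e : Z.pj x0 x + t • Z.w (Z.sl x0 x) - x0 = (x - x0) - (1 - t) • Z.wL (x - x0) := by
      change x - Z.wL (x - x0) + t • Z.wL (x - x0) - x0 = _
      rw [sub_smul, one_smul]; abel
    rw [e]
    calc _ ≤ ‖x - x0‖ + ‖(1 - t) • Z.wL (x - x0)‖ := norm_sub_le _ _
      _ ≤ ‖x - x0‖ + 1 * (κ * ‖x - x0‖) := by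
        rw [norm_smul]
        have : ‖1 - t‖ ≤ 1 := by rw [Real.norm_eq_abs, abs_le]; constructor <;> linarith [ht.1, ht.2]
        gcongr
        exact hκ1 _
      _ = (1 + κ) * ‖x - x0‖ := by ring
      _ < (1 + κ) * δ := by gcongr
      _ ≤ r := hδ1
  have loc1 : ∀ x0 ∈ X, ∀ x ∈ Metric.ball x0 δ, Z.pj x0 x ∈ G := by
    intro x0 hx0 x hx
    simpa using loc0 x0 hx0 x hx 0 ⟨le_rfl, zero_le_one⟩
  have loc2 : ∀ x0 ∈ X, ∀ x ∈ Metric.ball x0 δ, 4 * B * l1 (Z.ell (Z.sl x0 x)) ≤ 1 := by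
    intro x0 hx0 x hx
    rw [Metric.mem_ball, dist_eq_norm] at hx
    rw [Z.ell_eq]
    calc _ ≤ 4 * B * (16 * (κ * δ)) := by
          gcongr
          refine (l1_lin _).trans ?_
          gcongr
          exact (hκ1 (x - x0)).trans (by gcongr)
      _ ≤ 1 := by linarith
  have locU : ∀ x0 ∈ X, ∀ x ∈ Metric.ball x0 δ, ∀ P, Z.Ug N c P x = Z.Uf N x0 P x := by
    intro x0 hx0 x hx P
    rw [Metric.mem_ball, dist_eq_norm] at hx
    have : Z.sg c x = Z.sl x0 x := by
      refine sg_eq (fun i => ?_) fun i => ?_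
      · obtain ⟨k, h1, h2⟩ := hXs x0 hx0 i
        refine ⟨k, ?_⟩
        rw [hm]; linarith
      · refine (hν i _).trans_lt ?_
        rcases hν0.eq_or_lt with h | h
        · have : ν i = 0 := le_antisymm (h ▸ hν' i) (ν0 i)
          rw [this]; norm_num
        · calc ν i * ‖x - x0‖ ≤ (∑ i, ν i) * ‖x - x0‖ := by gcongr; exact hν' i
            _ < (∑ i, ν i) * δ := by gcongr
            _ ≤ 1 / 2 := hδ3
    rw [Crd.Ug, this]
    rfl
  obtain ⟨O, hO⟩ : ∃ O, O = Metric.thickening δ X := ⟨_, rfl⟩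
  have oO : IsOpen O := hO ▸ Metric.isOpen_thickening
  have hOx : ∀ x ∈ O, ∃ x0 ∈ X, x ∈ Metric.ball x0 δ := by
    intro x hx
    rw [hO, Metric.mem_thickening_iff] at hx
    exact hx
  have XO : X ⊆ O := hO ▸ Metric.self_subset_thickening hδ0 X
  have pO : PerS O := by
    intro x hx l
    obtain ⟨x0, h1, h2⟩ := hOx x hx
    rw [hO, Metric.mem_thickening_iff]
    exact ⟨x0 + iv l, pX x0 h1 l, by rw [dist_add_right]; exact h2⟩
  have hder : ∀ P, ∀ x ∈ O, HasFDerivAt (Z.Ug N c P) (gr fun q => Z.Ug N c (MvPolynomial.X q * P) x) x := by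
    intro P x hx
    obtain ⟨x0, hx0, hx⟩ := hOx x hx
    have h1 := Uf_deriv hA hB hb1 (loc1 x0 hx0) (loc2 x0 hx0) hN' oG Metric.isOpen_ball (convex_ball x0 δ).isPreconnected P hx
    have h2 : Z.Ug N c P =ᶠ[𝓝 x] Z.Uf N x0 P :=
      Filter.eventually_of_mem (Metric.isOpen_ball.mem_nhds hx) fun y hy => locU x0 hx0 y hy P
    have h3 := h1.congr_of_eventuallyEq h2
    have h4 : (fun q => Z.Ug N c (MvPolynomial.X q * P) x) = fun q => Z.Uf N x0 (MvPolynomial.X q * P) x :=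
      funext fun q => locU x0 hx0 x hx _
    rw [h4]; exact h3
  have hlin : ∀ x ∈ O, ∃ E : PR ℝ →ₗ[ℝ] ℂ, ∀ P, Z.Ug N c P x = E P := by
    intro x hx
    obtain ⟨x0, hx0, hx⟩ := hOx x hx
    obtain ⟨E, hE⟩ := Uf_lin hA hB hb1 (loc1 x0 hx0) (loc2 x0 hx0) hN' hx
    exact ⟨E, fun P => by rw [locU x0 hx0 x hx, hE]⟩
  have hQ : ∀ x ∈ O, ∀ b, Z.Ug N c (Q ℝ b) x = S b x := by
    intro x hx b
    obtain ⟨x0, hx0, hx⟩ := hOx x hx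
    rw [locU x0 hx0 x hx, Crd.Uf]
    have h2 := loc2 x0 hx0 x hx
    rw [Z.ell_eq] at h2
    have h3 := taylor_line hA hB (S b) (Z.pj x0 x) (Z.w (Z.sl x0 x))
      (fun t ht P d hd => (hb _ (GG _ (loc0 x0 hx0 x hx t ht))).2 b P d hd) h2
    have e : Z.pj x0 x + Z.w (Z.sl x0 x) = x := by rw [Crd.pj]; abel
    rw [e] at h3
    rw [← h3.tsum_eq]
    refine tsum_congr fun n => ?_
    rw [Crd.gg, mul_comm (Q ℝ b), nQ _ (GG0 (loc1 x0 hx0 x hx)), Z.ell_eq]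
  -- cutoff
  have pOc : PerS Oᶜ := fun x hx l h => hx ((pO.mem_iff x l).1 h)
  obtain ⟨χ, pχ, χ1, χ0⟩ := urysohn hX oO.isClosed_compl pX pOc (Set.disjoint_compl_right_iff_subset.2 XO)
  obtain ⟨u, hu⟩ := glue oO χ0 (fam_on (fun q P => MvPolynomial.X q * P) oO (fun P => Z.Ug N c P) hder 1)
  refine ⟨u, ?_, fun b => ?_⟩
  · rw [mem_QP]
    intro l x
    rw [hu, hu, pχ, Ug_per hm qN]; ring
  · obtain ⟨V, hV⟩ : ∃ V : Set E16, V = O ∩ {x | ∀ᶠ y in 𝓝 x, (χ - 1) y = 0} := ⟨_, rfl⟩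
    have oV : IsOpen V := hV ▸ oO.inter isOpen_setOf_eventually_nhds
    have XV : X ⊆ V := fun x hx => hV ▸ ⟨XO hx, mem_Nl'.1 χ1 x hx⟩
    have VO : V ⊆ O := hV ▸ Set.inter_subset_left
    have h1 : ∀ x ∈ V, u x = Z.Ug N c 1 x := by
      intro x hx
      rw [hV] at hx
      have hx2 : ∀ᶠ y in 𝓝 x, (χ - 1) y = 0 := hx.2
      have h2 : (χ - 1) x = 0 := hx2.self_of_nhds
      rw [Sm.sub_apply, Sm.one_apply, sub_eq_zero] at h2
      rw [hu, h2, one_mul]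
    have h2 := fam_op oV h1 (fun x hx => hlin x (VO hx)) (fun P x hx => hder P x (VO hx)) (Q ℝ b)
    rw [mem_Nl']
    intro x hx
    filter_upwards [oV.mem_nhds (XV hx)] with y hy
    rw [Sm.sub_apply, h2 y hy, hQ y (VO hy), sub_self]

theorem ck_base (hn : Good Z.n) {m : Fin 5 → Fin 16 → ℤ} (hm : ∀ i, Z.n i = iv (m i)) {c : Fin 5 → ℝ} {θ : E16}
    (R : ROp θ (Q ℝ 0) Set.univ)
    {X : Set E16} (hX : IsClosed X) (pX : PerS X) (hXs : ∀ x ∈ X, ∀ i, x ∈ slab (m i) (c i) (c i)) : Exs θ X := by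
  intro T hT hc
  obtain ⟨u0, hu0⟩ : ∃ u0, u0 = R.R (T 0) := ⟨_, rfl⟩
  have q0 : u0 ∈ QP θ := hu0 ▸ R.qp _ (hT 0)
  have e0 : op (Q ℝ 0) u0 = T 0 := by rw [hu0, ← R.comm, R.inv _ (hT 0)]
  obtain ⟨u, qu, hu⟩ := ck_harm hn hm hX pX hXs (S := fun a => T a - op (Q ℝ a) u0)
    (fun a => Submodule.sub_mem _ (hT a) (QP_op _ q0)) (hc.sub (Clo.D0 _ _)) (by rw [e0, sub_self])
  refine ⟨u + u0, Submodule.add_mem _ qu q0, fun a => ?_⟩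
  have := hu a
  rw [map_add]
  have e : op (Q ℝ a) u + op (Q ℝ a) u0 - T a = op (Q ℝ a) u - (T a - op (Q ℝ a) u0) := by abel
  rw [e]; exact this

end OK

namespace OK
open Finset MvPolynomial
open scoped ContDiff Topology
open MeasureTheory Set

lemma qr_smul {K : Type*} [CommRing K] (q : K) (n : Fin 5 → Fin 16 → K) (a : Fin 10) :
    qr (fun i p => q * n i p) a = C (q ^ 2) * qr n a := by
  have e : (fun p => ∑ i, C (q * n i p) * X i : Fin 16 → P5 K) = fun p => C q * ∑ i, C (n i p) * X i := by
    funext p; rw [Finset.mul_sum]; refine Finset.sum_congr rfl fun i _ => ?_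
    rw [map_mul]; ring
  rw [qr, qr, e, ph_sum, ph_sum, Finset.mul_sum]
  refine Finset.sum_congr rfl fun i _ => ?_
  rw [map_pow]; ring

lemma Good.smul {K : Type*} [Field K] {n : Fin 5 → Fin 16 → K} (h : Good n) {q : K} (hq : q ≠ 0) :
    Good (fun i p => q * n i p) := by
  intro d hd α
  refine (?_ : Rd n d ≤ Rd _ d) (h d hd α)
  rw [Rd, Submodule.span_le]
  rintro _ ⟨k, rfl⟩
  rcases k with ⟨a, γ⟩ | β
  · have h1 : col (fun i p => q * n i p) d (.inl (a, γ)) ∈ Rd (fun i p => q * n i p) d :=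
      Submodule.subset_span ⟨_, rfl⟩
    have h2 := Submodule.smul_mem _ ((q ^ 2)⁻¹) h1
    have e : (q ^ 2)⁻¹ • col (fun i p => q * n i p) d (.inl (a, γ)) = col n d (.inl (a, γ)) := by
      simp only [col, qr_smul, smul_eq_C_mul]
      have : (C (q ^ 2)⁻¹ * C (q ^ 2) : P5 K) = 1 := by
        rw [← map_mul, inv_mul_cancel₀ (pow_ne_zero _ hq), map_one]
      linear_combination (monomial γ.1 1 * qr n a) * this
    rw [← e]; exact h2
  · exact Submodule.subset_span ⟨.inr β, rfl⟩

lemma generic_normals {ι : Type} [Fintype ι] [DecidableEq ι] (c : ι → E16) {ε : ι → ℝ} (hε : ∀ j, 0 < ε j) :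
    ∃ n : ι → Fin 16 → ℚ, (∀ j p, |(n j p : ℝ) - c j p| < ε j) ∧
      ∀ e : Fin 5 → ι, Function.Injective e → Good (fun i p => (n (e i) p : ℝ)) := by
  obtain ⟨G, hG0, hG⟩ := good_generic
  have G0 : G ≠ 0 := by rintro rfl; simp at hG0
  let f : (Fin 5 ↪ ι) → Fin 5 × Fin 16 → ι × Fin 16 := fun e ip => (e ip.1, ip.2)
  have fi : ∀ e, Function.Injective (f e) := by
    rintro e ⟨i, p⟩ ⟨j, q⟩ h
    simp only [f, Prod.mk.injEq, EmbeddingLike.apply_eq_iff_eq] at h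
    exact Prod.ext h.1 h.2
  obtain ⟨H, hH⟩ : ∃ H : MvPolynomial (ι × Fin 16) ℚ, H = ∏ e : Fin 5 ↪ ι, rename (f e) G := ⟨_, rfl⟩
  have H0 : H ≠ 0 := by
    rw [hH, Finset.prod_ne_zero_iff]
    intro e _ h
    exact G0 (rename_injective _ (fi e) (by rw [h, map_zero]))
  let s : ι × Fin 16 → Set ℚ := fun jp => {r | |(r : ℝ) - c jp.1 jp.2| < ε jp.1}
  have hs : ∀ jp, (s jp).Infinite := by
    intro jp
    obtain ⟨r1, h1, h2⟩ := exists_rat_btwn (show c jp.1 jp.2 - ε jp.1 < c jp.1 jp.2 by linarith [hε jp.1])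
    obtain ⟨r2, h3, h4⟩ := exists_rat_btwn (show c jp.1 jp.2 < c jp.1 jp.2 + ε jp.1 by linarith [hε jp.1])
    have : r1 < r2 := by exact_mod_cast h2.trans h3
    refine (Set.Ioo_infinite this).mono ?_
    rintro r ⟨h5, h6⟩
    have h5 : (r1 : ℝ) < r := by exact_mod_cast h5
    have h6 : (r : ℝ) < r2 := by exact_mod_cast h6
    change |(r : ℝ) - c jp.1 jp.2| < ε jp.1
    rw [abs_lt]; constructor <;> linarith
  have hex : ∃ x ∈ Set.pi Set.univ s, eval x H ≠ 0 := by
    by_contra! h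
    exact H0 (MvPolynomial.funext_set s hs (fun x hx => by rw [h x hx, map_zero]))
  obtain ⟨x, hx, hx0⟩ := hex
  refine ⟨fun j p => x (j, p), fun j p => hx (j, p) trivial, fun e he => hG ℝ _ ?_⟩
  rw [hH, map_prod, Finset.prod_ne_zero_iff] at hx0
  have h1 := hx0 ⟨e, he⟩ (Finset.mem_univ _)
  rw [eval_rename] at h1
  have h2 : aeval (fun ip : Fin 5 × Fin 16 => ((x (e ip.1, ip.2) : ℚ) : ℝ)) G = algebraMap ℚ ℝ (eval (x ∘ f ⟨e, he⟩) G) := by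
    rw [← MvPolynomial.aeval_eq_eval]
    change _ = algebraMap ℚ ℝ (aeval (x ∘ f ⟨e, he⟩) G)
    rw [← MvPolynomial.aeval_algebraMap_apply]; rfl
  rw [h2]
  simpa using h1

lemma int_normals {ι : Type} [Fintype ι] [DecidableEq ι] (c : ι → E16) {ε : ι → ℝ} (hε : ∀ j, 0 < ε j) :
    ∃ (q : ℕ) (N : ι → Fin 16 → ℤ), 0 < q ∧ (∀ j p, |(N j p : ℝ) - q * c j p| < q * ε j) ∧
      ∀ e : Fin 5 → ι, Function.Injective e → Good (fun i => iv (N (e i))) := by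
  obtain ⟨n, hn, hg⟩ := generic_normals c hε
  obtain ⟨q, hq⟩ : ∃ q : ℕ, q = ∏ jp : ι × Fin 16, (n jp.1 jp.2).den := ⟨_, rfl⟩
  have q0 : 0 < q := hq ▸ Finset.prod_pos fun jp _ => (n jp.1 jp.2).den_pos
  have hd : ∀ j p, ∃ k : ℤ, (k : ℝ) = q * n j p := by
    intro j p
    have : (n j p).den ∣ q := hq ▸ Finset.dvd_prod_of_mem (fun jp : ι × Fin 16 => (n jp.1 jp.2).den) (Finset.mem_univ (j, p))
    obtain ⟨d, hd⟩ := this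
    refine ⟨d * (n j p).num, ?_⟩
    have h1 : ((n j p).den : ℚ) * n j p = (n j p).num := Rat.den_mul_eq_num _
    have h2 : ((n j p).den : ℝ) * (n j p : ℝ) = (n j p).num := by exact_mod_cast h1
    rw [hd]; push_cast; rw [← h2]; ring
  choose N hN using hd
  refine ⟨q, N, q0, fun j p => ?_, fun e he => ?_⟩
  · rw [hN, ← mul_sub, abs_mul, abs_of_pos (show (0:ℝ) < q by exact_mod_cast q0)]
    exact mul_lt_mul_of_pos_left (hn j p) (by exact_mod_cast q0)
  · have : (fun i => iv (N (e i))) = fun i p => (q : ℝ) * (n (e i) p : ℝ) := by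
      funext i p; rw [iv, hN]
    rw [this]
    exact (hg e he).smul (by exact_mod_cast q0.ne')

end OK

namespace OK
open Finset MvPolynomial
open scoped ContDiff Topology Manifold
open MeasureTheory Set

lemma lf_balls {r : ℝ} : LocallyFinite fun l : Fin 16 → ℤ => Metric.closedBall (iv l) r := by
  intro x
  refine ⟨Metric.ball x 1, Metric.ball_mem_nhds _ one_pos, ?_⟩
  refine (Set.finite_Icc (fun p => ⌊x p - 1 - r⌋) (fun p => ⌈x p + 1 + r⌉)).subset ?_
  rintro l ⟨y, h1, h2⟩
  rw [Metric.mem_closedBall, dist_eq_norm] at h1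
  rw [Metric.mem_ball, dist_eq_norm] at h2
  have h3 : ∀ p, |y p - l p| ≤ r := fun p => (norm_le_pi_norm (y - iv l) p).trans h1
  have h4 : ∀ p, |y p - x p| < 1 := fun p => (norm_le_pi_norm (y - x) p).trans_lt h2
  constructor
  · intro p
    have a1 := abs_le.1 (h3 p)
    have a2 := abs_lt.1 (h4 p)
    have := Int.floor_le (x p - 1 - r)
    have : ((⌊x p - 1 - r⌋ : ℤ) : ℝ) ≤ l p := by linarith
    exact_mod_cast this
  · intro p
    have a1 := abs_le.1 (h3 p)
    have a2 := abs_lt.1 (h4 p)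
    have := Int.le_ceil (x p + 1 + r)
    have : (l p : ℝ) ≤ (⌈x p + 1 + r⌉ : ℤ) := by linarith
    exact_mod_cast this

lemma iv_add (l m : Fin 16 → ℤ) : iv (l + m) = iv l + iv m := by ext p; simp [iv]

lemma iv_norm {l : Fin 16 → ℤ} (h : l ≠ 0) : 1 ≤ ‖iv l‖ := by
  obtain ⟨p, hp⟩ := Function.ne_iff.1 h
  refine le_trans ?_ (norm_le_pi_norm (iv l) p)
  rw [iv, Real.norm_eq_abs]
  have := Int.one_le_abs (show l p ≠ 0 from hp)
  exact_mod_cast this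

/-- quasi-periodization -/
lemma periodize (θ : E16) {r : ℝ} (hr : r < 1 / 2) (T : Sm) (hT : ∀ x, r < ‖x‖ → T x = 0) :
    ∃ S ∈ QP θ, (∀ x, ‖x‖ < 1 / 2 → S x = T x) ∧ ∀ x, (∀ l, r < ‖x + iv l‖) → S x = 0 := by
  obtain ⟨F, hF⟩ : ∃ F : (Fin 16 → ℤ) → E16 → ℂ, F = fun l x =>
    Complex.exp (2 * Real.pi * Complex.I * (θ ⬝ᵥ iv l : ℝ)) * T (x - iv l) := ⟨_, rfl⟩
  have hF0 : ∀ l x, r < ‖x - iv l‖ → F l x = 0 := fun l x h => by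
    rw [hF]; simp only []; rw [hT _ h, mul_zero]
  have h1 : ContDiff ℝ ∞ fun x => ∑ᶠ l, F l x := by
    rw [← contMDiff_iff_contDiff]
    refine contMDiff_finsum (fun l => contMDiff_iff_contDiff.2 ?_) ?_
    · rw [hF]
      exact contDiff_const.mul ((cdS T).comp (contDiff_id.sub contDiff_const))
    · refine (lf_balls (r := r)).subset fun l x hx => ?_
      by_contra h
      rw [Metric.mem_closedBall, dist_eq_norm, not_le] at h
      exact hx (hF0 l x h)
  refine ⟨⟨_, h1⟩, mem_QP.2 fun m x => ?_, fun x hx => ?_, fun x hx => ?_⟩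
  · change ∑ᶠ l, F l (x + iv m) = _ * ∑ᶠ l, F l x
    rw [← smul_eq_mul, smul_finsum]
    · simp only [smul_eq_mul]
      refine finsum_eq_of_bijective (fun l => l - m) (Equiv.subRight m).bijective fun l => ?_
      rw [hF]; simp only []
      have e1 : l = (l - m) + m := by abel
      have e2 : iv l = iv (l - m) + iv m := by rw [← iv_add, ← e1]
      rw [e2, dotProduct_add, ← mul_assoc, ← Complex.exp_add]
      congr 2
      · push_cast; ring
      · rw [add_sub_add_right_eq_sub]
  · change ∑ᶠ l, F l x = _
    rw [finsum_eq_single _ 0]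
    · have e : iv 0 = 0 := by ext p; simp [iv]
      rw [hF]; simp [e]
    · intro l hl
      refine hF0 l x ?_
      have := norm_sub_norm_le (iv l) x
      rw [norm_sub_rev] at this
      have := iv_norm hl
      linarith
  · change ∑ᶠ l, F l x = _
    rw [← finsum_zero (α := Fin 16 → ℤ)]
    refine finsum_congr fun l => hF0 l x ?_
    have := hx (-l)
    have e : iv (-l) = - iv l := by ext p; simp [iv]
    rwa [e, ← sub_eq_add_neg] at this

lemma far_open {r : ℝ} : IsOpen {x : E16 | ∀ l, r < ‖x + iv l‖} := by
  have : {x : E16 | ∀ l, r < ‖x + iv l‖} = (⋃ l : Fin 16 → ℤ, Metric.closedBall (iv l) r)ᶜ := by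
    ext x
    simp only [mem_setOf_eq, mem_compl_iff, mem_iUnion, Metric.mem_closedBall, not_exists, not_le, dist_eq_norm]
    have e : ∀ l, iv (-l) = - iv l := fun l => by ext p; simp [iv]
    constructor
    · intro h l; have := h (-l); rwa [e, ← sub_eq_add_neg] at this
    · intro h l; have := h (-l); rwa [e, sub_neg_eq_add] at this
  rw [this]
  exact (lf_balls.isClosed_iUnion fun l => Metric.isClosed_closedBall).isOpen_compl

lemma Exs_cell {ι : Type} [Fintype ι] [DecidableEq ι] (N : ι → Fin 16 → ℤ)
    (hg : ∀ e : Fin 5 → ι, Function.Injective e → Good (fun i => iv (N (e i))))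
    (a b : ι → ℝ) (hab : ∀ j, a j < b j) (hab1 : ∀ j, b j - a j < 1) :
    ∃ θ, Exs θ (cell N ∅ a Finset.univ a b) := by
  obtain ⟨θ, ⟨R⟩, hR⟩ := exROp N
  refine ⟨θ, Ex_cell N a b hab hab1 hR ?_ Finset.univ ∅ a (by simp) (by simp)⟩
  intro I c hI X hX pX hs
  let e := (Finset.equivFinOfCardEq hI).symm
  have he : Function.Injective (fun i => (e i : ι)) := Subtype.val_injective.comp e.injective
  have hG := hg _ he
  obtain ⟨Z, hZ⟩ := Crd.exists_of_li _ hG.li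
  have hm : ∀ i, Z.n i = iv (N (e i)) := fun i => by rw [hZ]
  exact ck_base (Z := Z) (hZ ▸ hG) hm (c := fun i => c (e i)) R hX pX fun x hx i => hs x hx _ (e i).2

theorem poly_solve {ι : Type} [Fintype ι] [DecidableEq ι] (N : ι → Fin 16 → ℤ)
    (hg : ∀ e : Fin 5 → ι, Function.Injective e → Good (fun i => iv (N (e i))))
    (a b : ι → ℝ) (hab : ∀ j, a j < b j) (ha : ∀ j, -(1 / 4) ≤ a j) (hb : ∀ j, b j ≤ 1 / 4)
    {r : ℝ} (hr : r < 1 / 2) (hN : ∀ j x, ‖x‖ ≤ r → |iv (N j) ⬝ᵥ x| < 1 / 4)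
    (T : Fin 10 → Sm) (hT0 : ∀ a x, r < ‖x‖ → T a x = 0)
    (hT : Clo {x | ‖x‖ ≤ r ∧ ∀ j, a j ≤ iv (N j) ⬝ᵥ x ∧ iv (N j) ⬝ᵥ x ≤ b j} T) :
    ∃ u, Sol {x | ‖x‖ ≤ r ∧ ∀ j, a j ≤ iv (N j) ⬝ᵥ x ∧ iv (N j) ⬝ᵥ x ≤ b j} T u := by
  obtain ⟨θ, hθ⟩ := Exs_cell N hg a b hab (fun j => by linarith [ha j, hb j])
  choose S hSq hS1 hS0 using fun a => periodize θ hr (T a) (hT0 a)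
  have near : ∀ x, ‖x‖ ≤ r → ∀ a, T a - S a ∈ Nl {x} := by
    intro x hx a
    rw [mem_Nl']
    simp only [mem_singleton_iff, forall_eq]
    have : {y : E16 | ‖y‖ < 1 / 2} ∈ 𝓝 x := (isOpen_lt continuous_norm continuous_const).mem_nhds (lt_of_le_of_lt hx hr)
    filter_upwards [this] with y hy
    rw [Sm.sub_apply, hS1 a y hy, sub_self]
  have hc : Clo (cell N ∅ a Finset.univ a b) S := by
    have hq : ∀ i, ∑ a, op (rl ℝ i a) (S a) ∈ QP θ := fun i => Submodule.sum_mem _ fun a _ => QP_op _ (hSq a)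
    suffices h : cell N ∅ a Finset.univ a b ⊆ zs (fun i => ∑ a, op (rl ℝ i a) (S a)) by
      intro i
      rw [Nl_pt]
      exact fun x hx => h hx i
    intro x hx
    by_cases h : ∀ l, r < ‖x + iv l‖
    · refine Clo.of_Nl (X := {x}) fun a => ?_
      rw [mem_Nl']
      simp only [mem_singleton_iff, forall_eq]
      filter_upwards [far_open.mem_nhds h] with y hy
      exact hS0 a y hy
    · push Not at h
      obtain ⟨l, hl⟩ := h
      rw [← (zs_per hq).mem_iff x l]
      refine Clo.congr (Clo.mono hT ?_) (near _ hl)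
      rw [Set.singleton_subset_iff]
      refine ⟨hl, fun j => ?_⟩
      obtain ⟨k, h1, h2⟩ := (cell_per x hx l).2 j (Finset.mem_univ j)
      have h3 := abs_lt.1 (hN j _ hl)
      have h4 := ha j
      have h5 := hb j
      have k0 : k = 0 := by
        have h6 : (k : ℝ) < 1 := by linarith
        have h7 : (-1 : ℝ) < k := by linarith
        have h6 : k < 1 := by exact_mod_cast h6
        have h7 : -1 < k := by exact_mod_cast h7
        omega
      subst k0
      simp only [Int.cast_zero, sub_zero] at h1 h2
      exact ⟨h1, h2⟩
  obtain ⟨u, -, hu⟩ := hθ S hSq hc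
  refine ⟨u, fun c => ?_⟩
  rw [Nl_pt]
  intro x hx
  have h1 : op (Q ℝ c) u - S c ∈ Nl {x} := by
    refine Nl_mono ?_ (hu c)
    rw [Set.singleton_subset_iff]
    exact ⟨fun i hi => by simp at hi, fun j _ => ⟨0, by simpa using (hx.2 j).1, by simpa using (hx.2 j).2⟩⟩
  have e : op (Q ℝ c) u - T c = (op (Q ℝ c) u - S c) - (T c - S c) := by abel
  rw [e]
  exact Submodule.sub_mem _ h1 (near x hx.1 c)

end OK

namespace OK
open Finset MvPolynomial
open scoped ContDiff Topology
open MeasureTheory Set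

/-- dilation -/
def dil (s : ℝ) : Sm →ₗ[ℝ] Sm where
  toFun f := ⟨fun x => f (s • x), (cdS f).comp (contDiff_const_smul s)⟩
  map_add' f g := rfl
  map_smul' c f := rfl

lemma dil_apply (s : ℝ) (f : Sm) (x : E16) : dil s f x = f (s • x) := rfl

def sc (s : ℝ) : PR ℝ →ₐ[ℝ] PR ℝ := aeval fun p => C s * X p

lemma dd_dil (s : ℝ) (v : E16) (f : Sm) : dd v (dil s f) = s • dil s (dd v f) := by
  ext x
  rw [Sm.rsmul_apply, dil_apply, dd_apply, dd_apply]
  have h1 : HasFDerivAt (fun x : E16 => s • x) (s • ContinuousLinearMap.id ℝ E16) x :=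
    (hasFDerivAt_id x).const_smul s
  have h2 := ((diffS f (s • x)).hasFDerivAt.comp x h1).fderiv
  change fderiv ℝ (fun y => f (s • y)) x v = _
  have h3 : (fun y => f (s • y)) = f.1 ∘ fun y => s • y := rfl
  rw [h3, h2]
  simp

lemma op_dil (s : ℝ) (P : PR ℝ) (f : Sm) : op P (dil s f) = dil s (op (sc s P) f) := by
  induction P using MvPolynomial.induction_on generalizing f with
  | C a => rw [op_Cf, sc, aeval_C, algebraMap_eq, op_Cf, map_smul]
  | add p q hp hq => rw [op_add, hp, hq, map_add, op_add, map_add]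
  | mul_X p i hp =>
    rw [op_mul, op_X, dd_dil, map_smul, hp, map_mul, op_mul]
    rw [show sc s (X i) = C s * X i by simp [sc], op_mul, op_Cf, op_X, map_smul, map_smul]

lemma sc_Q (s : ℝ) (a : Fin 10) : sc s (Q ℝ a) = C (s ^ 2) * Q ℝ a := by
  rw [Q, ph_sum, map_sum, Finset.mul_sum]
  refine Finset.sum_congr rfl fun i _ => ?_
  simp only [map_mul, map_intCast, sc, aeval_X, map_pow]; ring

lemma sc_rl (s : ℝ) (i : Fin 16) (a : Fin 10) : sc s (rl ℝ i a) = C s * rl ℝ i a := by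
  simp only [rl, gm, map_mul, map_intCast, sc, aeval_X]; ring

lemma Nl_dil {s : ℝ} {X : Set E16} {f : Sm} (hf : f ∈ Nl X) : dil s f ∈ Nl {x | s • x ∈ X} := by
  rw [mem_Nl'] at *
  intro x hx
  exact (continuous_const_smul s).continuousAt.eventually (hf _ hx)

lemma Clo_dil {s : ℝ} {X : Set E16} {T : Fin 10 → Sm} (h : Clo X T) :
    Clo {x | s • x ∈ X} (fun a => dil s (T a)) := by
  intro i
  have : ∑ a, op (rl ℝ i a) (dil s (T a)) = s • dil s (∑ a, op (rl ℝ i a) (T a)) := by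
    rw [map_sum, Finset.smul_sum]
    refine Finset.sum_congr rfl fun a _ => ?_
    rw [op_dil, sc_rl, op_mul, op_Cf, map_smul]
  rw [this]
  exact Submodule.smul_mem _ _ (Nl_dil (h i))

lemma Sol_dil {s : ℝ} (hs : s ≠ 0) {X : Set E16} {T : Fin 10 → Sm} {u : Sm}
    (h : Sol {x | s • x ∈ X} (fun a => dil s (T a)) u) : Sol X T (s ^ 2 • dil s⁻¹ u) := by
  intro a
  have h1 := Nl_dil (s := s⁻¹) (h a)
  have e1 : {x : E16 | s⁻¹ • x ∈ {x | s • x ∈ X}} = X := by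
    ext x; simp only [mem_setOf_eq, smul_smul, mul_inv_cancel₀ hs, one_smul]
  have e2 : dil s⁻¹ (op (Q ℝ a) u - dil s (T a)) = op (Q ℝ a) (s ^ 2 • dil s⁻¹ u) - T a := by
    rw [map_smul, op_dil, sc_Q, op_mul, op_Cf, map_smul, smul_smul, ← mul_pow, mul_inv_cancel₀ hs, one_pow, one_smul,
      map_sub]
    congr 1
    ext x
    rw [dil_apply, dil_apply, smul_smul, mul_inv_cancel₀ hs, one_smul]
  rwa [e1, e2] at h1

lemma bump (R : ℝ) (hR : 0 < R) : ∃ χ : Sm, χ - 1 ∈ Nl (Metric.ball 0 R) ∧ ∀ x, 2 * R < ‖x‖ → χ x = 0 := by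
  let β : ContDiffBump (0 : E16) := ⟨R, 2 * R, hR, by linarith⟩
  have h : ContDiff ℝ ∞ fun x => ((β x : ℝ) : ℂ) := Complex.ofRealCLM.contDiff.comp β.contDiff
  refine ⟨⟨_, h⟩, mem_Nl'.2 fun x hx => ?_, fun x hx => ?_⟩
  · filter_upwards [Metric.isOpen_ball.mem_nhds hx] with y hy
    change ((β y : ℝ) : ℂ) - 1 = 0
    rw [β.one_of_mem_closedBall (Metric.ball_subset_closedBall hy)]; simp
  · change ((β x : ℝ) : ℂ) = 0
    rw [β.zero_of_le_dist (by rw [dist_zero_right]; exact hx.le)]; simp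

lemma sep {K : Set E16} (hK : IsCompact K) (cK : Convex ℝ K) {y : E16} (hy : y ∉ K) :
    ∃ (n : E16) (g : ℝ), 0 < g ∧ ∀ x ∈ K, n ⬝ᵥ y + g < n ⬝ᵥ x := by
  obtain ⟨f, u, h1, h2⟩ := geometric_hahn_banach_point_closed cK hK.isClosed hy
  refine ⟨fun p => f (Pi.single p 1), u - f y, by linarith, fun x hx => ?_⟩
  have e : ∀ x, (fun p => f (Pi.single p 1)) ⬝ᵥ x = f x := by
    intro x
    have : x = ∑ p, x p • (Pi.single p 1 : E16) := by
      ext q; simp [Finset.sum_apply, Pi.single_apply]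
    conv_rhs => rw [this, map_sum]
    simp [dotProduct, mul_comm]
  rw [e, e]
  linarith [h2 x hx]

theorem local_solve {K O : Set E16} (hK : IsCompact K) (cK : Convex ℝ K) (oO : IsOpen O) (KO : K ⊆ O)
    {T : Fin 10 → Sm} (hT : Clo O T) : ∃ u, Sol K T u := by
  classical
  obtain ⟨R0, hR0⟩ := hK.isBounded.subset_ball 0
  obtain ⟨R, hR, hKR⟩ : ∃ R > 0, K ⊆ Metric.ball 0 R :=
    ⟨max R0 1, by positivity, hR0.trans (Metric.ball_subset_ball (le_max_left _ _))⟩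
  obtain ⟨S, hS⟩ : ∃ S, S = Metric.closedBall (0 : E16) (2 * R) \ (O ∩ Metric.ball 0 R) := ⟨_, rfl⟩
  have cS : IsCompact S := hS ▸ (isCompact_closedBall _ _).diff (oO.inter Metric.isOpen_ball)
  have hSK : ∀ y ∈ S, y ∉ K := fun y hy hk => by rw [hS] at hy; exact hy.2 ⟨KO hk, hKR hk⟩
  choose! c g hg hsep using fun y (hy : y ∈ S) => sep hK cK (hSK y hy)
  obtain ⟨t, htS, ht⟩ := cS.elim_nhds_subcover (fun y => {z | c y ⬝ᵥ z < c y ⬝ᵥ y + g y / 4}) (fun y hy => by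
    refine (isOpen_lt (cont_dot _) continuous_const).mem_nhds ?_
    change c y ⬝ᵥ y < c y ⬝ᵥ y + g y / 4
    linarith [hg y hy])
  obtain ⟨q, N, q0, hN, hG⟩ := int_normals (fun j : t => c j) (ε := fun j => g j / (128 * R))
    (fun j => div_pos (hg j (htS j j.2)) (by positivity))
  have q0' : (0 : ℝ) < q := by exact_mod_cast q0
  have hdiff : ∀ (j : t) x, ‖x‖ ≤ 2 * R → |iv (N j) ⬝ᵥ x - q * (c j ⬝ᵥ x)| ≤ q * (g j / 4) := by
    intro j x hx
    have e : iv (N j) ⬝ᵥ x - q * (c j ⬝ᵥ x) = ∑ p, (N j p - q * c j p) * x p := by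
      simp only [dotProduct, iv, Finset.mul_sum, ← Finset.sum_sub_distrib]
      refine Finset.sum_congr rfl fun p _ => by ring
    rw [e]
    calc _ ≤ ∑ p, |(N j p - q * c j p) * x p| := Finset.abs_sum_le_sum_abs _ _
      _ ≤ ∑ p : Fin 16, q * (g j / (128 * R)) * (2 * R) := by
        refine Finset.sum_le_sum fun p _ => ?_
        rw [abs_mul]
        exact mul_le_mul (hN j p).le ((norm_le_pi_norm x p).trans hx) (abs_nonneg _)
          ((abs_nonneg _).trans (hN j p).le)
      _ = _ := by
        rw [Finset.sum_const, Finset.card_univ, Fintype.card_fin, nsmul_eq_mul]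
        field_simp; norm_num; ring
  obtain ⟨a, ha⟩ : ∃ a : t → ℝ, a = fun j : t => (q : ℝ) * (c j.1 ⬝ᵥ j.1 + g j.1 / 2) := ⟨_, rfl⟩
  have hKa : ∀ (j : t), ∀ x ∈ K, a j < iv (N j) ⬝ᵥ x := by
    intro j x hx
    have h1 := abs_le.1 (hdiff j x (by have := hKR hx; rw [mem_ball_zero_iff] at this; linarith))
    have h2 := mul_lt_mul_of_pos_left (hsep j (htS j j.2) x hx) q0'
    have h3 := mul_pos q0' (hg j (htS j j.2))
    rw [ha]; simp only []
    nlinarith [h1.1, h2, h3]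
  have hSa : ∀ x, ‖x‖ ≤ 2 * R → (∀ j : t, a j ≤ iv (N j) ⬝ᵥ x) → x ∈ O ∩ Metric.ball 0 R := by
    intro x hx h
    by_contra hxn
    have hxS : x ∈ S := by rw [hS]; exact ⟨by rwa [mem_closedBall_zero_iff], hxn⟩
    obtain ⟨j, hj, hxj⟩ := Set.mem_iUnion₂.1 (ht hxS)
    have h1 := abs_le.1 (hdiff ⟨j, hj⟩ x hx)
    have h2 := h ⟨j, hj⟩
    have hxj : c j ⬝ᵥ x < c j ⬝ᵥ j + g j / 4 := hxj
    have h3 := mul_lt_mul_of_pos_left hxj q0'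
    rw [ha] at h2; simp only [] at h2 h1
    nlinarith [h1.2, h2, h3]
  choose ν ν0 hν using fun j : t => dot_bound (iv (N j))
  obtain ⟨b, hb⟩ : ∃ b : t → ℝ, b = fun j => |a j| + ν j * (2 * R) + 1 := ⟨_, rfl⟩
  have b0 : ∀ j, |a j| + ν j * (2 * R) < b j := fun j => by rw [hb]; simp only []; linarith
  have bp : ∀ j, 0 < b j := fun j => lt_of_le_of_lt (by have := ν0 j; positivity) (b0 j)
  have hxb : ∀ j x, ‖x‖ ≤ 2 * R → |iv (N j) ⬝ᵥ x| ≤ ν j * (2 * R) := fun j x hx =>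
    (hν j x).trans (mul_le_mul_of_nonneg_left hx (ν0 j))
  obtain ⟨s, s0, hs1, hs2⟩ : ∃ s : ℝ, 0 < s ∧ 4 * R < s ∧ ∀ j, 4 * b j < s := by
    have h1 : 0 ≤ ∑ j, 4 * b j := Finset.sum_nonneg fun j _ => by linarith [bp j]
    refine ⟨1 + 4 * R + ∑ j, 4 * b j, by positivity, by linarith, fun j => ?_⟩
    have := Finset.single_le_sum (f := fun j => 4 * b j) (fun j _ => by linarith [bp j]) (mem_univ j)
    linarith
  obtain ⟨χ, χ1, χ0⟩ := bump R hR
  have nrm : ∀ x : E16, ‖x‖ ≤ 2 * R / s ↔ ‖s • x‖ ≤ 2 * R := fun x => by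
    rw [norm_smul, Real.norm_of_nonneg s0.le, le_div_iff₀ s0, mul_comm]
  have dts : ∀ j (x : E16), iv (N j) ⬝ᵥ x = (iv (N j) ⬝ᵥ (s • x)) / s := fun j x => by
    rw [dotProduct_smul, smul_eq_mul]; field_simp
  have hps := poly_solve N hG (fun j => a j / s) (fun j => b j / s)
    (fun j => by
      refine div_lt_div_of_pos_right ?_ s0
      have := b0 j; have := le_abs_self (a j); have := mul_nonneg (ν0 j) hR.le; nlinarith)
    (fun j => by
      rw [le_div_iff₀ s0]
      have := b0 j; have := neg_abs_le (a j); have := mul_nonneg (ν0 j) hR.le; have := hs2 j; nlinarith)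
    (fun j => by rw [div_le_iff₀ s0]; linarith [hs2 j])
    (r := 2 * R / s) (by rw [div_lt_iff₀ s0]; linarith)
    (fun j x hx => by
      rw [nrm] at hx
      rw [dts, abs_div, abs_of_pos s0, div_lt_iff₀ s0]
      have := hxb j _ hx; have := b0 j; have := abs_nonneg (a j); have := hs2 j; linarith)
    (fun c => dil s (χ * T c))
    (fun c x hx => by
      rw [dil_apply, Sm.mul_apply, χ0, zero_mul]
      by_contra h
      exact absurd ((nrm x).2 (not_lt.1 h)) (not_le.2 hx))
    (by
      have h1 : Clo (O ∩ Metric.ball 0 R) (fun c => χ * T c) := by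
        refine (hT.mono Set.inter_subset_left).congr fun c => ?_
        have e : T c - χ * T c = -(T c * (χ - 1)) := by ring
        rw [e]
        exact Submodule.neg_mem _ (Nl_mul _ (Nl_mono Set.inter_subset_right χ1))
      refine (Clo_dil (s := s) h1).mono ?_
      rintro x ⟨hx, h⟩
      refine hSa _ ((nrm x).1 hx) fun j => ?_
      have := (h j).1
      rw [dts] at this
      exact (div_le_div_iff_of_pos_right s0).1 this)
  obtain ⟨u, hu⟩ := hps
  refine ⟨s ^ 2 • dil s⁻¹ u, ?_⟩
  have h2 : Sol {x | s • x ∈ K} (fun c => dil s (χ * T c)) u := by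
    intro c
    refine Nl_mono ?_ (hu c)
    intro x hx
    have hx : s • x ∈ K := hx
    have hx2 : ‖s • x‖ ≤ 2 * R := by have := hKR hx; rw [mem_ball_zero_iff] at this; linarith
    refine ⟨(nrm x).2 hx2, fun j => ?_⟩
    rw [dts]
    refine ⟨div_le_div_of_nonneg_right (hKa j _ hx).le s0.le, div_le_div_of_nonneg_right ?_ s0.le⟩
    have := hxb j _ hx2; have := le_abs_self (iv (N j) ⬝ᵥ (s • x)); have := b0 j; have := abs_nonneg (a j)
    linarith
  intro c
  have h3 := Sol_dil s0.ne' h2 c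
  have e : op (Q ℝ c) (s ^ 2 • dil s⁻¹ u) - T c = (op (Q ℝ c) (s ^ 2 • dil s⁻¹ u) - χ * T c) + T c * (χ - 1) := by ring
  rw [e]
  exact Submodule.add_mem _ h3 (Nl_mul _ (Nl_mono hKR χ1))

end OK

namespace OK
open Finset MvPolynomial
open scoped ContDiff Topology
open MeasureTheory Set

section
variable (E : PR ℝ →ₗ[ℝ] ℂ) (x0 : E16)

/-- polynomial solutions -/
def pH (k : ℕ) (P : PR ℝ) (x : E16) : ℂ := E (lin (x - x0) ^ k * P)

lemma pH_succ (k : ℕ) (P : PR ℝ) (x : E16) :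
    pH E x0 (k + 1) P x = ∑ q, ((x q - x0 q : ℝ) : ℂ) * pH E x0 k (X q * P) x := by
  have : lin (x - x0) ^ (k + 1) * P = ∑ q, (x q - x0 q) • (lin (x - x0) ^ k * (X q * P)) := by
    rw [pow_succ, mul_assoc]
    nth_rewrite 2 [lin]
    rw [Finset.sum_mul, Finset.mul_sum]
    refine Finset.sum_congr rfl fun q _ => ?_
    rw [smul_eq_C_mul, Pi.sub_apply]; ring
  rw [pH, this, map_sum]
  refine Finset.sum_congr rfl fun q _ => ?_
  rw [map_smul, Complex.real_smul, pH]

lemma pH_deriv (k : ℕ) : ∀ (P : PR ℝ) (x : E16),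
    HasFDerivAt (pH E x0 k P) (gr fun p => pH E x0 (k - 1) (C (k : ℝ) * X p * P) x) x := by
  induction k with
  | zero =>
    intro P x
    have h1 : pH E x0 0 P = fun _ => E P := by funext y; simp [pH]
    have h2 : (fun p => pH E x0 (0 - 1) (C ((0 : ℕ) : ℝ) * X p * P) x) = fun _ => 0 := by
      funext p; simp [pH]
    rw [h1, h2]
    refine (hasFDerivAt_const _ _).congr_fderiv (ContinuousLinearMap.ext fun v => ?_)
    simp [gr_apply]
  | succ k ih =>
    intro P x
    have h1 : pH E x0 (k + 1) P = fun x => ∑ q, ((x q - x0 q : ℝ) : ℂ) * pH E x0 k (X q * P) x := by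
      funext y; exact pH_succ E x0 k P y
    have h2 : ∀ q : Fin 16, HasFDerivAt (fun x : E16 => ((x q - x0 q : ℝ) : ℂ))
        (Complex.ofRealCLM.comp (ContinuousLinearMap.proj (R := ℝ) (φ := fun _ : Fin 16 => ℝ) q)) x := fun q =>
      Complex.ofRealCLM.hasFDerivAt.comp x ((hasFDerivAt_apply q x).sub_const _)
    have h3 := HasFDerivAt.fun_sum (u := Finset.univ) (fun q _ => (h2 q).mul (ih (X q * P) x))
    rw [h1]
    refine h3.congr_fderiv (ContinuousLinearMap.ext fun v => ?_)
    simp only [ContinuousLinearMap.sum_apply, ContinuousLinearMap.add_apply, ContinuousLinearMap.smul_apply,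
      ContinuousLinearMap.comp_apply, ContinuousLinearMap.proj_apply, Complex.ofRealCLM_apply, smul_eq_mul, gr_apply,
      Nat.add_sub_cancel]
    have h4 : ∀ p, ∑ q, ((x q - x0 q : ℝ) : ℂ) * pH E x0 (k - 1) (C (k : ℝ) * X p * (X q * P)) x
        = pH E x0 k (C (k : ℝ) * X p * P) x := by
      intro p
      cases k with
      | zero => simp [pH]
      | succ k =>
        rw [pH_succ]
        refine Finset.sum_congr rfl fun q _ => ?_
        congr 2
        ring
    rw [Finset.sum_add_distrib]
    simp only [Finset.mul_sum]
    rw [Finset.sum_comm, ← Finset.sum_add_distrib]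
    refine Finset.sum_congr rfl fun p _ => ?_
    have h5 : ∑ q, ((x q - x0 q : ℝ) : ℂ) * ((v p : ℂ) * pH E x0 (k - 1) (C (k : ℝ) * X p * (X q * P)) x)
        = (v p : ℂ) * pH E x0 k (C (k : ℝ) * X p * P) x := by
      rw [← h4, Finset.mul_sum]
      exact Finset.sum_congr rfl fun q _ => by ring
    rw [h5]
    have h6 : pH E x0 k (C ((k + 1 : ℕ) : ℝ) * X p * P) x = pH E x0 k (C (k : ℝ) * X p * P) x + pH E x0 k (X p * P) x := by
      rw [pH, pH, pH, ← map_add]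
      congr 1
      push_cast
      rw [map_add, map_one]; ring
    rw [h6]; ring

lemma pH_cd (k : ℕ) (P : PR ℝ) : ContDiff ℝ ∞ (pH E x0 k P) :=
  fam_S (fun p (kP : ℕ × PR ℝ) => (kP.1 - 1, C (kP.1 : ℝ) * X p * kP.2)) (fun kP => pH E x0 kP.1 kP.2)
    (fun kP x => pH_deriv E x0 kP.1 kP.2 x) (k, P)

/-- smooth version -/
def pS (k : ℕ) (P : PR ℝ) : Sm := ⟨pH E x0 k P, pH_cd E x0 k P⟩

lemma op_pS_X (k : ℕ) (P : PR ℝ) (p : Fin 16) : op (X p) (pS E x0 k P) = pS E x0 (k - 1) (C (k : ℝ) * X p * P) := by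
  rw [op_X]
  ext x
  rw [dd_apply]
  have := (pH_deriv E x0 k P x).fderiv
  change fderiv ℝ (pH E x0 k P) x _ = pH E x0 (k - 1) (C (k : ℝ) * X p * P) x
  rw [this, gr_single]

lemma op_pS_Q (h : ∀ a P, E (P * Q ℝ a) = 0) (k : ℕ) (a : Fin 10) : op (Q ℝ a) (pS E x0 k 1) = 0 := by
  ext x
  have e : op (Q ℝ a) (pS E x0 k 1) x = pH E x0 (k - 1 - 1) (C (k : ℝ) * C ((k - 1 : ℕ) : ℝ) * Q ℝ a) x := by
    rw [Q, ph_sum, op_sum, Sm.sum_apply]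
    rw [Finset.mul_sum, pH, Finset.mul_sum, map_sum]
    refine Finset.sum_congr rfl fun i _ => ?_
    have e1 : (X i * ((sg a i : PR ℝ) * X (sh a i)) : PR ℝ) = C ((sg a i : ℤ) : ℝ) * (X i * X (sh a i)) := by
      rw [map_intCast]; ring
    rw [e1, op_mul, op_mul, op_pS_X, op_pS_X, op_Cf, Sm.rsmul_apply]
    have e2 : lin (x - x0) ^ (k - 1 - 1) * (C (k : ℝ) * C ((k - 1 : ℕ) : ℝ) * (C ((sg a i : ℤ) : ℝ) * (X i * X (sh a i))))
      = ((sg a i : ℤ) : ℝ) • (lin (x - x0) ^ (k - 1 - 1) * (C ((k - 1 : ℕ) : ℝ) * X i * (C (k : ℝ) * X (sh a i) * 1))) := by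
      rw [smul_eq_C_mul]; ring
    rw [e2, map_smul, Complex.real_smul]; rfl
  rw [e, pH, ← mul_assoc, h]; rfl
end

/-- uniformly approximable by global solutions -/
def Apx (K : Set E16) (h : E16 → ℂ) : Prop :=
  ∀ ε > 0, ∃ g : Sm, (∀ a, op (Q ℝ a) g = 0) ∧ ∀ x ∈ K, ‖h x - g x‖ ≤ ε

lemma Apx.lim {K : Set E16} {h : E16 → ℂ} (H : ∀ ε > 0, ∃ h', Apx K h' ∧ ∀ x ∈ K, ‖h x - h' x‖ ≤ ε) : Apx K h := by
  intro ε hε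
  obtain ⟨h', h1, h2⟩ := H (ε / 2) (by positivity)
  obtain ⟨g, hg, h3⟩ := h1 (ε / 2) (by positivity)
  refine ⟨g, hg, fun x hx => ?_⟩
  have := norm_add_le (h x - h' x) (h' x - g x)
  rw [sub_add_sub_cancel] at this
  linarith [h2 x hx, h3 x hx]

lemma Apx.add {K : Set E16} {h h' : E16 → ℂ} (H : Apx K h) (H' : Apx K h') : Apx K (fun x => h x + h' x) := by
  intro ε hε
  obtain ⟨g, hg, h1⟩ := H (ε / 2) (by positivity)
  obtain ⟨g', hg', h2⟩ := H' (ε / 2) (by positivity)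
  refine ⟨g + g', fun a => by rw [map_add, hg, hg', add_zero], fun x hx => ?_⟩
  have := norm_add_le (h x - g x) (h' x - g' x)
  rw [Sm.add_apply, add_sub_add_comm]
  linarith [h1 x hx, h2 x hx]

lemma Apx.smul {K : Set E16} {h : E16 → ℂ} (H : Apx K h) (c : ℂ) : Apx K (fun x => c * h x) := by
  intro ε hε
  obtain ⟨g, hg, h1⟩ := H (ε / (‖c‖ + 1)) (by positivity)
  refine ⟨c • g, fun a => by rw [← smul_op, hg, smul_zero], fun x hx => ?_⟩
  rw [Sm.smul_apply, ← mul_sub, norm_mul]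
  have := h1 x hx
  calc ‖c‖ * ‖h x - g x‖ ≤ (‖c‖ + 1) * (ε / (‖c‖ + 1)) := by gcongr; linarith
    _ = ε := by field_simp

lemma Apx.zero {K : Set E16} : Apx K (fun _ => 0) := fun ε hε =>
  ⟨0, fun a => map_zero _, fun x _ => by simpa [Sm.zero_apply] using hε.le⟩

lemma Apx.sum {K : Set E16} {ι : Type*} (s : Finset ι) {h : ι → E16 → ℂ} (H : ∀ i, Apx K (h i)) :
    Apx K (fun x => ∑ i ∈ s, h i x) := by
  classical
  induction s using Finset.induction_on with
  | empty => simpa using Apx.zero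
  | insert i s hi ih => simp only [Finset.sum_insert hi]; exact (H i).add ih

theorem runge {K : Set E16} (hK : IsCompact K) (cK : Convex ℝ K) {f : Sm} (hf : ∀ a, op (Q ℝ a) f ∈ Nl K) : Apx K f := by
  rcases K.eq_empty_or_nonempty with rfl | ⟨x0, hx0⟩
  · exact fun ε hε => ⟨0, fun a => map_zero _, fun x hx => by simp at hx⟩
  -- analytic bounds
  obtain ⟨A, B, L, hA, hB, hL, hb, hw⟩ : ∃ A B L : ℝ, 0 ≤ A ∧ 1 ≤ B ∧ 1 ≤ L ∧ (∀ x ∈ K, ∀ P d, P.totalDegree ≤ d →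
      ‖op P f x‖ ≤ A * l1 P * B ^ d * d.factorial) ∧ ∀ x ∈ K, l1 (lin (x - x0)) ≤ L := by
    obtain ⟨C, hC, hh⟩ := harm_poly
    obtain ⟨G, hG⟩ : ∃ G, G = zs (fun a => op (Q ℝ a) f) := ⟨_, rfl⟩
    have oG : IsOpen G := hG ▸ zs_open _
    have KG : K ⊆ G := fun x hx => by rw [hG]; exact fun a => Nl_pt.1 (hf a) x hx
    obtain ⟨δ, hδ, hs⟩ := hK.exists_thickening_subset_open oG KG
    obtain ⟨M, hM⟩ := (hK.cthickening (r := 1)).exists_bound_of_continuousOn (contS f).continuousOn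
    obtain ⟨D, hD⟩ := hK.isBounded.subset_closedBall x0
    have M0 : 0 ≤ M := (norm_nonneg _).trans (hM x0 (Metric.self_subset_cthickening K hx0))
    have h1 : 0 < min δ 1 := by positivity
    refine ⟨M, C / min δ 1, 16 * |D| + 1, M0, ?_, by have := abs_nonneg D; linarith, fun x hx P d hP => ?_, fun x hx => ?_⟩
    · rw [le_div_iff₀ h1, one_mul]; exact (min_le_right _ _).trans hC
    · have := hh f x (min δ 1) M h1 (min_le_right _ _) (fun y hy => ?_) (fun y hy => ?_) P d hP
      · refine this.trans (le_of_eq ?_); ring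
      · have : y ∈ G := hs (Metric.mem_thickening_iff.2 ⟨x, hx, (Metric.mem_ball.1 hy).trans_le (min_le_left _ _)⟩)
        rw [hG] at this
        exact Nl_mem (this 0) rfl
      · refine hM y (Metric.thickening_subset_cthickening _ _ (Metric.mem_thickening_iff.2 ⟨x, hx, ?_⟩))
        exact (Metric.mem_ball.1 hy).trans_le (min_le_right _ _)
    · refine (l1_lin _).trans ?_
      have := hD hx
      rw [Metric.mem_closedBall, dist_eq_norm] at this
      have := le_abs_self D
      linarith
  have hseg : ∀ x ∈ K, ∀ t ∈ Set.Icc (0:ℝ) 1, x0 + t • (x - x0) ∈ K := by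
    intro x hx t ht
    have := cK hx0 hx (sub_nonneg.2 ht.2) ht.1 (by ring)
    convert this using 1
    rw [smul_sub, sub_smul, one_smul]; abel
  have B0 : 0 < B := by linarith
  have L0 : 0 < L := by linarith
  obtain ⟨h, hh⟩ : ∃ h : ℕ → ℝ → E16 → ℂ, h = fun k t x => op (lin (x - x0) ^ k) f (x0 + t • (x - x0)) := ⟨_, rfl⟩
  have hbd : ∀ k n x, x ∈ K → ∀ t ∈ Set.Icc (0:ℝ) 1, ‖h (k + n) t x‖ ≤ A * (2 * B * L) ^ k * k.factorial * (2 * B * L) ^ n * n.factorial := by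
    intro k n x hx t ht
    rw [hh]
    have h1 := hb _ (hseg x hx t ht) (lin (x - x0) ^ (k + n)) (k + n) (by
      have := totalDegree_lin_pow 1 (x - x0) (k + n); simpa using this)
    refine h1.trans ?_
    have h2 := fact_add_le k n
    have h3 : l1 (lin (x - x0) ^ (k + n)) ≤ L ^ (k + n) :=
      (l1_pow _ _).trans (pow_le_pow_left₀ (l1_nonneg _) (hw x hx) _)
    calc _ ≤ A * L ^ (k + n) * B ^ (k + n) * (2 ^ (k + n) * k.factorial * n.factorial) := by gcongr
      _ = _ := by rw [mul_pow, mul_pow, mul_pow, mul_pow, pow_add, pow_add, pow_add]; ring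
  obtain ⟨M, hM⟩ := exists_nat_gt (4 * B * L)
  have M0 : (0 : ℝ) < M := lt_trans (by positivity) hM
  obtain ⟨δ, hδ⟩ : ∃ δ : ℝ, δ = 1 / M := ⟨_, rfl⟩
  have δ0 : 0 < δ := by rw [hδ]; positivity
  have hδ2 : 2 * B * L * δ ≤ 1 / 2 := by
    rw [hδ, mul_one_div, div_le_iff₀ M0]; linarith
  have step : ∀ k t x, x ∈ K → 0 ≤ t → t + δ ≤ 1 →
      HasSum (fun n : ℕ => (n.factorial : ℂ)⁻¹ * ((δ : ℂ) ^ n * h (k + n) t x)) (h k (t + δ) x) := by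
    intro k t x hx ht htδ
    have key := taylor_chain (φ := fun n τ => (δ : ℂ) ^ n * h (k + n) (t + τ * δ) x)
      (A := A * (2 * B * L) ^ k * k.factorial) (c := 1 / 2) ?_ (by norm_num) (by norm_num) ?_
    · simpa using key
    · intro n τ _
      rw [hh]
      have h1 : HasDerivAt (fun τ : ℝ => x0 + (t + τ * δ) • (x - x0)) (δ • (x - x0)) τ := by
        have : HasDerivAt (fun τ : ℝ => t + τ * δ) δ τ := by
          simpa using ((hasDerivAt_id τ).mul_const δ).const_add t
        exact (this.smul_const (x - x0)).const_add x0
      have h2 := (diffS (op (lin (x - x0) ^ (k + n)) f) (x0 + (t + τ * δ) • (x - x0))).hasFDerivAt.comp_hasDerivAt τ h1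
      have h3 := h2.const_mul ((δ : ℂ) ^ n)
      refine h3.congr_deriv ?_
      have e : k + (n + 1) = (k + n) + 1 := by ring
      rw [e]
      beta_reduce
      rw [pow_succ' (lin (x - x0)), op_mul, op_lin, dd_apply, map_smul, Complex.real_smul]
      ring
    · intro n τ hτ
      rw [norm_mul, norm_pow, Complex.norm_real, Real.norm_of_nonneg δ0.le]
      have h1 := hbd k n x hx (t + τ * δ) ⟨by have := hτ.1; positivity, by nlinarith [hτ.2]⟩
      calc _ ≤ δ ^ n * (A * (2 * B * L) ^ k * k.factorial * (2 * B * L) ^ n * n.factorial) := by gcongr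
        _ = A * (2 * B * L) ^ k * k.factorial * (2 * B * L * δ) ^ n * n.factorial := by rw [mul_pow _ δ]; ring
        _ ≤ _ := by gcongr
  have main : ∀ m : ℕ, m ≤ M → ∀ k, Apx K (h k (m * δ)) := by
    intro m
    induction m with
    | zero =>
      intro _ k ε hε
      obtain ⟨E, hE⟩ : ∃ E : PR ℝ →ₗ[ℝ] ℂ, ∀ P, E P = op P f x0 :=
        ⟨⟨⟨fun P => op P f x0, fun P R => by rw [op_add, Sm.add_apply]⟩, fun c P => by
          change op (c • P) f x0 = c • op P f x0
          rw [smul_eq_C_mul, op_mul, op_Cf, Sm.rsmul_apply]; simp⟩, fun P => rfl⟩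
      refine ⟨pS E x0 k 1, op_pS_Q E x0 (fun a P => ?_) k, fun x hx => ?_⟩
      · rw [hE, op_mul]
        exact Nl_mem (Nl_op P (hf a)) hx0
      · have : h k ((0 : ℕ) * δ) x = pS E x0 k 1 x := by
          change _ = E (lin (x - x0) ^ k * 1)
          rw [hE, hh]; simp
        rw [this, sub_self, norm_zero]; exact hε.le
    | succ m ih =>
      intro hm k
      have hm' : (m : ℝ) * δ + δ ≤ 1 := by
        have : ((m + 1 : ℕ) : ℝ) ≤ M := by exact_mod_cast hm
        rw [hδ]; rw [← add_one_mul, mul_one_div, div_le_one M0]; exact_mod_cast hm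
      have e : ((m + 1 : ℕ) : ℝ) * δ = m * δ + δ := by push_cast; ring
      rw [e]
      refine Apx.lim fun ε hε => ?_
      obtain ⟨A', hA'⟩ : ∃ A' : ℝ, A' = A * (2 * B * L) ^ k * k.factorial := ⟨_, rfl⟩
      have A0 : 0 ≤ A' := hA' ▸ by positivity
      obtain ⟨n, hn⟩ : ∃ n : ℕ, A' * 2 * (1 / 2 : ℝ) ^ n < ε := by
        obtain ⟨n, hn⟩ := exists_pow_lt_of_lt_one (show 0 < ε / (A' * 2 + 1) by positivity) (show (1/2 : ℝ) < 1 by norm_num)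
        refine ⟨n, ?_⟩
        rw [lt_div_iff₀ (by positivity)] at hn
        have : 0 < (1/2 : ℝ) ^ n := by positivity
        nlinarith
      refine ⟨fun x => ∑ i ∈ Finset.range n, ((i.factorial : ℂ)⁻¹ * (δ : ℂ) ^ i) * h (k + i) (m * δ) x,
        Apx.sum _ fun i => (ih (by omega) (k + i)).smul _, fun x hx => ?_⟩
      have h1 := step k (m * δ) x hx (by positivity) hm'
      have hT : ∀ i : ℕ, ‖(i.factorial : ℂ)⁻¹ * ((δ : ℂ) ^ i * h (k + i) (m * δ) x)‖ ≤ A' * (1 / 2) ^ i := by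
        intro i
        rw [norm_mul, norm_mul, norm_pow, Complex.norm_real, Real.norm_of_nonneg δ0.le, norm_inv, Complex.norm_natCast]
        have h2 := hbd k i x hx (m * δ) ⟨by positivity, by linarith⟩
        have h3 : (0:ℝ) < i.factorial := by exact_mod_cast i.factorial_pos
        rw [inv_mul_le_iff₀ h3]
        calc _ ≤ δ ^ i * (A * (2 * B * L) ^ k * k.factorial * (2 * B * L) ^ i * i.factorial) := by gcongr
          _ = i.factorial * (A' * (2 * B * L * δ) ^ i) := by rw [mul_pow _ δ, hA']; ring
          _ ≤ _ := by gcongr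
      have h4 := dist_le_of_le_geometric_of_tendsto (r := 1/2) (C := A') (by norm_num)
        (f := fun n => ∑ i ∈ Finset.range n, (i.factorial : ℂ)⁻¹ * ((δ : ℂ) ^ i * h (k + i) (m * δ) x)) (fun n => by
          rw [Finset.sum_range_succ, dist_self_add_right]; exact hT n) h1.tendsto_sum_nat n
      rw [dist_comm, dist_eq_norm] at h4
      simp only [mul_assoc]
      refine h4.trans (le_trans (le_of_eq ?_) hn.le)
      ring
  have h1 := main M le_rfl 0
  have h2 : h 0 (M * δ) = f := by
    rw [hh, hδ]; funext x
    have : (M : ℝ) * (1 / M) = 1 := by field_simp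
    rw [this]; simp [op_one]
  rwa [h2] at h1

end OK

namespace OK
open Finset MvPolynomial
open scoped ContDiff Topology
open MeasureTheory Set
open scoped Manifold

lemma exhaust {Ω : Set E16} (hO : IsOpen Ω) (hc : Convex ℝ Ω) : ∃ (K : ℕ → Set E16) (r : ℕ → ℝ),
    (∀ j, IsCompact (K j)) ∧ (∀ j, Convex ℝ (K j)) ∧ (∀ j, K j ⊆ Ω) ∧ (∀ j, 0 < r j) ∧ (∀ j, r j ≤ 1) ∧
    (∀ j, ∀ x ∈ K j, Metric.ball x (r j) ⊆ K (j + 1)) ∧ ∀ x ∈ Ω, ∃ j, x ∈ K j := by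
  obtain ⟨s, hs⟩ : ∃ s : ℕ → ℝ, s = fun j : ℕ => 1 / ((j : ℝ) + 1) := ⟨_, rfl⟩
  have s0 : ∀ j, 0 < s j := fun j => by rw [hs]; positivity
  have s1 : ∀ j, s (j + 1) < s j := fun j => by
    rw [hs]; push_cast
    exact one_div_lt_one_div_of_lt (by positivity) (by linarith)
  have s2 : ∀ j, s j ≤ 1 := fun j => by
    rw [hs]; simp only []
    rw [div_le_one (by positivity)]; linarith [Nat.cast_nonneg (α := ℝ) j]
  refine ⟨fun j => Metric.closedBall 0 j ∩ {x | Metric.ball x (s j) ⊆ Ω}, fun j => s j - s (j + 1),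
    fun j => ?_, fun j => ?_, fun j x hx => hx.2 (Metric.mem_ball_self (s0 j)), fun j => by linarith [s1 j],
    fun j => by linarith [s2 j, s0 (j + 1)], fun j x hx y hy => ⟨?_, fun z hz => hx.2 ?_⟩, fun x hx => ?_⟩
  · refine (isCompact_closedBall _ _).inter_right ?_
    have : {x | Metric.ball x (s j) ⊆ Ω} = (⋃ y ∈ Ωᶜ, Metric.ball y (s j))ᶜ := by
      ext x
      simp only [mem_setOf_eq, mem_compl_iff, mem_iUnion, exists_prop, not_exists, not_and]
      constructor
      · intro h y hy hx; exact hy (h (by rw [Metric.mem_ball_comm]; exact hx))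
      · intro h y hy; by_contra hn
        exact h y hn (by rw [Metric.mem_ball_comm]; exact hy)
    rw [this]
    exact (isOpen_biUnion fun y _ => Metric.isOpen_ball).isClosed_compl
  · refine (convex_closedBall _ _).inter ?_
    intro x hx y hy a b ha hb hab z hz
    have hz' : ‖z - (a • x + b • y)‖ < s j := by simpa [dist_eq_norm] using hz
    have e : z = a • (x + (z - (a • x + b • y))) + b • (y + (z - (a • x + b • y))) := by
      have : z - (a • x + b • y) = (a + b) • (z - (a • x + b • y)) := by rw [hab, one_smul]
      calc z = a • x + b • y + (z - (a • x + b • y)) := by abel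
        _ = a • x + b • y + (a + b) • (z - (a • x + b • y)) := by rw [← this]
        _ = _ := by rw [smul_add, smul_add, add_smul]; abel
    rw [e]
    exact hc (hx (by simpa [dist_eq_norm] using hz')) (hy (by simpa [dist_eq_norm] using hz')) ha hb hab
  · have h1 := mem_closedBall_zero_iff.1 hx.1
    have h2 : ‖y - x‖ < s j - s (j + 1) := by simpa [dist_eq_norm] using hy
    rw [mem_closedBall_zero_iff]; push_cast
    calc ‖y‖ = ‖x + (y - x)‖ := by congr 1; abel
      _ ≤ ‖x‖ + ‖y - x‖ := norm_add_le _ _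
      _ ≤ _ := by linarith [s2 j, s0 (j + 1)]
  · rw [Metric.mem_ball] at *
    linarith [dist_triangle z y x]
  · obtain ⟨ε, hε, hb⟩ := Metric.isOpen_iff.1 hO x hx
    obtain ⟨m, hm⟩ := exists_nat_one_div_lt hε
    obtain ⟨n, hn⟩ := exists_nat_ge ‖x‖
    refine ⟨max m n, ?_, fun y hy => hb ?_⟩
    · rw [mem_closedBall_zero_iff]
      exact hn.trans (by exact_mod_cast le_max_right m n)
    · have : s (max m n) ≤ s m := by
        rw [hs]; simp only []
        exact one_div_le_one_div_of_le (by positivity) (by gcongr; exact le_max_left _ _)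
      rw [Metric.mem_ball] at *
      rw [hs] at this hy; simp only [] at this hy
      linarith

lemma cutT {Ω K : Set E16} (hO : IsOpen Ω) (hK : IsCompact K) (KO : K ⊆ Ω) : ∃ O, IsOpen O ∧ K ⊆ O ∧ O ⊆ Ω ∧
    ∀ f : E16 → ℂ, ContDiffOn ℝ ∞ f Ω → ∃ S : Sm, ∀ x ∈ O, S x = f x := by
  obtain ⟨L, hL, KL, LO⟩ := exists_compact_between hK hO KO
  obtain ⟨φ, h1, h0, -⟩ := exists_contMDiffMap_one_nhds_of_subset_interior 𝓘(ℝ, E16) (n := (⊤ : ℕ∞)) hK.isClosed KL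
  obtain ⟨χ, hχ⟩ : ∃ χ : Sm, ∀ x, χ x = (φ x : ℂ) :=
    ⟨⟨fun x => (φ x : ℂ), Complex.ofRealCLM.contDiff.comp φ.contMDiff.contDiff⟩, fun x => rfl⟩
  obtain ⟨O, oO, KO', hO'⟩ := mem_nhdsSet_iff_exists.1 (Filter.inter_mem h1 (hO.mem_nhdsSet.2 KO))
  refine ⟨O, oO, KO', fun x hx => (hO' hx).2, fun f hf => ?_⟩
  have hn : χ ∈ Nl Ωᶜ := by
    rw [mem_Nl']
    intro x hx
    filter_upwards [hL.isClosed.isOpen_compl.mem_nhds (fun h => hx (LO h) : x ∈ Lᶜ)] with y hy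
    rw [hχ, h0 y hy]; simp
  obtain ⟨u, hu⟩ := glue hO hn hf
  refine ⟨u, fun x hx => ?_⟩
  have : φ x = 1 := (hO' hx).1
  rw [hu, hχ, this]; simp


lemma gr_sub (c d : Fin 16 → ℂ) : gr c - gr d = gr fun q => c q - d q := by
  ext v
  simp only [ContinuousLinearMap.sub_apply, gr_apply, mul_sub, Finset.sum_sub_distrib]

theorem global_solve {Ω : Set E16} (hO : IsOpen Ω) (hc : Convex ℝ Ω) (T : Fin 10 → E16 → ℂ)
    (hT : ∀ a, ContDiffOn ℝ ∞ (T a) Ω)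
    (hcl : ∀ (S : Fin 10 → Sm) (O : Set E16), IsOpen O → O ⊆ Ω → (∀ a, ∀ x ∈ O, S a x = T a x) → Clo O S) :
    ∃ u : E16 → ℂ, ContDiffOn ℝ ∞ u Ω ∧ ∀ (w : Sm) (O : Set E16), IsOpen O → O ⊆ Ω → (∀ x ∈ O, w x = u x) →
      ∀ a, ∀ x ∈ O, op (Q ℝ a) w x = T a x := by
  obtain ⟨K, r, hK, cK, KΩ, r0, r1, hball, hex⟩ := exhaust hO hc
  have Kmono : Monotone K := monotone_nat_of_le_succ fun j x hx => hball j x hx (Metric.mem_ball_self (r0 j))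
  choose O oO KO OΩ hS using fun j => cutT hO (hK j) (KΩ j)
  choose S hS using fun j a => hS j (T a) (hT a)
  choose u hu using fun j => local_solve (hK j) (cK j) (oO j) (KO j) (hcl (S j) (O j) (oO j) (OΩ j) (fun a => hS j a))
  have hd : ∀ j a, op (Q ℝ a) (u (j + 1) - u j) ∈ Nl (K j) := by
    intro j a
    have h1 : op (Q ℝ a) (u (j + 1)) - S (j + 1) a ∈ Nl (K j) := Nl_mono (Kmono (Nat.le_succ j)) (hu (j + 1) a)
    have h2 : S (j + 1) a - S j a ∈ Nl (K j) := by
      rw [mem_Nl']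
      intro x hx
      filter_upwards [(oO j).mem_nhds (KO j hx), (oO (j + 1)).mem_nhds (KO (j + 1) (Kmono (Nat.le_succ j) hx))] with y hy hy'
      rw [Sm.sub_apply, hS _ _ _ hy, hS _ _ _ hy', sub_self]
    have h3 := (Nl (K j)).sub_mem ((Nl (K j)).add_mem h1 h2) (hu j a)
    have e : op (Q ℝ a) (u (j + 1) - u j) = op (Q ℝ a) (u (j + 1)) - S (j + 1) a + (S (j + 1) a - S j a)
      - (op (Q ℝ a) (u j) - S j a) := by rw [map_sub]; abel
    rw [e]; exact h3
  choose g hg hge using fun j => runge (hK j) (cK j) (hd j) ((1 / 2) ^ j) (by positivity)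
  obtain ⟨v, hv⟩ : ∃ v : ℕ → Sm, v = fun j => u j - ∑ i ∈ Finset.range j, g i := ⟨_, rfl⟩
  have hvQ : ∀ j a, op (Q ℝ a) (v j) = op (Q ℝ a) (u j) := by
    intro j a
    rw [hv]; simp only []
    rw [map_sub, map_sum, Finset.sum_eq_zero (fun i _ => hg i a), sub_zero]
  have hW : ∀ j, v (j + 1) - v j = u (j + 1) - u j - g j := by
    intro j; rw [hv]; simp only []
    rw [Finset.sum_range_succ]; abel
  obtain ⟨C, hC, hh⟩ := harm_poly
  have est : ∀ m P, ∃ c : ℝ, 0 ≤ c ∧ ∀ x ∈ K m, ∀ n, dist (op P (v (n + (m + 1))) x) (op P (v (n + 1 + (m + 1))) x) ≤ c * (1 / 2) ^ n := by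
    intro m P
    refine ⟨l1 P * ((C / r m) ^ P.totalDegree * P.totalDegree.factorial * 1), ?_, fun x hx n => ?_⟩
    · have := l1_nonneg P
      have := r0 m
      positivity
    have hsub : Metric.ball x (r m) ⊆ K (n + (m + 1)) := (hball m x hx).trans (Kmono (by omega))
    have h1 := hh (v (n + (m + 1) + 1) - v (n + (m + 1))) x (r m) ((1 / 2) ^ (n + (m + 1))) (r0 m) (r1 m) (fun y hy => by
      rw [hW, map_sub, hg, sub_zero]; exact Nl_mem (hd _ 0) (hsub hy)) (fun y hy => by
      rw [hW, Sm.sub_apply]; exact hge _ y (hsub hy)) P _ le_rfl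
    rw [dist_comm, dist_eq_norm, ← Sm.sub_apply, ← map_sub, show n + 1 + (m + 1) = n + (m + 1) + 1 by omega]
    refine h1.trans ?_
    have h2 : (1 / 2 : ℝ) ^ (n + (m + 1)) ≤ 1 * (1 / 2) ^ n := by
      rw [one_mul]; exact pow_le_pow_of_le_one (by norm_num) (by norm_num) (by omega)
    have h3 := l1_nonneg P
    have h4 := r0 m
    calc _ ≤ l1 P * ((C / r m) ^ P.totalDegree * P.totalDegree.factorial * (1 * (1 / 2) ^ n)) := by gcongr
      _ = _ := by ring
  have hlim : ∀ P x, ∃ l, x ∈ Ω → Filter.Tendsto (fun n => op P (v n) x) Filter.atTop (𝓝 l) := by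
    intro P x
    by_cases hx : x ∈ Ω
    · obtain ⟨m, hm⟩ := hex x hx
      obtain ⟨c, -, hc⟩ := est m P
      obtain ⟨l, hl⟩ := cauchySeq_tendsto_of_complete (cauchySeq_of_le_geometric (1 / 2) c (by norm_num) (hc x hm))
      exact ⟨l, fun _ => (Filter.tendsto_add_atTop_iff_nat (m + 1)).1 hl⟩
    · exact ⟨0, fun h => (hx h).elim⟩
  choose U hU using hlim
  have unif : ∀ P m, TendstoUniformlyOn (fun n x => op P (v n) x) (U P) Filter.atTop (K m) := by
    intro P m
    obtain ⟨c, c0, hc⟩ := est m P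
    rw [Metric.tendstoUniformlyOn_iff]
    intro ε hε
    have hz : Filter.Tendsto (fun n : ℕ => c * (1 / 2 : ℝ) ^ n / (1 - 1 / 2)) Filter.atTop (𝓝 0) := by
      have := ((tendsto_pow_atTop_nhds_zero_of_lt_one (r := (1 / 2 : ℝ)) (by norm_num) (by norm_num)).const_mul c).div_const (1 - 1 / 2)
      simpa using this
    obtain ⟨N, hN⟩ := Filter.eventually_atTop.1 (hz.eventually (gt_mem_nhds hε))
    refine Filter.eventually_atTop.2 ⟨N + (m + 1), fun n hn x hx => ?_⟩
    obtain ⟨k, rfl⟩ : ∃ k, n = k + (m + 1) := ⟨n - (m + 1), by omega⟩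
    rw [dist_comm]
    refine lt_of_le_of_lt ?_ (hN k (by omega))
    exact dist_le_of_le_geometric_of_tendsto (1 / 2) c (by norm_num) (hc x hx)
      ((Filter.tendsto_add_atTop_iff_nat (m + 1)).2 (hU P x (KΩ m hx))) k
  have der : ∀ P, ∀ x ∈ Ω, HasFDerivAt (U P) (gr fun q => U (X q * P) x) x := by
    intro P x hx
    obtain ⟨m, hm⟩ := hex x hx
    have hsub := hball m x hm
    refine hasFDerivAt_of_tendstoUniformlyOn (l := Filter.atTop) (f := fun n x => op P (v n) x)
      (f' := fun n y => gr fun q => op (X q * P) (v n) y) (g' := fun y => gr fun q => U (X q * P) y)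
      (Metric.isOpen_ball (x := x) (ε := r m)) ?_ ?_ ?_ (Metric.mem_ball_self (r0 m))
    · rw [Metric.tendstoUniformlyOn_iff]
      intro ε hε
      have h1 : ∀ q : Fin 16, ∀ᶠ n in Filter.atTop, ∀ y ∈ K (m + 1), dist (U (X q * P) y) (op (X q * P) (v n) y) < ε / 17 :=
        fun q => Metric.tendstoUniformlyOn_iff.1 (unif (X q * P) (m + 1)) (ε / 17) (by positivity)
      filter_upwards [Filter.eventually_all.2 h1] with n hn y hy
      rw [dist_eq_norm, gr_sub]
      refine (gr_norm _).trans_lt ?_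
      calc _ ≤ ∑ q : Fin 16, ε / 17 := Finset.sum_le_sum fun q _ => by
            have := hn q y (hsub hy)
            rw [dist_eq_norm] at this; exact this.le
        _ < ε := by simp; linarith
    · intro n y hy
      have := hasFDerivAt_S (op P (v n)) y
      refine this.congr_fderiv ?_
      congr 1; funext q
      rw [op_mul, op_X]
    · intro y hy
      exact hU P y (KΩ _ (hsub hy))
  refine ⟨U 1, fam_on (fun q P => X q * P) hO U der 1, fun w O' oO' hO' hw a x hx => ?_⟩
  rw [fam_op oO' hw ?_ (fun P x hx => der P x (hO' hx)) (Q ℝ a) x hx]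
  · obtain ⟨m, hm⟩ := hex x (hO' hx)
    refine tendsto_nhds_unique (hU (Q ℝ a) x (hO' hx)) (tendsto_const_nhds.congr' ?_)
    filter_upwards [Filter.eventually_ge_atTop m] with n hn
    rw [hvQ]
    have h1 := Nl_mem (hu n a) (Kmono hn hm)
    rw [Sm.sub_apply, hS _ _ _ (KO n (Kmono hn hm))] at h1
    exact (sub_eq_zero.1 h1).symm
  · intro x hx
    refine ⟨⟨⟨fun P => U P x, fun P R => ?_⟩, fun c P => ?_⟩, fun P => rfl⟩
    · refine tendsto_nhds_unique (hU (P + R) x (hO' hx)) (((hU P x (hO' hx)).add (hU R x (hO' hx))).congr fun n => ?_)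
      rw [op_add, Sm.add_apply]
    · change U (c • P) x = c • U P x
      refine tendsto_nhds_unique (hU (c • P) x (hO' hx)) (((hU P x (hO' hx)).const_smul c).congr fun n => ?_)
      rw [smul_eq_C_mul, op_mul, op_Cf, Sm.rsmul_apply]; simp

end OK

namespace OK
open Finset MvPolynomial
open scoped ContDiff Topology
open MeasureTheory Set

/-- components of an octonion -/
def cmp (a : Oct) : Fin 8 → ℝ :=
  ![a.1.re, a.1.imI, a.1.imJ, a.1.imK, a.2.re, a.2.imI, a.2.imJ, a.2.imK]

lemma cmp_ext {a b : Oct} (h : ∀ r, cmp a r = cmp b r) : a = b := by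
  refine Prod.ext (QuaternionAlgebra.ext ?_ ?_ ?_ ?_) (QuaternionAlgebra.ext ?_ ?_ ?_ ?_)
  · exact h 0
  · exact h 1
  · exact h 2
  · exact h 3
  · exact h 4
  · exact h 5
  · exact h 6
  · exact h 7

lemma cmp_add (a b : Oct) (r : Fin 8) : cmp (a + b) r = cmp a r + cmp b r := by
  fin_cases r <;> simp [cmp]

lemma cmp_smul (c : ℝ) (a : Oct) (r : Fin 8) : cmp (c • a) r = c * cmp a r := by
  fin_cases r <;> simp [cmp]

/-- component map as a continuous linear map -/
def cmpL (r : Fin 8) : Oct →L[ℝ] ℝ :=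
  LinearMap.toContinuousLinearMap ⟨⟨fun a => cmp a r, fun a b => cmp_add a b r⟩, fun c a => cmp_smul c a r⟩

lemma cmpL_apply (r : Fin 8) (a : Oct) : cmpL r a = cmp a r := rfl

lemma cmp_sum {ι : Type*} (s : Finset ι) (f : ι → Oct) (r : Fin 8) : cmp (∑ i ∈ s, f i) r = ∑ i ∈ s, cmp (f i) r := by
  simp only [← cmpL_apply, map_sum]

/-- flat index -/
def idx (i : Fin 2) (p : Fin 8) : Fin 16 := finProdFinEquiv (i, p)

/-- the ten scalar components of a Hermitian matrix -/
def tauH (α β : ℝ) (q : Oct) : Fin 10 → ℝ :=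
  ![α + β, 2 * cmp q 0, 2 * cmp q 1, 2 * cmp q 2, 2 * cmp q 3, 2 * cmp q 4, 2 * cmp q 5, 2 * cmp q 6, 2 * cmp q 7, α - β]

lemma cmp_hess (H : Fin 8 → Fin 8 → ℝ) (r : Fin 8) :
    2 * cmp (∑ p, ∑ q, H p q • omul (e p) (oconj (e q))) r =
      ∑ p : Fin 8, 2 * (sg (⟨r + 1, by omega⟩) ⟨p, by omega⟩ : ℝ) * H p (p ^^^ r) := by
  simp only [cmp_sum, cmp_smul]
  fin_cases r <;>
  · simp [Fin.sum_univ_eight, cmp, omul, oconj, e, qI, qJ, qK, sg]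
    ring

lemma hess_iff (H : Fin 16 → Fin 16 → ℝ) (hH : ∀ i j, H i j = H j i) (α β : ℝ) (w : Oct) :
    (∑ p, H (idx 0 p) (idx 0 p) = α ∧ ∑ p, H (idx 1 p) (idx 1 p) = β ∧
      ∑ p, ∑ q, H (idx 0 p) (idx 1 q) • omul (e p) (oconj (e q)) = w) ↔
    ∀ a, ∑ i, (sg a i : ℝ) * H i (sh a i) = tauH α β w a := by
  have e0 : ∑ i, (sg 0 i : ℝ) * H i (sh 0 i) = ∑ p, H (idx 0 p) (idx 0 p) + ∑ p, H (idx 1 p) (idx 1 p) := by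
    simp [Fin.sum_univ_succ, sg, sh, msk, idx, finProdFinEquiv, Fin.succ]; ring
  have e9 : ∑ i, (sg 9 i : ℝ) * H i (sh 9 i) = ∑ p, H (idx 0 p) (idx 0 p) - ∑ p, H (idx 1 p) (idx 1 p) := by
    simp [Fin.sum_univ_succ, sg, sh, msk, idx, finProdFinEquiv, Fin.succ]; ring
  have er : ∀ r : Fin 8, ∑ i, (sg ⟨r + 1, by omega⟩ i : ℝ) * H i (sh ⟨r + 1, by omega⟩ i) =
      2 * cmp (∑ p, ∑ q, H (idx 0 p) (idx 1 q) • omul (e p) (oconj (e q))) r := by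
    intro r
    rw [cmp_hess (fun p q => H (idx 0 p) (idx 1 q)) r]
    fin_cases r <;>
    · simp [Fin.sum_univ_succ, sg, sh, msk, idx, finProdFinEquiv, Fin.succ]
      simp only [hH 8, hH 9, hH 10, hH 11, hH 12, hH 13, hH 14, hH 15]
      ring
  constructor
  · rintro ⟨h1, h2, h3⟩
    rw [h1, h2] at e0 e9
    rw [h3] at er
    intro a
    fin_cases a
    · exact e0
    · exact er 0
    · exact er 1
    · exact er 2
    · exact er 3
    · exact er 4
    · exact er 5
    · exact er 6
    · exact er 7
    · exact e9
  · intro h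
    have h0 := h 0
    have h9 := h 9
    rw [e0] at h0
    rw [e9] at h9
    change _ = α + β at h0
    change _ = α - β at h9
    refine ⟨by linarith, by linarith, cmp_ext fun r => ?_⟩
    have h1 := (er r).symm.trans (h _)
    have h2 : tauH α β w ⟨r + 1, by omega⟩ = 2 * cmp w r := by fin_cases r <;> rfl
    linarith

lemma cmp_row1 (B : Fin 8 → Oct) (b : Fin 8 → ℝ) (r : Fin 8) :
    cmp (∑ p, omul (B p) (e p) - ∑ p, b p • e p) r =
      ∑ s : Fin 8, (sg (⟨s + 1, by omega⟩) ⟨r, by omega⟩ : ℝ) * cmp (B (r ^^^ s)) s - b r := by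
  rw [sub_eq_add_neg, ← neg_one_smul ℝ, cmp_add, cmp_smul]
  simp only [cmp_sum, cmp_smul]
  fin_cases r <;>
  · simp [Fin.sum_univ_eight, cmp, omul, e, qI, qJ, qK, sg]
    ring

lemma cmp_row2 (A : Fin 8 → Oct) (b : Fin 8 → ℝ) (r : Fin 8) :
    cmp (∑ p, omul (oconj (A p)) (e p) - ∑ p, b p • e p) r =
      ∑ s : Fin 8, (sg (⟨s + 1, by omega⟩) ⟨r + 8, by omega⟩ : ℝ) * cmp (A (r ^^^ s)) s - b r := by
  rw [sub_eq_add_neg, ← neg_one_smul ℝ, cmp_add, cmp_smul]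
  simp only [cmp_sum, cmp_smul]
  fin_cases r <;>
  · simp [Fin.sum_univ_eight, cmp, omul, oconj, e, qI, qJ, qK, sg]
    ring

lemma row_iff (α β : Fin 16 → ℝ) (W : Fin 16 → Oct) :
    (∑ p, omul (W (idx 1 p)) (e p) = ∑ p, β (idx 0 p) • e p ∧
      ∑ p, omul (oconj (W (idx 0 p))) (e p) = ∑ p, α (idx 1 p) • e p) ↔
    ∀ i, ∑ a, (et a : ℝ) * ((sg a i : ℝ) * tauH (α (sh a i)) (β (sh a i)) (W (sh a i)) a) = 0 := by
  have h1 : ∀ r : Fin 8, ∑ a, (et a : ℝ) * ((sg a (idx 0 r) : ℝ) * tauH (α (sh a (idx 0 r))) (β (sh a (idx 0 r))) (W (sh a (idx 0 r))) a)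
      = 2 * cmp (∑ p, omul (W (idx 1 p)) (e p) - ∑ p, β (idx 0 p) • e p) r := by
    intro r
    rw [cmp_row1 (fun p => W (idx 1 p)) (fun p => β (idx 0 p))]
    fin_cases r <;>
    · simp [Fin.sum_univ_succ, et, tauH, sg, sh, msk, idx, finProdFinEquiv, Fin.succ]
      ring
  have h2 : ∀ r : Fin 8, ∑ a, (et a : ℝ) * ((sg a (idx 1 r) : ℝ) * tauH (α (sh a (idx 1 r))) (β (sh a (idx 1 r))) (W (sh a (idx 1 r))) a)
      = 2 * cmp (∑ p, omul (oconj (W (idx 0 p))) (e p) - ∑ p, α (idx 1 p) • e p) r := by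
    intro r
    rw [cmp_row2 (fun p => W (idx 0 p)) (fun p => α (idx 1 p))]
    fin_cases r <;>
    · simp [Fin.sum_univ_succ, et, tauH, sg, sh, msk, idx, finProdFinEquiv, Fin.succ]
      ring
  have z : ∀ r, cmp 0 r = 0 := fun r => by fin_cases r <;> rfl
  constructor
  · rintro ⟨a1, a2⟩ i
    obtain ⟨⟨j, r⟩, rfl⟩ := (finProdFinEquiv (m := 2) (n := 8)).surjective i
    fin_cases j
    · refine (h1 r).trans ?_
      rw [a1, sub_self, z, mul_zero]
    · refine (h2 r).trans ?_
      rw [a2, sub_self, z, mul_zero]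
  · intro h
    constructor
    · refine sub_eq_zero.1 (cmp_ext fun r => ?_)
      have := (h1 r).symm.trans (h _)
      rw [z]; linarith
    · refine sub_eq_zero.1 (cmp_ext fun r => ?_)
      have := (h2 r).symm.trans (h _)
      rw [z]; linarith
end OK

namespace OK
open Finset MvPolynomial
open scoped ContDiff Topology
open MeasureTheory Set

/-- identification of the flat and the structured coordinate spaces -/
def J : E16 ≃L[ℝ] Pt := LinearEquiv.toContinuousLinearEquiv
  { toFun := fun y i p => y (idx i p)
    invFun := fun x k => x (finProdFinEquiv.symm k : Fin 2 × Fin 8).1 (finProdFinEquiv.symm k : Fin 2 × Fin 8).2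
    map_add' := fun _ _ => rfl
    map_smul' := fun _ _ => rfl
    left_inv := fun y => by
      funext k
      change y (finProdFinEquiv (finProdFinEquiv.symm k : Fin 2 × Fin 8)) = y k
      rw [Equiv.apply_symm_apply]
    right_inv := fun x => by
      funext i p
      change x (finProdFinEquiv.symm (finProdFinEquiv (i, p)) : Fin 2 × Fin 8).1
        (finProdFinEquiv.symm (finProdFinEquiv (i, p)) : Fin 2 × Fin 8).2 = x i p
      rw [Equiv.symm_apply_apply] }

lemma J_apply (y : E16) (i : Fin 2) (p : Fin 8) : J y i p = y (idx i p) := rfl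

lemma J_single (i : Fin 2) (p : Fin 8) : J (Pi.single (idx i p) 1) = uvec i p := by
  funext j q
  rw [J_apply, uvec, Pi.single_apply]
  by_cases h : j = i
  · subst h
    rw [Pi.single_eq_same, Pi.single_apply]
    simp [idx]
  · rw [Pi.single_eq_of_ne h]
    simp [idx, h]

/-- flat partial derivative -/
def fd (i : Fin 16) (h : Pt → ℝ) : Pt → ℝ := fun x => fderiv ℝ h x (J (Pi.single i 1))

lemma pd_eq (i : Fin 2) (p : Fin 8) : pd i p = fd (idx i p) := by
  funext h x
  rw [pd, fd, J_single]

lemma re_dd {g : Sm} {h : Pt → ℝ} {O : Set E16} (oO : IsOpen O) (hg : ∀ y ∈ O, (g y).re = h (J y)) (i : Fin 16) :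
    ∀ y ∈ O, (dd (Pi.single i 1) g y).re = fd i h (J y) := by
  intro y hy
  have h1 : h =ᶠ[𝓝 (J y)] fun x => (g (J.symm x)).re := by
    have : J.symm ⁻¹' O ∈ 𝓝 (J y) := (oO.preimage J.symm.continuous).mem_nhds (by simpa using hy)
    filter_upwards [this] with x hx
    rw [hg _ hx, J.apply_symm_apply]
  have h2 := (Complex.reCLM.hasFDerivAt).comp (J y)
    ((diffS g (J.symm (J y))).hasFDerivAt.comp (J y) J.symm.hasFDerivAt)
  have h3 : fderiv ℝ (fun x => (g (J.symm x)).re) (J y) = _ := h2.fderiv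
  rw [fd, h1.fderiv_eq, h3]
  simp [dd_apply]

lemma of_dd {g : Sm} {h : Pt → ℝ} {O : Set E16} (oO : IsOpen O) (hg : ∀ y ∈ O, g y = (h (J y) : ℂ)) (i : Fin 16) :
    ∀ y ∈ O, dd (Pi.single i 1) g y = (fd i h (J y) : ℂ) := by
  intro y hy
  apply Complex.ext
  · rw [re_dd oO (h := h) (fun y hy => by rw [hg y hy]; simp) i y hy]; simp
  · have h1 : (fun y => (g y).im) =ᶠ[𝓝 y] fun _ => 0 := by
      filter_upwards [oO.mem_nhds hy] with z hz
      rw [hg z hz]; simp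
    have h2 := (Complex.imCLM.hasFDerivAt).comp y (diffS g y).hasFDerivAt
    have h3 : fderiv ℝ (fun y => (g y).im) y = _ := h2.fderiv
    rw [h1.fderiv_eq] at h3
    have h4 := congrArg (fun L : E16 →L[ℝ] ℝ => L (Pi.single i 1)) h3
    simp at h4
    rw [dd_apply, ← h4]; simp

lemma re_dd2 {g : Sm} {h : Pt → ℝ} {O : Set E16} (oO : IsOpen O) (hg : ∀ y ∈ O, (g y).re = h (J y)) (i j : Fin 16) :
    ∀ y ∈ O, (dd (Pi.single i 1) (dd (Pi.single j 1) g) y).re = fd i (fd j h) (J y) :=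
  re_dd oO (re_dd oO hg j) i

lemma fd_comm {g : Sm} {h : Pt → ℝ} {O : Set E16} (oO : IsOpen O) (hg : ∀ y ∈ O, (g y).re = h (J y)) (i j : Fin 16) :
    ∀ y ∈ O, fd i (fd j h) (J y) = fd j (fd i h) (J y) := by
  intro y hy
  rw [← re_dd2 oO hg i j y hy, ← re_dd2 oO hg j i y hy]
  have := LinearMap.congr_fun (dd_comm (Pi.single i 1) (Pi.single j 1)) g
  change dd _ (dd _ g) = dd _ (dd _ g) at this
  rw [this]

lemma op_int (n : ℤ) (P : PR ℝ) (f : Sm) (y : E16) : op ((n : PR ℝ) * P) f y = (n : ℂ) * op P f y := by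
  rw [← map_intCast (C : ℝ →+* PR ℝ) n, op_mul, op_Cf, Sm.rsmul_apply]; simp

lemma op_Q_apply (a : Fin 10) (f : Sm) (y : E16) : op (Q ℝ a) f y =
    ∑ i, (sg a i : ℂ) * dd (Pi.single i 1) (dd (Pi.single (sh a i) 1) f) y := by
  rw [Q, ph_sum, op_sum, Sm.sum_apply]
  refine Finset.sum_congr rfl fun i _ => ?_
  rw [mul_left_comm, op_int, op_mul, op_X, op_X]

lemma op_rl_apply (i : Fin 16) (a : Fin 10) (f : Sm) (y : E16) : op (rl ℝ i a) f y =
    (et a : ℂ) * ((sg a i : ℂ) * dd (Pi.single (sh a i) 1) f y) := by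
  rw [rl, gm, op_int, op_int, op_X]

lemma re_Q {g : Sm} {h : Pt → ℝ} {O : Set E16} (oO : IsOpen O) (hg : ∀ y ∈ O, (g y).re = h (J y)) (a : Fin 10) :
    ∀ y ∈ O, (op (Q ℝ a) g y).re = ∑ i, (sg a i : ℝ) * fd i (fd (sh a i) h) (J y) := by
  intro y hy
  rw [op_Q_apply, Complex.re_sum]
  refine Finset.sum_congr rfl fun i _ => ?_
  rw [← re_dd2 oO hg _ _ y hy]
  simp

/-- linear version of tauH -/
def tauL (a : Fin 10) : ℝ × ℝ × Oct →L[ℝ] ℝ :=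
  LinearMap.toContinuousLinearMap ⟨⟨fun z => tauH z.1 z.2.1 z.2.2 a, fun z w => by
    fin_cases a <;> simp [tauH, cmp_add] <;> ring⟩, fun c z => by
    fin_cases a <;> simp [tauH, cmp_smul] <;> ring⟩

lemma tauL_apply (a : Fin 10) (z : ℝ × ℝ × Oct) : tauL a z = tauH z.1 z.2.1 z.2.2 a := rfl

lemma fd_tau {T11 T22 : Pt → ℝ} {T12 : Pt → Oct} {x : Pt} (h11 : DifferentiableAt ℝ T11 x)
    (h22 : DifferentiableAt ℝ T22 x) (h12 : DifferentiableAt ℝ T12 x) (a : Fin 10) (k : Fin 16) :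
    fd k (fun x => tauH (T11 x) (T22 x) (T12 x) a) x =
      tauH (fd k T11 x) (fd k T22 x) (fderiv ℝ T12 x (J (Pi.single k 1))) a := by
  have h := (tauL a).hasFDerivAt.comp x (h11.hasFDerivAt.prodMk (h22.hasFDerivAt.prodMk h12.hasFDerivAt))
  have h3 : fderiv ℝ (fun x => tauH (T11 x) (T22 x) (T12 x) a) x = _ := h.fderiv
  rw [fd, h3]
  rfl

/-- conjugation as a continuous linear map -/
def conjL : Oct →L[ℝ] Oct :=
  LinearMap.toContinuousLinearMap ⟨⟨oconj, fun z w => by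
    simp [oconj, add_comm]⟩, fun c z => by simp [oconj]⟩

lemma fderiv_oconj {T12 : Pt → Oct} {x : Pt} (h12 : DifferentiableAt ℝ T12 x) (v : Pt) :
    fderiv ℝ (fun y => oconj (T12 y)) x v = oconj (fderiv ℝ T12 x v) := by
  have h := conjL.hasFDerivAt.comp x h12.hasFDerivAt
  have h3 : fderiv ℝ (fun x => oconj (T12 x)) x = _ := h.fderiv
  rw [h3]; rfl

/-- the closedness equations at a point in scalar form -/
lemma closed_iff {T11 T22 : Pt → ℝ} {T12 : Pt → Oct} {x : Pt} (h11 : DifferentiableAt ℝ T11 x)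
    (h22 : DifferentiableAt ℝ T22 x) (h12 : DifferentiableAt ℝ T12 x) :
    ((∑ p, omul (fderiv ℝ T12 x (uvec 1 p)) (e p) = ∑ p, pd 0 p T22 x • e p) ∧
        (∑ p, omul (fderiv ℝ (fun y => oconj (T12 y)) x (uvec 0 p)) (e p) = ∑ p, pd 1 p T11 x • e p)) ↔
    ∀ i, ∑ a, (et a : ℝ) * ((sg a i : ℝ) * fd (sh a i) (fun x => tauH (T11 x) (T22 x) (T12 x) a) x) = 0 := by
  simp only [fderiv_oconj h12, fd_tau h11 h22 h12, pd_eq, ← J_single]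
  exact row_iff (fun k => fd k T11 x) (fun k => fd k T22 x) (fun k => fderiv ℝ T12 x (J (Pi.single k 1)))

lemma hess_iff' {u : Pt → ℝ} {x : Pt} (hs : ∀ i j, fd i (fd j u) x = fd j (fd i u) x) (α β : ℝ) (w : Oct) :
    (lap 0 u x = α ∧ lap 1 u x = β ∧ hessEntry u 0 1 x = w) ↔
    ∀ a, ∑ i, (sg a i : ℝ) * fd i (fd (sh a i) u) x = tauH α β w a := by
  rw [← hess_iff (fun i j => fd i (fd j u) x) hs]
  simp only [lap, hessEntry, pd_eq]

theorem main (Ω : Set Pt) (hopen : IsOpen Ω) (hconv : Convex ℝ Ω)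
    (T11 T22 : Pt → ℝ) (T12 : Pt → Oct)
    (h11 : ContDiffOn ℝ ∞ T11 Ω) (h22 : ContDiffOn ℝ ∞ T22 Ω)
    (h12 : ContDiffOn ℝ ∞ T12 Ω) :
    (∀ x ∈ Ω,
        (∑ p, omul (fderiv ℝ T12 x (uvec 1 p)) (e p)
            = ∑ p, pd 0 p T22 x • e p) ∧
        (∑ p, omul (fderiv ℝ (fun y => oconj (T12 y)) x (uvec 0 p)) (e p)
            = ∑ p, pd 1 p T11 x • e p))
    ↔ ∃ u : Pt → ℝ, ContDiffOn ℝ ∞ u Ω ∧ ∀ x ∈ Ω,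
        lap 0 u x = T11 x ∧ lap 1 u x = T22 x ∧ hessEntry u 0 1 x = T12 x := by
  have d11 : ∀ x ∈ Ω, DifferentiableAt ℝ T11 x := fun x hx =>
    (h11.contDiffAt (hopen.mem_nhds hx)).differentiableAt (by simp)
  have d22 : ∀ x ∈ Ω, DifferentiableAt ℝ T22 x := fun x hx =>
    (h22.contDiffAt (hopen.mem_nhds hx)).differentiableAt (by simp)
  have d12 : ∀ x ∈ Ω, DifferentiableAt ℝ T12 x := fun x hx =>
    (h12.contDiffAt (hopen.mem_nhds hx)).differentiableAt (by simp)
  obtain ⟨Y, hY⟩ : ∃ Y : Set E16, Y = J ⁻¹' Ω := ⟨_, rfl⟩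
  have oY : IsOpen Y := hY ▸ hopen.preimage J.continuous
  have mY : ∀ y ∈ Y, J y ∈ Ω := fun y hy => by rw [hY] at hy; exact hy
  have mΩ : ∀ x ∈ Ω, J.symm x ∈ Y := fun x hx => by
    rw [hY]; change J (J.symm x) ∈ Ω; rwa [J.apply_symm_apply]
  have cJ : ∀ h : Pt → ℝ, ContDiffOn ℝ ∞ h Ω → ContDiffOn ℝ ∞ (fun y => (h (J y) : ℂ)) Y := fun h hh =>
    Complex.ofRealCLM.contDiff.comp_contDiffOn (hh.comp J.contDiff.contDiffOn mY)
  constructor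
  · intro hcl
    obtain ⟨u, hu, hw⟩ := global_solve oY (hY ▸ hconv.linear_preimage J.toLinearMap)
      (fun a y => (tauH (T11 (J y)) (T22 (J y)) (T12 (J y)) a : ℂ))
      (fun a => cJ (fun x => tauH (T11 x) (T22 x) (T12 x) a)
        ((tauL a).contDiff.comp_contDiffOn (h11.prodMk (h22.prodMk h12))))
      (fun S O oO hO hS i => by
        rw [mem_Nl']
        intro y0 hy0
        filter_upwards [oO.mem_nhds hy0] with y hy
        have hx := mY y (hO hy)
        have h1 := (closed_iff (d11 _ hx) (d22 _ hx) (d12 _ hx)).1 (hcl _ hx) i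
        have h2 := congrArg (fun t : ℝ => (t : ℂ)) h1
        push_cast at h2
        rw [Sm.sum_apply, ← h2]
        refine Finset.sum_congr rfl fun a _ => ?_
        rw [op_rl_apply, of_dd oO (h := fun x => tauH (T11 x) (T22 x) (T12 x) a) (hS a) _ y hy])
    refine ⟨fun x => (u (J.symm x)).re,
      Complex.reCLM.contDiff.comp_contDiffOn (hu.comp J.symm.contDiff.contDiffOn mΩ), fun x hx => ?_⟩
    obtain ⟨O, oO, hO1, hO2, hO3⟩ := cutT oY (isCompact_singleton (x := J.symm x)) (Set.singleton_subset_iff.2 (mΩ x hx))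
    obtain ⟨w, hwu⟩ := hO3 u hu
    have hre : ∀ y ∈ O, (w y).re = (fun x => (u (J.symm x)).re) (J y) := fun y hy => by
      simp [hwu y hy]
    have hy0 : J.symm x ∈ O := Set.singleton_subset_iff.1 hO1
    have hc := fun i j => fd_comm (h := fun x => (u (J.symm x)).re) oO hre i j _ hy0
    have hq := fun a => re_Q (h := fun x => (u (J.symm x)).re) oO hre a _ hy0
    rw [J.apply_symm_apply] at hc hq
    refine (hess_iff' hc _ _ _).2 fun a => ?_
    rw [← hq, hw w O oO hO2 hwu a _ hy0, J.apply_symm_apply, Complex.ofReal_re]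
  · rintro ⟨u, hu, hh⟩ x hx
    obtain ⟨O, oO, hO1, hO2, hO3⟩ := cutT oY (isCompact_singleton (x := J.symm x)) (Set.singleton_subset_iff.2 (mΩ x hx))
    obtain ⟨w, hwu⟩ := hO3 _ (cJ u hu)
    have hre : ∀ y ∈ O, (w y).re = u (J y) := fun y hy => by
      simp [hwu y hy]
    have hy0 : J.symm x ∈ O := Set.singleton_subset_iff.1 hO1
    have hQ : ∀ a, ∀ y ∈ O, (op (Q ℝ a) w y).re = (fun x => tauH (T11 x) (T22 x) (T12 x) a) (J y) := by
      intro a y hy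
      rw [re_Q oO hre a y hy]
      exact (hess_iff' (fun i j => fd_comm oO hre i j y hy) _ _ _).1 (hh _ (mY y (hO2 hy))) a
    refine (closed_iff (d11 x hx) (d22 x hx) (d12 x hx)).2 fun i => ?_
    have h1 := Nl_mem (Clo.D0 O w i) hy0
    rw [Sm.sum_apply] at h1
    have h2 := congrArg Complex.re h1
    rw [Complex.re_sum, Complex.zero_re] at h2
    rw [← h2]
    refine Finset.sum_congr rfl fun a _ => ?_
    have h3 := re_dd (h := fun x => tauH (T11 x) (T22 x) (T12 x) a) oO (hQ a) (sh a i) _ hy0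
    rw [J.apply_symm_apply] at h3
    rw [op_rl_apply, ← h3]
    simp

end OK

/-- Theorem 8.2 (the local dd^c-lemma for octonionic Kähler metrics): on an open
convex Ω ⊂ ℝ¹⁶ ≅ 𝕆², a smooth octonionic-Hermitian-matrix-valued function
T = (T₁₁, T₂₂, T₁₂) satisfies the closedness equations
Σ_p (∂T₁₂/∂x₂^p)·e_p = Σ_p e_p·(∂T₂₂/∂x₁^p) and
Σ_p (∂conj(T₁₂)/∂x₁^p)·e_p = Σ_p e_p·(∂T₁₁/∂x₂^p)
iff T = Hess_𝕆(u) on Ω for a smooth real function u. -/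
theorem local_ddc_lemma (Ω : Set Pt) (hopen : IsOpen Ω) (hconv : Convex ℝ Ω)
    (T11 T22 : Pt → ℝ) (T12 : Pt → Oct)
    (h11 : ContDiffOn ℝ (⊤ : ℕ∞) T11 Ω) (h22 : ContDiffOn ℝ (⊤ : ℕ∞) T22 Ω)
    (h12 : ContDiffOn ℝ (⊤ : ℕ∞) T12 Ω) :
    (∀ x ∈ Ω,
        (∑ p, omul (fderiv ℝ T12 x (uvec 1 p)) (e p)
            = ∑ p, pd 0 p T22 x • e p) ∧
        (∑ p, omul (fderiv ℝ (fun y => oconj (T12 y)) x (uvec 0 p)) (e p)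
            = ∑ p, pd 1 p T11 x • e p))
    ↔ ∃ u : Pt → ℝ, ContDiffOn ℝ (⊤ : ℕ∞) u Ω ∧ ∀ x ∈ Ω,
        lap 0 u x = T11 x ∧ lap 1 u x = T22 x ∧ hessEntry u 0 1 x = T12 x := by
  exact OK.main Ω hopen hconv T11 T22 T12 h11 h22 h12
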